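/- For all real x > 1, |u(x)| ≤ 1501.93/log x, where u(x) = ∑_{n ≤ x, n odd} (−2)^{Ω(n)}/n. -/

import Mathlib

open Finset MeasureTheory
open ArithmeticFunction hiding log
open Real (log exp log_mul log_le_log log_pow exp_pos pi_pos log_div exp_add exp_le_exp rpow_neg rpow_natCast log_sqrt)
open Complex (I)
open Filter (atTop Tendsto Eventually)
open scoped Real

/-- `u x = ∑_{n ≤ x, n odd} (-2)^{Ω(n)}/n`. -/
noncomputable def u (x : ℝ) : ℝ :=
  ∑ n ∈ (Finset.Icc 1 ⌊x⌋₊).filter (fun n => Odd n), (-2 : ℝ) ^ (cardFactors n) / n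

/-! ### Part C: finite factorization and Hadamard-type limit formula -/

lemma hd_norm_ratio {f F : ℂ → ℂ} {Z : Multiset ℂ} {z0:ℂ} {R B:ℝ}
    (hF : Differentiable ℂ F)
    (hfac : ∀ z, f z = (Z.map (fun ρ => z - ρ)).prod * F z)
    (hZ : ∀ ρ ∈ Z, ‖ρ‖ ≤ R) (hR : 0 < R) (r:ℝ) (hr : 2 * R + ‖z0‖ ≤ r) (hz0 : ‖z0‖ ≤ R)
    (hB : ∀ z, ‖z‖ = r → ‖f z‖ ≤ B) (z:ℂ) (hz : ‖z‖ ≤ r) :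
    ‖F z‖ * (Z.map (fun ρ => ‖z0 - ρ‖)).prod ≤ B := by
  have key : ∀ w : ℂ, ‖w‖ = r → ‖F w‖ * (Z.map (fun ρ => ‖z0 - ρ‖)).prod ≤ B := by
    intro w hw
    have h1 := hB w hw
    rw [hfac w, norm_mul] at h1
    have h2 : (Z.map (fun ρ => ‖z0 - ρ‖)).prod ≤ ‖(Z.map (fun ρ => w - ρ)).prod‖ := by
      have : ‖(Z.map (fun ρ => w - ρ)).prod‖ = (Z.map (fun ρ => ‖w - ρ‖)).prod := by
        have := Multiset.prod_hom (Z.map (fun ρ => w - ρ)) (normHom : ℂ →*₀ ℝ)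
        simpa [Multiset.map_map, Function.comp_def] using this.symm
      rw [this]
      apply Multiset.prod_map_le_prod_map₀
      · intro i hi; positivity
      · intro ρ hρ
        have h3 := hZ ρ hρ
        have h4 : ‖w‖ ≤ ‖w - ρ‖ + ‖ρ‖ := by simpa using norm_add_le (w - ρ) ρ
        have h5 : ‖z0 - ρ‖ ≤ ‖z0‖ + ‖ρ‖ := norm_sub_le _ _
        linarith
    calc ‖F w‖ * (Z.map (fun ρ => ‖z0 - ρ‖)).prod
        ≤ ‖F w‖ * ‖(Z.map (fun ρ => w - ρ)).prod‖ := by gcongr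
      _ ≤ B := by linarith
  have hr0 : 0 < r := by have := norm_nonneg z0; linarith
  set c : ℂ := (((Z.map (fun ρ => ‖z0 - ρ‖)).prod:ℝ):ℂ) with hc
  have hcn : ‖c‖ = (Z.map (fun ρ => ‖z0 - ρ‖)).prod := by
    rw [hc, Complex.norm_real, Real.norm_of_nonneg]
    apply Multiset.prod_nonneg
    intro a ha
    obtain ⟨b, _, rfl⟩ := Multiset.mem_map.1 ha
    positivity
  have := Complex.norm_le_of_forall_mem_frontier_norm_le (f := fun w => F w * c)
    (U := Metric.ball (0:ℂ) r) Metric.isBounded_ball (C := B)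
    ((hF.mul_const c).diffContOnCl) (by
      intro w hw
      rw [frontier_ball _ hr0.ne'] at hw
      have hw' : ‖w‖ = r := by simpa using hw
      rw [norm_mul, hcn]
      exact key w hw') (z := z) (by
      rw [closure_ball _ hr0.ne']; simpa using hz)
  rwa [norm_mul, hcn] at this

lemma hd_factor {f : ℂ → ℂ} (hf : Differentiable ℂ f) {z0:ℂ} (hz0 : f z0 ≠ 0) (R:ℝ)
    (hR : 0 < R) (hz0R : ‖z0‖ ≤ R) :
    ∃ (Z : Multiset ℂ) (F : ℂ → ℂ), Differentiable ℂ F ∧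
      (∀ ρ ∈ Z, ‖ρ‖ ≤ R ∧ f ρ = 0) ∧
      (∀ z, f z = (Z.map (fun ρ => z - ρ)).prod * F z) ∧ ∀ z, ‖z‖ ≤ R → F z ≠ 0 := by
  classical
  let P : ℕ → Prop := fun n => ∃ (Z : Multiset ℂ) (F : ℂ → ℂ), Z.card = n ∧ Differentiable ℂ F ∧
      (∀ ρ ∈ Z, ‖ρ‖ ≤ R ∧ f ρ = 0) ∧
      (∀ z, f z = (Z.map (fun ρ => z - ρ)).prod * F z)
  have hP0 : P 0 := ⟨0, f, by simp, hf, by simp, by simp⟩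
  -- bound
  obtain ⟨M, hM⟩ : ∃ M, ∀ z : ℂ, ‖z‖ ≤ 5 * R → ‖f z‖ ≤ M := by
    obtain ⟨M, hM⟩ := (isCompact_closedBall (0:ℂ) (5 * R)).exists_bound_of_continuousOn
      hf.continuous.continuousOn
    exact ⟨M, fun z hz => hM z (by simpa using hz)⟩
  have hbound : ∀ n, P n → (2:ℝ) ^ n * ‖f z0‖ ≤ M := by
    rintro n ⟨Z, F, hcard, hF, hZ, hfac⟩
    have key : ∀ w : ℂ, ‖w‖ = 5 * R →
        ‖F w‖ * (Z.map (fun ρ => 2 * ‖z0 - ρ‖)).prod ≤ M := by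
      intro w hw
      have h1 := hM w hw.le
      rw [hfac w, norm_mul] at h1
      have h2 : (Z.map (fun ρ => 2 * ‖z0 - ρ‖)).prod ≤ ‖(Z.map (fun ρ => w - ρ)).prod‖ := by
        have : ‖(Z.map (fun ρ => w - ρ)).prod‖ = (Z.map (fun ρ => ‖w - ρ‖)).prod := by
          have := Multiset.prod_hom (Z.map (fun ρ => w - ρ)) (normHom : ℂ →*₀ ℝ)
          simpa [Multiset.map_map, Function.comp_def] using this.symm
        rw [this]
        apply Multiset.prod_map_le_prod_map₀
        · intro i hi; positivity
        · intro ρ hρ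
          have h3 := (hZ ρ hρ).1
          have h4 : ‖w‖ ≤ ‖w - ρ‖ + ‖ρ‖ := by simpa using norm_add_le (w - ρ) ρ
          have h5 : ‖z0 - ρ‖ ≤ ‖z0‖ + ‖ρ‖ := norm_sub_le _ _
          linarith
      calc _ ≤ ‖F w‖ * ‖(Z.map (fun ρ => w - ρ)).prod‖ := by gcongr
        _ ≤ M := by linarith
    set c : ℂ := (((Z.map (fun ρ => 2 * ‖z0 - ρ‖)).prod:ℝ):ℂ) with hc
    have hcn : ‖c‖ = (Z.map (fun ρ => 2 * ‖z0 - ρ‖)).prod := by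
      rw [hc, Complex.norm_real, Real.norm_of_nonneg]
      apply Multiset.prod_nonneg
      intro a ha
      obtain ⟨b, _, rfl⟩ := Multiset.mem_map.1 ha
      positivity
    have := Complex.norm_le_of_forall_mem_frontier_norm_le (f := fun w => F w * c)
      (U := Metric.ball (0:ℂ) (5 * R)) Metric.isBounded_ball (C := M)
      ((hF.mul_const c).diffContOnCl) (by
        intro w hw
        rw [frontier_ball _ (by positivity)] at hw
        have hw' : ‖w‖ = 5 * R := by simpa using hw
        rw [norm_mul, hcn]
        exact key w hw') (z := z0) (by
        rw [closure_ball _ (by positivity)]; simp; linarith)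
    rw [norm_mul, hcn] at this
    rw [hfac z0, norm_mul]
    have h6 : ‖(Z.map (fun ρ => z0 - ρ)).prod‖ = (Z.map (fun ρ => ‖z0 - ρ‖)).prod := by
      have := Multiset.prod_hom (Z.map (fun ρ => z0 - ρ)) (normHom : ℂ →*₀ ℝ)
      simpa [Multiset.map_map, Function.comp_def] using this.symm
    rw [h6]
    rw [Multiset.prod_map_mul] at this
    simp [hcard] at this
    linarith
  obtain ⟨N, hN⟩ : ∃ N : ℕ, M / ‖f z0‖ < (2:ℝ) ^ N := pow_unbounded_of_one_lt _ (by norm_num)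
  have hf0 : 0 < ‖f z0‖ := norm_pos_iff.2 hz0
  have hbd : ∀ n, P n → n ≤ N := by
    intro n hn
    by_contra hlt
    push Not at hlt
    have h1 := hbound n hn
    have h2 : (2:ℝ) ^ N ≤ 2 ^ n := pow_le_pow_right₀ (by norm_num) hlt.le
    rw [div_lt_iff₀ hf0] at hN
    nlinarith
  have hmax : P (Nat.findGreatest P N) := Nat.findGreatest_spec (Nat.zero_le N) hP0
  obtain ⟨Z, F, hcard, hF, hZ, hfac⟩ := hmax
  refine ⟨Z, F, hF, hZ, hfac, ?_⟩
  intro z hz hFz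
  have : P (Nat.findGreatest P N + 1) := by
    refine ⟨z ::ₘ Z, dslope F z, by simp [hcard], ?_, ?_, ?_⟩
    · rw [← differentiableOn_univ]
      exact (Complex.differentiableOn_dslope Filter.univ_mem).2 hF.differentiableOn
    · intro ρ hρ
      rcases Multiset.mem_cons.1 hρ with h | h
      · subst h
        refine ⟨hz, ?_⟩
        rw [hfac, hFz, mul_zero]
      · exact hZ ρ h
    · intro w
      rw [hfac w, Multiset.map_cons, Multiset.prod_cons]
      have := sub_smul_dslope F z w
      rw [hFz, sub_zero, smul_eq_mul] at this
      rw [← this]; ring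
  have := Nat.le_findGreatest (hbd _ this) this
  omega

lemma hd_even_log {k : ℂ → ℂ} {R M:ℝ} {z0:ℂ} (hk : Differentiable ℂ k) (hR : 0 < R)
    (hne : ∀ z, ‖z‖ < R → k z ≠ 0) (heven : ∀ z, k (-z) = k z) (hz0 : ‖z0‖ ≤ R / 8)
    (hM : 0 < M) (hbd : ∀ z, ‖z‖ < R → ‖k z‖ ≤ ‖k z0‖ * exp M) :
    (∀ z, ‖z‖ < R / 8 → |log ‖k z‖ - log ‖k 0‖| ≤ 4 * M * (‖z‖ / (R / 8)) ^ 2) ∧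
    (∀ z, ‖z‖ + 1 < R / 8 → ‖deriv k z / k z‖ ≤ 4 * M * ((‖z‖ + 1) / (R / 8)) ^ 2) := by
  have hz0' : ‖z0‖ < R := by linarith
  have hlogd : DifferentiableOn ℂ (fun w => deriv k w / k w) (Metric.ball 0 R) := by
    apply DifferentiableOn.div
    · exact (hk.contDiff (n := 2)).differentiable_deriv_two.differentiableOn
    · exact hk.differentiableOn
    · intro x hx; exact hne x (by simpa using hx)
  obtain ⟨φ, hφ0, hφ⟩ := (hlogd.isExactOn_ball).with_val_at z0 0
  have hmem : ∀ w : ℂ, w ∈ Metric.ball (0:ℂ) R ↔ ‖w‖ < R := by simp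
  have hdiff : DifferentiableOn ℂ φ (Metric.ball 0 R) :=
    fun x hx => (hφ x hx).differentiableAt.differentiableWithinAt
  have hconst : ∀ w, ‖w‖ < R → k w = k z0 * Complex.exp (φ w) := by
    intro w hw
    have hder : ∀ x ∈ Metric.ball (0:ℂ) R,
        HasDerivAt (fun x => k x * Complex.exp (-φ x)) 0 x := by
      intro x hx
      have h1 := (hk x).hasDerivAt.mul ((hφ x hx).neg.cexp)
      have hx0 : k x ≠ 0 := hne x (by simpa using hx)
      have h4 : k x * (deriv k x / k x) = deriv k x := by field_simp
      refine HasDerivAt.congr_deriv h1 ?_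
      linear_combination (-Complex.exp (-φ x)) * h4
    have h2 := (convex_ball (0:ℂ) R).isPreconnected
    have h3 := (Metric.isOpen_ball (x := (0:ℂ)) (ε := R)).is_const_of_deriv_eq_zero
      h2 (f := fun x => k x * Complex.exp (-φ x))
      (fun x hx => (hder x hx).differentiableAt.differentiableWithinAt)
      (fun x hx => (hder x hx).deriv) ((hmem w).2 hw) ((hmem z0).2 hz0')
    simp only [hφ0, neg_zero, Complex.exp_zero, mul_one] at h3
    rw [← h3, mul_assoc, ← Complex.exp_add]; simp
  have hlog : ∀ w, ‖w‖ < R → log ‖k w‖ = log ‖k z0‖ + (φ w).re := by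
    intro w hw
    rw [hconst w hw, norm_mul, log_mul (norm_ne_zero_iff.2 (hne z0 hz0'))
      (norm_ne_zero_iff.2 (Complex.exp_ne_zero _)), Complex.norm_exp, Real.log_exp]
  have hre : ∀ w, ‖w‖ < R → (φ w).re ≤ M := by
    intro w hw
    have h1 := hbd w hw
    rw [hconst w hw, norm_mul, Complex.norm_exp] at h1
    have h2 : 0 < ‖k z0‖ := norm_pos_iff.2 (hne z0 hz0')
    exact exp_le_exp.1 (le_of_mul_le_mul_left h1 h2)
  have hbc : ∀ w, ‖w‖ < R / 8 → ‖φ w‖ ≤ 2 * M := by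
    intro w hw
    have hwz : ‖w - z0‖ ≤ R / 4 := by
      have := norm_sub_le w z0; linarith
    have h1 := Complex.borelCaratheodory_zero (f := fun x => φ (z0 + x)) (R := R / 2) (M := M)
      (z := w - z0) hM ?_ ?_ (by positivity) ?_ ?_
    · simp only [add_sub_cancel] at h1
      refine h1.trans ?_
      rw [div_le_iff₀ (by linarith)]
      nlinarith [norm_nonneg (w - z0)]
    · apply hdiff.comp (by fun_prop)
      intro x hx
      rw [hmem]
      have : ‖x‖ < R / 2 := by simpa using hx
      have := norm_add_le z0 x; linarith
    · intro x hx
      apply hre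
      have : ‖x‖ < R / 2 := by simpa using hx
      have := norm_add_le z0 x; linarith
    · simp; linarith
    · simp [hφ0]
  have h0R : ‖(0:ℂ)‖ < R / 8 := by simp; positivity
  have hsch : ∀ z, ‖z‖ < R / 8 → ‖φ z - φ 0‖ ≤ 4 * M * (‖z‖ / (R / 8)) ^ 2 := by
    intro z hz
    have hsch := Complex.dist_le_mul_div_pow_of_mapsTo_ball_of_isLittleO (f := φ) (c := 0) (z := z)
      (R₁ := R / 8) (R₂ := 4 * M) (n := 1) ?_ ?_ ?_ ?_
    · rw [dist_eq_norm, dist_eq_norm, sub_zero] at hsch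
      exact hsch
    · apply hdiff.mono
      apply Metric.ball_subset_ball; linarith
    · intro x hx
      have hx' : ‖x‖ < R / 8 := by simpa using hx
      rw [Metric.mem_closedBall, dist_eq_norm]
      have := norm_sub_le (φ x) (φ 0)
      have := hbc x hx'
      have := hbc 0 h0R
      linarith
    · have hd0 : deriv k 0 = 0 := by
        have h1 : deriv (fun x => k (-x)) 0 = -deriv k (-0) := deriv_comp_neg k 0
        have h2 : (fun x => k (-x)) = k := funext heven
        rw [h2, neg_zero] at h1
        have : 2 * deriv k 0 = 0 := by linear_combination h1
        simpa using this
      have h1 := hφ 0 (by simpa using hR)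
      rw [hd0, zero_div, hasDerivAt_iff_isLittleO] at h1
      simp only [smul_zero, sub_zero] at h1
      simpa using h1.norm_right
    · simpa using hz
  constructor
  · intro z hz
    have h1 : |(φ z).re - (φ 0).re| ≤ ‖φ z - φ 0‖ := by
      rw [← Complex.sub_re]; exact Complex.abs_re_le_norm _
    rw [hlog z (by linarith), hlog 0 (by linarith)]
    calc _ = |(φ z).re - (φ 0).re| := by ring_nf
      _ ≤ _ := h1.trans (hsch z hz)
  · intro z hz
    have hzR : ‖z‖ < R := by linarith
    have h1 : deriv (fun w => φ w - φ 0) z = deriv k z / k z := by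
      rw [deriv_sub_const]; exact (hφ z ((hmem z).2 hzR)).deriv
    have h2 := Complex.norm_deriv_le_of_forall_mem_sphere_norm_le (c := z) (R := 1)
      (f := fun w => φ w - φ 0) (C := 4 * M * ((‖z‖ + 1) / (R / 8)) ^ 2) one_pos ?_ ?_
    · rw [h1, div_one] at h2
      exact h2
    · apply DifferentiableOn.diffContOnCl
      rw [closure_ball _ one_ne_zero]
      apply (hdiff.sub_const _).mono
      intro w hw
      rw [hmem]
      rw [Metric.mem_closedBall, dist_eq_norm] at hw
      have := norm_add_le (w - z) z
      rw [sub_add_cancel] at this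
      linarith
    · intro w hw
      rw [Metric.mem_sphere, dist_eq_norm] at hw
      have := norm_add_le (w - z) z
      rw [sub_add_cancel] at this
      refine (hsch w (by linarith)).trans ?_
      gcongr
      linarith

lemma hd_logDeriv_prod (S : Multiset ℂ) (z:ℂ) (h : ∀ ρ ∈ S, z ^ 2 - ρ ^ 2 ≠ 0) :
    HasDerivAt (fun z => (S.map (fun ρ => -(z ^ 2 - ρ ^ 2))).prod)
      ((S.map (fun ρ => -(z ^ 2 - ρ ^ 2))).prod * (S.map (fun ρ => 2 * z / (z ^ 2 - ρ ^ 2))).sum)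
      z := by
  induction S using Multiset.induction_on with
  | empty => simpa using hasDerivAt_const z (1:ℂ)
  | cons a S ih =>
    simp only [Multiset.map_cons, Multiset.prod_cons, Multiset.sum_cons]
    have h1 := ih (fun ρ hρ => h ρ (Multiset.mem_cons_of_mem hρ))
    have h0 := h a (Multiset.mem_cons_self a S)
    have h2 : HasDerivAt (fun z : ℂ => -(z ^ 2 - a ^ 2)) (-(2 * z)) z := by
      have := ((hasDerivAt_pow 2 z).sub_const (a ^ 2)).neg
      refine HasDerivAt.congr_deriv this ?_
      simp
    refine HasDerivAt.congr_deriv (h2.mul h1) ?_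
    field_simp
    ring

/-- Limit formula. -/
lemma hd_limit {f : ℂ → ℂ} (hf : Differentiable ℂ f) (heven : ∀ z, f (-z) = f z)
    {z0:ℂ} (hz0 : f z0 ≠ 0) {C:ℝ} (hC : 0 < C)
    (hgrowth : ∀ z, ‖f z‖ ≤ exp (C * (1 + ‖z‖) ^ (3 / 2:ℝ))) :
    ∃ Z : ℕ → Multiset ℂ, (∀ N, ∀ ρ ∈ Z N, f ρ = 0) ∧
      (∀ ρ, f ρ = 0 → ∀ᶠ N in atTop, ρ ∈ Z N) ∧
      ∀ z1 z2, f z1 ≠ 0 → f z2 ≠ 0 → Tendsto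
        (fun N => ((Z N).map (fun ρ => log ‖z1 ^ 2 - ρ ^ 2‖ - log ‖z2 ^ 2 - ρ ^ 2‖)).sum)
        atTop (nhds (2 * (log ‖f z1‖ - log ‖f z2‖))) ∧
        Tendsto (fun N => ((Z N).map (fun ρ => 2 * z1 / (z1 ^ 2 - ρ ^ 2))).sum)
          atTop (nhds (2 * (deriv f z1 / f z1))) := by
  have hex : ∀ N : ℕ, ∃ (Z : Multiset ℂ) (F : ℂ → ℂ), Differentiable ℂ F ∧
      (∀ ρ ∈ Z, ‖ρ‖ ≤ (‖z0‖ + N + 1) ∧ f ρ = 0) ∧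
      (∀ z, f z = (Z.map (fun ρ => z - ρ)).prod * F z) ∧ ∀ z, ‖z‖ ≤ (‖z0‖ + N + 1) → F z ≠ 0 :=
    fun N => hd_factor hf hz0 _ (by positivity) (by linarith [Nat.cast_nonneg (α := ℝ) N])
  choose Z F hF hZ hfac hnz using hex
  refine ⟨Z, fun N ρ hρ => (hZ N ρ hρ).2, ?_, ?_⟩
  · intro ρ hρ
    filter_upwards [Filter.eventually_ge_atTop ⌈‖ρ‖⌉₊] with N hN
    have hN' : ‖ρ‖ ≤ N := Nat.ceil_le.1 hN
    have h1 := hfac N ρ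
    rw [hρ] at h1
    rcases mul_eq_zero.1 h1.symm with h | h
    · rw [Multiset.prod_eq_zero_iff, Multiset.mem_map] at h
      obtain ⟨a, ha, hb⟩ := h
      rw [sub_eq_zero] at hb
      rwa [hb]
    · exact absurd h (hnz N ρ (by linarith [norm_nonneg z0]))
  -- main convergence
  have hsq : ∀ N z, f z * f z =
      ((Z N).map (fun ρ => -(z ^ 2 - ρ ^ 2))).prod * (F N z * F N (-z)) := by
    intro N z
    have e1 := hfac N z
    have e2 := hfac N (-z)
    rw [heven] at e2
    nth_rewrite 1 [e1]
    rw [e2]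
    have : ((Z N).map (fun ρ => -(z ^ 2 - ρ ^ 2))).prod =
        ((Z N).map (fun ρ => z - ρ)).prod * ((Z N).map (fun ρ => -z - ρ)).prod := by
      rw [← Multiset.prod_map_mul]
      congr 1
      apply Multiset.map_congr rfl
      intro x _
      ring
    rw [this]; ring
  have hlogf : ∀ N z, f z ≠ 0 → 2 * log ‖f z‖ =
      ((Z N).map (fun ρ => log ‖z ^ 2 - ρ ^ 2‖)).sum + log ‖F N z * F N (-z)‖ := by
    intro N z hz
    have h1 := hsq N z
    have h2 : ‖f z‖ * ‖f z‖ = ((Z N).map (fun ρ => ‖z ^ 2 - ρ ^ 2‖)).prod * ‖F N z * F N (-z)‖ := by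
      rw [← norm_mul, h1, norm_mul]
      congr 1
      have := Multiset.prod_hom ((Z N).map (fun ρ => -(z ^ 2 - ρ ^ 2))) (normHom : ℂ →*₀ ℝ)
      simp only [Multiset.map_map, Function.comp_def] at this
      rw [show ‖((Z N).map (fun ρ => -(z ^ 2 - ρ ^ 2))).prod‖ =
        (normHom : ℂ →*₀ ℝ) ((Z N).map (fun ρ => -(z ^ 2 - ρ ^ 2))).prod from rfl, ← this]
      congr 1
      apply Multiset.map_congr rfl
      intro x _
      change ‖-(z ^ 2 - x ^ 2)‖ = _
      rw [norm_neg]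
    have hfz : ‖f z‖ ≠ 0 := norm_ne_zero_iff.2 hz
    have hprod : ((Z N).map (fun ρ => ‖z ^ 2 - ρ ^ 2‖)).prod ≠ 0 := by
      intro h; rw [h, zero_mul] at h2; exact hfz (by simpa using h2)
    have hFF : ‖F N z * F N (-z)‖ ≠ 0 := by
      intro h; rw [h, mul_zero] at h2; exact hfz (by simpa using h2)
    have h3 := congrArg log h2
    rw [log_mul hfz hfz, log_mul hprod hFF] at h3
    rw [two_mul, h3]
    congr 1
    have : ∀ S : Multiset ℂ, (S.map (fun ρ => ‖z ^ 2 - ρ ^ 2‖)).prod ≠ 0 →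
        log (S.map (fun ρ => ‖z ^ 2 - ρ ^ 2‖)).prod =
        (S.map (fun ρ => log ‖z ^ 2 - ρ ^ 2‖)).sum := by
      intro S
      induction S using Multiset.induction_on with
      | empty => simp
      | cons a S ih =>
        intro h
        simp only [Multiset.map_cons, Multiset.prod_cons, Multiset.sum_cons] at h ⊢
        have hh := mul_ne_zero_iff.1 h
        rw [log_mul hh.1 hh.2, ih hh.2]
    exact this _ hprod
  -- bound for k
  set A : ℝ := |log ‖f z0‖| with hA
  have hkey : ∀ z, ∀ᶠ N : ℕ in atTop,
      |log ‖F N z * F N (-z)‖ - log ‖F N 0 * F N (-0)‖| ≤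
        4 * (2 * (C * (6 * (N:ℝ)) ^ (3 / 2:ℝ) + A)) * (‖z‖ / ((N:ℝ) / 8)) ^ 2 ∧
      ‖deriv (fun w => F N w * F N (-w)) z / (F N z * F N (-z))‖ ≤
        4 * (2 * (C * (6 * (N:ℝ)) ^ (3 / 2:ℝ) + A)) * ((‖z‖ + 1) / ((N:ℝ) / 8)) ^ 2 := by
    intro z
    filter_upwards [Filter.eventually_ge_atTop (⌈8 * ‖z0‖ + 8 * ‖z‖⌉₊ + 16)] with N hN
    have hN' : 8 * ‖z0‖ + 8 * ‖z‖ + 16 ≤ N := by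
      have h1 := Nat.le_ceil (8 * ‖z0‖ + 8 * ‖z‖)
      have h2 : ((⌈8 * ‖z0‖ + 8 * ‖z‖⌉₊ + 16:ℕ):ℝ) ≤ N := by exact_mod_cast hN
      push_cast at h2
      linarith
    have hn0 := norm_nonneg z0
    have hnz0 := norm_nonneg z
    have hNpos : (0:ℝ) < N := by linarith
    set E := C * (6 * (N:ℝ)) ^ (3 / 2:ℝ) with hE
    have hEpos : 0 < E := by positivity
    have hA0 : 0 ≤ A := abs_nonneg _
    have hfz0 : 0 < ‖f z0‖ := norm_pos_iff.2 hz0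
    have hball : ∀ w, ‖w‖ = 4 * (N:ℝ) → ‖f w‖ ≤ exp E := by
      intro w hw
      refine (hgrowth w).trans (exp_le_exp.2 ?_)
      rw [hE]
      gcongr
      linarith
    set Pz := ((Z N).map (fun ρ => ‖z0 - ρ‖)).prod with hPz
    have hb1 : ∀ w, ‖w‖ ≤ 4 * (N:ℝ) → ‖F N w‖ * Pz ≤ exp E := fun w hw =>
      hd_norm_ratio (hF N) (hfac N) (fun ρ hρ => (hZ N ρ hρ).1) (by positivity) (4 * (N:ℝ))
        (by linarith) (by linarith) hball w hw
    set Pz' := ((Z N).map (fun ρ => ‖-z0 - ρ‖)).prod with hPz'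
    have hb2 : ∀ w, ‖w‖ ≤ 4 * (N:ℝ) → ‖F N w‖ * Pz' ≤ exp E := fun w hw =>
      hd_norm_ratio (hF N) (hfac N) (fun ρ hρ => (hZ N ρ hρ).1) (by positivity) (4 * (N:ℝ))
        (by rw [norm_neg]; linarith) (by rw [norm_neg]; linarith) hball w hw
    have hnm : ∀ w, ‖f w‖ = ((Z N).map (fun ρ => ‖w - ρ‖)).prod * ‖F N w‖ := by
      intro w
      rw [hfac N w, norm_mul]
      congr 1
      have := Multiset.prod_hom ((Z N).map (fun ρ => w - ρ)) (normHom : ℂ →*₀ ℝ)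
      simpa [Multiset.map_map, Function.comp_def] using this.symm
    have e1 : ‖f z0‖ = Pz * ‖F N z0‖ := hnm z0
    have e2 : ‖f z0‖ = Pz' * ‖F N (-z0)‖ := by rw [← heven z0]; exact hnm (-z0)
    have hPpos : 0 < Pz := by
      rcases (lt_trichotomy Pz 0) with h | h | h
      · exfalso
        have := norm_nonneg (F N z0); nlinarith
      · rw [h, zero_mul] at e1; linarith
      · exact h
    have hPpos' : 0 < Pz' := by
      rcases (lt_trichotomy Pz' 0) with h | h | h
      · exfalso
        have := norm_nonneg (F N (-z0)); nlinarith
      · rw [h, zero_mul] at e2; linarith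
      · exact h
    have hexpA : exp (-A) ≤ ‖f z0‖ := by
      rw [← Real.exp_log hfz0]
      apply exp_le_exp.2
      exact neg_abs_le _
    have h1e : ∀ w, ‖w‖ ≤ 4 * (N:ℝ) → ‖F N w‖ ≤ ‖F N z0‖ * exp (E + A) := by
      intro w hw
      have h := hb1 w hw
      rw [exp_add]
      have h2 : 1 ≤ ‖f z0‖ * exp A := by
        calc (1:ℝ) = exp (-A) * exp A := by rw [← exp_add]; simp
          _ ≤ _ := by gcongr
      have h3 : ‖F N w‖ * Pz ≤ (‖F N z0‖ * (exp E * exp A)) * Pz := by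
        calc ‖F N w‖ * Pz ≤ exp E * 1 := by linarith
          _ ≤ exp E * (‖f z0‖ * exp A) := by gcongr
          _ = _ := by rw [e1]; ring
      exact le_of_mul_le_mul_right h3 hPpos
    have h2e : ∀ w, ‖w‖ ≤ 4 * (N:ℝ) → ‖F N w‖ ≤ ‖F N (-z0)‖ * exp (E + A) := by
      intro w hw
      have h := hb2 w hw
      rw [exp_add]
      have h2 : 1 ≤ ‖f z0‖ * exp A := by
        calc (1:ℝ) = exp (-A) * exp A := by rw [← exp_add]; simp
          _ ≤ _ := by gcongr
      have h3 : ‖F N w‖ * Pz' ≤ (‖F N (-z0)‖ * (exp E * exp A)) * Pz' := by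
        calc ‖F N w‖ * Pz' ≤ exp E * 1 := by linarith
          _ ≤ exp E * (‖f z0‖ * exp A) := by gcongr
          _ = _ := by rw [e2]; ring
      exact le_of_mul_le_mul_right h3 hPpos'
    have hs := hd_even_log (k := fun w => F N w * F N (-w)) (R := N) (z0 := z0)
      (M := 2 * (E + A)) ?_ hNpos ?_ ?_ (by linarith) (by positivity) ?_
    · exact ⟨hs.1 z (by linarith), hs.2 z (by linarith)⟩
    · exact (hF N).mul ((hF N).comp differentiable_neg)
    · intro w hw
      exact mul_ne_zero (hnz N w (by linarith)) (hnz N (-w) (by rw [norm_neg]; linarith))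
    · intro w; simp [mul_comm]
    · intro w hw
      have a1 := h1e w (by linarith)
      have a2 := h2e (-w) (by rw [norm_neg]; linarith)
      simp only [norm_mul]
      calc ‖F N w‖ * ‖F N (-w)‖ ≤ (‖F N z0‖ * exp (E + A)) * (‖F N (-z0)‖ * exp (E + A)) := by
            gcongr
        _ = _ := by rw [two_mul, exp_add (E + A)]; ring
  have hlim : ∀ z : ℝ, Tendsto (fun N : ℕ =>
        4 * (2 * (C * (6 * (N:ℝ)) ^ (3 / 2:ℝ) + A)) * (z / ((N:ℝ) / 8)) ^ 2)
        atTop (nhds 0) := by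
    intro z
    have t1 : Tendsto (fun N : ℕ => (N:ℝ) ^ (-(1/2):ℝ)) atTop (nhds 0) :=
      (tendsto_rpow_neg_atTop (by norm_num)).comp tendsto_natCast_atTop_atTop
    have t2 : Tendsto (fun N : ℕ => (N:ℝ) ^ (-2:ℝ)) atTop (nhds 0) :=
      (tendsto_rpow_neg_atTop (by norm_num)).comp tendsto_natCast_atTop_atTop
    have t3 := (t1.const_mul (8 * C * 6 ^ (3 / 2:ℝ) * (8 * z) ^ 2)).add
      (t2.const_mul (8 * A * (8 * z) ^ 2))
    simp only [mul_zero, add_zero] at t3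
    refine t3.congr' ?_
    filter_upwards [Filter.eventually_gt_atTop 0] with N hN
    have hNp : (0:ℝ) < N := by exact_mod_cast hN
    rw [Real.mul_rpow (by norm_num) hNp.le,
      show (-(1/2):ℝ) = 3 / 2 - (2:ℕ) by norm_num, Real.rpow_sub_natCast hNp.ne',
      show (-2:ℝ) = 0 - (2:ℕ) by norm_num, Real.rpow_sub_natCast hNp.ne', Real.rpow_zero]
    field_simp
    ring
  have hconv : ∀ z, Tendsto (fun N =>
      log ‖F N z * F N (-z)‖ - log ‖F N 0 * F N (-0)‖) atTop (nhds 0) := by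
    intro z
    exact squeeze_zero_norm' ((hkey z).mono (fun N h => by simpa using h.1)) (hlim ‖z‖)
  intro z1 z2 h1 h2
  refine ⟨?_, ?_⟩
  swap
  · have t4 : Tendsto (fun N => deriv (fun w => F N w * F N (-w)) z1 / (F N z1 * F N (-z1)))
        atTop (nhds 0) :=
      squeeze_zero_norm' ((hkey z1).mono (fun N h => h.2)) (hlim (‖z1‖ + 1))
    have t5 := t4.const_sub (2 * (deriv f z1 / f z1))
    rw [sub_zero] at t5
    refine t5.congr ?_
    intro N
    have e1 : (fun z => f z * f z) =
        fun z => ((Z N).map (fun ρ => -(z ^ 2 - ρ ^ 2))).prod * (F N z * F N (-z)) :=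
      funext (hsq N)
    have hne := hsq N z1
    have hp : ((Z N).map (fun ρ => -(z1 ^ 2 - ρ ^ 2))).prod ≠ 0 := by
      intro h; rw [h, zero_mul] at hne; exact h1 (by simpa using hne)
    have hk0 : F N z1 * F N (-z1) ≠ 0 := by
      intro h; rw [h, mul_zero] at hne; exact h1 (by simpa using hne)
    have d1 := hd_logDeriv_prod (Z N) z1 (by
      intro ρ hρ h0
      apply hp
      apply Multiset.prod_eq_zero
      rw [Multiset.mem_map]
      exact ⟨ρ, hρ, by rw [h0, neg_zero]⟩)
    have d2 : HasDerivAt (fun w => F N w * F N (-w)) _ z1 :=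
      (((hF N).mul ((hF N).comp differentiable_neg)) z1).hasDerivAt
    have d3 := d1.mul d2
    have d4 := (hf z1).hasDerivAt.mul (hf z1).hasDerivAt
    have d5 := d3.unique (d4.congr_of_eventuallyEq (Eventually.of_forall (fun z => (hsq N z).symm)))
    change _ + _ * deriv (fun w => F N w * F N (-w)) z1 = _ at d5
    set D := deriv (fun w => F N w * F N (-w)) z1
    set S := ((Z N).map (fun ρ => 2 * z1 / (z1 ^ 2 - ρ ^ 2))).sum
    set P := ((Z N).map (fun ρ => -(z1 ^ 2 - ρ ^ 2))).prod
    set K := F N z1 * F N (-z1) with hK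
    have d6 : P * K * (S + D / K) = P * K * (2 * (deriv f z1 / f z1)) := by
      have a1 : P * K * (S + D / K) = P * S * K + P * D := by field_simp
      have a2 : P * K * (2 * (deriv f z1 / f z1)) = deriv f z1 * f z1 + f z1 * deriv f z1 := by
        rw [← hne]; field_simp; ring
      rw [a1, a2, d5]
    have d7 := mul_left_cancel₀ (mul_ne_zero hp hk0) d6
    linear_combination -d7
  have t := (((hconv z2).sub (hconv z1))).const_add (2 * (log ‖f z1‖ - log ‖f z2‖))
  simp only [sub_zero, add_zero] at t
  refine t.congr ?_
  intro N
  rw [Multiset.sum_map_sub]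
  have a1 := hlogf N z1 h1
  have a2 := hlogf N z2 h2
  linarith

/-- completed zeta without poles: `g(s) = s(s-1) Γ_ℝ(s) ζ(s)`. -/
noncomputable def xiG (s:ℂ) : ℂ := 1 + s * (s - 1) * completedRiemannZeta₀ s

lemma xiG_diff : Differentiable ℂ xiG := by
  unfold xiG
  have := differentiable_completedZeta₀
  fun_prop

lemma xiG_one_sub (s:ℂ) : xiG (1 - s) = xiG s := by
  unfold xiG
  rw [completedRiemannZeta₀_one_sub]; ring

lemma xiG_eq {s:ℂ} (hs : 0 < s.re) (h1 : s ≠ 1) :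
    xiG s = s * (s - 1) * Complex.Gammaℝ s * riemannZeta s := by
  have h0 : s ≠ 0 := by rintro rfl; simp at hs
  have h2 : (1 - s) ≠ 0 := sub_ne_zero.2 h1.symm
  rw [riemannZeta_def_of_ne_zero h0, completedRiemannZeta_eq]
  have := Complex.Gammaℝ_ne_zero_of_re_pos hs
  unfold xiG
  field_simp
  ring

lemma xiG_one : xiG 1 = 1 := by simp [xiG]

lemma xiG_ne_zero {s:ℂ} (hs : 1 ≤ s.re) : xiG s ≠ 0 := by
  by_cases h1 : s = 1
  · rw [h1, xiG_one]; norm_num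
  · rw [xiG_eq (by linarith) h1]
    have h0 : s ≠ 0 := by rintro rfl; norm_num at hs
    exact mul_ne_zero (mul_ne_zero (mul_ne_zero h0 (sub_ne_zero.2 h1))
      (Complex.Gammaℝ_ne_zero_of_re_pos (by linarith))) (riemannZeta_ne_zero_of_one_le_re hs)

lemma xiG_zero_re {s:ℂ} (hs : xiG s = 0) : 0 < s.re ∧ s.re < 1 := by
  constructor
  · by_contra h
    push Not at h
    exact xiG_ne_zero (s := 1 - s) (by simp; linarith) (by rw [xiG_one_sub, hs])
  · by_contra h
    push Not at h
    exact xiG_ne_zero h hs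

lemma xiG_zero_zeta {s:ℂ} (hs : 0 < s.re) (hz : riemannZeta s = 0) : xiG s = 0 := by
  by_cases h1 : s = 1
  · exact absurd hz (by rw [h1]; exact riemannZeta_one_ne_zero)
  · rw [xiG_eq hs h1, hz, mul_zero]

lemma xiG_conj_aux {s:ℂ} (hs : 0 < s.re) : xiG (starRingEnd ℂ s) = starRingEnd ℂ (xiG s) := by
  by_cases h1 : s = 1
  · rw [h1]; simp [xiG_one]
  · have h1' : starRingEnd ℂ s ≠ 1 := by
      intro h; apply h1
      have := congrArg (starRingEnd ℂ) h
      simpa using this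
    rw [xiG_eq hs h1, xiG_eq (by simpa using hs) h1', riemannZeta_conj]
    simp only [Complex.Gammaℝ_def, map_mul, map_sub, map_one]
    congr 2
    have h3 := Complex.cpow_conj (π:ℂ) (-s / 2)
      (by rw [Complex.arg_ofReal_of_nonneg Real.pi_nonneg]; exact pi_pos.ne)
    rw [Complex.conj_ofReal] at h3
    have h4 : (starRingEnd ℂ) (2:ℂ) = 2 := Complex.conj_ofNat 2
    rw [← Complex.Gamma_conj, ← h3]
    simp [h4]

lemma xiG_conj (s:ℂ) : xiG (starRingEnd ℂ s) = starRingEnd ℂ (xiG s) := by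
  by_cases hs : 0 < s.re
  · exact xiG_conj_aux hs
  · rw [← xiG_one_sub, ← xiG_one_sub s, ← xiG_conj_aux (s := 1 - s) (by simp; linarith)]
    simp

lemma cz0_bound : ∃ K : ℝ, ∀ s : ℂ, 0 ≤ s.re → s.re ≤ 2 → ‖completedRiemannZeta₀ s‖ ≤ K := by
  set P := HurwitzZeta.hurwitzEvenFEPair 0
  have hconv : ∀ s, MellinConvergent P.f_modif s := fun s =>
    (P.isStrongFEPair_toStrongFEPair.hasMellin s).1
  have h0 := (hconv 0).norm
  have h1 := (hconv 1).norm
  refine ⟨(∫ t in Set.Ioi (0:ℝ), (‖(t:ℂ) ^ ((0:ℂ) - 1) • P.f_modif t‖ +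
    ‖(t:ℂ) ^ ((1:ℂ) - 1) • P.f_modif t‖)) / 2, ?_⟩
  intro s hs0 hs2
  have e : completedRiemannZeta₀ s = mellin P.f_modif (s / 2) / 2 := rfl
  rw [e, norm_div, Complex.norm_ofNat]
  gcongr
  unfold mellin
  refine (norm_integral_le_integral_norm _).trans ?_
  apply setIntegral_mono_on
  · exact (hconv (s / 2)).norm
  · exact h0.add h1
  · exact measurableSet_Ioi
  · intro t ht
    have ht : 0 < t := ht
    simp only [norm_smul, Complex.norm_cpow_eq_rpow_re_of_pos ht]
    rw [← add_mul]
    gcongr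
    simp only [Complex.sub_re, Complex.zero_re, Complex.one_re, Complex.div_ofNat_re]
    rcases le_total t 1 with h | h
    · have : t ^ (s.re / 2 - 1) ≤ t ^ ((0:ℝ) - 1) :=
        Real.rpow_le_rpow_of_exponent_ge ht h (by linarith)
      exact le_add_of_le_of_nonneg this (by positivity)
    · have : t ^ (s.re / 2 - 1) ≤ t ^ ((1:ℝ) - 1) :=
        Real.rpow_le_rpow_of_exponent_le h (by linarith)
      exact le_add_of_nonneg_of_le (by positivity) this

lemma norm_Gamma_le {s:ℂ} (hs : 0 < s.re) : ‖Complex.Gamma s‖ ≤ Real.Gamma s.re := by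
  rw [Complex.Gamma_eq_integral hs, Real.Gamma_eq_integral hs, Complex.GammaIntegral]
  refine (norm_integral_le_integral_norm _).trans (le_of_eq ?_)
  apply setIntegral_congr_fun measurableSet_Ioi
  intro t ht
  have ht : 0 < t := ht
  simp only [norm_mul, Complex.norm_cpow_eq_rpow_re_of_pos ht]
  rw [Complex.norm_real, Real.norm_of_nonneg (exp_pos _).le]
  simp

lemma zeta_bound2 : ∃ K : ℝ, 0 < K ∧ ∀ s : ℂ, 2 ≤ s.re → ‖riemannZeta s‖ ≤ K := by
  have hsum : Summable (fun n : ℕ => 1 / ((n:ℝ) + 1) ^ (2:ℝ)) := by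
    have := (Real.summable_one_div_nat_rpow (p := 2)).2 (by norm_num)
    exact_mod_cast (summable_nat_add_iff 1).2 this
  refine ⟨(∑' n : ℕ, 1 / ((n:ℝ) + 1) ^ (2:ℝ)) + 1, ?_, ?_⟩
  · have : 0 ≤ ∑' n : ℕ, 1 / ((n:ℝ) + 1) ^ (2:ℝ) := tsum_nonneg (fun n => by positivity)
    linarith
  · intro s hs
    rw [zeta_eq_tsum_one_div_nat_add_one_cpow (by linarith)]
    have hle : ∀ n : ℕ, ‖1 / ((n:ℂ) + 1) ^ s‖ ≤ 1 / ((n:ℝ) + 1) ^ (2:ℝ) := by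
      intro n
      have : ((n:ℂ) + 1) = ((n + 1:ℝ):ℂ) := by push_cast; rfl
      rw [this, norm_div, norm_one, Complex.norm_cpow_eq_rpow_re_of_pos (by positivity)]
      gcongr
      simp
    have := tsum_of_norm_bounded hsum.hasSum hle
    linarith

lemma xiG_growth : ∃ C : ℝ, 0 < C ∧ ∀ z : ℂ,
    ‖xiG (1 / 2 + z)‖ ≤ exp (C * (1 + ‖z‖) ^ (3 / 2:ℝ)) := by
  obtain ⟨K1, hK1⟩ := cz0_bound
  obtain ⟨K2, hK2, hK2'⟩ := zeta_bound2
  have hK1n : 0 ≤ K1 := (norm_nonneg _).trans (hK1 1 (by simp) (by norm_num))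
  refine ⟨1 + K1 + K2 + 14, by positivity, ?_⟩
  have main : ∀ z : ℂ, 0 ≤ z.re →
      ‖xiG (1 / 2 + z)‖ ≤ exp ((1 + K1 + K2 + 14) * (1 + ‖z‖) ^ (3 / 2:ℝ)) := by
    intro z hz
    set y := 1 + ‖z‖ with hy
    have hy1 : 1 ≤ y := by have := norm_nonneg z; linarith
    have hyy : y ≤ y ^ (3 / 2:ℝ) := by
      calc y = y ^ (1:ℝ) := by simp
        _ ≤ _ := Real.rpow_le_rpow_of_exponent_le hy1 (by norm_num)
    have hn1 : ‖(1 / 2 + z:ℂ)‖ ≤ y := by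
      have := norm_add_le (1 / 2:ℂ) z
      have h2 : ‖(1 / 2:ℂ)‖ = 1 / 2 := by norm_num
      linarith
    have hn2 : ‖(1 / 2 + z - 1:ℂ)‖ ≤ y := by
      have := norm_add_le (-1 / 2:ℂ) z
      have h2 : ‖(-1 / 2:ℂ)‖ = 1 / 2 := by norm_num
      rw [show (1 / 2 + z - 1:ℂ) = -1 / 2 + z by ring]
      linarith
    have hye : y ^ 2 ≤ exp (2 * y) := by
      have h1 : y ≤ exp y := by linarith [Real.add_one_le_exp y]
      calc y ^ 2 ≤ (exp y) ^ 2 := by gcongr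
        _ = _ := by rw [← Real.exp_nat_mul]; norm_num
    rcases le_total (1 / 2 + z:ℂ).re 2 with h2 | h2
    · have h3 := hK1 (1 / 2 + z) (by simp; linarith) h2
      have : ‖xiG (1 / 2 + z)‖ ≤ 1 + y * y * K1 := by
        unfold xiG
        refine (norm_add_le _ _).trans ?_
        rw [norm_one, norm_mul, norm_mul]
        gcongr
      refine this.trans ?_
      calc 1 + y * y * K1 ≤ (1 + K1) * y ^ 2 := by nlinarith
        _ ≤ exp (1 + K1) * exp (2 * y) := by
          gcongr
          linarith [Real.add_one_le_exp (1 + K1)]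
        _ = exp (1 + K1 + 2 * y) := by rw [← exp_add]
        _ ≤ _ := by
          apply exp_le_exp.2
          nlinarith
    · have hre : 0 < (1 / 2 + z:ℂ).re := by linarith
      have hne1 : (1 / 2 + z:ℂ) ≠ 1 := by
        intro h; rw [h] at h2; norm_num at h2
      rw [xiG_eq hre hne1]
      set s := (1 / 2 + z:ℂ) with hs
      have hG : ‖Complex.Gammaℝ s‖ ≤ (3 * y) ^ (3 * y) := by
        rw [Complex.Gammaℝ_def, norm_mul]
        have e1 : ‖(π:ℂ) ^ (-s / 2)‖ ≤ 1 := by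
          rw [Complex.norm_cpow_eq_rpow_re_of_pos pi_pos]
          apply Real.rpow_le_one_of_one_le_of_nonpos
          · linarith [Real.pi_gt_three]
          · simp only [Complex.div_ofNat_re, Complex.neg_re]; linarith
        have e2 : ‖Complex.Gamma (s / 2)‖ ≤ (3 * y) ^ (3 * y) := by
          have hre2 : (s / 2).re = s.re / 2 := by simp
          refine (norm_Gamma_le (by rw [hre2]; linarith)).trans ?_
          rw [hre2]
          set x := s.re / 2 with hx
          have hx1 : 1 ≤ x := by linarith
          have hxy : x ≤ y := by
            have := Complex.re_le_norm s; linarith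
          have g1 : Real.Gamma x ≤ Real.Gamma (x + 1) := by
            rw [Real.Gamma_add_one (by linarith)]
            have := Real.Gamma_pos_of_pos (s := x) (by linarith)
            nlinarith
          have g2 : Real.Gamma (x + 1) ≤ Real.Gamma ((⌈x⌉₊ + 1:ℕ) + 1) := by
            apply Real.Gamma_strictMonoOn_Ici.monotoneOn
            · simp; linarith
            · simp only [Set.mem_Ici]; push_cast; have := Nat.le_ceil x; linarith
            · push_cast; have := Nat.le_ceil x; linarith
          rw [Real.Gamma_nat_eq_factorial] at g2
          have g3 : (((⌈x⌉₊ + 1).factorial:ℕ):ℝ) ≤ ((⌈x⌉₊ + 1:ℕ):ℝ) ^ (⌈x⌉₊ + 1) := by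
            exact_mod_cast Nat.factorial_le_pow _
          have g4 : ((⌈x⌉₊ + 1:ℕ):ℝ) ≤ 3 * y := by
            push_cast; have := Nat.ceil_lt_add_one (show 0 ≤ x by linarith); linarith
          calc Real.Gamma x ≤ ((⌈x⌉₊ + 1:ℕ):ℝ) ^ (⌈x⌉₊ + 1) := by linarith
            _ = ((⌈x⌉₊ + 1:ℕ):ℝ) ^ ((⌈x⌉₊ + 1:ℕ):ℝ) := by rw [rpow_natCast]
            _ ≤ (3 * y) ^ ((⌈x⌉₊ + 1:ℕ):ℝ) := by
              apply Real.rpow_le_rpow (by positivity) g4 (by positivity)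
            _ ≤ (3 * y) ^ (3 * y) := by
              apply Real.rpow_le_rpow_of_exponent_le (by linarith) g4
        calc _ ≤ 1 * (3 * y) ^ (3 * y) := by gcongr
          _ = _ := one_mul _
      have hG2 : (3 * y) ^ (3 * y) ≤ exp (12 * y ^ (3 / 2:ℝ)) := by
        rw [Real.rpow_def_of_pos (by linarith)]
        apply exp_le_exp.2
        have h4 : log (3 * y) ≤ 2 * Real.sqrt (3 * y) := by
          have := Real.log_le_sub_one_of_pos (x := Real.sqrt (3 * y)) (by positivity)
          rw [log_sqrt (by positivity)] at this
          linarith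
        have h5 : Real.sqrt (3 * y) ≤ 2 * Real.sqrt y := by
          rw [show 2 * Real.sqrt y = Real.sqrt (4 * y) by
            rw [Real.sqrt_mul (by norm_num), show (4:ℝ) = 2 ^ 2 by norm_num,
              Real.sqrt_sq (by norm_num)]]
          apply Real.sqrt_le_sqrt; linarith
        have h6 : y ^ (3 / 2:ℝ) = y * Real.sqrt y := by
          rw [Real.sqrt_eq_rpow, show (3 / 2:ℝ) = 1 + 1 / 2 by norm_num,
            Real.rpow_add (by linarith), Real.rpow_one]
        rw [h6]
        have : log (3 * y) * (3 * y) ≤ (4 * Real.sqrt y) * (3 * y) := by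
          gcongr; linarith
        linarith
      rw [norm_mul, norm_mul, norm_mul]
      calc ‖s‖ * ‖s - 1‖ * ‖Complex.Gammaℝ s‖ * ‖riemannZeta s‖
          ≤ y * y * exp (12 * y ^ (3 / 2:ℝ)) * K2 := by
            gcongr
            · exact hG.trans hG2
            · exact hK2' s h2
        _ = y ^ 2 * exp (12 * y ^ (3 / 2:ℝ)) * K2 := by ring
        _ ≤ exp (2 * y) * exp (12 * y ^ (3 / 2:ℝ)) * exp K2 := by
          gcongr
          linarith [Real.add_one_le_exp K2]
        _ = exp (2 * y + 12 * y ^ (3 / 2:ℝ) + K2) := by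
          rw [← exp_add, ← exp_add]
        _ ≤ _ := by
          apply exp_le_exp.2
          nlinarith
  intro z
  rcases le_total 0 z.re with h | h
  · exact main z h
  · have := main (-z) (by simpa using h)
    rw [norm_neg] at this
    rw [← xiG_one_sub]
    convert this using 3
    ring

/-- Hadamard limit formula for `xiG`. -/
lemma xiG_hadamard : ∃ Z : ℕ → Multiset ℂ, (∀ N, ∀ ρ ∈ Z N, xiG ρ = 0) ∧
      (∀ ρ, xiG ρ = 0 → ∀ᶠ N in atTop, ρ ∈ Z N) ∧
      ∀ s1 s2, xiG s1 ≠ 0 → xiG s2 ≠ 0 → Tendsto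
        (fun N => ((Z N).map (fun ρ => log (‖s1 - ρ‖ * ‖s1 - (1 - ρ)‖)
          - log (‖s2 - ρ‖ * ‖s2 - (1 - ρ)‖))).sum)
        atTop (nhds (2 * (log ‖xiG s1‖ - log ‖xiG s2‖))) ∧
        Tendsto (fun N => ((Z N).map (fun ρ => (s1 - ρ)⁻¹ + (s1 - (1 - ρ))⁻¹)).sum)
        atTop (nhds (2 * (deriv xiG s1 / xiG s1))) := by
  obtain ⟨C, hC, hgr⟩ := xiG_growth
  obtain ⟨Z, h1, h2, h3⟩ := hd_limit (f := fun z => xiG (1 / 2 + z))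
    (xiG_diff.comp (by fun_prop)) (by
      intro z
      rw [← xiG_one_sub]; congr 1; ring) (z0 := 1 / 2) (by norm_num [xiG_one]) hC hgr
  refine ⟨fun N => (Z N).map (fun ρ => 1 / 2 + ρ), ?_, ?_, ?_⟩
  · intro N ρ hρ
    obtain ⟨a, ha, rfl⟩ := Multiset.mem_map.1 hρ
    exact h1 N a ha
  · intro ρ hρ
    have := h2 (ρ - 1 / 2) (by simpa using hρ)
    filter_upwards [this] with N hN
    exact Multiset.mem_map.2 ⟨_, hN, by ring⟩
  · intro s1 s2 e1 e2
    have := h3 (s1 - 1 / 2) (s2 - 1 / 2) (by simpa using e1) (by simpa using e2)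
    simp only [add_sub_cancel] at this
    constructor
    · refine this.1.congr ?_
      intro N
      rw [Multiset.map_map]
      congr 1
      apply Multiset.map_congr rfl
      intro x _
      simp only [Function.comp]
      rw [← norm_mul, ← norm_mul]
      congr 3 <;> ring
    · have e3 : deriv (fun z => xiG (1 / 2 + z)) (s1 - 1 / 2) = deriv xiG s1 := by
        rw [deriv_comp_const_add]; congr 1; ring
      rw [e3] at this
      refine this.2.congr ?_
      intro N
      rw [Multiset.map_map]
      congr 1
      apply Multiset.map_congr rfl
      intro x hx
      simp only [Function.comp]
      have hx0 : xiG (1 / 2 + x) = 0 := h1 N x hx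
      have n1 : s1 - (1 / 2 + x) ≠ 0 := by
        intro h; rw [sub_eq_zero] at h; rw [h] at e1; exact e1 hx0
      have n2 : s1 - (1 - (1 / 2 + x)) ≠ 0 := by
        intro h; rw [sub_eq_zero] at h; rw [h, xiG_one_sub] at e1; exact e1 hx0
      have n3 : (s1 - 1 / 2) ^ 2 - x ^ 2 ≠ 0 := by
        have := mul_ne_zero n1 n2
        convert this using 1; ring
      rw [inv_add_inv n1 n2, div_eq_div_iff n3 (mul_ne_zero n1 n2)]
      ring

/-- sum of real parts of the pair of Hadamard terms -/
noncomputable def hdD (u c y:ℝ) : ℝ :=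
  (u - c) / ((u - c) ^ 2 + y ^ 2) + (u + c) / ((u + c) ^ 2 + y ^ 2)

noncomputable def hdL (u c y:ℝ) : ℝ :=
  (log ((u - c) ^ 2 + y ^ 2) + log ((u + c) ^ 2 + y ^ 2)) / 2

/-- real part of the logarithmic derivative of `xiG` -/
noncomputable def zA (σ t:ℝ) : ℝ := (deriv xiG ⟨σ, t⟩ / xiG ⟨σ, t⟩).re

lemma deriv_xiG_conj (s:ℂ) : deriv xiG (starRingEnd ℂ s) = starRingEnd ℂ (deriv xiG s) := by
  have h := (xiG_diff s).hasDerivAt.star_conj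
  have e : (star ∘ xiG ∘ (starRingEnd ℂ)) = xiG := by
    funext z
    simp only [Function.comp]
    rw [xiG_conj]; simp
  have h2 := h.deriv
  rw [show (star ∘ xiG ∘ (starRingEnd ℂ)) = xiG from e] at h2
  exact h2

lemma hd_inv_re (σ t β γ:ℝ) :
    ((⟨σ, t⟩ - ⟨β, γ⟩:ℂ)⁻¹).re = (σ - β) / ((σ - β) ^ 2 + (t - γ) ^ 2) := by
  rw [Complex.inv_re]
  simp [Complex.normSq_apply, pow_two]

lemma hd_norm_log (σ t β γ:ℝ) :
    log ‖(⟨σ, t⟩ - ⟨β, γ⟩:ℂ)‖ = log ((σ - β) ^ 2 + (t - γ) ^ 2) / 2 := by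
  rw [Complex.norm_def, log_sqrt (Complex.normSq_nonneg _)]
  simp [Complex.normSq_apply, pow_two]

lemma xiG_real : ∃ Z : ℕ → Multiset ℂ, (∀ N, ∀ ρ ∈ Z N, xiG ρ = 0) ∧
      (∀ ρ, xiG ρ = 0 → ∀ᶠ N in atTop, ρ ∈ Z N) ∧
      (∀ σ t : ℝ, xiG ⟨σ, t⟩ ≠ 0 → Tendsto
        (fun N => ((Z N).map (fun ρ => (hdD (σ - 1 / 2) (ρ.re - 1 / 2) (t - ρ.im)
          + hdD (σ - 1 / 2) (ρ.re - 1 / 2) (t + ρ.im)) / 4)).sum)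
        atTop (nhds (zA σ t))) ∧
      (∀ σ1 σ2 t1 t2 : ℝ, xiG ⟨σ1, t1⟩ ≠ 0 → xiG ⟨σ2, t2⟩ ≠ 0 → Tendsto
        (fun N => ((Z N).map (fun ρ => (hdL (σ1 - 1 / 2) (ρ.re - 1 / 2) (t1 - ρ.im)
          + hdL (σ1 - 1 / 2) (ρ.re - 1 / 2) (t1 + ρ.im)
          - hdL (σ2 - 1 / 2) (ρ.re - 1 / 2) (t2 - ρ.im)
          - hdL (σ2 - 1 / 2) (ρ.re - 1 / 2) (t2 + ρ.im)) / 4)).sum)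
        atTop (nhds (log ‖xiG ⟨σ1, t1⟩‖ - log ‖xiG ⟨σ2, t2⟩‖))) := by
  obtain ⟨Z, h1, h2, h3⟩ := xiG_hadamard
  have hconj : ∀ σ t : ℝ, (⟨σ, -t⟩:ℂ) = starRingEnd ℂ ⟨σ, t⟩ := fun σ t => rfl
  have hone : ∀ ρ : ℂ, (1 - ρ:ℂ) = ⟨1 - ρ.re, -ρ.im⟩ := by
    intro ρ; apply Complex.ext <;> simp
  refine ⟨Z, h1, h2, ?_, ?_⟩
  · intro σ t hne
    have hne' : xiG ⟨σ, -t⟩ ≠ 0 := by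
      rw [hconj, xiG_conj]; simpa using hne
    have a1 := (h3 _ 1 hne (by rw [xiG_one]; norm_num)).2
    have a2 := (h3 _ 1 hne' (by rw [xiG_one]; norm_num)).2
    have a3 := (Complex.continuous_re.tendsto _).comp (a1.add a2)
    have a4 := a3.const_mul (1 / 4)
    have e : (1 / 4:ℝ) * (2 * (deriv xiG ⟨σ, t⟩ / xiG ⟨σ, t⟩) +
        2 * (deriv xiG ⟨σ, -t⟩ / xiG ⟨σ, -t⟩)).re = zA σ t := by
      rw [hconj, xiG_conj, deriv_xiG_conj, ← map_div₀, zA]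
      generalize (deriv xiG ⟨σ, t⟩ / xiG ⟨σ, t⟩) = w
      rw [← mul_add, Complex.add_conj, ← Complex.ofReal_ofNat, ← Complex.ofReal_mul,
        Complex.ofReal_re]
      ring
    rw [e] at a4
    refine a4.congr ?_
    intro N
    simp only [Function.comp]
    have hre : ∀ w : ℂ, w.re = Complex.reAddGroupHom w := fun w => rfl
    rw [← Multiset.sum_map_add, hre, map_multiset_sum, Multiset.map_map,
      ← Multiset.sum_map_mul_left]
    congr 1
    apply Multiset.map_congr rfl
    intro ρ hρ
    simp only [Function.comp, Complex.coe_reAddGroupHom, Complex.add_re]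
    rw [hone]
    have e0 : ρ = ⟨ρ.re, ρ.im⟩ := rfl
    rw [show ((⟨σ, t⟩ - ρ:ℂ)⁻¹).re = _ from hd_inv_re σ t ρ.re ρ.im, hd_inv_re,
      show ((⟨σ, -t⟩ - ρ:ℂ)⁻¹).re = _ from hd_inv_re σ (-t) ρ.re ρ.im, hd_inv_re]
    unfold hdD
    rw [show σ - 1 / 2 - (ρ.re - 1 / 2) = σ - ρ.re by ring,
      show σ - 1 / 2 + (ρ.re - 1 / 2) = σ - (1 - ρ.re) by ring,
      show (-t - ρ.im) ^ 2 = (t + ρ.im) ^ 2 by ring,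
      show (-t - -ρ.im) ^ 2 = (t - ρ.im) ^ 2 by ring,
      show (t - -ρ.im) ^ 2 = (t + ρ.im) ^ 2 by ring]
    ring
  · intro σ1 σ2 t1 t2 hn1 hn2
    have hn1' : xiG ⟨σ1, -t1⟩ ≠ 0 := by
      rw [hconj, xiG_conj]; simpa using hn1
    have hn2' : xiG ⟨σ2, -t2⟩ ≠ 0 := by
      rw [hconj, xiG_conj]; simpa using hn2
    have a1 := (h3 _ _ hn1 hn2).1
    have a2 := (h3 _ _ hn1' hn2').1
    have a4 := (a1.add a2).const_mul (1 / 4)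
    have e : (1 / 4:ℝ) * (2 * (log ‖xiG ⟨σ1, t1⟩‖ - log ‖xiG ⟨σ2, t2⟩‖) +
        2 * (log ‖xiG ⟨σ1, -t1⟩‖ - log ‖xiG ⟨σ2, -t2⟩‖)) =
        log ‖xiG ⟨σ1, t1⟩‖ - log ‖xiG ⟨σ2, t2⟩‖ := by
      rw [hconj, xiG_conj, hconj, xiG_conj, RCLike.norm_conj, RCLike.norm_conj]
      ring
    rw [e] at a4
    refine a4.congr ?_
    intro N
    rw [← Multiset.sum_map_add, ← Multiset.sum_map_mul_left]
    congr 1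
    apply Multiset.map_congr rfl
    intro ρ hρ
    have hz := h1 N ρ hρ
    have key : ∀ σ t : ℝ, xiG ⟨σ, t⟩ ≠ 0 →
        log (‖(⟨σ, t⟩ - ρ:ℂ)‖ * ‖(⟨σ, t⟩ - (1 - ρ):ℂ)‖) =
        log ((σ - ρ.re) ^ 2 + (t - ρ.im) ^ 2) / 2
          + log ((σ - (1 - ρ.re)) ^ 2 + (t + ρ.im) ^ 2) / 2 := by
      intro σ t hne
      have n1 : (⟨σ, t⟩ - ρ:ℂ) ≠ 0 := by
        intro h; rw [sub_eq_zero] at h; rw [h] at hne; exact hne hz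
      have n2 : (⟨σ, t⟩ - (1 - ρ):ℂ) ≠ 0 := by
        intro h; rw [sub_eq_zero] at h; rw [h, xiG_one_sub] at hne; exact hne hz
      rw [log_mul (norm_ne_zero_iff.2 n1) (norm_ne_zero_iff.2 n2), hone,
        show log ‖(⟨σ, t⟩ - ρ:ℂ)‖ = _ from hd_norm_log σ t ρ.re ρ.im, hd_norm_log]
      congr 4; ring
    rw [key _ _ hn1, key _ _ hn2, key _ _ hn1', key _ _ hn2']
    unfold hdL
    rw [show ∀ σ : ℝ, σ - 1 / 2 - (ρ.re - 1 / 2) = σ - ρ.re by intro σ; ring,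
      show σ2 - 1 / 2 - (ρ.re - 1 / 2) = σ2 - ρ.re by ring,
      show σ2 - 1 / 2 + (ρ.re - 1 / 2) = σ2 - (1 - ρ.re) by ring,
      show σ1 - 1 / 2 + (ρ.re - 1 / 2) = σ1 - (1 - ρ.re) by ring,
      show (-t1 - ρ.im) ^ 2 = (t1 + ρ.im) ^ 2 by ring,
      show (-t1 + ρ.im) ^ 2 = (t1 - ρ.im) ^ 2 by ring,
      show (-t2 - ρ.im) ^ 2 = (t2 + ρ.im) ^ 2 by ring,
      show (-t2 + ρ.im) ^ 2 = (t2 - ρ.im) ^ 2 by ring]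
    ring

lemma dg_artanh {q:ℂ} (hq : ‖q‖ < 1) :
    ‖Complex.log (1 + q) - Complex.log (1 - q) - 2 * q‖ ≤ 2 / 3 * ‖q‖ ^ 3 / (1 - ‖q‖ ^ 2) := by
  have hs : HasSum (fun k : ℕ => (2:ℂ) * (1 / (2 * k + 1)) * q ^ (2 * k + 1))
      (Complex.log (1 + q) - Complex.log (1 - q)) := by
    set term := fun n : ℕ => -1 * ((-q) ^ (n + 1) / ((n:ℂ) + 1)) + q ^ (n + 1) / (n + 1)
    have h_term_eq_goal :
        term ∘ (2 * ·) = fun k : ℕ => 2 * (1 / (2 * (k:ℂ) + 1)) * q ^ (2 * k + 1) := by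
      ext n
      dsimp only [term, (· ∘ ·)]
      rw [Odd.neg_pow (⟨n, rfl⟩ : Odd (2 * n + 1)) q]
      push_cast
      ring_nf
    rw [← h_term_eq_goal, (mul_right_injective₀ (two_ne_zero' ℕ)).hasSum_iff]
    · have h₁ := (Complex.hasSum_taylorSeries_neg_log' (z := -q)
        (by rwa [norm_neg])).mul_left (-1)
      have h2 := h₁.add (Complex.hasSum_taylorSeries_neg_log' hq)
      rw [show -1 * -Complex.log (1 - -q) + -Complex.log (1 - q)
        = Complex.log (1 + q) - Complex.log (1 - q) by rw [sub_neg_eq_add]; ring] at h2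
      exact h2
    · intro m hm
      rw [Set.mem_range, not_exists] at hm
      have hm' : Even (m + 1) := by
        rw [Nat.even_add_one]
        rintro ⟨k, rfl⟩
        exact hm k (by ring)
      dsimp [term]
      rw [Even.neg_pow hm', neg_one_mul, neg_add_cancel]
  have hs1 := (hasSum_nat_add_iff' 1).2 hs
  simp only [Finset.sum_range_one] at hs1
  norm_num at hs1
  have hg : HasSum (fun k : ℕ => 2 / 3 * ‖q‖ ^ 3 * (‖q‖ ^ 2) ^ k)
      (2 / 3 * ‖q‖ ^ 3 * (1 - ‖q‖ ^ 2)⁻¹) :=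
    (hasSum_geometric_of_lt_one (by positivity) (by
      have := norm_nonneg q
      nlinarith)).mul_left _
  rw [div_eq_mul_inv, ← hs1.tsum_eq]
  refine tsum_of_norm_bounded hg ?_
  intro k
  rw [norm_mul, norm_mul, norm_pow, norm_inv]
  have e : ‖(2 * ((k:ℂ) + 1) + 1)‖ = 2 * k + 3 := by
    rw [show (2 * ((k:ℂ) + 1) + 1) = ((2 * k + 3:ℕ):ℂ) by push_cast; ring,
      Complex.norm_natCast]; push_cast; ring
  rw [e, show ‖(2:ℂ)‖ = 2 by simp, show 2 * (k + 1) + 1 = 3 + 2 * k by ring, pow_add, pow_mul]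
  have : (2 * (k:ℝ) + 3)⁻¹ ≤ 3⁻¹ := by
    apply inv_anti₀ (by norm_num); have : (0:ℝ) ≤ k := by positivity
    linarith
  calc 2 * (2 * (k:ℝ) + 3)⁻¹ * (‖q‖ ^ 3 * (‖q‖ ^ 2) ^ k)
      ≤ 2 * 3⁻¹ * (‖q‖ ^ 3 * (‖q‖ ^ 2) ^ k) := by gcongr
    _ = _ := by ring

lemma dg_step {w:ℂ} (hw : 1 / 2 < w.re) :
    |log ‖w + 1 / 2‖ - log ‖w - 1 / 2‖ - (w⁻¹).re| ≤
      1 / 24 * (1 / (w.re - 1 / 2) ^ 2 - 1 / (w.re + 1 / 2) ^ 2) := by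
  have hw0 : w ≠ 0 := by rintro rfl; norm_num at hw
  have hwn : w.re ≤ ‖w‖ := Complex.re_le_norm w
  set q : ℂ := 1 / (2 * w) with hqd
  have hqn : ‖q‖ = 1 / (2 * ‖w‖) := by rw [hqd]; simp
  have hq : ‖q‖ < 1 := by
    rw [hqn, div_lt_one (by linarith)]; linarith
  have h := (Complex.abs_re_le_norm _).trans (dg_artanh hq)
  have n1 : w + 1 / 2 ≠ 0 := by
    intro h; have := congrArg Complex.re h; simp at this; linarith
  have n2 : w - 1 / 2 ≠ 0 := by
    intro h; have := congrArg Complex.re h; simp at this; linarith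
  have e1 : 1 + q = (w + 1 / 2) / w := by rw [hqd]; field_simp
  have e2 : 1 - q = (w - 1 / 2) / w := by rw [hqd]; field_simp
  have e3 : 2 * q = w⁻¹ := by rw [hqd]; field_simp
  rw [Complex.sub_re, Complex.sub_re, Complex.log_re, Complex.log_re, e1, e2, e3, norm_div, norm_div,
    log_div (norm_ne_zero_iff.2 n1) (norm_ne_zero_iff.2 hw0),
    log_div (norm_ne_zero_iff.2 n2) (norm_ne_zero_iff.2 hw0)] at h
  rw [show log ‖w + 1 / 2‖ - log ‖w - 1 / 2‖ - (w⁻¹).re =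
    log ‖w + 1 / 2‖ - log ‖w‖ - (log ‖w - 1 / 2‖ - log ‖w‖) - (w⁻¹).re by ring]
  refine h.trans ?_
  rw [hqn]
  set x := w.re
  have hρ : 0 < ‖w‖ := by linarith
  set ρ := ‖w‖
  have a1 : 0 < x - 1 / 2 := by linarith
  have a2 : 0 < ρ - 1 / 2 := by linarith
  have a3 : 0 < x ^ 2 - 1 / 4 := by nlinarith
  have a4 : 0 < ρ ^ 2 - 1 / 4 := by nlinarith
  have e4 : 2 / 3 * (1 / (2 * ρ)) ^ 3 / (1 - (1 / (2 * ρ)) ^ 2) = 1 / 12 * (1 / (ρ * (ρ ^ 2 - 1 / 4))) := by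
    have : 1 - (1 / (2 * ρ)) ^ 2 = (ρ ^ 2 - 1 / 4) / ρ ^ 2 := by field_simp; ring
    rw [this]
    field_simp; norm_num
  have e5 : 1 / 24 * (1 / (x - 1 / 2) ^ 2 - 1 / (x + 1 / 2) ^ 2) = 1 / 12 * (x / (x ^ 2 - 1 / 4) ^ 2) := by
    rw [show x ^ 2 - 1 / 4 = (x - 1 / 2) * (x + 1 / 2) by ring]
    have h1 : x + 1 / 2 ≠ 0 := by linarith
    have h2 : x - 1 / 2 ≠ 0 := a1.ne'
    rw [mul_pow, div_sub_div _ _ (pow_ne_zero 2 h2) (pow_ne_zero 2 h1), mul_div, mul_div]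
    congr 1
    ring
  rw [e4, e5]
  refine mul_le_mul_of_nonneg_left ?_ (by norm_num)
  rw [div_le_div_iff₀ (by positivity) (by positivity)]
  have b1 : x * (x ^ 2 - 1 / 4) ≤ ρ * (ρ ^ 2 - 1 / 4) := by gcongr
  calc 1 * (x ^ 2 - 1 / 4) ^ 2 ≤ x * (x * (x ^ 2 - 1 / 4)) := by nlinarith
    _ ≤ _ := by gcongr

lemma dg_sum {z:ℂ} (hz : 1 / 2 < z.re) (n:ℕ) :
    |log ‖z + n - 1 / 2‖ - log ‖z - 1 / 2‖ - ∑ j ∈ range n, ((z + j)⁻¹).re| ≤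
      1 / 24 * (1 / (z.re - 1 / 2) ^ 2 - 1 / (z.re + n - 1 / 2) ^ 2) := by
  induction n with
  | zero => simp
  | succ n ih =>
    have h := dg_step (w := z + n) (by simp; have : (0:ℝ) ≤ n := by positivity
                                       norm_num at hz; linarith)
    rw [sum_range_succ]
    have h2 := abs_add_le (log ‖z + n - 1 / 2‖ - log ‖z - 1 / 2‖ - ∑ j ∈ range n, ((z + j)⁻¹).re)
      (log ‖z + n + 1 / 2‖ - log ‖z + n - 1 / 2‖ - ((z + n)⁻¹).re)
    have e : z + ((n + 1:ℕ):ℂ) - 1 / 2 = z + n + 1 / 2 := by push_cast; ring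
    rw [e]
    simp only [Complex.add_re, Complex.natCast_re] at h
    rw [show z.re + ((n + 1:ℕ):ℝ) - 1 / 2 = z.re + n + 1 / 2 by push_cast; ring]
    calc _ = |_| := by congr 1; ring
      _ ≤ _ := h2
      _ ≤ _ := by linarith

lemma dg_const {x:ℝ} (hx : 11 / 8 ≤ x) (y:ℝ) (hy : 0 ≤ y) :
    1 / 24 * (1 / (x - 1 / 2) ^ 2 - y) ≤ 3 / 50 := by
  have : 1 / (x - 1 / 2) ^ 2 ≤ 1 / (7 / 8:ℝ) ^ 2 := by gcongr; linarith
  norm_num at this ⊢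
  linarith

lemma dg_gammaSeq (x y:ℝ) (hx : 0 < x) (n:ℕ) (hn : 0 < n) :
    log ‖Complex.GammaSeq ⟨x, y⟩ n‖ = x * log n + log (n.factorial)
      - ∑ j ∈ range (n + 1), log ((x + j) ^ 2 + y ^ 2) / 2 := by
  have hj : ∀ j : ℕ, (⟨x, y⟩ + j:ℂ) ≠ 0 := by
    intro j h
    have := congrArg Complex.re h
    simp at this
    have : (0:ℝ) ≤ j := by positivity
    linarith
  have hn' : (0:ℝ) < n := by positivity
  rw [Complex.GammaSeq, norm_div, norm_mul, norm_prod, log_div, log_mul, Real.log_prod,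
    Complex.norm_natCast_cpow_of_pos hn, Real.log_rpow hn', Complex.norm_natCast]
  · congr 1
    apply sum_congr rfl
    intro j _
    rw [Complex.norm_def, log_sqrt (Complex.normSq_nonneg _)]
    simp [Complex.normSq_apply, pow_two]
  · intro j _
    exact norm_ne_zero_iff.2 (hj j)
  · rw [Complex.norm_natCast_cpow_of_pos hn]; positivity
  · simp [Nat.factorial_ne_zero]
  · rw [Complex.norm_natCast_cpow_of_pos hn]
    have := Nat.factorial_pos n
    simp [Nat.factorial_ne_zero]; positivity
  · exact (prod_pos (fun j _ => norm_pos_iff.2 (hj j))).ne'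

lemma dg_diff {x y h:ℝ} (hx : 11 / 8 ≤ x) (hh : 0 < h) :
    h * (log ‖(⟨x, y⟩ - 1 / 2:ℂ)‖ - 3 / 50) ≤
      log ‖Complex.Gamma ⟨x + h, y⟩‖ - log ‖Complex.Gamma ⟨x, y⟩‖ ∧
    log ‖Complex.Gamma ⟨x + h, y⟩‖ - log ‖Complex.Gamma ⟨x, y⟩‖ ≤
      h * (log ‖(⟨x + h, y⟩ - 1 / 2:ℂ)‖ + 3 / 50) := by
  have hG : ∀ x' : ℝ, 0 < x' → Tendsto (fun n => log ‖Complex.GammaSeq ⟨x', y⟩ n‖)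
      atTop (nhds (log ‖Complex.Gamma ⟨x', y⟩‖)) := by
    intro x' hx'
    apply Tendsto.log
    · exact (Complex.GammaSeq_tendsto_Gamma _).norm
    · exact norm_ne_zero_iff.2 (Complex.Gamma_ne_zero_of_re_pos hx')
  have hlim := (hG (x + h) (by linarith)).sub (hG x (by linarith))
  -- norm monotone
  have hmono : ∀ a b : ℝ, 1 / 2 ≤ a → a ≤ b → ‖(⟨a, y⟩ - 1 / 2:ℂ)‖ ≤ ‖(⟨b, y⟩ - 1 / 2:ℂ)‖ := by
    intro a b ha hab
    rw [Complex.norm_def, Complex.norm_def]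
    apply Real.sqrt_le_sqrt
    simp only [Complex.normSq_apply]
    norm_num
    nlinarith
  have hpos : ∀ a : ℝ, 1 / 2 < a → 0 < ‖(⟨a, y⟩ - 1 / 2:ℂ)‖ := by
    intro a ha
    apply norm_pos_iff.2
    intro h; have := congrArg Complex.re h; norm_num at this; linarith
  have key : ∀ n : ℕ, 0 < n →
      h * (log ‖(⟨x, y⟩ - 1 / 2:ℂ)‖ - 3 / 50 - (x + h + |y| + 2) / n) ≤
        log ‖Complex.GammaSeq ⟨x + h, y⟩ n‖ - log ‖Complex.GammaSeq ⟨x, y⟩ n‖ ∧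
      log ‖Complex.GammaSeq ⟨x + h, y⟩ n‖ - log ‖Complex.GammaSeq ⟨x, y⟩ n‖ ≤
        h * (log ‖(⟨x + h, y⟩ - 1 / 2:ℂ)‖ + 3 / 50) := by
    intro n hn
    have hn' : (0:ℝ) < n := by positivity
    have hn1 : (1:ℝ) ≤ n := by exact_mod_cast hn
    rw [dg_gammaSeq _ _ (by linarith) _ hn, dg_gammaSeq _ _ (by linarith) _ hn]
    set g : ℝ → ℝ := fun x' => x' * log n + log (n.factorial)
      - ∑ j ∈ range (n + 1), log ((x' + j) ^ 2 + y ^ 2) / 2 with hg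
    have hder : ∀ x', x ≤ x' → HasDerivAt g (log n - ∑ j ∈ range (n + 1),
        (((⟨x', y⟩:ℂ) + j)⁻¹).re) x' := by
      intro x' hx'
      have d1 : HasDerivAt (fun x' : ℝ => x' * log n + log (n.factorial)) (log n) x' := by
        simpa using ((hasDerivAt_id x').mul_const (log n)).add_const (log (n.factorial))
      refine d1.sub ?_
      apply HasDerivAt.fun_sum
      intro j _
      have hj : (0:ℝ) ≤ j := by positivity
      have hp : 0 < (x' + j) ^ 2 + y ^ 2 := by
        have : 0 < x' + j := by linarith
        positivity
      have d2 : HasDerivAt (fun x' : ℝ => (x' + j) ^ 2 + y ^ 2) (2 * (x' + j)) x' := by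
        have := (((hasDerivAt_id x').add_const (j:ℝ)).pow 2).add_const (y ^ 2)
        simpa using this
      have d3 := (d2.log hp.ne').div_const 2
      refine d3.congr_deriv ?_
      rw [Complex.inv_re]
      simp only [Complex.normSq_apply, Complex.add_re, Complex.add_im, Complex.natCast_re,
        Complex.natCast_im, add_zero]
      rw [← pow_two, ← pow_two]
      field_simp
    have hc : ContinuousOn g (Set.Icc x (x + h)) := fun w hw =>
      (hder w hw.1).continuousAt.continuousWithinAt
    obtain ⟨c, hc1, hc2⟩ := exists_hasDerivAt_eq_slope g _ (by linarith) hc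
      (fun w hw => hder w hw.1.le)
    rw [eq_div_iff (by linarith)] at hc2
    have hgg : x + h - x = h := by ring
    rw [hgg] at hc2
    change _ ≤ g (x + h) - g x ∧ g (x + h) - g x ≤ _
    rw [← hc2, mul_comm _ h]
    have hs := dg_sum (z := ⟨c, y⟩) (by have := hc1.1; change 1 / 2 < c; linarith) (n + 1)
    have hb := hs.trans (dg_const (x := c) (by linarith [hc1.1]) _ (by positivity))
    rw [abs_le] at hb
    have m1 : log ‖(⟨x, y⟩ - 1 / 2:ℂ)‖ ≤ log ‖(⟨c, y⟩ - 1 / 2:ℂ)‖ :=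
      log_le_log (hpos _ (by linarith)) (hmono _ _ (by linarith) hc1.1.le)
    have m2 : log ‖(⟨c, y⟩ - 1 / 2:ℂ)‖ ≤ log ‖(⟨x + h, y⟩ - 1 / 2:ℂ)‖ :=
      log_le_log (hpos _ (by linarith [hc1.1])) (hmono _ _ (by linarith [hc1.1]) hc1.2.le)
    have e1 : ‖(⟨c, y⟩ + ((n + 1:ℕ):ℂ) - 1 / 2:ℂ)‖ ≤ n * (1 + (x + h + |y| + 2) / n) := by
      have := Complex.norm_le_abs_re_add_abs_im (⟨c, y⟩ + ((n + 1:ℕ):ℂ) - 1 / 2:ℂ)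
      simp only [Complex.sub_re, Complex.add_re, Complex.sub_im, Complex.add_im] at this
      norm_num at this
      rw [abs_of_nonneg (by linarith [hc1.1])] at this
      have e : n * (1 + (x + h + |y| + 2) / n) = n + (x + h + |y| + 2) := by field_simp
      rw [e]
      push_cast
      linarith [hc1.2]
    have e2 : (n:ℝ) ≤ ‖(⟨c, y⟩ + ((n + 1:ℕ):ℂ) - 1 / 2:ℂ)‖ := by
      refine le_trans ?_ (Complex.re_le_norm _)
      simp
      norm_num
      linarith [hc1.1]
    have e3 := log_le_log hn' e2
    have e5 : 0 ≤ (x + h + |y| + 2) / n := by have := abs_nonneg y; positivity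
    have e4 := log_le_log (by linarith) e1
    rw [log_mul hn'.ne' (by linarith)] at e4
    have e6 := Real.log_le_sub_one_of_pos (show 0 < 1 + (x + h + |y| + 2) / n by linarith)
    constructor
    · apply mul_le_mul_of_nonneg_left _ hh.le
      linarith [hb.2]
    · apply mul_le_mul_of_nonneg_left _ hh.le
      linarith [hb.1]
  constructor
  · have ht : Tendsto (fun n : ℕ => h * (log ‖(⟨x, y⟩ - 1 / 2:ℂ)‖ - 3 / 50
        - (x + h + |y| + 2) / n)) atTop (nhds (h * (log ‖(⟨x, y⟩ - 1 / 2:ℂ)‖ - 3 / 50 - 0))) :=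
      (tendsto_const_nhds.sub (tendsto_const_div_atTop_nhds_zero_nat _)).const_mul h
    rw [sub_zero] at ht
    refine le_of_tendsto_of_tendsto ht hlim ?_
    filter_upwards [Filter.eventually_gt_atTop 0] with n hn using (key n hn).1
  · refine le_of_tendsto hlim ?_
    filter_upwards [Filter.eventually_gt_atTop 0] with n hn using (key n hn).2

/-- derivative of `log ‖f‖` in the real direction -/
lemma dg_log_norm_deriv {f : ℂ → ℂ} {f':ℂ} {x y:ℝ} (hf : HasDerivAt f f' ⟨x, y⟩)
    (h0 : f ⟨x, y⟩ ≠ 0) :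
    HasDerivAt (fun x' : ℝ => log ‖f ⟨x', y⟩‖) (f' / f ⟨x, y⟩).re x := by
  have d1 : HasDerivAt (fun x' : ℝ => (⟨x', y⟩:ℂ)) 1 x := by
    have h1 : (fun x' : ℝ => (⟨x', y⟩:ℂ)) = fun x' : ℝ => (x':ℂ) + (y:ℂ) * I := by
      funext x'; apply Complex.ext <;> simp
    rw [h1]
    exact (Complex.ofRealCLM.hasDerivAt (x := x)).add_const _
  have d2 : HasDerivAt (fun x' : ℝ => f ⟨x', y⟩) f' x := by
    have := hf.scomp x d1
    simpa [Function.comp_def] using this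
  have dre : HasDerivAt (fun x' : ℝ => (f ⟨x', y⟩).re) f'.re x :=
    (Complex.reCLM.hasFDerivAt.comp_hasDerivAt x d2)
  have dim : HasDerivAt (fun x' : ℝ => (f ⟨x', y⟩).im) f'.im x :=
    (Complex.imCLM.hasFDerivAt.comp_hasDerivAt x d2)
  have hp : Complex.normSq (f ⟨x, y⟩) ≠ 0 := by simpa using h0
  have d3 : HasDerivAt (fun x' : ℝ => Complex.normSq (f ⟨x', y⟩))
      (2 * ((f ⟨x, y⟩).re * f'.re + (f ⟨x, y⟩).im * f'.im)) x := by
    have := (dre.mul dre).add (dim.mul dim)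
    refine (this.congr_deriv (by ring)).congr_of_eventuallyEq ?_
    filter_upwards with x'
    simp [Complex.normSq_apply]
  have d4 := (d3.log hp).div_const 2
  have e : (fun x' : ℝ => log ‖f ⟨x', y⟩‖) = fun x' : ℝ => log (Complex.normSq (f ⟨x', y⟩)) / 2 := by
    funext x'
    rw [Complex.norm_def, log_sqrt (Complex.normSq_nonneg _)]
  rw [e]
  refine d4.congr_deriv ?_
  rw [Complex.div_re]
  field_simp

lemma dg_psi {x y:ℝ} (hx : 11 / 8 ≤ x) :
    |(deriv Complex.Gamma ⟨x, y⟩ / Complex.Gamma ⟨x, y⟩).re - log ‖(⟨x, y⟩ - 1 / 2:ℂ)‖| ≤ 3 / 50 := by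
  have hd : DifferentiableAt ℂ Complex.Gamma ⟨x, y⟩ := by
    apply Complex.differentiableAt_Gamma
    intro m h
    have := congrArg Complex.re h
    simp at this
    have : (0:ℝ) ≤ m := by positivity
    linarith
  have h1 := dg_log_norm_deriv hd.hasDerivAt
    (Complex.Gamma_ne_zero_of_re_pos (by change 0 < x; linarith))
  have h2 := hasDerivAt_iff_tendsto_slope_zero.1 h1
  have h3 := h2.mono_left (nhdsWithin_mono 0 (show Set.Ioi (0:ℝ) ⊆ {0}ᶜ from fun t ht => ne_of_gt ht))
  have hc : Tendsto (fun h : ℝ => log ‖(⟨x + h, y⟩ - 1 / 2:ℂ)‖ + 3 / 50)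
      (nhdsWithin 0 (Set.Ioi 0)) (nhds (log ‖(⟨x, y⟩ - 1 / 2:ℂ)‖ + 3 / 50)) := by
    have hn : (⟨x, y⟩ - 1 / 2:ℂ) ≠ 0 := by
      intro h; have := congrArg Complex.re h; norm_num at this; linarith
    have c1 := (dg_log_norm_deriv (f := fun s => s - 1 / 2) (f' := 1) (x := x) (y := y)
      ((hasDerivAt_id _).sub_const _) hn).continuousAt
    have c2 : ContinuousAt (fun h : ℝ => x + h) 0 := by fun_prop
    have c3 := ContinuousAt.comp (f := fun h : ℝ => x + h) (x := 0)
      (show ContinuousAt (fun x' : ℝ => log ‖(⟨x', y⟩ - 1 / 2:ℂ)‖) (x + 0) by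
        rw [add_zero]; exact c1) c2
    have c4 := c3.tendsto.add_const (3 / 50)
    simp only [Function.comp, add_zero] at c4
    exact c4.mono_left nhdsWithin_le_nhds
  rw [abs_le]
  constructor
  · have : log ‖(⟨x, y⟩ - 1 / 2:ℂ)‖ - 3 / 50 ≤ (deriv Complex.Gamma ⟨x, y⟩ / Complex.Gamma ⟨x, y⟩).re := by
      refine ge_of_tendsto h3 ?_
      filter_upwards [self_mem_nhdsWithin] with h hh
      have := (dg_diff (y := y) hx hh).1
      rw [smul_eq_mul, inv_mul_eq_div, le_div_iff₀ hh]
      linarith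
    linarith
  · have : (deriv Complex.Gamma ⟨x, y⟩ / Complex.Gamma ⟨x, y⟩).re ≤ log ‖(⟨x, y⟩ - 1 / 2:ℂ)‖ + 3 / 50 := by
      refine le_of_tendsto_of_tendsto h3 hc ?_
      filter_upwards [self_mem_nhdsWithin] with h hh
      have := (dg_diff (y := y) hx hh).2
      rw [smul_eq_mul, inv_mul_eq_div, div_le_iff₀ hh]
      linarith
    linarith

lemma xi_log {σ t:ℝ} (hσ : 0 < σ) (h1 : (⟨σ, t⟩:ℂ) ≠ 1) (hz : riemannZeta ⟨σ, t⟩ ≠ 0) :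
    log ‖xiG ⟨σ, t⟩‖ = log 2 + log ((σ - 1) ^ 2 + t ^ 2) / 2 - σ / 2 * log π
      + log ‖Complex.Gamma ⟨σ / 2 + 1, t / 2⟩‖ + log ‖riemannZeta ⟨σ, t⟩‖ := by
  set s : ℂ := ⟨σ, t⟩ with hs
  have h0 : s ≠ 0 := by intro h; have := congrArg Complex.re h; simp [hs] at this; linarith
  have e1 : xiG s = 2 * (s - 1) * (π:ℂ) ^ (-s / 2) * Complex.Gamma ⟨σ / 2 + 1, t / 2⟩ * riemannZeta s := by
    rw [xiG_eq (by simpa [hs] using hσ) h1, Complex.Gammaℝ]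
    have : (⟨σ / 2 + 1, t / 2⟩:ℂ) = s / 2 + 1 := by apply Complex.ext <;> simp [hs]
    rw [this, Complex.Gamma_add_one _ (by simpa using h0)]
    ring
  have hpi : ‖(π:ℂ) ^ (-s / 2)‖ = π ^ (-σ / 2) := by
    rw [Complex.norm_cpow_eq_rpow_re_of_pos pi_pos]
    congr 1
    simp [hs]
  have hg : Complex.Gamma ⟨σ / 2 + 1, t / 2⟩ ≠ 0 :=
    Complex.Gamma_ne_zero_of_re_pos (by change 0 < σ / 2 + 1; linarith)
  have hs1 : s - 1 ≠ 0 := sub_ne_zero.2 h1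
  have hpp := Real.rpow_pos_of_pos pi_pos (-σ / 2)
  have q1 : 0 < ‖s - 1‖ := norm_pos_iff.2 hs1
  have q2 := norm_pos_iff.2 hg
  have q3 := norm_pos_iff.2 hz
  have q4 : ‖(2:ℂ)‖ = 2 := by simp
  rw [e1, norm_mul, norm_mul, norm_mul, norm_mul, hpi, q4, log_mul (by positivity) q3.ne',
    log_mul (by positivity) q2.ne', log_mul (by positivity) hpp.ne',
    log_mul (by positivity) q1.ne', Real.log_rpow pi_pos]
  have : log ‖s - 1‖ = log ((σ - 1) ^ 2 + t ^ 2) / 2 := by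
    rw [Complex.norm_def, log_sqrt (Complex.normSq_nonneg _)]
    simp [Complex.normSq_apply, pow_two, hs]
  rw [this]
  ring

/-- main term from the Gamma factor -/
noncomputable def lgT (σ t:ℝ) : ℝ := log ((σ + 1) ^ 2 + t ^ 2) / 4 - log (2 * π) / 2

/-- real part of minus the log derivative of zeta -/
noncomputable def vM (σ t:ℝ) : ℝ := ∑' n : ℕ, vonMangoldt n * (n:ℝ) ^ (-σ) * Real.cos (t * log n)

lemma vM_summable0 {σ:ℝ} (hσ : 1 < σ) : Summable (fun n : ℕ => vonMangoldt n * (n:ℝ) ^ (-σ)) := by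
  have h := LSeriesSummable_vonMangoldt (s := (σ:ℂ)) (by simpa using hσ)
  have h2 := h.norm
  refine h2.congr ?_
  intro n
  rcases Nat.eq_zero_or_pos n with rfl | hn
  · simp
  · rw [LSeries.norm_term_eq]
    simp only [hn.ne', if_false]
    rw [Complex.norm_real, Real.norm_of_nonneg vonMangoldt_nonneg, rpow_neg (by positivity)]
    simp [div_eq_mul_inv]

lemma vM_hasSum {σ:ℝ} (t:ℝ) (hσ : 1 < σ) :
    HasSum (fun n : ℕ => vonMangoldt n * (n:ℝ) ^ (-σ) * Real.cos (t * log n)) (vM σ t) := by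
  apply Summable.hasSum
  refine Summable.of_norm_bounded (vM_summable0 hσ) ?_
  intro n
  rw [norm_mul, Real.norm_of_nonneg (mul_nonneg vonMangoldt_nonneg (by positivity))]
  have := Real.abs_cos_le_one (t * log n)
  exact mul_le_of_le_one_right (mul_nonneg vonMangoldt_nonneg (by positivity)) this

lemma vM_eq {σ:ℝ} (t:ℝ) (hσ : 1 < σ) :
    (deriv riemannZeta ⟨σ, t⟩ / riemannZeta ⟨σ, t⟩).re = - vM σ t := by
  have hs : 1 < (⟨σ, t⟩:ℂ).re := hσ
  have h := LSeries_vonMangoldt_eq_deriv_riemannZeta_div hs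
  have h1 := (LSeriesSummable_vonMangoldt hs).hasSum
  change HasSum _ (LSeries _ _) at h1
  rw [h] at h1
  have h2 := Complex.hasSum_re h1
  have h3 : HasSum (fun n : ℕ => vonMangoldt n * (n:ℝ) ^ (-σ) * Real.cos (t * log n))
      (-deriv riemannZeta ⟨σ, t⟩ / riemannZeta ⟨σ, t⟩).re := by
    refine h2.congr_fun ?_
    intro n
    rcases Nat.eq_zero_or_pos n with rfl | hn
    · simp
    · have hn' : (0:ℝ) < n := by positivity
      rw [LSeries.term_of_ne_zero hn.ne', div_eq_mul_inv, ← Complex.cpow_neg, Complex.re_ofReal_mul, mul_assoc]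
      congr 1
      rw [Complex.cpow_def_of_ne_zero (by exact_mod_cast hn.ne'), ← Complex.natCast_log, Complex.exp_re]
      simp only [Complex.mul_re, Complex.mul_im, Complex.ofReal_re, Complex.ofReal_im, Complex.neg_re, Complex.neg_im]
      rw [Real.rpow_def_of_pos hn']
      congr 1
      · congr 1; ring
      · rw [← Real.cos_neg]; congr 1; ring
  have h4 := (vM_hasSum t hσ).unique h3
  rw [h4, neg_div, Complex.neg_re, neg_neg]

lemma zA_bound {σ:ℝ} (t:ℝ) (hσ : 1 < σ) :
    |zA σ t - ((σ - 1) / ((σ - 1) ^ 2 + t ^ 2) + lgT σ t - vM σ t)| ≤ 3 / 100 := by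
  have hne : ∀ σ' : ℝ, 1 < σ' → (⟨σ', t⟩:ℂ) ≠ 1 := by
    intro σ' h' h; have := congrArg Complex.re h; simp at this; linarith
  have hzn : ∀ σ' : ℝ, 1 < σ' → riemannZeta (⟨σ', t⟩:ℂ) ≠ 0 := fun σ' h' =>
    riemannZeta_ne_zero_of_one_le_re (by change 1 ≤ σ'; linarith)
  have d1 := dg_log_norm_deriv (x := σ) (y := t) (xiG_diff _).hasDerivAt
    (xiG_ne_zero (s := ⟨σ, t⟩) (by change 1 ≤ σ; linarith))
  have hd : DifferentiableAt ℂ Complex.Gamma ⟨σ / 2 + 1, t / 2⟩ := by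
    apply Complex.differentiableAt_Gamma
    intro m h
    have := congrArg Complex.re h
    simp at this
    have : (0:ℝ) ≤ m := by positivity
    linarith
  have d2 := dg_log_norm_deriv hd.hasDerivAt
    (Complex.Gamma_ne_zero_of_re_pos (by change 0 < σ / 2 + 1; linarith))
  have d2' : HasDerivAt (fun σ' : ℝ => log ‖Complex.Gamma ⟨σ' / 2 + 1, t / 2⟩‖)
      ((deriv Complex.Gamma ⟨σ / 2 + 1, t / 2⟩ / Complex.Gamma ⟨σ / 2 + 1, t / 2⟩).re * (1 / 2)) σ := by
    have c : HasDerivAt (fun σ' : ℝ => σ' / 2 + 1) (1 / 2) σ :=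
      ((hasDerivAt_id σ).div_const 2).add_const 1
    exact HasDerivAt.comp (h := fun σ' : ℝ => σ' / 2 + 1)
      (h₂ := fun x : ℝ => log ‖Complex.Gamma ⟨x, t / 2⟩‖) σ d2 c
  have d3 := dg_log_norm_deriv (x := σ) (y := t) (differentiableAt_riemannZeta (hne σ hσ)).hasDerivAt (hzn σ hσ)
  have hp : 0 < (σ - 1) ^ 2 + t ^ 2 := by
    have : 0 < σ - 1 := by linarith
    positivity
  have d4 : HasDerivAt (fun x' : ℝ => log ((x' - 1) ^ 2 + t ^ 2) / 2)
      ((σ - 1) / ((σ - 1) ^ 2 + t ^ 2)) σ := by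
    have d : HasDerivAt (fun x' : ℝ => (x' - 1) ^ 2 + t ^ 2) (2 * (σ - 1)) σ := by
      have := (((hasDerivAt_id σ).sub_const (1:ℝ)).pow 2).add_const (t ^ 2)
      simpa using this
    refine ((d.log hp.ne').div_const 2).congr_deriv ?_
    field_simp
  have d5 : HasDerivAt (fun x' : ℝ => x' / 2 * log π) (1 / 2 * log π) σ :=
    ((hasDerivAt_id σ).div_const 2).mul_const _
  have d6 := ((((d4.const_add (log 2)).sub d5).add d2').add d3)
  have d7 := d6.congr_of_eventuallyEq (f₁ := fun x' : ℝ => log ‖xiG ⟨x', t⟩‖) (by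
    filter_upwards [lt_mem_nhds hσ] with x' hx'
    exact xi_log (by linarith) (hne x' hx') (hzn x' hx'))
  have e := d1.unique d7
  rw [vM_eq t hσ] at e
  have hps := dg_psi (x := σ / 2 + 1) (y := t / 2) (by linarith)
  have e2 : log ‖(⟨σ / 2 + 1, t / 2⟩ - 1 / 2:ℂ)‖ = log ((σ + 1) ^ 2 + t ^ 2) / 2 - log 2 := by
    rw [Complex.norm_def, log_sqrt (Complex.normSq_nonneg _)]
    have : Complex.normSq (⟨σ / 2 + 1, t / 2⟩ - 1 / 2:ℂ) = ((σ + 1) ^ 2 + t ^ 2) / 2 ^ 2 := by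
      simp only [Complex.normSq_apply]
      norm_num
      ring
    rw [this, log_div (by nlinarith) (by norm_num), log_pow]
    push_cast; ring
  rw [e2, abs_le] at hps
  have e3 : lgT σ t = 1 / 2 * (log ((σ + 1) ^ 2 + t ^ 2) / 2 - log 2) - 1 / 2 * log π := by
    rw [lgT, log_mul (by norm_num) Real.pi_ne_zero]; ring
  rw [zA, e, e3, abs_le]
  constructor <;> linarith [hps.1, hps.2]

lemma ms_sum_le {g : ℂ → ℝ} {S T : Multiset ℂ} (h : S ≤ T) (hg : ∀ ρ ∈ T, 0 ≤ g ρ) :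
    (S.map g).sum ≤ (T.map g).sum := by
  obtain ⟨R, rfl⟩ := Multiset.le_iff_exists_add.1 h
  rw [Multiset.map_add, Multiset.sum_add]
  have : 0 ≤ (R.map g).sum := by
    apply Multiset.sum_nonneg
    intro x hx
    obtain ⟨ρ, hρ, rfl⟩ := Multiset.mem_map.1 hx
    exact hg ρ (Multiset.mem_add.2 (Or.inr hρ))
  linarith

section zsum
variable {Z : ℕ → Multiset ℂ} {F : ℝ → ℝ → ℝ} {t L:ℝ}

lemma zs_ge (hZ : ∀ N, ∀ ρ ∈ Z N, xiG ρ = 0) (hZ2 : ∀ ρ, xiG ρ = 0 → ∀ᶠ N in atTop, ρ ∈ Z N)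
    (hF : ∀ c y, -(1 / 2) < c → c < 1 / 2 → 0 ≤ F c y)
    (hL : Tendsto (fun N => ((Z N).map (fun ρ => (F (ρ.re - 1 / 2) (t - ρ.im)
          + F (ρ.re - 1 / 2) (t + ρ.im)) / 4)).sum) atTop (nhds L))
    (S : Finset ℂ) (hS : ∀ ρ ∈ S, xiG ρ = 0) :
    ∑ ρ ∈ S, (F (ρ.re - 1 / 2) (t - ρ.im) + F (ρ.re - 1 / 2) (t + ρ.im)) / 4 ≤ L := by
  refine ge_of_tendsto hL ?_
  have : ∀ᶠ N in atTop, ∀ ρ ∈ S, ρ ∈ Z N := by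
    rw [Filter.eventually_all_finset]
    exact fun ρ hρ => hZ2 ρ (hS ρ hρ)
  filter_upwards [this] with N hN
  have hle : S.val ≤ Z N := (Multiset.le_iff_subset S.nodup).2 (fun ρ hρ => hN ρ hρ)
  refine ms_sum_le hle ?_
  intro ρ hρ
  have := xiG_zero_re (hZ N ρ hρ)
  have a := hF (ρ.re - 1 / 2) (t - ρ.im) (by linarith) (by linarith)
  have b := hF (ρ.re - 1 / 2) (t + ρ.im) (by linarith) (by linarith)
  linarith

lemma zs_two (hZ : ∀ N, ∀ ρ ∈ Z N, xiG ρ = 0) (hZ2 : ∀ ρ, xiG ρ = 0 → ∀ᶠ N in atTop, ρ ∈ Z N)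
    (hF : ∀ c y, -(1 / 2) < c → c < 1 / 2 → 0 ≤ F c y)
    (hL : Tendsto (fun N => ((Z N).map (fun ρ => (F (ρ.re - 1 / 2) (t - ρ.im)
          + F (ρ.re - 1 / 2) (t + ρ.im)) / 4)).sum) atTop (nhds L))
    {β γ:ℝ} (h0 : xiG ⟨β, γ⟩ = 0) (hγ : γ ≠ 0) :
    (F (β - 1 / 2) (t - γ) + F (β - 1 / 2) (t + γ)) / 2 ≤ L := by
  have hc : xiG ⟨β, -γ⟩ = 0 := by
    have := xiG_conj ⟨β, γ⟩
    rw [h0, _root_.map_zero] at this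
    exact this
  have h := zs_ge hZ hZ2 hF hL {⟨β, γ⟩, ⟨β, -γ⟩} (by simp [h0, hc])
  rw [sum_pair (by
    intro h; have := congrArg Complex.im h; simp at this; exact hγ (by linarith))] at h
  simp only [sub_neg_eq_add, ← sub_eq_add_neg] at h
  linarith

lemma zs_four (hZ : ∀ N, ∀ ρ ∈ Z N, xiG ρ = 0) (hZ2 : ∀ ρ, xiG ρ = 0 → ∀ᶠ N in atTop, ρ ∈ Z N)
    (hF : ∀ c y, -(1 / 2) < c → c < 1 / 2 → 0 ≤ F c y) (hFe : ∀ c y, F (-c) y = F c y)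
    (hL : Tendsto (fun N => ((Z N).map (fun ρ => (F (ρ.re - 1 / 2) (t - ρ.im)
          + F (ρ.re - 1 / 2) (t + ρ.im)) / 4)).sum) atTop (nhds L))
    {β γ:ℝ} (h0 : xiG ⟨β, γ⟩ = 0) (hγ : γ ≠ 0) (hβ : β ≠ 1 / 2) :
    F (β - 1 / 2) (t - γ) + F (β - 1 / 2) (t + γ) ≤ L := by
  have hone : ∀ x y : ℝ, (1 - ⟨x, y⟩:ℂ) = ⟨1 - x, -y⟩ := by
    intro x y; apply Complex.ext <;> simp
  have hc : xiG ⟨β, -γ⟩ = 0 := by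
    have := xiG_conj ⟨β, γ⟩
    rw [h0, _root_.map_zero] at this
    exact this
  have hc2 : xiG ⟨1 - β, -γ⟩ = 0 := by rw [← hone, xiG_one_sub, h0]
  have hc3 : xiG ⟨1 - β, γ⟩ = 0 := by
    have := hone β (-γ)
    rw [neg_neg] at this
    rw [← this, xiG_one_sub, hc]
  have n1 : γ ≠ -γ := fun h => hγ (by linarith)
  have n2 : β ≠ 1 - β := fun h => hβ (by linarith)
  have h := zs_ge hZ hZ2 hF hL {⟨β, γ⟩, ⟨β, -γ⟩, ⟨1 - β, γ⟩, ⟨1 - β, -γ⟩} (by simp [h0, hc, hc2, hc3])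
  rw [sum_insert (by simp [n1, n2]), sum_insert (by simp [n1, n2]), sum_pair (by simp [n1])] at h
  simp only [sub_neg_eq_add, ← sub_eq_add_neg] at h
  rw [show 1 - β - 1 / 2 = -(β - 1 / 2) by ring, hFe, hFe] at h
  linarith

end zsum

lemma hdD_even (u c y:ℝ) : hdD u (-c) y = hdD u c y := by
  unfold hdD; rw [sub_neg_eq_add, ← sub_eq_add_neg]; ring

lemma hdD_nonneg {u:ℝ} (hu : 1 / 2 ≤ u) (c y:ℝ) (h1 : -(1 / 2) < c) (h2 : c < 1 / 2) :
    0 ≤ hdD u c y := by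
  unfold hdD
  have : 0 ≤ u - c := by linarith
  have : 0 ≤ u + c := by linarith
  positivity

lemma zA_nonneg {σ:ℝ} (hσ : 1 ≤ σ) (t:ℝ) : 0 ≤ zA σ t := by
  obtain ⟨Z, h1, h2, h3, -⟩ := xiG_real
  have := zs_ge h1 h2 (F := hdD (σ - 1 / 2)) (hdD_nonneg (by linarith))
    (h3 σ t (xiG_ne_zero (s := ⟨σ, t⟩) hσ)) ∅ (by simp)
  simpa using this

lemma hdD_frac {u c y:ℝ} (h1 : 0 < u - c) (h2 : 0 < u + c) :
    hdD u c y = 2 * u * ((u ^ 2 - c ^ 2 + y ^ 2) / ((u ^ 2 - c ^ 2 + y ^ 2) ^ 2 + 4 * c ^ 2 * y ^ 2)) := by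
  unfold hdD
  have a1 : 0 < (u - c) ^ 2 + y ^ 2 := by positivity
  have a2 : 0 < (u + c) ^ 2 + y ^ 2 := by positivity
  have e : (u ^ 2 - c ^ 2 + y ^ 2) ^ 2 + 4 * c ^ 2 * y ^ 2 = ((u - c) ^ 2 + y ^ 2) * ((u + c) ^ 2 + y ^ 2) := by
    ring
  rw [e]
  field_simp
  ring

lemma stk_nonneg {u:ℝ} (hu : 1 / 2 ≤ u) (c y:ℝ) (h1 : -(1 / 2) < c) (h2 : c < 1 / 2) :
    0 ≤ hdD u c y - 4 / 9 * hdD (u + 5 / 8) c y := by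
  rw [hdD_frac (by linarith) (by linarith), hdD_frac (by linarith) (by linarith)]
  have he : c ^ 2 < 1 / 4 := by nlinarith
  have ha : 0 < u ^ 2 - c ^ 2 := by nlinarith
  set e := c ^ 2
  have hA : 1 ≤ (u + 5 / 8) ^ 2 - e := by nlinarith
  have haA : u ^ 2 - e ≤ (u + 5 / 8) ^ 2 - e := by nlinarith
  set a := u ^ 2 - e
  set A := (u + 5 / 8) ^ 2 - e
  have he0 : 0 ≤ e := sq_nonneg c
  have hY : 0 ≤ y ^ 2 := sq_nonneg y
  set Y := y ^ 2
  have q : (A + Y) / ((A + Y) ^ 2 + 4 * e * Y) ≤ (a + Y) / ((a + Y) ^ 2 + 4 * e * Y) := by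
    rw [div_le_div_iff₀ (by positivity) (by positivity)]
    have : 0 ≤ (A - a) * (Y ^ 2 + (A + a - 4 * e) * Y + a * A) := by
      apply mul_nonneg (by linarith)
      have : 0 ≤ A + a - 4 * e := by linarith
      positivity
    nlinarith
  have q0 : 0 ≤ (A + Y) / ((A + Y) ^ 2 + 4 * e * Y) := by positivity
  have q1 : 4 / 9 * (2 * (u + 5 / 8)) ≤ 2 * u := by linarith
  calc (0:ℝ) ≤ 2 * u * ((a + Y) / ((a + Y) ^ 2 + 4 * e * Y)) - 2 * u * ((A + Y) / ((A + Y) ^ 2 + 4 * e * Y)) := by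
        rw [← mul_sub]; apply mul_nonneg <;> linarith
    _ ≤ _ := by
      have := mul_le_mul_of_nonneg_right q1 q0
      linarith

lemma stk_zero {u c y:ℝ} (hu : 1 / 2 ≤ u) (hu1 : u ≤ 1) (h1 : 0 ≤ c) (h2 : c < 1 / 2)
    (hy : |y| ≤ 1 / 16) :
    (u - c) / ((u - c) ^ 2 + y ^ 2) ≤ hdD u c y - 4 / 9 * hdD (u + 5 / 8) c y := by
  rw [hdD_frac (u := u + 5 / 8) (by linarith) (by linarith)]
  unfold hdD
  have hY1 : y ^ 2 ≤ 1 / 256 := by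
    rw [← sq_abs]; nlinarith [abs_nonneg y]
  have hY : 0 ≤ y ^ 2 := sq_nonneg y
  have hA : 1 ≤ (u + 5 / 8) ^ 2 - c ^ 2 := by nlinarith
  have e1 : ((u + 5 / 8) ^ 2 - c ^ 2 + y ^ 2) / (((u + 5 / 8) ^ 2 - c ^ 2 + y ^ 2) ^ 2 + 4 * c ^ 2 * y ^ 2)
      ≤ 1 / ((u + 5 / 8) ^ 2 - c ^ 2) := by
    set A := (u + 5 / 8) ^ 2 - c ^ 2
    rw [div_le_div_iff₀ (by positivity) (by positivity)]
    nlinarith [mul_nonneg (sq_nonneg c) hY]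
  have e2 : 4 / 9 * (2 * (u + 5 / 8) * (1 / ((u + 5 / 8) ^ 2 - c ^ 2))) ≤ (u + c) / ((u + c) ^ 2 + y ^ 2) := by
    rw [show 4 / 9 * (2 * (u + 5 / 8) * (1 / ((u + 5 / 8) ^ 2 - c ^ 2))) =
      (8 / 9 * (u + 5 / 8)) / ((u + 5 / 8) ^ 2 - c ^ 2) by ring]
    have hp : 0 < u + c := by linarith
    rw [div_le_div_iff₀ (by positivity) (by positivity)]
    have : 8 / 9 * (u + 5 / 8) * ((u + c) ^ 2 + y ^ 2) ≤ 8 / 9 * (u + 5 / 8) * ((u + c) ^ 2 + 1 / 256) := by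
      gcongr
    refine this.trans ?_
    obtain ⟨d, rfl⟩ : ∃ d, u = 1 / 2 + d := ⟨u - 1 / 2, by ring⟩
    obtain ⟨f, rfl⟩ : ∃ f, c = 1 / 2 - f := ⟨1 / 2 - c, by ring⟩
    have hd : 0 ≤ d := by linarith
    have hd1 : d ≤ 1 / 2 := by linarith
    have hf : 0 ≤ f := by linarith
    have hf1 : f ≤ 1 / 2 := by linarith
    nlinarith [mul_nonneg hd hf, mul_nonneg (mul_nonneg hd hf) hd, mul_nonneg (mul_nonneg hd hf) hf,
      mul_nonneg hd hd, mul_nonneg hf hf, mul_nonneg (mul_nonneg hf hf) (sub_nonneg.2 hf1),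
      mul_nonneg hf (sub_nonneg.2 hf1), mul_nonneg hd (sub_nonneg.2 hd1), mul_nonneg hd (sub_nonneg.2 hf1),
      mul_nonneg hf (sub_nonneg.2 hd1)]
  have e3 := mul_le_mul_of_nonneg_left e1 (show (0:ℝ) ≤ 4 / 9 * (2 * (u + 5 / 8)) by linarith)
  linarith

/-- Stechkin combination -/
noncomputable def P2 (σ t:ℝ) : ℝ := zA σ t - 4 / 9 * zA (σ + 5 / 8) t

lemma P2_tendsto : ∃ Z : ℕ → Multiset ℂ, (∀ N, ∀ ρ ∈ Z N, xiG ρ = 0) ∧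
      (∀ ρ, xiG ρ = 0 → ∀ᶠ N in atTop, ρ ∈ Z N) ∧
      ∀ σ t : ℝ, 1 ≤ σ → Tendsto
        (fun N => ((Z N).map (fun ρ =>
          ((fun c y => hdD (σ - 1 / 2) c y - 4 / 9 * hdD (σ - 1 / 2 + 5 / 8) c y) (ρ.re - 1 / 2) (t - ρ.im)
          + (fun c y => hdD (σ - 1 / 2) c y - 4 / 9 * hdD (σ - 1 / 2 + 5 / 8) c y)
              (ρ.re - 1 / 2) (t + ρ.im)) / 4)).sum)
        atTop (nhds (P2 σ t)) := by
  obtain ⟨Z, h1, h2, h3, -⟩ := xiG_real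
  refine ⟨Z, h1, h2, ?_⟩
  intro σ t hσ
  have a := h3 σ t (xiG_ne_zero (s := ⟨σ, t⟩) hσ)
  have b := h3 (σ + 5 / 8) t (xiG_ne_zero (s := ⟨σ + 5 / 8, t⟩) (by change 1 ≤ σ + 5 / 8; linarith))
  refine (a.sub (b.const_mul (4 / 9))).congr ?_
  intro N
  rw [← Multiset.sum_map_mul_left, ← Multiset.sum_map_sub]
  congr 1
  apply Multiset.map_congr rfl
  intro ρ _
  rw [show σ + 5 / 8 - 1 / 2 = σ - 1 / 2 + 5 / 8 by ring]
  ring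

lemma P2_nonneg {σ:ℝ} (hσ : 1 ≤ σ) (t:ℝ) : 0 ≤ P2 σ t := by
  obtain ⟨Z, h1, h2, h3⟩ := P2_tendsto
  have := zs_ge h1 h2 (fun c y => stk_nonneg (by linarith) c y) (h3 σ t hσ) ∅ (by simp)
  simpa using this

lemma P2_zero {σ t β γ:ℝ} (hσ : 1 ≤ σ) (hσ1 : σ ≤ 3 / 2) (h0 : xiG ⟨β, γ⟩ = 0) (hγ : γ ≠ 0)
    (hβ : 1 / 2 < β) (ht : |t - γ| ≤ 1 / 16) :
    (σ - β) / ((σ - β) ^ 2 + (t - γ) ^ 2) ≤ P2 σ t := by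
  obtain ⟨Z, h1, h2, h3⟩ := P2_tendsto
  have hb := xiG_zero_re h0
  have h := zs_four h1 h2 (fun c y => stk_nonneg (by linarith) c y)
    (fun c y => by simp only [hdD_even]) (h3 σ t hσ) h0 hγ hβ.ne'
  have k1 := stk_zero (u := σ - 1 / 2) (c := β - 1 / 2) (y := t - γ) (by linarith) (by linarith)
    (by linarith) (by linarith [hb.2]) ht
  have k2 := stk_nonneg (u := σ - 1 / 2) (by linarith) (β - 1 / 2) (t + γ) (by linarith) (by linarith [hb.2])
  rw [show σ - 1 / 2 - (β - 1 / 2) = σ - β by ring] at k1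
  linarith

/-- weights -/
noncomputable def wS (σ:ℝ) (n:ℕ) : ℝ :=
  vonMangoldt n * (n:ℝ) ^ (-σ) * (1 - 4 / 9 * (n:ℝ) ^ (-(5 / 8):ℝ))

lemma wS_nonneg (σ:ℝ) (n:ℕ) : 0 ≤ wS σ n := by
  unfold wS
  rcases Nat.eq_zero_or_pos n with rfl | hn
  · simp
  · have h1 : (n:ℝ) ^ (-(5 / 8):ℝ) ≤ 1 :=
      Real.rpow_le_one_of_one_le_of_nonpos (by exact_mod_cast hn) (by norm_num)
    have h2 : 0 ≤ 1 - 4 / 9 * (n:ℝ) ^ (-(5 / 8):ℝ) := by linarith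
    exact mul_nonneg (mul_nonneg vonMangoldt_nonneg (by positivity)) h2

lemma wS_hasSum {σ:ℝ} (hσ : 1 < σ) (t:ℝ) :
    HasSum (fun n => wS σ n * Real.cos (t * log n)) (vM σ t - 4 / 9 * vM (σ + 5 / 8) t) := by
  refine ((vM_hasSum t hσ).sub ((vM_hasSum t (σ := σ + 5 / 8) (by linarith)).mul_left (4 / 9))).congr_fun ?_
  intro n
  unfold wS
  rcases Nat.eq_zero_or_pos n with rfl | hn
  · simp
  · rw [show -(σ + 5 / 8) = -σ + (-(5 / 8)) by ring, Real.rpow_add (by exact_mod_cast hn)]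
    ring

noncomputable def E0 (σ t:ℝ) : ℝ := (σ - 1) / ((σ - 1) ^ 2 + t ^ 2) + lgT σ t

lemma P2_upper {σ:ℝ} (hσ : 1 < σ) (t:ℝ) :
    P2 σ t ≤ E0 σ t - 4 / 9 * E0 (σ + 5 / 8) t + 13 / 300 - (vM σ t - 4 / 9 * vM (σ + 5 / 8) t) := by
  have a := (abs_le.1 (zA_bound t hσ)).2
  have b := (abs_le.1 (zA_bound t (σ := σ + 5 / 8) (by linarith))).1
  unfold P2 E0
  linarith

lemma P2_upper2 {σ:ℝ} (hσ : 1 < σ) (t:ℝ) :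
    P2 σ t ≤ (σ - 1) / ((σ - 1) ^ 2 + t ^ 2) + 5 / 9 * lgT σ t + 13 / 300
      - (vM σ t - 4 / 9 * vM (σ + 5 / 8) t) := by
  refine (P2_upper hσ t).trans ?_
  have h1 : lgT σ t ≤ lgT (σ + 5 / 8) t := by
    unfold lgT
    have : log ((σ + 1) ^ 2 + t ^ 2) ≤ log ((σ + 5 / 8 + 1) ^ 2 + t ^ 2) := by
      apply log_le_log (by nlinarith)
      nlinarith
    linarith
  have h2 : 0 ≤ (σ + 5 / 8 - 1) / ((σ + 5 / 8 - 1) ^ 2 + t ^ 2) := by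
    have : 0 < σ + 5 / 8 - 1 := by linarith
    positivity
  unfold E0
  linarith

/-- the basic inequality -/
lemma cert_basic {σ t β γ a0 a1 a2 a3:ℝ} (hσ : 1 < σ) (hσ1 : σ ≤ 3 / 2)
    (ha1 : 0 ≤ a1) (ha2 : 0 ≤ a2) (ha3 : 0 ≤ a3) (ha0 : 0 ≤ a0)
    (htr : ∀ x : ℝ, 0 ≤ a0 + a1 * Real.cos x + a2 * Real.cos (2 * x) + a3 * Real.cos (3 * x))
    (h0 : xiG ⟨β, γ⟩ = 0) (hγ : γ ≠ 0) (hβ : 1 / 2 < β) (ht : |t - γ| ≤ 1 / 16) (S : Finset ℕ) :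
    a1 * ((σ - β) / ((σ - β) ^ 2 + (t - γ) ^ 2)) ≤
      a0 * (1 / (σ - 1) + lgT σ 0 - 4 / 9 * (1 / (σ - 3 / 8) + lgT (σ + 5 / 8) 0) + 13 / 300)
      + a1 * ((σ - 1) / ((σ - 1) ^ 2 + t ^ 2) + 5 / 9 * lgT σ t + 13 / 300)
      + a2 * ((σ - 1) / ((σ - 1) ^ 2 + (2 * t) ^ 2) + 5 / 9 * lgT σ (2 * t) + 13 / 300)
      + a3 * ((σ - 1) / ((σ - 1) ^ 2 + (3 * t) ^ 2) + 5 / 9 * lgT σ (3 * t) + 13 / 300)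
      - ∑ n ∈ S, wS σ n * (a0 + a1 * Real.cos (t * log n) + a2 * Real.cos (2 * (t * log n))
          + a3 * Real.cos (3 * (t * log n))) := by
  have q0 := P2_upper hσ 0
  have q1 := P2_upper2 hσ t
  have q2 := P2_upper2 hσ (2 * t)
  have q3 := P2_upper2 hσ (3 * t)
  have p0 := P2_nonneg hσ.le 0
  have p2 := P2_nonneg hσ.le (2 * t)
  have p3 := P2_nonneg hσ.le (3 * t)
  have p1 := P2_zero hσ.le hσ1 h0 hγ hβ ht
  have e0 : E0 σ 0 - 4 / 9 * E0 (σ + 5 / 8) 0 =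
      1 / (σ - 1) + lgT σ 0 - 4 / 9 * (1 / (σ - 3 / 8) + lgT (σ + 5 / 8) 0) := by
    unfold E0
    have n1 : σ - 1 ≠ 0 := by linarith
    have n2 : σ + 5 / 8 - 1 = σ - 3 / 8 := by ring
    have n3 : σ - 3 / 8 ≠ 0 := by linarith
    rw [n2]
    have key : ∀ x : ℝ, x ≠ 0 → x / (x ^ 2 + 0 ^ 2) = 1 / x := by
      intro x hx
      rw [div_eq_div_iff (by simpa using hx) hx]
      ring
    rw [key _ n1, key _ n3]
  rw [e0] at q0
  have hs := ((((wS_hasSum hσ 0).mul_left a0).add ((wS_hasSum hσ t).mul_left a1)).add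
    ((wS_hasSum hσ (2 * t)).mul_left a2)).add ((wS_hasSum hσ (3 * t)).mul_left a3)
  have hle : ∑ n ∈ S, wS σ n * (a0 + a1 * Real.cos (t * log n) + a2 * Real.cos (2 * (t * log n))
          + a3 * Real.cos (3 * (t * log n))) ≤
        a0 * (vM σ 0 - 4 / 9 * vM (σ + 5 / 8) 0) + a1 * (vM σ t - 4 / 9 * vM (σ + 5 / 8) t)
        + a2 * (vM σ (2 * t) - 4 / 9 * vM (σ + 5 / 8) (2 * t))
        + a3 * (vM σ (3 * t) - 4 / 9 * vM (σ + 5 / 8) (3 * t)) := by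
    refine le_trans (le_of_eq ?_) (sum_le_hasSum S ?_ hs)
    · apply sum_congr rfl
      intro n _
      rw [zero_mul, Real.cos_zero, mul_assoc 2 t, mul_assoc 3 t]
      ring
    · intro n _
      have := mul_nonneg (wS_nonneg σ n) (htr (t * log n))
      rw [zero_mul, Real.cos_zero, mul_assoc 2 t, mul_assoc 3 t]
      linarith [this]
  have m0 := mul_le_mul_of_nonneg_left (p0.trans q0) ha0
  have m1 := mul_le_mul_of_nonneg_left (p1.trans q1) ha1
  have m2 := mul_le_mul_of_nonneg_left (p2.trans q2) ha2
  have m3 := mul_le_mul_of_nonneg_left (p3.trans q3) ha3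
  linarith

lemma low_zero_aux (h : zA 2 0 ≤ 1 / 10) {β γ:ℝ} (h0 : xiG ⟨β, γ⟩ = 0) : 25 ≤ γ ^ 2 := by
  obtain ⟨Z, h1, h2, h3, -⟩ := xiG_real
  have hb := xiG_zero_re h0
  simp only at hb
  have hF := hdD_nonneg (u := 2 - 1 / 2) (by norm_num)
  have hL := h3 2 0 (xiG_ne_zero (s := ⟨2, 0⟩) (by norm_num))
  have hlow : 3 / (4 + γ ^ 2) ≤ hdD (2 - 1 / 2) (β - 1 / 2) γ := by
    unfold hdD
    have a1 : 0 < 2 - β := by linarith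
    have a2 : 0 < 1 + β := by linarith
    rw [show (2:ℝ) - 1 / 2 - (β - 1 / 2) = 2 - β by ring, show (2:ℝ) - 1 / 2 + (β - 1 / 2) = 1 + β by ring]
    have b1 : (2 - β) / (4 + γ ^ 2) ≤ (2 - β) / ((2 - β) ^ 2 + γ ^ 2) := by
      apply div_le_div_of_nonneg_left a1.le (by positivity)
      nlinarith
    have b2 : (1 + β) / (4 + γ ^ 2) ≤ (1 + β) / ((1 + β) ^ 2 + γ ^ 2) := by
      apply div_le_div_of_nonneg_left a2.le (by positivity)
      nlinarith
    have : 3 / (4 + γ ^ 2) = (2 - β) / (4 + γ ^ 2) + (1 + β) / (4 + γ ^ 2) := by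
      rw [← add_div]; ring
    linarith
  have hneg : hdD (2 - 1 / 2) (β - 1 / 2) (-γ) = hdD (2 - 1 / 2) (β - 1 / 2) γ := by
    unfold hdD; rw [neg_sq]
  have hγ : γ ≠ 0 := by
    rintro rfl
    have := zs_ge h1 h2 hF hL {⟨β, 0⟩} (by simpa using h0)
    simp only [sum_singleton, sub_zero, add_zero] at this
    norm_num at hlow this
    linarith
  have := zs_two h1 h2 hF hL h0 hγ
  rw [zero_sub, zero_add, hneg] at this
  have h5 : 3 / (4 + γ ^ 2) ≤ 1 / 10 := by linarith
  rw [div_le_div_iff₀ (by positivity) (by norm_num)] at h5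
  linarith

/-- call by value for natural numbers -/
def force {α : Type} (n:ℕ) (f : ℕ → α) : α :=
  Nat.rec (motive := fun _ => α) (f 0) (fun m _ => f (Nat.succ m)) n

def forceZ {α : Type} (z:ℤ) (f : ℤ → α) : α :=
  match z with
  | Int.ofNat n => force n fun m => f (Int.ofNat m)
  | Int.negSucc n => force n fun m => f (Int.negSucc m)

lemma force_eq {α : Type} (n:ℕ) (f : ℕ → α) : force n f = f n := by
  cases n <;> rfl

lemma forceZ_eq {α : Type} (z:ℤ) (f : ℤ → α) : forceZ z f = f z := by
  cases z with
  | ofNat n => exact force_eq n (fun m => f (Int.ofNat m))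
  | negSucc n => exact force_eq n (fun m => f (Int.negSucc m))

/-- table entries: prime, exponent, scaled logarithm of the prime, scaled eighth root -/
structure TE where
  p : ℕ
  k : ℕ
  y : ℕ
  q : ℕ

def tab : List TE :=
  [⟨2, 1, 12486629536330709, 18295683⟩, ⟨3, 1, 19790839575481371, 19246867⟩,
   ⟨2, 2, 12486629536330709, 19951584⟩, ⟨5, 1, 28993055930856631, 20515927⟩,
   ⟨7, 1, 35054400888727871, 21397210⟩, ⟨2, 3, 12486629536330709, 21757357⟩,
   ⟨3, 2, 19790839575481371, 22080057⟩, ⟨11, 1, 43196641028192820, 22640915⟩,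
   ⟨13, 1, 46206019881951831, 23118668⟩, ⟨2, 4, 12486629536330709, 23726566⟩,
   ⟨17, 1, 51038634242210706, 23907051⟩, ⟨19, 1, 53042297157556513, 24241757⟩,
   ⟨23, 1, 56484042329923382, 24827664⟩, ⟨5, 2, 28993055930856631, 25087789⟩,
   ⟨3, 3, 19790839575481371, 25330301⟩, ⟨29, 1, 60659808980693148, 25557575⟩,
   ⟨31, 1, 61861213978057328, 25771524⟩, ⟨2, 5, 12486629536330709, 25874004⟩,
   ⟨37, 1, 65048514263399804, 26347845⟩, ⟨41, 1, 66897767103291894, 26688113⟩,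
   ⟨43, 1, 67755757758013453, 26847475⟩, ⟨47, 1, 69358093217531184, 27147642⟩,
   ⟨7, 2, 35054400888727871, 27289426⟩, ⟨53, 1, 71522420729701576, 27558424⟩,
   ⟨59, 1, 73454384451852017, 27930351⟩, ⟨61, 1, 74054920011431984, 28046981⟩,
   ⟨2, 6, 12486629536330709, 28215801⟩, ⟨67, 1, 75745008455586346, 28377834⟩,
   ⟨71, 1, 76789614023371739, 28584275⟩, ⟨73, 1, 77290046161616299, 28683705⟩,
   ⟨79, 1, 78712974880740972, 28968318⟩, ⟨3, 4, 19790839575481371, 29058990⟩,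
   ⟨83, 1, 79602755658729295, 29147724⟩, ⟨89, 1, 80860084328509071, 29403135⟩,
   ⟨97, 1, 82410666632461978, 29721201⟩, ⟨101, 1, 83138620159664670, 29871708⟩,
   ⟨103, 1, 83491854977416653, 29945015⟩, ⟨107, 1, 84178200790594751, 30087968⟩,
   ⟨109, 1, 84511810297089897, 30157699⟩, ⟨113, 1, 85161048075154618, 30293866⟩,
   ⟨11, 2, 43196641028192820, 30553999⟩, ⟨5, 3, 28993055930856631, 30678466⟩,
   ⟨127, 1, 87265116629951242, 30739398⟩, ⟨2, 7, 12486629536330709, 30769549⟩,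
   ⟨131, 1, 87823747392505097, 30858783⟩, ⟨137, 1, 88630497056917669, 31032014⟩,
   ⟨139, 1, 88891579866066938, 31088283⟩, ⟨149, 1, 90143082875351446, 31359431⟩,
   ⟨151, 1, 90383278413972469, 31411741⟩, ⟨157, 1, 91085226899440770, 31565113⟩,
   ⟨163, 1, 91760846025086562, 31713439⟩, ⟨167, 1, 92197580105938070, 31809691⟩,
   ⟨13, 2, 46206019881951831, 31857062⟩, ⟨173, 1, 92833448418846474, 31950352⟩,
   ⟨179, 1, 93447635128845339, 32086808⟩, ⟨181, 1, 93647797171581249, 32131405⟩,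
   ⟨191, 1, 94616546613594667, 32348121⟩, ⟨193, 1, 94804198294873255, 32390269⟩,
   ⟨197, 1, 95173737376266899, 32473430⟩, ⟨199, 1, 95355702544750306, 32514458⟩,
   ⟨211, 1, 96410505182649883, 32753310⟩, ⟨223, 1, 97406947100303802, 32980558⟩,
   ⟨227, 1, 97727211508930817, 33053931⟩, ⟨229, 1, 97885233561766526, 33090195⟩,
   ⟨233, 1, 98197178993042501, 33161898⟩, ⟨239, 1, 98655196847146973, 33267459⟩,
   ⟨241, 1, 98805317703484963, 33302131⟩, ⟨3, 5, 19790839575481371, 33336552⟩,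
   ⟨251, 1, 99537711190907992, 33471803⟩, ⟨2, 8, 12486629536330709, 33554432⟩,
   ⟨257, 1, 99963267952738098, 33570788⟩, ⟨263, 1, 100379003291866667, 33667770⟩,
   ⟨269, 1, 100785360337680777, 33762836⟩, ⟨271, 1, 100918800936795763, 33794113⟩,
   ⟨277, 1, 101313292580761275, 33886745⟩, ⟨281, 1, 101571567951176109, 33947530⟩,
   ⟨283, 1, 101699330178263523, 33977639⟩, ⟨17, 2, 51038634242210706, 34066861⟩,
   ⟨293, 1, 102324892981476926, 34125446⟩]

/-- scaled logarithm -/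
def lnT (n:ℕ) : ℕ → ℕ :=
  Nat.rec 0 (fun k a => a + 2 ^ 55 / ((2 * k + 1) * (2 * n + 1) ^ (2 * k + 1)))

def lnA : ℕ → ℕ :=
  Nat.rec 0 (fun n a => a + Nat.rec 0 (fun _ _ => lnT n 18) n)

def noDiv (p:ℕ) : ℕ → Bool :=
  Nat.rec true (fun m r => and (or (Nat.ble m 1) (Nat.ble 1 (p % m))) r)

def teOK (e : TE) : Bool :=
  and (and (Nat.ble 2 e.p) (Nat.ble e.p 300)) (and (noDiv e.p e.p) (and (Nat.beq (lnA e.p) e.y)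
    (and (Nat.ble 1 e.k) (and (Nat.ble e.k 8)
    (and (Nat.ble (e.q ^ 8) (e.p ^ e.k * 2 ^ 192)) (Nat.ble (e.p ^ e.k * 2 ^ 192) ((e.q + 1) ^ 8)))))))

def allOK : List TE → Bool :=
  List.rec true (fun e _ r => and (teOK e) r)

def incOK (n:ℕ) (l : List TE) : Bool :=
  List.rec (motive := fun _ => ℕ → Bool) (fun _ => true)
    (fun e _ r m => and (Nat.blt m (e.p ^ e.k)) (r (e.p ^ e.k))) l n

lemma tab_allOK : allOK tab = true := by decide +kernel

lemma tab_incOK : incOK 1 tab = true := by decide +kernel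

/-- the weights, scaled by `2 ^ 20` -/
def omg (d:ℕ) (e : TE) : ℕ :=
  (e.y - 20 * e.p) * 2 ^ (24 * d) * (9 * e.q ^ 5 - 4 * 2 ^ 120) * 2 ^ 20 /
    (2 ^ 54 * (e.p ^ e.k * (e.q + 1) ^ d) * (9 * e.q ^ 5))

def Z80 : ℤ := Int.ofNat (Nat.pow 2 80)
def Z60 : ℤ := Int.ofNat (Nat.pow 2 60)
def Z20 : ℤ := Int.ofNat (Nat.pow 2 20)
def N60 : ℕ := Nat.pow 2 60
def N80 : ℕ := Nat.pow 2 80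

/-- approximate points on the circle of radius `2 ^ 80` -/
structure AP where
  c : ℤ
  s : ℤ
  e : ℕ

def mkAP (c s:ℤ) (e:ℕ) : AP :=
  forceZ c fun c => forceZ s fun s => force e fun e => ⟨c, s, e⟩

def baseAP (y e:ℕ) : AP :=
  mkAP (Int.ofNat (N80 - Nat.mul y y / Nat.pow 2 81)) (Int.ofNat y) (e + Nat.pow y 3 / Nat.pow 2 160 + 4)

def mulAP (a b : AP) : AP :=
  match a, b with
  | ⟨c, s, e⟩, ⟨c', s', e'⟩ =>
    forceZ (Int.mul c c') fun x1 => forceZ (Int.mul s s') fun x2 =>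
    forceZ (Int.mul c s') fun x3 => forceZ (Int.mul s c') fun x4 =>
    forceZ (Int.sub x1 x2) fun x5 => forceZ (Int.add x3 x4) fun x6 =>
    mkAP (Int.ediv x5 Z80) (Int.ediv x6 Z80)
      (Nat.add (Nat.add e e') (Nat.add (Nat.div (Nat.mul e e') N80) 4))

def sqn (a : AP) : ℕ → AP := Nat.rec a (fun _ b => mulAP b b)

def powAP (a : AP) : ℕ → AP := Nat.rec ⟨Z80, 0, 0⟩ (fun _ b => mulAP b a)

/-- the spacing base -/
def XX : ℕ := Nat.pow 2 288 - 1

/-- packed polynomials -/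
structure PP where
  a : AP
  re : ℤ
  im : ℤ
  ok : Bool

def ppStep (i:ℕ) (v : PP) : PP :=
  match v with
  | ⟨⟨c0, s0, e0⟩, re0, im0, ok0⟩ =>
    forceZ (c0 / Z60) fun c => forceZ (s0 / Z60) fun s =>
    force (Nat.pow XX (Nat.pow 2 i)) fun B =>
    forceZ (c * re0 - s * im0) fun a3 => forceZ (c * im0 + s * re0) fun b3 =>
    forceZ (Z20 * re0 + a3 * Int.ofNat B) fun re => forceZ (Z20 * im0 + b3 * Int.ofNat B) fun im =>
    ⟨mulAP ⟨c0, s0, e0⟩ ⟨c0, s0, e0⟩, re, im, and (Nat.ble e0 N60) ok0⟩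

def ppRun (a : AP) : ℕ → PP := Nat.rec ⟨a, 1, 0, true⟩ (fun i v => ppStep i v)

def ppOf (L:ℕ) (e : TE) : PP :=
  ppRun (sqn (baseAP (e.k * e.y) (20 * e.p * e.k)) 22) L

structure ACC where
  v : ℤ
  w : ℕ
  ok : Bool

def accStep (L d b:ℕ) (e : TE) (r : ACC) : ACC :=
  match ppOf L e with
  | ⟨a, re, im, ok⟩ => match powAP a b with
    | ⟨c, s, er⟩ =>
      force (omg d e) fun w =>
      forceZ (Int.ofNat w * (c / Z60)) fun wc => forceZ (Int.ofNat w * (s / Z60)) fun ws =>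
      forceZ (wc * re) fun x1 => forceZ (ws * im) fun x2 => forceZ (x1 - x2) fun x3 =>
      match r with
      | ⟨v0, w0, ok0⟩ => forceZ (v0 + x3) fun v =>
        force (w0 + w) fun w' => ⟨v, w', and (and ok (Nat.ble er N60)) ok0⟩

def accAll (L d b:ℕ) : List TE → ACC :=
  List.rec ⟨0, 0, true⟩ (fun e _ r => accStep L d b e r)

def chk (t:ℕ) : ℕ → ℕ → Bool :=
  Nat.rec (fun v => Nat.ble t v) (fun m r v =>
    force (Nat.pow XX (Nat.pow 2 m)) fun B => and (r (Nat.mod v B)) (r (Nat.div v B)))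

/-- dyadic threshold lists -/
def chkD (l : List ℕ) : ℕ → ℕ → Bool :=
  List.rec (motive := fun _ => ℕ → ℕ → Bool) (fun _ _ => true) (fun t _ r m v =>
    force m fun m => force (Nat.pow XX (Nat.pow 2 m)) fun B =>
      and (force t fun t => chk t m (Nat.div v B)) (r (Nat.pred m) (Nat.mod v B))) l

def OFF : ℕ := Nat.pow 2 286

lemma lnT_eq (n k:ℕ) : lnT n k = ∑ i ∈ range k, 2 ^ 55 / ((2 * i + 1) * (2 * n + 1) ^ (2 * i + 1)) := by
  induction k with
  | zero => rfl
  | succ k ih =>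
    rw [sum_range_succ, ← ih]
    rfl

lemma lnT_spec {n:ℕ} (hn : 1 ≤ n) :
    (lnT n 18:ℝ) ≤ 2 ^ 54 * log (1 + (n:ℝ)⁻¹) ∧
    2 ^ 54 * log (1 + (n:ℝ)⁻¹) ≤ lnT n 18 + 20 := by
  have hn' : (1:ℝ) ≤ n := by exact_mod_cast hn
  have hs := (Real.hasSum_log_one_add_inv (a := n) (by linarith)).mul_left (2 ^ 54)
  set f : ℕ → ℝ := fun i => 2 ^ 54 * (2 * (1 / (2 * (i:ℝ) + 1)) * (1 / (2 * (n:ℝ) + 1)) ^ (2 * i + 1)) with hf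
  have hf0 : ∀ i, 0 ≤ f i := fun i => by positivity
  have hfe : ∀ i, f i = ((2 ^ 55:ℕ):ℝ) / (((2 * i + 1) * (2 * n + 1) ^ (2 * i + 1):ℕ):ℝ) := by
    intro i
    simp only [hf]
    push_cast
    rw [one_div_pow]
    field_simp
    norm_num
  have h1 : ∀ i, ((2 ^ 55 / ((2 * i + 1) * (2 * n + 1) ^ (2 * i + 1)):ℕ):ℝ) ≤ f i := by
    intro i
    rw [hfe]
    exact Nat.cast_div_le
  have h2 : ∀ i, f i ≤ ((2 ^ 55 / ((2 * i + 1) * (2 * n + 1) ^ (2 * i + 1)):ℕ):ℝ) + 1 := by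
    intro i
    rw [hfe]
    exact (Nat.lt_floor_add_one _).le.trans (by rw [Nat.floor_div_eq_div])
  have htail : ∀ i, f (i + 18) ≤ 1 / 2 * (1 / 9) ^ i := by
    intro i
    have e1 : f (i + 18) ≤ 2 ^ 55 * (1 / 37) * (1 / 3) ^ (2 * (i + 18) + 1) := by
      simp only [hf]
      have a1 : 1 / (2 * ((i + 18:ℕ):ℝ) + 1) ≤ 1 / 37 := by
        apply one_div_le_one_div_of_le (by norm_num)
        push_cast
        have : (0:ℝ) ≤ i := by positivity
        linarith
      have a2 : (1 / (2 * (n:ℝ) + 1)) ^ (2 * (i + 18) + 1) ≤ (1 / 3) ^ (2 * (i + 18) + 1) := by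
        apply pow_le_pow_left₀ (by positivity)
        apply one_div_le_one_div_of_le (by norm_num)
        linarith
      calc 2 ^ 54 * (2 * (1 / (2 * ((i + 18:ℕ):ℝ) + 1)) * (1 / (2 * (n:ℝ) + 1)) ^ (2 * (i + 18) + 1))
          ≤ 2 ^ 54 * (2 * (1 / 37) * (1 / 3) ^ (2 * (i + 18) + 1)) := by gcongr
        _ = _ := by ring
    refine e1.trans ?_
    rw [show 2 * (i + 18) + 1 = 2 * i + 37 by ring, pow_add, pow_mul]
    have : (0:ℝ) ≤ (1 / 9:ℝ) ^ i := by positivity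
    rw [show ((1:ℝ) / 3) ^ 2 = 1 / 9 by norm_num]
    have c : (2:ℝ) ^ 55 * (1 / 37) * (1 / 3) ^ 37 ≤ 1 / 2 := by norm_num
    calc (2:ℝ) ^ 55 * (1 / 37) * ((1 / 9) ^ i * (1 / 3) ^ 37)
        = (2 ^ 55 * (1 / 37) * (1 / 3) ^ 37) * (1 / 9) ^ i := by ring
      _ ≤ _ := mul_le_mul_of_nonneg_right c this
  constructor
  · have := sum_le_hasSum (range 18) (fun i _ => hf0 i) hs
    refine le_trans ?_ this
    rw [lnT_eq, Nat.cast_sum]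
    exact sum_le_sum fun i _ => h1 i
  · have e := hs.summable.sum_add_tsum_nat_add 18
    rw [hs.tsum_eq] at e
    have g := (hasSum_geometric_of_lt_one (r := (1 / 9:ℝ)) (by norm_num) (by norm_num)).mul_left (1 / 2)
    have t1 : ∑' i, f (i + 18) ≤ 1 / 2 * (1 - 1 / 9)⁻¹ := by
      rw [← g.tsum_eq]
      exact ((summable_nat_add_iff 18).2 hs.summable).tsum_le_tsum htail g.summable
    have t2 : ∑ i ∈ range 18, f i ≤ lnT n 18 + 18 := by
      rw [lnT_eq, Nat.cast_sum]
      calc ∑ i ∈ range 18, f i ≤ ∑ i ∈ range 18, (((2 ^ 55 / ((2 * i + 1) * (2 * n + 1) ^ (2 * i + 1)):ℕ):ℝ) + 1) :=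
            sum_le_sum fun i _ => h2 i
        _ = _ := by rw [sum_add_distrib]; simp
    norm_num at t1
    linarith

lemma lnA_spec {n:ℕ} (hn : 1 ≤ n) :
    (lnA n:ℝ) ≤ 2 ^ 54 * log n ∧ 2 ^ 54 * log n ≤ lnA n + 20 * n := by
  induction n, hn using Nat.le_induction with
  | base =>
    have : lnA 1 = 0 := rfl
    simp [this]
  | succ n hn ih =>
    have e : lnA (n + 1) = lnA n + lnT n 18 := by
      obtain ⟨m, rfl⟩ : ∃ m, n = m + 1 := ⟨n - 1, by omega⟩
      rfl
    have hn' : (1:ℝ) ≤ n := by exact_mod_cast hn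
    have l : log ((n + 1:ℕ):ℝ) = log n + log (1 + (n:ℝ)⁻¹) := by
      rw [← log_mul (by positivity) (by positivity)]
      congr 1
      push_cast
      field_simp
    obtain ⟨h1, h2⟩ := lnT_spec hn
    rw [e, l]
    push_cast
    constructor <;> nlinarith

/-- approximation predicate -/
def isAP (a : AP) (θ:ℝ) : Prop :=
  ‖((a.c:ℂ) + a.s * I) - 2 ^ 80 * Complex.exp (θ * I)‖ ≤ a.e

lemma mkAP_eq (c s:ℤ) (e:ℕ) : mkAP c s e = ⟨c, s, e⟩ := by
  unfold mkAP
  rw [forceZ_eq, forceZ_eq, force_eq]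

lemma norm_gauss_le (x y:ℝ) : ‖(x:ℂ) + y * I‖ ≤ |x| + |y| := by
  refine (norm_add_le _ _).trans ?_
  simp

lemma floor_err (x:ℤ) {m:ℤ} (hm : 0 < m) : |((x / m:ℤ):ℝ) - (x:ℝ) / m| ≤ 1 := by
  have hm' : (0:ℝ) < m := by exact_mod_cast hm
  have h1 : (x:ℝ) = m * ((x / m:ℤ):ℝ) + ((x % m:ℤ):ℝ) := by
    exact_mod_cast (Int.mul_ediv_add_emod x m).symm
  have h2 : (0:ℝ) ≤ ((x % m:ℤ):ℝ) := by exact_mod_cast Int.emod_nonneg x hm.ne'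
  have h3 : ((x % m:ℤ):ℝ) ≤ m := by exact_mod_cast (Int.emod_lt_of_pos x hm).le
  have h4 : ((x / m:ℤ):ℝ) - (x:ℝ) / m = - (((x % m:ℤ):ℝ) / m) := by
    field_simp; linarith
  rw [h4, abs_neg, abs_of_nonneg (by positivity), div_le_one hm']
  exact h3

lemma mulAP_spec {a b : AP} {θ φ:ℝ} (ha : isAP a θ) (hb : isAP b φ) : isAP (mulAP a b) (θ + φ) := by
  obtain ⟨c, s, e⟩ := a
  obtain ⟨c', s', e'⟩ := b
  unfold isAP at *
  simp only [mulAP, forceZ_eq, mkAP_eq] at *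
  set A : ℂ := (c:ℂ) + s * I
  set B : ℂ := (c':ℂ) + s' * I
  set E : ℂ := Complex.exp (θ * I)
  set F : ℂ := Complex.exp (φ * I)
  have hE : ‖E‖ = 1 := Complex.norm_exp_ofReal_mul_I θ
  have hF : ‖F‖ = 1 := Complex.norm_exp_ofReal_mul_I φ
  have hEF : Complex.exp (((θ + φ:ℝ):ℂ) * I) = E * F := by
    rw [← Complex.exp_add]; congr 1; push_cast; ring
  rw [hEF]
  set x5 : ℤ := Int.sub (Int.mul c c') (Int.mul s s') with h5
  set x6 : ℤ := Int.add (Int.mul c s') (Int.mul s c') with h6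
  have hAB : A * B = (x5:ℂ) + x6 * I := by
    have e5 : x5 = c * c' - s * s' := rfl
    have e6 : x6 = c * s' + s * c' := rfl
    rw [e5, e6]
    simp only [A, B]
    push_cast
    linear_combination (s * s':ℂ) * Complex.I_sq
  have hZ : (Z80:ℤ) = 2 ^ 80 := rfl
  have f5 := floor_err x5 (m := 2 ^ 80) (by norm_num)
  have f6 := floor_err x6 (m := 2 ^ 80) (by norm_num)
  have hfl : ‖(((x5 / 2 ^ 80:ℤ):ℂ) + ((x6 / 2 ^ 80:ℤ):ℂ) * I) - A * B / 2 ^ 80‖ ≤ 2 := by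
    have := norm_gauss_le (((x5 / 2 ^ 80:ℤ):ℝ) - (x5:ℝ) / (2 ^ 80:ℤ)) (((x6 / 2 ^ 80:ℤ):ℝ) - (x6:ℝ) / (2 ^ 80:ℤ))
    refine le_trans (le_of_eq ?_) (this.trans (by linarith))
    congr 1
    rw [hAB]
    push_cast
    ring
  have hmain : ‖A * B / 2 ^ 80 - 2 ^ 80 * (E * F)‖ ≤ e + e' + e * e' / 2 ^ 80 := by
    have : A * B / 2 ^ 80 - 2 ^ 80 * (E * F) = (A - 2 ^ 80 * E) * F + E * (B - 2 ^ 80 * F)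
        + (A - 2 ^ 80 * E) * (B - 2 ^ 80 * F) / 2 ^ 80 := by ring
    rw [this]
    refine (norm_add_le _ _).trans (add_le_add ((norm_add_le _ _).trans (add_le_add ?_ ?_)) ?_)
    · rw [norm_mul, hF, mul_one]; exact ha
    · rw [norm_mul, hE, one_mul]; exact hb
    · rw [norm_div, norm_mul]
      have : ‖(2 ^ 80:ℂ)‖ = 2 ^ 80 := by rw [norm_pow]; norm_num
      rw [this]
      gcongr
  have hdiv : (e * e':ℝ) / 2 ^ 80 ≤ ((e * e' / N80:ℕ):ℝ) + 1 := by
    have : (e * e':ℝ) / 2 ^ 80 = ((e * e':ℕ):ℝ) / ((N80:ℕ):ℝ) := by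
      have : N80 = 2 ^ 80 := rfl
      rw [this]; push_cast; norm_num
    rw [this]
    exact (Nat.lt_floor_add_one _).le.trans (by rw [Nat.floor_div_eq_div])
  have hfin : ((Nat.add (Nat.add e e') (Nat.add (Nat.div (Nat.mul e e') N80) 4):ℕ):ℝ)
      = e + e' + (((e * e' / N80:ℕ):ℝ) + 4) := by
    have : Nat.add (Nat.add e e') (Nat.add (Nat.div (Nat.mul e e') N80) 4) = e + e' + (e * e' / N80 + 4) := rfl
    rw [this]; push_cast; ring
  rw [hfin]
  have hx : Int.ediv x5 Z80 = x5 / 2 ^ 80 := rfl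
  have hy : Int.ediv x6 Z80 = x6 / 2 ^ 80 := rfl
  rw [hx, hy]
  have := norm_sub_le_norm_sub_add_norm_sub (((x5 / 2 ^ 80:ℤ):ℂ) + ((x6 / 2 ^ 80:ℤ):ℂ) * I) (A * B / 2 ^ 80) (2 ^ 80 * (E * F))
  linarith

lemma sqn_spec {a : AP} {θ:ℝ} (ha : isAP a θ) (n:ℕ) : isAP (sqn a n) (2 ^ n * θ) := by
  induction n with
  | zero => simpa [sqn] using ha
  | succ n ih =>
    have := mulAP_spec ih ih
    rw [show (2:ℝ) ^ (n + 1) * θ = 2 ^ n * θ + 2 ^ n * θ by ring]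
    exact this

lemma powAP_spec {a : AP} {θ:ℝ} (ha : isAP a θ) (n:ℕ) : isAP (powAP a n) (n * θ) := by
  induction n with
  | zero =>
    have : Z80 = 2 ^ 80 := rfl
    simp [powAP, isAP, this]
    norm_num
  | succ n ih =>
    have := mulAP_spec ih ha
    rw [show ((n + 1:ℕ):ℝ) * θ = n * θ + θ by push_cast; ring]
    exact this

lemma baseAP_spec {y e:ℕ} {l:ℝ} (h1 : (y:ℝ) ≤ 2 ^ 54 * l) (h2 : 2 ^ 54 * l ≤ y + e) (hl : 0 ≤ l)
    (hy : y ≤ 2 ^ 58) (he : e ≤ 2 ^ 20) :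
    isAP (baseAP y e) (l / 2 ^ 26) := by
  unfold isAP baseAP
  rw [mkAP_eq]
  simp only
  have hy' : (y:ℝ) ≤ 2 ^ 58 := by exact_mod_cast hy
  have he' : (e:ℝ) ≤ 2 ^ 20 := by exact_mod_cast he
  have hy0 : (0:ℝ) ≤ y := by positivity
  have he0 : (0:ℝ) ≤ e := by positivity
  obtain ⟨Y, hY⟩ : ∃ Y : ℝ, Y = 2 ^ 54 * l := ⟨_, rfl⟩
  rw [← hY] at h1 h2
  have hθ : l / 2 ^ 26 = Y / 2 ^ 80 := by rw [hY]; norm_num; ring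
  rw [hθ]
  have hYu : Y ≤ 2 ^ 59 := by nlinarith
  have hY0 : 0 ≤ Y := hy0.trans h1
  set z : ℂ := ((Y / 2 ^ 80:ℝ):ℂ) * I with hz
  have hzn : ‖z‖ = Y / 2 ^ 80 := by
    rw [hz, norm_mul, Complex.norm_I, mul_one, Complex.norm_real, Real.norm_of_nonneg (by positivity)]
  have hb := Complex.exp_bound' (x := z) (n := 3) (by
    rw [hzn, div_le_iff₀ (by positivity)]
    rw [div_le_iff₀ (by positivity)]
    norm_num at hYu ⊢
    linarith)
  rw [hzn] at hb
  have hsum : ∑ m ∈ range 3, z ^ m / (m.factorial:ℂ) = 1 + z + z ^ 2 / 2 := by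
    simp [sum_range_succ]
  rw [hsum] at hb
  have hz2 : z ^ 2 = -((Y / 2 ^ 80:ℝ):ℂ) ^ 2 := by
    rw [hz, mul_pow, Complex.I_sq]; ring
  set q : ℕ := y * y / 2 ^ 81 with hq
  have hq1 : (q:ℝ) ≤ (y * y:ℝ) / 2 ^ 81 := by
    have := Nat.cast_div_le (α := ℝ) (m := y * y) (n := 2 ^ 81)
    push_cast at this
    exact_mod_cast this
  have hq2 : (y * y:ℝ) / 2 ^ 81 ≤ q + 1 := by
    have := (Nat.lt_floor_add_one (((y * y:ℕ):ℝ) / ((2 ^ 81:ℕ):ℝ))).le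
    rw [Nat.floor_div_eq_div] at this
    push_cast at this ⊢
    exact_mod_cast this
  have hq3 : q ≤ 2 ^ 80 := by
    have : (q:ℝ) ≤ 2 ^ 80 := by
      refine hq1.trans ?_
      rw [div_le_iff₀ (by positivity)]
      nlinarith
    exact_mod_cast this
  have hc : ((Int.ofNat (N80 - Nat.mul y y / Nat.pow 2 81):ℤ):ℂ) = 2 ^ 80 - (q:ℂ) := by
    have : N80 - Nat.mul y y / Nat.pow 2 81 = 2 ^ 80 - q := rfl
    rw [this, Int.ofNat_eq_natCast, Int.cast_natCast, Nat.cast_sub hq3]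
    push_cast; norm_num
  rw [hc]
  have hs : ((Int.ofNat y:ℤ):ℂ) = y := by simp
  rw [hs]
  set w : ℕ := y ^ 3 / 2 ^ 160 with hw
  have hw2 : (y ^ 3:ℝ) / 2 ^ 160 ≤ w + 1 := by
    have := (Nat.lt_floor_add_one (((y ^ 3:ℕ):ℝ) / ((2 ^ 160:ℕ):ℝ))).le
    rw [Nat.floor_div_eq_div] at this
    push_cast at this ⊢
    exact_mod_cast this
  have hee : ((e + Nat.pow y 3 / Nat.pow 2 160 + 4:ℕ):ℝ) = e + w + 4 := by
    have : e + Nat.pow y 3 / Nat.pow 2 160 + 4 = e + w + 4 := rfl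
    rw [this]; push_cast; rfl
  rw [hee]
  have hA : ‖((2 ^ 80 - (q:ℂ)) + y * I) - 2 ^ 80 * (1 + z + z ^ 2 / 2)‖ ≤ e + 2 := by
    have e1 : ((2 ^ 80 - (q:ℂ)) + y * I) - 2 ^ 80 * (1 + z + z ^ 2 / 2)
        = (((Y * Y / 2 ^ 81 - q:ℝ)):ℂ) + ((y - Y:ℝ):ℂ) * I := by
      rw [hz2, hz]; push_cast; ring
    rw [e1]
    refine (norm_gauss_le _ _).trans ?_
    have a1 : |(y:ℝ) - Y| ≤ e := by rw [abs_le]; constructor <;> linarith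
    have a2 : |Y * Y / 2 ^ 81 - q| ≤ 2 := by
      have b1 : (y * y:ℝ) / 2 ^ 81 ≤ Y * Y / 2 ^ 81 := by gcongr
      have b2 : Y * Y / 2 ^ 81 ≤ (y * y:ℝ) / 2 ^ 81 + 1 := by
        rw [div_add_one (by positivity)]
        gcongr
        nlinarith
      rw [abs_le]; constructor <;> linarith
    linarith
  have hB : ‖2 ^ 80 * (1 + z + z ^ 2 / 2) - 2 ^ 80 * Complex.exp z‖ ≤ w + 2 := by
    rw [← mul_sub, norm_mul, norm_sub_rev]
    have : ‖(2 ^ 80:ℂ)‖ = 2 ^ 80 := by rw [norm_pow]; norm_num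
    rw [this]
    have b3 : Y ^ 3 ≤ y ^ 3 + 2 ^ 160 := by
      have : Y ^ 3 ≤ (y + e) ^ 3 := pow_le_pow_left₀ hY0 h2 3
      have : (y + e:ℝ) ^ 3 = y ^ 3 + e * (3 * y ^ 2 + 3 * y * e + e ^ 2) := by ring
      have : (3 * y ^ 2 + 3 * y * e + e ^ 2:ℝ) ≤ 2 ^ 130 := by
        have p1 : (y:ℝ) ^ 2 ≤ (2 ^ 58) ^ 2 := pow_le_pow_left₀ hy0 hy' 2
        have p2 : (e:ℝ) ^ 2 ≤ (2 ^ 20) ^ 2 := pow_le_pow_left₀ he0 he' 2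
        have p3 : (y:ℝ) * e ≤ 2 ^ 58 * 2 ^ 20 := mul_le_mul hy' he' he0 (by positivity)
        norm_num at p1 p2 p3 ⊢
        linarith
      have : (e:ℝ) * (3 * y ^ 2 + 3 * y * e + e ^ 2) ≤ 2 ^ 20 * 2 ^ 130 :=
        mul_le_mul he' this (by positivity) (by positivity)
      norm_num at this ⊢
      linarith
    calc (2:ℝ) ^ 80 * ‖Complex.exp z - (1 + z + z ^ 2 / 2)‖
        ≤ 2 ^ 80 * ((Y / 2 ^ 80) ^ 3 / (Nat.factorial 3:ℕ) * 2) := by gcongr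
      _ = Y ^ 3 / 2 ^ 160 / 3 := by
        rw [show ((Nat.factorial 3:ℕ):ℝ) = 6 by norm_num [Nat.factorial]]
        ring
      _ ≤ (y ^ 3 + 2 ^ 160) / 2 ^ 160 / 3 := by gcongr
      _ = ((y:ℝ) ^ 3 / 2 ^ 160 + 1) / 3 := by rw [add_div, div_self (by positivity)]
      _ ≤ w + 2 := by
        have : (0:ℝ) ≤ w := by positivity
        linarith
  have := norm_sub_le_norm_sub_add_norm_sub ((2 ^ 80 - (q:ℂ)) + y * I) (2 ^ 80 * (1 + z + z ^ 2 / 2))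
    (2 ^ 80 * Complex.exp z)
  have h5 : ((e:ℝ) + 2) + (w + 2) ≤ e + w + 4 := by linarith
  exact (this.trans (add_le_add hA hB)).trans h5

lemma trunc_spec {c s:ℤ} {e:ℕ} {θ:ℝ} (ha : isAP ⟨c, s, e⟩ θ) (he : e ≤ N60) :
    ‖(((c / Z60:ℤ):ℂ) + ((s / Z60:ℤ):ℂ) * I) - 2 ^ 20 * Complex.exp (θ * I)‖
      ≤ 2 ^ 20 * (1 / 2 ^ 18) := by
  unfold isAP at ha
  simp only at ha
  have hZ : (Z60:ℤ) = 2 ^ 60 := rfl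
  rw [hZ]
  have he' : (e:ℝ) ≤ 2 ^ 60 := by
    have : N60 = 2 ^ 60 := rfl
    rw [this] at he
    exact_mod_cast he
  set E : ℂ := Complex.exp (θ * I)
  have f5 := floor_err c (m := 2 ^ 60) (by norm_num)
  have f6 := floor_err s (m := 2 ^ 60) (by norm_num)
  have h1 : ‖(((c / 2 ^ 60:ℤ):ℂ) + ((s / 2 ^ 60:ℤ):ℂ) * I) - ((c:ℂ) + s * I) / 2 ^ 60‖ ≤ 2 := by
    have := norm_gauss_le (((c / 2 ^ 60:ℤ):ℝ) - (c:ℝ) / (2 ^ 60:ℤ)) (((s / 2 ^ 60:ℤ):ℝ) - (s:ℝ) / (2 ^ 60:ℤ))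
    refine le_trans (le_of_eq ?_) (this.trans (by linarith))
    congr 1
    push_cast
    ring
  have h2 : ‖((c:ℂ) + s * I) / 2 ^ 60 - 2 ^ 20 * E‖ ≤ 1 := by
    have : ((c:ℂ) + s * I) / 2 ^ 60 - 2 ^ 20 * E = (((c:ℂ) + s * I) - 2 ^ 80 * E) / 2 ^ 60 := by
      ring
    rw [this, norm_div]
    have : ‖(2 ^ 60:ℂ)‖ = 2 ^ 60 := by rw [norm_pow]; norm_num
    rw [this, div_le_one (by positivity)]
    exact ha.trans he'
  have h3 := norm_sub_le_norm_sub_add_norm_sub (((c / 2 ^ 60:ℤ):ℂ) + ((s / 2 ^ 60:ℤ):ℂ) * I)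
    (((c:ℂ) + s * I) / 2 ^ 60) (2 ^ 20 * E)
  exact (h3.trans (add_le_add h1 h2)).trans (by norm_num)

/-- the relative error after `n` factors -/
noncomputable def rE (n:ℕ) : ℝ := (1 + 1 / 2 ^ 18) ^ n - 1

lemma rE_nonneg (n:ℕ) : 0 ≤ rE n := by
  unfold rE
  have : (1:ℝ) ≤ (1 + 1 / 2 ^ 18) ^ n := one_le_pow₀ (by norm_num)
  linarith

lemma rE_mono {m n:ℕ} (h : m ≤ n) : rE m ≤ rE n := by
  unfold rE
  have : (1 + 1 / 2 ^ 18:ℝ) ^ m ≤ (1 + 1 / 2 ^ 18) ^ n := pow_le_pow_right₀ (by norm_num) h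
  linarith

lemma prod_err {a v E F:ℂ} {M:ℝ} {n:ℕ} (hM : 0 ≤ M) (hE : ‖E‖ = 1) (hF : ‖F‖ = 1)
    (ha : ‖a - 2 ^ 20 * E‖ ≤ 2 ^ 20 * (1 / 2 ^ 18)) (hv : ‖v - M * F‖ ≤ M * rE n) :
    ‖a * v - (2 ^ 20 * M:ℝ) * (E * F)‖ ≤ 2 ^ 20 * M * rE (n + 1) := by
  have e1 : a * v - (2 ^ 20 * M:ℝ) * (E * F) = (a - 2 ^ 20 * E) * (v - M * F) + (a - 2 ^ 20 * E) * (M * F)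
      + 2 ^ 20 * E * (v - M * F) := by push_cast; ring
  rw [e1]
  have hr : rE (n + 1) = 1 / 2 ^ 18 * rE n + 1 / 2 ^ 18 + rE n := by unfold rE; ring
  have n1 : ‖(2 ^ 20:ℂ) * E‖ = 2 ^ 20 := by rw [norm_mul, hE, norm_pow]; norm_num
  have n2 : ‖(M:ℂ) * F‖ = M := by rw [norm_mul, hF, Complex.norm_real, Real.norm_of_nonneg hM, mul_one]
  refine (norm_add₃_le).trans ?_
  rw [norm_mul, norm_mul, norm_mul (2 ^ 20 * E), n1, n2, hr]
  have r0 := rE_nonneg n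
  have i1 : ‖a - 2 ^ 20 * E‖ * ‖v - M * F‖ ≤ 2 ^ 20 * (1 / 2 ^ 18) * (M * rE n) :=
    mul_le_mul ha hv (norm_nonneg _) (by positivity)
  have i2 : ‖a - 2 ^ 20 * E‖ * M ≤ 2 ^ 20 * (1 / 2 ^ 18) * M := mul_le_mul_of_nonneg_right ha hM
  have i3 : 2 ^ 20 * ‖v - M * F‖ ≤ 2 ^ 20 * (M * rE n) := by gcongr
  calc _ ≤ 2 ^ 20 * (1 / 2 ^ 18) * (M * rE n) + 2 ^ 20 * (1 / 2 ^ 18) * M + 2 ^ 20 * (M * rE n) :=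
        add_le_add (add_le_add i1 i2) i3
    _ = _ := by ring

/-- meaning of a packed polynomial -/
def isPP (L:ℕ) (v : PP) (θ:ℝ) : Prop :=
  isAP v.a (2 ^ L * θ) ∧ ∃ A B : ℕ → ℤ, v.re = ∑ j ∈ range (2 ^ L), A j * (XX:ℤ) ^ j ∧
    v.im = ∑ j ∈ range (2 ^ L), B j * (XX:ℤ) ^ j ∧
    ∀ j < 2 ^ L, ‖((A j:ℂ) + B j * I) - ((2 ^ (20 * L):ℝ):ℂ) * Complex.exp (((j * θ:ℝ):ℂ) * I)‖
      ≤ 2 ^ (20 * L) * rE L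

lemma sum_split (A : ℕ → ℤ) (C : ℕ → ℤ) (m:ℕ) (X:ℤ) :
    ∑ j ∈ range (2 * m), (if j < m then A j else C (j - m)) * X ^ j =
      ∑ j ∈ range m, A j * X ^ j + (∑ j ∈ range m, C j * X ^ j) * X ^ m := by
  rw [two_mul, sum_range_add, sum_mul]
  congr 1
  · apply sum_congr rfl
    intro j hj
    rw [if_pos (mem_range.1 hj)]
  · apply sum_congr rfl
    intro j _
    rw [if_neg (by omega), Nat.add_sub_cancel_left, pow_add]
    ring

lemma ppRun_spec {a : AP} {θ:ℝ} (ha : isAP a θ) (L:ℕ) (hok : (ppRun a L).ok = true) :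
    isPP L (ppRun a L) θ := by
  induction L with
  | zero =>
    refine ⟨by simpa [ppRun] using ha, fun _ => 1, fun _ => 0, by simp [ppRun], by simp [ppRun], ?_⟩
    intro j hj
    have : j = 0 := by simpa using hj
    subst this
    simp [rE]
  | succ L ih =>
    have hrun : ppRun a (L + 1) = ppStep L (ppRun a L) := rfl
    rw [hrun] at hok ⊢
    generalize ppRun a L = v at *
    obtain ⟨⟨c, s, e⟩, re, im, ok⟩ := v
    simp only [ppStep, forceZ_eq, force_eq] at *
    rw [Bool.and_eq_true] at hok
    obtain ⟨h1, A, B, hA, hB, hAB⟩ := ih hok.2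
    have he : e ≤ N60 := Nat.le_of_ble_eq_true hok.1
    have ht := trunc_spec h1 he
    have hm := mulAP_spec h1 h1
    have hX : (Int.ofNat (Nat.pow XX (Nat.pow 2 L)):ℤ) = (XX:ℤ) ^ (2 ^ L) := by
      have : Nat.pow XX (Nat.pow 2 L) = XX ^ (2 ^ L) := rfl
      rw [this]; push_cast; rfl
    have hZ : Z20 = 2 ^ 20 := rfl
    rw [hX]
    refine ⟨?_, fun j => if j < 2 ^ L then 2 ^ 20 * A j else (c / Z60) * A (j - 2 ^ L) - (s / Z60) * B (j - 2 ^ L),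
      fun j => if j < 2 ^ L then 2 ^ 20 * B j else (c / Z60) * B (j - 2 ^ L) + (s / Z60) * A (j - 2 ^ L), ?_, ?_, ?_⟩
    · simp only
      rw [show (2:ℝ) ^ (L + 1) * θ = 2 ^ L * θ + 2 ^ L * θ by ring]
      exact hm
    · have := sum_split (fun j => 2 ^ 20 * A j) (fun j => (c / Z60) * A j - (s / Z60) * B j) (2 ^ L) XX
      rw [pow_succ, mul_comm (2 ^ L) 2]
      rw [this]
      simp only at hA hB ⊢
      rw [hA, hB, hZ, mul_sum, mul_sum, mul_sum, ← sum_sub_distrib]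
      congr 1
      · apply sum_congr rfl; intros; ring
      · congr 1; apply sum_congr rfl; intros; ring
    · have := sum_split (fun j => 2 ^ 20 * B j) (fun j => (c / Z60) * B j + (s / Z60) * A j) (2 ^ L) XX
      rw [pow_succ, mul_comm (2 ^ L) 2]
      rw [this]
      simp only at hA hB ⊢
      rw [hA, hB, hZ, mul_sum, mul_sum, mul_sum, ← sum_add_distrib]
      congr 1
      · apply sum_congr rfl; intros; ring
      · congr 1; apply sum_congr rfl; intros; ring
    · intro j hj
      by_cases hjl : j < 2 ^ L
      · simp only [if_pos hjl]
        have := hAB j hjl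
        have e1 : (((2 ^ 20 * A j:ℤ):ℂ) + ((2 ^ 20 * B j:ℤ):ℂ) * I) - ((2 ^ (20 * (L + 1)):ℝ):ℂ) * Complex.exp (((j * θ:ℝ):ℂ) * I)
            = 2 ^ 20 * (((A j:ℂ) + B j * I) - ((2 ^ (20 * L):ℝ):ℂ) * Complex.exp (((j * θ:ℝ):ℂ) * I)) := by
          push_cast; ring
        rw [e1, norm_mul]
        have : ‖(2 ^ 20:ℂ)‖ = 2 ^ 20 := by rw [norm_pow]; norm_num
        rw [this]
        calc _ ≤ 2 ^ 20 * (2 ^ (20 * L) * rE L) := by gcongr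
          _ ≤ 2 ^ 20 * (2 ^ (20 * L) * rE (L + 1)) := by
            gcongr; exact rE_mono (Nat.le_succ L)
          _ = _ := by ring
      · simp only [if_neg hjl]
        obtain ⟨i, rfl⟩ : ∃ i, j = 2 ^ L + i := ⟨j - 2 ^ L, by omega⟩
        rw [Nat.add_sub_cancel_left]
        have hi : i < 2 ^ L := by rw [pow_succ] at hj; omega
        have := prod_err (M := 2 ^ (20 * L)) (by positivity) (Complex.norm_exp_ofReal_mul_I _)
          (Complex.norm_exp_ofReal_mul_I _) ht (hAB i hi)
        refine le_trans (le_of_eq ?_) (this.trans (le_of_eq ?_))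
        · congr 1
          rw [← Complex.exp_add]
          congr 1
          · push_cast
            linear_combination (-((s / Z60:ℤ):ℂ) * B i) * Complex.I_sq
          · congr 1
            · push_cast; ring
            · congr 1; push_cast; ring
        · ring

noncomputable def teL (e : TE) : ℝ := e.k * log e.p

def bndOK : List TE → Bool :=
  List.rec true (fun e _ r => and (and (Nat.ble (e.k * e.y) (2 ^ 58)) (Nat.ble (20 * e.p * e.k) (2 ^ 20))) r)

lemma tab_bndOK : bndOK tab = true := by decide +kernel

/-- facts about a table entry -/
structure TF (e : TE) : Prop where
  prime : e.p.Prime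
  hk : 1 ≤ e.k
  y1 : (e.y:ℝ) ≤ 2 ^ 54 * log e.p
  y2 : 2 ^ 54 * log e.p ≤ e.y + 20 * e.p
  q1 : e.q ^ 8 ≤ e.p ^ e.k * 2 ^ 192
  q2 : e.p ^ e.k * 2 ^ 192 ≤ (e.q + 1) ^ 8
  b1 : e.k * e.y ≤ 2 ^ 58
  b2 : 20 * e.p * e.k ≤ 2 ^ 20

lemma noDiv_spec (p:ℕ) : ∀ m, noDiv p m = true → ∀ a < m, 2 ≤ a → ¬ a ∣ p := by
  intro m
  induction m with
  | zero => intro _ a ha; omega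
  | succ m ih =>
    intro h a ha h2 hd
    have h' : and (or (Nat.ble m 1) (Nat.ble 1 (p % m))) (noDiv p m) = true := h
    rw [Bool.and_eq_true, Bool.or_eq_true] at h'
    rcases Nat.lt_succ_iff_lt_or_eq.1 ha with h3 | h3
    · exact ih h'.2 a h3 h2 hd
    · subst h3
      rcases h'.1 with h4 | h4
      · have := Nat.le_of_ble_eq_true h4; omega
      · have := Nat.le_of_ble_eq_true h4
        rw [Nat.dvd_iff_mod_eq_zero] at hd
        omega

lemma tf_of_ok : ∀ l : List TE, allOK l = true → bndOK l = true → ∀ e ∈ l, TF e := by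
  intro l
  induction l with
  | nil => intro _ _ e he; cases he
  | cons a l ih =>
    intro h1 h2 e he
    have h1' : and (teOK a) (allOK l) = true := h1
    have h2' : and (and (Nat.ble (a.k * a.y) (2 ^ 58)) (Nat.ble (20 * a.p * a.k) (2 ^ 20))) (bndOK l) = true := h2
    simp only [Bool.and_eq_true] at h1' h2'
    rcases List.mem_cons.1 he with rfl | he
    · have h3 := h1'.1
      unfold teOK at h3
      simp only [Bool.and_eq_true] at h3
      obtain ⟨⟨p2, p3⟩, nd, hy, k1, k8, q1, q2⟩ := h3
      have p2 := Nat.le_of_ble_eq_true p2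
      have hy := Nat.eq_of_beq_eq_true hy
      have hl := lnA_spec (n := e.p) (by omega)
      rw [hy] at hl
      refine ⟨?_, Nat.le_of_ble_eq_true k1, hl.1, by exact_mod_cast hl.2, Nat.le_of_ble_eq_true q1, Nat.le_of_ble_eq_true q2,
        Nat.le_of_ble_eq_true h2'.1.1, Nat.le_of_ble_eq_true h2'.1.2⟩
      rw [Nat.prime_def_lt']
      refine ⟨p2, fun m hm1 hm2 => noDiv_spec _ _ nd m hm2 hm1⟩
    · exact ih h1'.2 h2'.2 e he

lemma tab_TF : ∀ e ∈ tab, TF e := tf_of_ok tab tab_allOK tab_bndOK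

lemma ppOf_spec {e : TE} (he : TF e) (L:ℕ) (hok : (ppOf L e).ok = true) : isPP L (ppOf L e) (teL e / 16) := by
  unfold ppOf at *
  apply ppRun_spec _ _ hok
  have hp : (0:ℝ) ≤ log e.p := Real.log_natCast_nonneg _
  have h := baseAP_spec (y := e.k * e.y) (e := 20 * e.p * e.k) (l := teL e) ?_ ?_ ?_ he.b1 he.b2
  · have := sqn_spec h 22
    convert this using 1
    ring
  · unfold teL; push_cast
    have := he.y1
    have : (e.k:ℝ) * e.y ≤ e.k * (2 ^ 54 * log e.p) := by gcongr
    linarith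
  · unfold teL; push_cast
    have := he.y2
    have : (e.k:ℝ) * (2 ^ 54 * log e.p) ≤ e.k * (e.y + 20 * e.p) := by gcongr
    linarith
  · unfold teL; positivity

/-- the cosine sum over a list -/
noncomputable def csum (d:ℕ) (l : List TE) (t:ℝ) : ℝ := (l.map fun e => (omg d e:ℝ) * Real.cos (t * teL e)).sum

lemma accAll_spec (L d b:ℕ) : ∀ l : List TE, (∀ e ∈ l, TF e) → (accAll L d b l).ok = true →
    (accAll L d b l).w = (l.map fun e => omg d e).sum ∧
    ∃ D : ℕ → ℤ, (accAll L d b l).v = ∑ j ∈ range (2 ^ L), D j * (XX:ℤ) ^ j ∧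
      ∀ j < 2 ^ L, |(D j:ℝ) - 2 ^ (20 * (L + 1)) * csum d l ((b * 2 ^ L + j) / 16)|
        ≤ 2 ^ (20 * (L + 1)) * rE (L + 1) * ((l.map fun e => omg d e).sum:ℕ) := by
  intro l
  induction l with
  | nil =>
    intro _ _
    refine ⟨rfl, fun _ => 0, by simp [accAll], ?_⟩
    intro j _
    simp [csum]
  | cons e l ih =>
    intro hT hok
    have hrun : accAll L d b (e :: l) = accStep L d b e (accAll L d b l) := rfl
    rw [hrun] at hok ⊢
    replace ih := ih fun e he => hT e (List.mem_cons_of_mem _ he)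
    have hp := ppOf_spec (hT e List.mem_cons_self) L
    unfold accStep at hok ⊢
    generalize accAll L d b l = r at *
    generalize ppOf L e = v at *
    obtain ⟨a, re, im, ok⟩ := v
    obtain ⟨v0, w0, ok0⟩ := r
    simp only [forceZ_eq, force_eq] at *
    have hpw := fun h => powAP_spec (a := a) (θ := 2 ^ L * (teL e / 16)) h b
    generalize powAP a b = c at *
    obtain ⟨c, s, er⟩ := c
    simp only [Bool.and_eq_true] at hok
    obtain ⟨⟨hok1, her⟩, hok0⟩ := hok
    obtain ⟨hw, D, hD, hDj⟩ := ih hok0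
    obtain ⟨ha, A, B, hA, hB, hAB⟩ := hp hok1
    have ht := trunc_spec (hpw ha) (Nat.le_of_ble_eq_true her)
    simp only at hw hD hA hB hDj ⊢
    refine ⟨?_, fun j => D j + (omg d e:ℤ) * ((c / Z60) * A j - (s / Z60) * B j), ?_, ?_⟩
    · simp only [List.map_cons, List.sum_cons, hw]
      exact Nat.add_comm _ _
    · rw [hD, hA, hB, mul_sum, mul_sum, ← sum_sub_distrib, ← sum_add_distrib]
      apply sum_congr rfl
      intros
      have : Int.ofNat (omg d e) = (omg d e:ℤ) := rfl
      rw [this]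
      ring
    · intro j hj
      have := prod_err (M := 2 ^ (20 * L)) (by positivity) (Complex.norm_exp_ofReal_mul_I _)
          (Complex.norm_exp_ofReal_mul_I _) ht (hAB j hj)
      have h1 := (Complex.abs_re_le_norm _).trans this
      rw [← Complex.exp_add] at h1
      have e1 : (((b:ℝ) * (2 ^ L * (teL e / 16)):ℝ):ℂ) * I + ((((j:ℝ) * (teL e / 16)):ℝ):ℂ) * I
          = ((((b * 2 ^ L + j) / 16 * teL e):ℝ):ℂ) * I := by push_cast; ring
      rw [e1, Complex.sub_re, Complex.re_ofReal_mul, Complex.exp_ofReal_mul_I_re] at h1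
      have e2 : (((((c / Z60:ℤ):ℂ) + ((s / Z60:ℤ):ℂ) * I) * ((A j:ℂ) + (B j:ℂ) * I)).re:ℝ)
          = ((c / Z60:ℤ):ℝ) * A j - ((s / Z60:ℤ):ℝ) * B j := by
        simp
      rw [e2] at h1
      have h3 := hDj j hj
      have hM : (2:ℝ) ^ (20 * (L + 1)) = 2 ^ 20 * 2 ^ (20 * L) := by rw [← pow_add]; congr 1; ring
      rw [hM] at h3 ⊢
      simp only [csum, List.map_cons, List.sum_cons] at h3 ⊢
      generalize (2:ℝ) ^ 20 * 2 ^ (20 * L) = M at *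
      have ho : (0:ℝ) ≤ omg d e := Nat.cast_nonneg _
      push_cast
      generalize (omg d e:ℝ) = o at *
      generalize Real.cos ((b * 2 ^ L + j) / 16 * teL e) = C at *
      generalize (List.map (fun e => (omg d e:ℝ) * Real.cos ((b * 2 ^ L + j) / 16 * teL e)) l).sum = S at *
      generalize ((c / Z60:ℤ):ℝ) * A j - ((s / Z60:ℤ):ℝ) * B j = Q at *
      have h4 : |(D j:ℝ) + o * Q - M * (o * C + S)| ≤ |(D j:ℝ) - M * S| + o * |Q - M * C| := by
        rw [← abs_of_nonneg ho, ← abs_mul, abs_of_nonneg ho]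
        refine le_trans (le_of_eq ?_) (abs_add_le _ _)
        congr 1; ring
      have h5 : o * |Q - M * C| ≤ o * (M * rE (L + 1)) := mul_le_mul_of_nonneg_left h1 ho
      push_cast at h3
      linarith

lemma dig_lt (D : ℕ → ℕ) (hD : ∀ j, D j < XX) (n:ℕ) : ∑ j ∈ range n, D j * XX ^ j < XX ^ n := by
  induction n with
  | zero => simp
  | succ n ih =>
    rw [sum_range_succ, pow_succ]
    have := hD n
    have : (D n + 1) * XX ^ n ≤ XX * XX ^ n := Nat.mul_le_mul_right _ this
    nlinarith

lemma dig_split (D : ℕ → ℕ) (hD : ∀ j, D j < XX) (n m:ℕ) :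
    (∑ j ∈ range (n + m), D j * XX ^ j) % XX ^ n = ∑ j ∈ range n, D j * XX ^ j ∧
    (∑ j ∈ range (n + m), D j * XX ^ j) / XX ^ n = ∑ j ∈ range m, D (n + j) * XX ^ j := by
  have h : ∑ j ∈ range (n + m), D j * XX ^ j = ∑ j ∈ range n, D j * XX ^ j + XX ^ n * ∑ j ∈ range m, D (n + j) * XX ^ j := by
    rw [sum_range_add, mul_sum]
    congr 1
    apply sum_congr rfl
    intro j _
    rw [pow_add]; ring
  have h0 := dig_lt D hD n
  rw [h]
  constructor
  · rw [Nat.add_mul_mod_self_left, Nat.mod_eq_of_lt h0]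
  · rw [Nat.add_mul_div_left _ _ (by omega), Nat.div_eq_of_lt h0, zero_add]

lemma chk_spec (t:ℕ) : ∀ (m:ℕ) (D : ℕ → ℕ), (∀ j, D j < XX) →
    chk t m (∑ j ∈ range (2 ^ m), D j * XX ^ j) = true → ∀ j < 2 ^ m, t ≤ D j := by
  intro m
  induction m with
  | zero =>
    intro D hD h j hj
    have : j = 0 := by simpa using hj
    subst this
    have h' : Nat.ble t (∑ j ∈ range (2 ^ 0), D j * XX ^ j) = true := h
    simpa using Nat.le_of_ble_eq_true h'
  | succ m ih =>
    intro D hD h j hj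
    have h' : force (Nat.pow XX (Nat.pow 2 m)) (fun B => and (chk t m (Nat.mod (∑ j ∈ range (2 ^ (m + 1)), D j * XX ^ j) B))
      (chk t m (Nat.div (∑ j ∈ range (2 ^ (m + 1)), D j * XX ^ j) B))) = true := h
    rw [force_eq, Bool.and_eq_true] at h'
    have e : 2 ^ (m + 1) = 2 ^ m + 2 ^ m := by ring
    obtain ⟨s1, s2⟩ := dig_split D hD (2 ^ m) (2 ^ m)
    rw [e] at h'
    have h1 : chk t m ((∑ j ∈ range (2 ^ m + 2 ^ m), D j * XX ^ j) % XX ^ 2 ^ m) = true := h'.1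
    have h2 : chk t m ((∑ j ∈ range (2 ^ m + 2 ^ m), D j * XX ^ j) / XX ^ 2 ^ m) = true := h'.2
    rw [s1] at h1
    rw [s2] at h2
    by_cases hjm : j < 2 ^ m
    · exact ih D hD h1 j hjm
    · have := ih (fun j => D (2 ^ m + j)) (fun j => hD _) h2 (j - 2 ^ m) (by omega)
      rwa [Nat.add_sub_cancel' (by omega)] at this

lemma chkD_cons (t:ℕ) (l : List ℕ) (m V:ℕ) (h : chkD (t :: l) m V = true) :
    chk t m (V / XX ^ 2 ^ m) = true ∧ chkD l (m - 1) (V % XX ^ 2 ^ m) = true := by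
  have h' : force m (fun m => force (Nat.pow XX (Nat.pow 2 m)) fun B =>
      and (force t fun t => chk t m (Nat.div V B)) (chkD l (Nat.pred m) (Nat.mod V B))) = true := h
  rw [force_eq, force_eq, force_eq, Bool.and_eq_true] at h'
  exact h'

lemma chkD_spec : ∀ (l : List ℕ) (m:ℕ) (D : ℕ → ℕ), (∀ j, D j < XX) → l.length ≤ m + 1 →
    chkD l m (∑ j ∈ range (2 ^ (m + 1)), D j * XX ^ j) = true →
    ∀ i (hi : i < l.length), ∀ j, 2 ^ (m - i) ≤ j → j < 2 ^ (m - i + 1) → l[i] ≤ D j := by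
  intro l
  induction l with
  | nil => intro m D _ _ _ i hi; cases hi
  | cons t l ih =>
    intro m D hD hl h i hi j hj1 hj2
    obtain ⟨h1, h2⟩ := chkD_cons _ _ _ _ h
    have e : 2 ^ (m + 1) = 2 ^ m + 2 ^ m := by ring
    obtain ⟨s1, s2⟩ := dig_split D hD (2 ^ m) (2 ^ m)
    rw [e, s2] at h1
    rw [e, s1] at h2
    rcases i with _ | i
    · have := chk_spec t m (fun j => D (2 ^ m + j)) (fun j => hD _) h1 (j - 2 ^ m) (by simp only [Nat.sub_zero] at hj1 hj2; omega)
      rw [Nat.sub_zero] at hj1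
      rw [Nat.add_sub_cancel' (by omega)] at this
      simpa using this
    · simp only [List.length_cons] at hl hi
      have hm : m = (m - 1) + 1 := by omega
      have h3 : chkD l (m - 1) (∑ j ∈ range (2 ^ (m - 1 + 1)), D j * XX ^ j) = true := by rw [← hm]; exact h2
      have := ih (m - 1) D hD (by omega) h3 i (by omega) j
      have e2 : m - 1 - i = m - (i + 1) := by omega
      rw [e2] at this
      simpa using this hj1 hj2

/-- threshold -/
def thr (L w s:ℕ) : ℕ := OFF + s * Nat.pow 2 (20 * (L + 1)) - w * Nat.pow 2 (20 * (L + 1))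

def pkV (v:ℤ) (L:ℕ) : ℕ := Int.toNat (v + Int.ofNat (OFF * ((Nat.pow XX (Nat.pow 2 L) - 1) / (XX - 1))))

def finD (L:ℕ) (l : List ℕ) : ACC → Bool
  | ⟨v, w, ok⟩ => and (and ok (Nat.ble w (Nat.pow 2 22))) (force (pkV v L) fun V => chkD (l.map (thr L w)) (Nat.pred L) V)

def finF (L s:ℕ) : ACC → Bool
  | ⟨v, w, ok⟩ => and (and ok (Nat.ble w (Nat.pow 2 22))) (force (pkV v L) fun V => force (thr L w s) fun t => chk t L V)

def blkD (L d b:ℕ) (l : List ℕ) : Bool := finD L l (accAll L d b tab)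

def blkF (L d b s:ℕ) : Bool := finF L s (accAll L d b tab)

lemma finD_spec {L:ℕ} {l : List ℕ} {r : ACC} (h : finD L l r = true) :
    r.ok = true ∧ r.w ≤ 2 ^ 22 ∧ chkD (l.map (thr L r.w)) (Nat.pred L) (pkV r.v L) = true := by
  obtain ⟨v, w, ok⟩ := r
  unfold finD at h
  dsimp only at h
  rw [force_eq, Bool.and_eq_true, Bool.and_eq_true] at h
  exact ⟨h.1.1, Nat.le_of_ble_eq_true h.1.2, h.2⟩

lemma finF_spec {L s:ℕ} {r : ACC} (h : finF L s r = true) :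
    r.ok = true ∧ r.w ≤ 2 ^ 22 ∧ chk (thr L r.w s) L (pkV r.v L) = true := by
  obtain ⟨v, w, ok⟩ := r
  unfold finF at h
  dsimp only at h
  rw [force_eq, force_eq, Bool.and_eq_true, Bool.and_eq_true] at h
  exact ⟨h.1.1, Nat.le_of_ble_eq_true h.1.2, h.2⟩

noncomputable def fsum (d:ℕ) (t:ℝ) : ℝ := (tab.map fun e => (omg d e:ℝ) * (1 + Real.cos (t * teL e))).sum

lemma fsum_eq (d:ℕ) (l : List TE) (t:ℝ) : (l.map fun e => (omg d e:ℝ) * (1 + Real.cos (t * teL e))).sum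
    = ((l.map fun e => omg d e).sum:ℕ) + csum d l t := by
  unfold csum
  induction l with
  | nil => simp
  | cons a l ih => simp only [List.map_cons, List.sum_cons, ih]; push_cast; ring

lemma rE_bound {L:ℕ} (hL : L ≤ 12) : rE (L + 1) ≤ 1 / 2 ^ 14 := by
  refine (rE_mono (show L + 1 ≤ 13 by omega)).trans ?_
  unfold rE; norm_num

lemma XX_two : 2 ≤ XX := by
  have : Nat.ble 2 XX = true := by decide +kernel
  exact Nat.le_of_ble_eq_true this

lemma OFF_bnd : 2 ^ 284 ≤ OFF ∧ OFF + 2 ^ 284 < XX := by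
  have h1 : Nat.ble (Nat.pow 2 284) OFF = true := by decide +kernel
  have h2 : Nat.ble (OFF + Nat.pow 2 284 + 1) XX = true := by decide +kernel
  exact ⟨Nat.le_of_ble_eq_true h1, Nat.le_of_ble_eq_true h2⟩

lemma off_bnd {D:ℤ} (h : |D| ≤ 2 ^ 284) : 0 ≤ D + OFF ∧ D + OFF < XX := by
  obtain ⟨h1, h2⟩ := OFF_bnd
  have h1' : (2:ℤ) ^ 284 ≤ OFF := by exact_mod_cast h1
  have h2' : (OFF:ℤ) + 2 ^ 284 < XX := by exact_mod_cast h2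
  obtain ⟨h3, h4⟩ := abs_le.1 h
  generalize (2:ℤ) ^ 284 = P at *
  constructor <;> linarith

lemma bnd_aux {D M w c r:ℝ} (hM : 0 ≤ M) (hr : r ≤ 1) (h0 : 0 ≤ w) (h1 : |D - M * c| ≤ M * r * w) (hc : |c| ≤ w) :
    |D| ≤ M * (w * 2) := by
  have e : D = (D - M * c) + M * c := by ring
  rw [e]
  refine (abs_add_le _ _).trans ?_
  rw [abs_mul, abs_of_nonneg hM]
  have b1 : M * r * w ≤ M * 1 * w := by gcongr
  have b2 : M * |c| ≤ M * w := by gcongr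
  linarith

lemma bnd_aux2 {D M w:ℝ} (h : D ≤ M * (w * 2)) (h0 : 0 ≤ M) (hM : M ≤ 2 ^ 260) (hw : w ≤ 2 ^ 22) :
    D ≤ 2 ^ 284 := by
  have a4 : M * (w * 2) ≤ M * (2 ^ 22 * 2) := by gcongr
  have a5 : M * (2 ^ 22 * 2) ≤ 2 ^ 260 * (2 ^ 22 * 2) := by gcongr
  refine (h.trans (a4.trans a5)).trans ?_
  rw [show (284:ℕ) = 260 + 24 from rfl, pow_add]
  gcongr
  norm_num

lemma bnd_aux3 {s w M D c r:ℝ} (hM : 0 < M) (hs : (s - w) * M ≤ D) (h1 : D - M * c ≤ M * r * w) (hr : r ≤ 1 / 2 ^ 14)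
    (hw : w ≤ 2 ^ 22) (hw0 : 0 ≤ w) : s - 2 ^ 8 ≤ w + c := by
  have b1 : r * w ≤ 2 ^ 8 := by
    calc r * w ≤ 1 / 2 ^ 14 * 2 ^ 22 := by gcongr
      _ = 2 ^ 8 := by norm_num
  have b2 : (s - w) * M ≤ (c + r * w) * M := by linarith
  have b3 := le_of_mul_le_mul_right b2 hM
  linarith

lemma blk_core {L d b:ℕ} (hL : L ≤ 12) (hok : (accAll L d b tab).ok = true)
    (hw : (accAll L d b tab).w ≤ 2 ^ 22) :
    ∃ D : ℕ → ℕ, (∀ j, D j < XX) ∧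
      pkV (accAll L d b tab).v L = ∑ j ∈ range (2 ^ L), D j * XX ^ j ∧
      ∀ j < 2 ^ L, ∀ s, thr L (accAll L d b tab).w s ≤ D j → (s:ℝ) - 2 ^ 8 ≤ fsum d ((b * 2 ^ L + j) / 16) := by
  obtain ⟨h1, D, h2, h3⟩ := accAll_spec L d b tab tab_TF hok
  generalize accAll L d b tab = r at *
  obtain ⟨v, w, ok⟩ := r
  simp only at *
  rw [← h1] at h3
  have hM1 : (1:ℝ) ≤ 2 ^ (20 * (L + 1)) := one_le_pow₀ (by norm_num)
  have hM2 : (2:ℝ) ^ (20 * (L + 1)) ≤ 2 ^ 260 := pow_le_pow_right₀ (by norm_num) (by omega)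
  have hw' : (w:ℝ) ≤ 2 ^ 22 := by exact_mod_cast hw
  have hr := rE_bound hL
  have hr0 := rE_nonneg (L + 1)
  have hc : ∀ t, |csum d tab t| ≤ w := by
    intro t
    rw [h1]
    unfold csum
    generalize tab = l
    induction l with
    | nil => simp
    | cons a l ih =>
      simp only [List.map_cons, List.sum_cons]
      push_cast
      refine (abs_add_le _ _).trans (add_le_add ?_ (by simpa using ih))
      rw [abs_mul, Nat.abs_cast]
      exact mul_le_of_le_one_right (Nat.cast_nonneg _) (Real.abs_cos_le_one _)
  have hDb : ∀ j < 2 ^ L, |D j| ≤ 2 ^ 284 := by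
    intro j hj
    have a1 := h3 j hj
    have a2 := hc ((b * 2 ^ L + j) / 16)
    have a3 := bnd_aux (by positivity) (hr.trans (by norm_num)) (Nat.cast_nonneg w) a1 a2
    have a5 : |(D j:ℝ)| ≤ 2 ^ 284 := bnd_aux2 a3 (by positivity) hM2 hw'
    exact_mod_cast a5
  have hpos : ∀ j < 2 ^ L, 0 ≤ D j + OFF ∧ D j + OFF < XX := by
    intro j hj
    exact off_bnd (hDb j hj)
  refine ⟨fun j => if j < 2 ^ L then (D j + OFF).toNat else 0, ?_, ?_, ?_⟩
  · intro j
    simp only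
    split_ifs with hj
    · have := hpos j hj
      rw [Int.toNat_lt this.1]
      exact this.2
    · exact lt_of_lt_of_le (by norm_num) XX_two
  · have hg : (Nat.pow XX (Nat.pow 2 L) - 1) / (XX - 1) = ∑ j ∈ range (2 ^ L), XX ^ j :=
      (Nat.geomSum_eq XX_two _).symm
    unfold pkV
    rw [hg, h2]
    have : (∑ j ∈ range (2 ^ L), D j * (XX:ℤ) ^ j) + Int.ofNat (OFF * ∑ j ∈ range (2 ^ L), XX ^ j) =
        ((∑ j ∈ range (2 ^ L), (if j < 2 ^ L then (D j + OFF).toNat else 0) * XX ^ j:ℕ):ℤ) := by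
      rw [Int.ofNat_eq_natCast]
      push_cast
      rw [mul_sum, ← sum_add_distrib]
      apply sum_congr rfl
      intro j hj
      rw [if_pos (mem_range.1 hj), Int.toNat_of_nonneg (hpos j (mem_range.1 hj)).1]
      ring
    rw [this, Int.toNat_natCast]
  · intro j hj s hs
    simp only [if_pos hj] at hs
    have a1 := abs_le.1 (h3 j hj)
    unfold thr at hs
    have a0 := (hpos j hj).1
    have hs' : (OFF:ℤ) + s * 2 ^ (20 * (L + 1)) - w * 2 ^ (20 * (L + 1)) ≤ D j + OFF := by
      have e1 : ((Nat.pow 2 (20 * (L + 1)):ℕ):ℤ) = 2 ^ (20 * (L + 1)) := by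
        rw [show Nat.pow 2 (20 * (L + 1)) = 2 ^ (20 * (L + 1)) from rfl]; push_cast; rfl
      have e2 : (OFF + s * Nat.pow 2 (20 * (L + 1)):ℕ) ≤ (D j + OFF).toNat + w * Nat.pow 2 (20 * (L + 1)) :=
        Nat.sub_le_iff_le_add.1 hs
      have e3 : ((OFF + s * Nat.pow 2 (20 * (L + 1)):ℕ):ℤ) ≤ ((D j + OFF).toNat + w * Nat.pow 2 (20 * (L + 1)):ℕ) := by exact_mod_cast e2
      push_cast at e3
      rw [e1, Int.toNat_of_nonneg a0] at e3
      linarith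
    have hs2 : ((s:ℝ) - w) * 2 ^ (20 * (L + 1)) ≤ D j := by
      have : ((s:ℤ) - w) * 2 ^ (20 * (L + 1)) ≤ D j := by linarith
      exact_mod_cast this
    unfold fsum
    rw [fsum_eq, ← h1]
    exact bnd_aux3 (by positivity) hs2 a1.2 hr hw' (Nat.cast_nonneg w)

lemma blkF_spec {L d b s:ℕ} (hL : L ≤ 12) (h : blkF L d b s = true) (j:ℕ) (hj : j < 2 ^ L) :
    (s:ℝ) - 2 ^ 8 ≤ fsum d ((b * 2 ^ L + j) / 16) := by
  have hc := blk_core (L := L) (d := d) (b := b) hL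
  obtain ⟨h1, h2, h3⟩ := finF_spec (r := accAll L d b tab) h
  obtain ⟨D, hD, hV, hs⟩ := hc h1 h2
  rw [hV] at h3
  exact hs j hj s (chk_spec _ L D hD h3 j hj)

lemma blkD_spec {L d b:ℕ} {l : List ℕ} (hL : L + 1 ≤ 12) (hl : l.length ≤ L + 1) (h : blkD (L + 1) d b l = true) (j i:ℕ)
    (hi : i < l.length) (hj1 : 2 ^ (L - i) ≤ j) (hj2 : j < 2 ^ (L - i + 1)) :
    (l[i]:ℝ) - 2 ^ 8 ≤ fsum d ((b * 2 ^ (L + 1) + j) / 16) := by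
  have hc := blk_core (L := L + 1) (d := d) (b := b) hL
  obtain ⟨h1, h2, h3⟩ := finD_spec (r := accAll (L + 1) d b tab) h
  obtain ⟨D, hD, hV, hs⟩ := hc h1 h2
  rw [hV] at h3
  have hj : j < 2 ^ (L + 1) := hj2.trans_le (Nat.pow_le_pow_right (by norm_num) (by omega))
  have hi' : i < (l.map (thr (L + 1) (accAll (L + 1) d b tab).w)).length := by rw [List.length_map]; exact hi
  have := chkD_spec (l.map (thr (L + 1) (accAll (L + 1) d b tab).w)) L D hD (by rw [List.length_map]; exact hl) h3 i hi' j hj1 hj2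
  rw [List.getElem_map] at this
  exact_mod_cast hs j hj _ this

lemma omg_le {e : TE} (he : TF e) (d:ℕ) : (omg d e:ℝ) ≤ 2 ^ 20 * wS (1 + d / 8) (e.p ^ e.k) := by
  obtain ⟨hp, hk, y1, y2, q1, q2, b1, b2⟩ := he
  have hn : 2 ≤ e.p ^ e.k := hp.two_le.trans (Nat.le_self_pow (by omega) _)
  have hL : vonMangoldt (e.p ^ e.k) = log e.p := by
    rw [vonMangoldt_apply_pow (by omega), vonMangoldt_apply_prime hp]
  have hq : 2 ^ 24 ≤ e.q := by
    by_contra h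
    push Not at h
    have h1 : (e.q + 1) ^ 8 ≤ (2 ^ 24) ^ 8 := Nat.pow_le_pow_left h 8
    have h2 : 2 * 2 ^ 192 ≤ e.p ^ e.k * 2 ^ 192 := Nat.mul_le_mul_right _ hn
    have := h2.trans (q2.trans h1)
    norm_num at this
  have hq5 : 4 * 2 ^ 120 ≤ 9 * e.q ^ 5 := by
    have : (2 ^ 24) ^ 5 ≤ e.q ^ 5 := Nat.pow_le_pow_left hq 5
    rw [← pow_mul] at this
    norm_num at this ⊢
    omega
  have hy : ((e.y - 20 * e.p:ℕ):ℝ) ≤ 2 ^ 54 * log e.p := by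
    refine le_trans ?_ y1
    exact_mod_cast Nat.sub_le _ _
  unfold omg wS
  rw [hL]
  refine Nat.cast_div_le.trans ?_
  have c1 : (((e.y - 20 * e.p) * 2 ^ (24 * d) * (9 * e.q ^ 5 - 4 * 2 ^ 120) * 2 ^ 20:ℕ):ℝ)
      = ((e.y - 20 * e.p:ℕ):ℝ) * 2 ^ (24 * d) * (9 * (e.q:ℝ) ^ 5 - 4 * 2 ^ 120) * 2 ^ 20 := by
    rw [Nat.cast_mul, Nat.cast_mul, Nat.cast_mul, Nat.cast_sub hq5]; push_cast; norm_num
  have c2 : ((2 ^ 54 * (e.p ^ e.k * (e.q + 1) ^ d) * (9 * e.q ^ 5):ℕ):ℝ)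
      = 2 ^ 54 * ((e.p:ℝ) ^ e.k * ((e.q:ℝ) + 1) ^ d) * (9 * (e.q:ℝ) ^ 5) := by push_cast; norm_num
  rw [c1, c2, Nat.cast_pow]
  obtain ⟨n, hnd⟩ : ∃ n : ℝ, n = (e.p:ℝ) ^ e.k := ⟨_, rfl⟩
  rw [← hnd]
  have hn1 : (0:ℝ) < n := by rw [hnd]; exact pow_pos (by exact_mod_cast hp.pos) _
  obtain ⟨R, hR⟩ : ∃ R, R = n ^ (1 / 8:ℝ) := ⟨_, rfl⟩
  have hR0 : 0 < R := by rw [hR]; positivity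
  have hR8 : R ^ 8 = n := by
    rw [hR, ← rpow_natCast, ← Real.rpow_mul hn1.le]; norm_num
  have hqr : (0:ℝ) < e.q := by
    have : 0 < e.q := lt_of_lt_of_le (by norm_num) hq
    exact_mod_cast this
  have r1 : (e.q:ℝ) ≤ R * 2 ^ 24 := by
    apply le_of_pow_le_pow_left₀ (n := 8) (by norm_num) (by positivity)
    rw [mul_pow, hR8, hnd, ← pow_mul]
    exact_mod_cast q1
  have r2 : R * 2 ^ 24 ≤ e.q + 1 := by
    apply le_of_pow_le_pow_left₀ (n := 8) (by norm_num) (by positivity)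
    rw [mul_pow, hR8, hnd, ← pow_mul]
    exact_mod_cast q2
  have e1 : n ^ (-(1 + d / 8:ℝ)) = 1 / (n * R ^ d) := by
    rw [neg_add, Real.rpow_add hn1, Real.rpow_neg_one, hR, ← rpow_natCast, ← Real.rpow_mul hn1.le, one_div, mul_inv,
      ← rpow_neg hn1.le]
    congr 2; ring
  have e2 : n ^ (-(5 / 8):ℝ) = 1 / R ^ 5 := by
    rw [hR, ← rpow_natCast, ← Real.rpow_mul hn1.le, one_div, ← rpow_neg hn1.le]
    congr 1; norm_num
  rw [e1, e2]
  have f1 : 2 ^ (24 * d) / ((e.q:ℝ) + 1) ^ d ≤ 1 / R ^ d := by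
    rw [div_le_div_iff₀ (by positivity) (by positivity), one_mul, pow_mul, ← mul_pow]
    gcongr
    linarith
  have f2 : (9 * (e.q:ℝ) ^ 5 - 4 * 2 ^ 120) / (9 * e.q ^ 5) ≤ 1 - 4 / 9 * (1 / R ^ 5) := by
    have : 1 / R ^ 5 ≤ 2 ^ 120 / (e.q:ℝ) ^ 5 := by
      rw [div_le_div_iff₀ (by positivity) (by positivity), one_mul]
      calc (e.q:ℝ) ^ 5 ≤ (R * 2 ^ 24) ^ 5 := by gcongr
        _ = _ := by rw [mul_pow, ← pow_mul]; ring
    have e3 : (9 * (e.q:ℝ) ^ 5 - 4 * 2 ^ 120) / (9 * e.q ^ 5) = 1 - 4 / 9 * (2 ^ 120 / (e.q:ℝ) ^ 5) := by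
      field_simp
    rw [e3]
    linarith
  have f0 : 0 ≤ (9 * (e.q:ℝ) ^ 5 - 4 * 2 ^ 120) / (9 * e.q ^ 5) := by
    apply div_nonneg _ (by positivity)
    have : (4 * 2 ^ 120:ℝ) ≤ 9 * (e.q:ℝ) ^ 5 := by exact_mod_cast hq5
    linarith
  have hlog : 0 ≤ log e.p := Real.log_natCast_nonneg _
  calc ((e.y - 20 * e.p:ℕ):ℝ) * 2 ^ (24 * d) * (9 * (e.q:ℝ) ^ 5 - 4 * 2 ^ 120) * 2 ^ 20 / (2 ^ 54 * (n * ((e.q:ℝ) + 1) ^ d) * (9 * (e.q:ℝ) ^ 5))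
      = 2 ^ 20 * (((e.y - 20 * e.p:ℕ):ℝ) / 2 ^ 54 * (1 / n * (2 ^ (24 * d) / ((e.q:ℝ) + 1) ^ d)) * ((9 * (e.q:ℝ) ^ 5 - 4 * 2 ^ 120) / (9 * e.q ^ 5))) := by
        rw [div_eq_mul_inv, div_eq_mul_inv, div_eq_mul_inv, div_eq_mul_inv, div_eq_mul_inv, mul_inv, mul_inv, mul_inv]
        ring
    _ ≤ 2 ^ 20 * (log e.p * (1 / n * (1 / R ^ d)) * (1 - 4 / 9 * (1 / R ^ 5))) := by
        have : ((e.y - 20 * e.p:ℕ):ℝ) / 2 ^ 54 ≤ log e.p := by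
          rw [div_le_iff₀ (by positivity)]; linarith
        gcongr
    _ = _ := by rw [one_div_mul_one_div]

lemma inc_aux : ∀ (l : List TE) (n:ℕ), incOK n l = true →
    (∀ e ∈ l, n < e.p ^ e.k) ∧ (l.map fun e => e.p ^ e.k).Nodup := by
  intro l
  induction l with
  | nil => intro n _; simp
  | cons a l ih =>
    intro n h
    have h' : and (Nat.blt n (a.p ^ a.k)) (incOK (a.p ^ a.k) l) = true := h
    rw [Bool.and_eq_true] at h'
    have h1 : n < a.p ^ a.k := Nat.le_of_ble_eq_true h'.1
    obtain ⟨h2, h3⟩ := ih _ h'.2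
    refine ⟨?_, ?_⟩
    · intro e he
      rcases List.mem_cons.1 he with rfl | he
      · exact h1
      · exact h1.trans (h2 e he)
    · rw [List.map_cons, List.nodup_cons]
      refine ⟨?_, h3⟩
      intro hm
      obtain ⟨e, he, he'⟩ := List.mem_map.1 hm
      have := h2 e he
      omega

def tabN : List ℕ := tab.map fun e => e.p ^ e.k
lemma tabN_nodup : tabN.Nodup := (inc_aux tab 1 tab_incOK).2

lemma teL_eq (e : TE) : teL e = log ((e.p ^ e.k:ℕ):ℝ) := by
  unfold teL; push_cast; rw [log_pow]

lemma fsum_le (d:ℕ) (t:ℝ) :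
    fsum d t / 2 ^ 20 ≤ ∑ n ∈ tabN.toFinset, wS (1 + d / 8) n * (1 + Real.cos (t * log n)) := by
  rw [List.sum_toFinset _ tabN_nodup, div_le_iff₀ (by positivity)]
  unfold fsum tabN
  rw [List.map_map, ← List.sum_map_mul_right]
  apply List.sum_le_sum
  intro e he
  simp only [Function.comp]
  rw [← teL_eq]
  have h1 := omg_le (tab_TF e he) d
  have h2 : 0 ≤ 1 + Real.cos (t * teL e) := by linarith [Real.neg_one_le_cos (t * teL e)]
  have := mul_le_mul_of_nonneg_right h1 h2
  linarith

lemma blk_a : blkD 10 4 0 [817889, 765460, 629145, 419430] = true := by decide +kernel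
lemma blk_b : blkD 12 2 0 [1488977, 1509949] = true := by decide +kernel
lemma blk_1 : blkF 12 2 1 1447034 = true := by decide +kernel
lemma blk_2 : blkF 12 2 2 1384120 = true := by decide +kernel
lemma blk_3 : blkF 12 2 3 1384120 = true := by decide +kernel
lemma blk_4 : blkF 12 2 4 1370488 = true := by decide +kernel
lemma blk_5 : blkF 12 2 5 1370488 = true := by decide +kernel
lemma blk_6 : blkF 12 2 6 1370488 = true := by decide +kernel
lemma blk_7 : blkF 12 2 7 1370488 = true := by decide +kernel

lemma log3_bd : 1.0986122 ≤ log 3 ∧ log 3 ≤ 1.0986124 := by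
  have h := lnA_spec (n := 3) (by norm_num)
  have e : lnA 3 = 19790839575481371 := by decide +kernel
  rw [e] at h
  norm_num at h
  constructor <;> linarith

lemma log5_bd : 1.6094379 ≤ log 5 ∧ log 5 ≤ 1.6094380 := by
  have h := lnA_spec (n := 5) (by norm_num)
  have e : lnA 5 = 28993055930856631 := by decide +kernel
  rw [e] at h
  norm_num at h
  constructor <;> linarith

lemma log23_bd : 3.1354942 ≤ log 23 ∧ log 23 ≤ 3.1354943 := by
  have h := lnA_spec (n := 23) (by norm_num)
  have e : lnA 23 = 56484042329923382 := by decide +kernel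
  rw [e] at h
  norm_num at h
  constructor <;> linarith

lemma log2_bd : 0.6931471 ≤ log 2 ∧ log 2 ≤ 0.6931472 :=
  ⟨by linarith [Real.log_two_gt_d9], by linarith [Real.log_two_lt_d9]⟩

lemma log2pi_bd : 1.83786 ≤ log (2 * π) ∧ log (2 * π) ≤ 1.8379 := by
  have p1 := Real.pi_gt_d6
  have p2 := Real.pi_lt_d6
  have e : log (2 * π) = 2 * log 5 - 2 * log 2 + log (8 * π / 25) := by
    have h5 : 2 * log 5 = log 25 := by
      rw [show (25:ℝ) = 5 ^ 2 by norm_num, log_pow]; norm_num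
    have h2 : 2 * log 2 = log 4 := by
      rw [show (4:ℝ) = 2 ^ 2 by norm_num, log_pow]; norm_num
    rw [h5, h2, ← log_div (by norm_num) (by norm_num), ← log_mul (by norm_num) (by positivity)]
    congr 1; ring
  have hpos : 0 < 8 * π / 25 := by positivity
  have u1 := Real.log_le_sub_one_of_pos hpos
  have u2 := Real.one_sub_inv_le_log_of_pos hpos
  have u3 : (8 * π / 25)⁻¹ ≤ 0.99472 := by
    rw [inv_le_comm₀ hpos (by norm_num)]; norm_num; linarith
  have := log5_bd; have := log2_bd
  constructor <;> linarith

/-- scaled partial sums of `Λ(n)/n²` -/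
def sq2 : List TE → ℕ := List.rec 0 (fun e _ r => r + e.y / (e.p ^ e.k) ^ 2)

lemma sq2_tab : Nat.ble (563 * 2 ^ 54) (1000 * sq2 tab) = true := by decide +kernel

lemma sq2_le : ∀ l : List TE, (∀ e ∈ l, TF e) →
    (sq2 l:ℝ) ≤ 2 ^ 54 * ((l.map fun e => e.p ^ e.k).map fun n => vonMangoldt n * (n:ℝ) ^ (-(2:ℝ)) * Real.cos (0 * log n)).sum := by
  intro l
  induction l with
  | nil => intro _; simp [sq2]
  | cons e l ih =>
    intro hT
    have h1 : sq2 (e :: l) = sq2 l + e.y / (e.p ^ e.k) ^ 2 := rfl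
    have h2 := ih fun e he => hT e (List.mem_cons_of_mem _ he)
    obtain ⟨hp, hk, y1, -⟩ := hT e List.mem_cons_self
    have hL : vonMangoldt (e.p ^ e.k) = log e.p := by
      rw [vonMangoldt_apply_pow (by omega), vonMangoldt_apply_prime hp]
    rw [h1]
    simp only [List.map_cons, List.sum_cons]
    rw [hL, Nat.cast_add]
    have h3 : ((e.y / (e.p ^ e.k) ^ 2:ℕ):ℝ) ≤ 2 ^ 54 * (log e.p * ((e.p ^ e.k:ℕ):ℝ) ^ (-(2:ℝ)) * Real.cos (0 * log ((e.p ^ e.k:ℕ):ℝ))) := by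
      refine Nat.cast_div_le.trans ?_
      rw [zero_mul, Real.cos_zero, mul_one, rpow_neg (Nat.cast_nonneg _), Nat.cast_pow, Real.rpow_two, div_eq_mul_inv, ← mul_assoc]
      gcongr
    linarith

lemma vM2_bd : 0.563 ≤ vM 2 0 := by
  have h := vM_hasSum 0 (σ := 2) (by norm_num)
  have h1 := sum_le_hasSum tabN.toFinset (fun n _ => by
    rw [zero_mul, Real.cos_zero, mul_one]
    exact mul_nonneg vonMangoldt_nonneg (by positivity)) h
  rw [List.sum_toFinset _ tabN_nodup] at h1
  have h2 := sq2_le tab tab_TF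
  have h3 := Nat.le_of_ble_eq_true sq2_tab
  have h4 : (563 * 2 ^ 54:ℝ) ≤ 1000 * sq2 tab := by exact_mod_cast h3
  unfold tabN at h1
  have h5 : (sq2 tab:ℝ) ≤ 2 ^ 54 * vM 2 0 := h2.trans (by gcongr)
  linarith

lemma low_zero {β γ:ℝ} (h0 : xiG ⟨β, γ⟩ = 0) : 25 ≤ γ ^ 2 := by
  refine low_zero_aux ?_ h0
  have h := (abs_le.1 (zA_bound (σ := 2) 0 (by norm_num))).2
  have h1 := vM2_bd
  have h2 : lgT 2 0 = 2 * log 3 / 4 - log (2 * π) / 2 := by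
    unfold lgT
    rw [show ((2:ℝ) + 1) ^ 2 + 0 ^ 2 = 3 ^ 2 by norm_num, log_pow]; norm_num
  rw [h2] at h
  have := log2pi_bd; have := log3_bd
  norm_num at h
  linarith

lemma xiG_neg {β γ:ℝ} (h0 : xiG ⟨β, γ⟩ = 0) : xiG ⟨β, -γ⟩ = 0 := by
  have := xiG_conj ⟨β, γ⟩
  rw [h0, _root_.map_zero] at this
  exact this

lemma frac_mono {x x1 y e:ℝ} (hx : 1 / 4 ≤ x) (h : x ≤ x1) (hy : |y| ≤ e) (he0 : e ≤ 1 / 4) :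
    x1 / (x1 ^ 2 + e ^ 2) ≤ x / (x ^ 2 + y ^ 2) := by
  have hy2 : y ^ 2 ≤ e ^ 2 := sq_le_sq' (by linarith [abs_le.1 hy]) (abs_le.1 hy).2
  have h0 : 0 ≤ e := (abs_nonneg y).trans hy
  rw [div_le_div_iff₀ (by nlinarith) (by nlinarith)]
  have : x1 * (x ^ 2 + y ^ 2) ≤ x1 * (x ^ 2 + e ^ 2) := by
    apply mul_le_mul_of_nonneg_left _ (by linarith); linarith
  have e2 : e ^ 2 ≤ x * x1 := by nlinarith
  nlinarith

lemma zf_core {d:ℕ} (hd1 : 2 ≤ d) (hd4 : d ≤ 4) {β γ t s η:ℝ} (h0 : xiG ⟨β, γ⟩ = 0)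
    (h : |t - γ| ≤ 1 / 32) (hs : s ≤ fsum d t / 2 ^ 20) (hη0 : η < 1 / 2)
    (hB : 8 / d + lgT (1 + d / 8) 0 - 4 / 9 * (1 / (1 + d / 8 - 3 / 8) + lgT (1 + d / 8 + 5 / 8) 0) + 26 / 300
      + (d / 8:ℝ) / ((d / 8) ^ 2 + t ^ 2) + 5 / 9 * lgT (1 + d / 8) t - s < (d / 8 + η) / ((d / 8 + η) ^ 2 + (1 / 32) ^ 2)) :
    β ≤ 1 - η := by
  by_contra hc
  push Not at hc
  have hb := xiG_zero_re h0
  simp only at hb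
  have hγ : γ ≠ 0 := by rintro rfl; have := low_zero h0; norm_num at this
  have hd1' : (2:ℝ) ≤ d := by exact_mod_cast hd1
  have hd4' : (d:ℝ) ≤ 4 := by exact_mod_cast hd4
  have hc := cert_basic (σ := 1 + d / 8) (t := t) (a0 := 1) (a1 := 1) (a2 := 0) (a3 := 0) (by linarith) (by linarith)
    (by norm_num) le_rfl le_rfl (by norm_num) (fun x => by linarith [Real.neg_one_le_cos x]) h0 hγ (by linarith)
    (h.trans (by norm_num)) tabN.toFinset
  have hf := hs.trans (fsum_le d t)
  have e1 : ∑ n ∈ tabN.toFinset, wS (1 + d / 8) n * (1 + 1 * Real.cos (t * log n) + 0 * Real.cos (2 * (t * log n))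
          + 0 * Real.cos (3 * (t * log n))) = ∑ n ∈ tabN.toFinset, wS (1 + d / 8) n * (1 + Real.cos (t * log n)) := by
    apply sum_congr rfl; intros; ring
  rw [e1] at hc
  have hm := frac_mono (x := 1 + d / 8 - β) (x1 := d / 8 + η) (by linarith) (by linarith) h (by norm_num)
  have e2 : (1:ℝ) + d / 8 - 1 = d / 8 := by ring
  have e3 : 1 / (d / 8:ℝ) = 8 / d := by rw [one_div_div]
  rw [e2, e3] at hc
  linarith

lemma lgT_zero {σ:ℝ} (h : 0 < σ + 1) : lgT σ 0 = log (σ + 1) / 2 - log (2 * π) / 2 := by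
  unfold lgT
  rw [show (σ + 1) ^ 2 + 0 ^ 2 = (σ + 1) ^ 2 by ring, log_pow]
  push_cast; ring

lemma lgT_le {σ t:ℝ} {m:ℕ} (h : 0 < σ + 1) (h1 : σ ≤ 3 / 2) (hm : 2 ≤ m) (ht0 : 0 ≤ t) (ht : t ≤ 2 ^ m) :
    lgT σ t ≤ (m * log 2 + 1 / 2 ^ m) / 2 - log (2 * π) / 2 := by
  unfold lgT
  have h2 : (4:ℝ) ≤ 2 ^ m := by
    calc (4:ℝ) = 2 ^ 2 := by norm_num
      _ ≤ 2 ^ m := pow_le_pow_right₀ (by norm_num) hm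
  have h3 : (σ + 1) ^ 2 + t ^ 2 ≤ (2 ^ m + 1) ^ 2 := by nlinarith
  have h4 : log ((σ + 1) ^ 2 + t ^ 2) ≤ 2 * log (2 ^ m + 1) := by
    have := log_le_log (by positivity) h3
    rwa [log_pow] at this
  have h5 : log (2 ^ m + 1) ≤ m * log 2 + 1 / 2 ^ m := by
    have : (2:ℝ) ^ m + 1 = 2 ^ m * (1 + 1 / 2 ^ m) := by field_simp
    rw [this, log_mul (by positivity) (by positivity), log_pow]
    have := Real.log_le_sub_one_of_pos (show (0:ℝ) < 1 + 1 / 2 ^ m by positivity)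
    linarith
  linarith

/-- the main term of the certificates -/
noncomputable def cB (d:ℕ) : ℝ :=
  8 / d + lgT (1 + d / 8) 0 - 4 / 9 * (1 / (1 + d / 8 - 3 / 8) + lgT (1 + d / 8 + 5 / 8) 0) + 26 / 300

lemma cB4 : cB 4 ≤ 1.3863 := by
  unfold cB
  rw [lgT_zero (by norm_num), lgT_zero (by norm_num)]
  have e1 : log (1 + ((4:ℕ):ℝ) / 8 + 1) = log 5 - log 2 := by
    rw [← log_div (by norm_num) (by norm_num)]; norm_num
  have e2 : log (1 + ((4:ℕ):ℝ) / 8 + 5 / 8 + 1) = 2 * log 5 - 3 * log 2 := by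
    rw [show 2 * log 5 = log (5 ^ 2) by rw [log_pow]; norm_num,
      show 3 * log 2 = log (2 ^ 3) by rw [log_pow]; norm_num,
      ← log_div (by norm_num) (by norm_num)]; norm_num
  rw [e1, e2]
  have := log2_bd; have := log5_bd; have := log2pi_bd
  norm_num
  linarith

lemma cB2 : cB 2 ≤ 3.2392 := by
  unfold cB
  rw [lgT_zero (by norm_num), lgT_zero (by norm_num)]
  have e1 : log (1 + ((2:ℕ):ℝ) / 8 + 1) = 2 * log 3 - 2 * log 2 := by
    rw [show 2 * log 3 = log (3 ^ 2) by rw [log_pow]; norm_num,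
      show 2 * log 2 = log (2 ^ 2) by rw [log_pow]; norm_num,
      ← log_div (by norm_num) (by norm_num)]; norm_num
  have e2 : log (1 + ((2:ℕ):ℝ) / 8 + 5 / 8 + 1) = log 23 - 3 * log 2 := by
    rw [show 3 * log 2 = log (2 ^ 3) by rw [log_pow]; norm_num,
      ← log_div (by norm_num) (by norm_num)]; norm_num
  rw [e1, e2]
  have := log2_bd; have := log3_bd; have := log23_bd; have := log2pi_bd
  norm_num
  linarith

lemma zf_range {d m:ℕ} (hd1 : 2 ≤ d) (hd4 : d ≤ 4) (hm : 2 ≤ m) {s η C:ℝ} (hη0 : η < 1 / 2) (hC : cB d ≤ C)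
    (hf : ∀ j : ℕ, 2 ^ (m + 3) ≤ j → j < 2 ^ (m + 4) → s ≤ fsum d (j / 16))
    (hB : C + (d / 8:ℝ) / (2 ^ m / 2) ^ 2 + 5 / 9 * ((m * 0.6931472 + 1 / 2 ^ m) / 2 - 0.91893) - s / 2 ^ 20
      < (d / 8 + η) / ((d / 8 + η) ^ 2 + (1 / 32) ^ 2))
    {β γ:ℝ} (h0 : xiG ⟨β, γ⟩ = 0) (h1 : 2 ^ m / 2 - 1 / 32 ≤ γ) (h2 : γ < 2 ^ m - 1 / 32) : β ≤ 1 - η := by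
  have h4 : (4:ℝ) ≤ 2 ^ m := by
    calc (4:ℝ) = 2 ^ 2 := by norm_num
      _ ≤ 2 ^ m := pow_le_pow_right₀ (by norm_num) hm
  obtain ⟨j, hj⟩ : ∃ j : ℕ, j = ⌊16 * γ + 1 / 2⌋₊ := ⟨_, rfl⟩
  have f1 : (j:ℝ) ≤ 16 * γ + 1 / 2 := by rw [hj]; exact Nat.floor_le (by linarith)
  have f2 : 16 * γ + 1 / 2 < j + 1 := by rw [hj]; exact Nat.lt_floor_add_one _
  have j1 : 2 ^ (m + 3) ≤ j := by
    rw [hj]; apply Nat.le_floor; push_cast; rw [pow_add]; norm_num; linarith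
  have j2 : j < 2 ^ (m + 4) := by
    have : (j:ℝ) < 2 ^ (m + 4) := by rw [pow_add]; norm_num; linarith
    exact_mod_cast this
  have j1' : (2:ℝ) ^ m * 8 ≤ j := by
    have : ((2 ^ (m + 3):ℕ):ℝ) ≤ j := by exact_mod_cast j1
    rw [pow_add] at this; push_cast at this; linarith
  have j2' : (j:ℝ) ≤ 2 ^ m * 16 := by
    have : (j:ℝ) ≤ ((2 ^ (m + 4):ℕ):ℝ) := by exact_mod_cast j2.le
    rw [pow_add] at this; push_cast at this; linarith
  have hd1' : (2:ℝ) ≤ d := by exact_mod_cast hd1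
  have hd4' : (d:ℝ) ≤ 4 := by exact_mod_cast hd4
  refine zf_core hd1 hd4 (t := j / 16) (s := s / 2 ^ 20) h0 ?_ ?_ hη0 ?_
  · rw [abs_le]; constructor <;> linarith
  · have := hf j j1 j2
    gcongr
  · refine lt_of_le_of_lt ?_ hB
    have b1 := lgT_le (σ := 1 + d / 8) (t := j / 16) (m := m) (by linarith) (by linarith) hm (by positivity) (by linarith)
    have b2 : (d / 8:ℝ) / ((d / 8) ^ 2 + (j / 16) ^ 2) ≤ (d / 8:ℝ) / (2 ^ m / 2) ^ 2 := by
      gcongr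
      have : (2:ℝ) ^ m / 2 ≤ j / 16 := by linarith
      have : ((2:ℝ) ^ m / 2) ^ 2 ≤ (j / 16) ^ 2 := by gcongr
      nlinarith
    have := log2pi_bd; have := log2_bd
    have b3 : (m:ℝ) * log 2 ≤ m * 0.6931472 := by gcongr; linarith
    unfold cB at hC
    linarith

lemma zf_pos {β γ:ℝ} (h0 : xiG ⟨β, γ⟩ = 0) (hγ : 0 < γ) :
    (γ < 32 - 1 / 32 → β ≤ 1 - 0.35) ∧ (32 - 1 / 32 ≤ γ → γ < 64 - 1 / 32 → β ≤ 1 - 0.25) ∧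
    (64 - 1 / 32 ≤ γ → γ < 128 - 1 / 32 → β ≤ 1 - 0.11) ∧ (128 - 1 / 32 ≤ γ → γ < 256 - 1 / 32 → β ≤ 1 - 0.08) ∧
    (256 - 1 / 32 ≤ γ → γ < 512 - 1 / 32 → β ≤ 1 - 0.058) ∧ (512 - 1 / 32 ≤ γ → γ < 1024 - 1 / 32 → β ≤ 1 - 0.04) ∧
    (1024 - 1 / 32 ≤ γ → γ < 2048 - 1 / 32 → β ≤ 1 - 0.027) := by
  have h5 : 5 ≤ γ := by
    have := low_zero h0
    by_contra hc; push Not at hc; nlinarith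
  refine ⟨fun h => ?_, fun h1 h2 => ?_, fun h1 h2 => ?_, fun h1 h2 => ?_, fun h1 h2 => ?_, fun h1 h2 => ?_, fun h1 h2 => ?_⟩
  · by_cases c1 : γ < 8 - 1 / 32
    · refine zf_range (d := 4) (m := 3) (s := 419430 - 2 ^ 8) (by norm_num) (by norm_num) (by norm_num) (by norm_num) cB4 ?_ (by norm_num) h0 (by norm_num; linarith) (by norm_num; linarith)
      intro j hj1 hj2
      have := blkD_spec (L := 9) (by norm_num) (by norm_num) blk_a j 3 (by norm_num) hj1 hj2
      simpa using this
    · by_cases c2 : γ < 16 - 1 / 32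
      · refine zf_range (d := 4) (m := 4) (s := 629145 - 2 ^ 8) (by norm_num) (by norm_num) (by norm_num) (by norm_num) cB4 ?_ (by norm_num) h0 (by norm_num; linarith) (by norm_num; linarith)
        intro j hj1 hj2
        have := blkD_spec (L := 9) (by norm_num) (by norm_num) blk_a j 2 (by norm_num) hj1 hj2
        simpa using this
      · refine zf_range (d := 4) (m := 5) (s := 765460 - 2 ^ 8) (by norm_num) (by norm_num) (by norm_num) (by norm_num) cB4 ?_ (by norm_num) h0 (by norm_num; linarith) (by norm_num; linarith)
        intro j hj1 hj2
        have := blkD_spec (L := 9) (by norm_num) (by norm_num) blk_a j 1 (by norm_num) hj1 hj2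
        simpa using this
  · refine zf_range (d := 4) (m := 6) (s := 817889 - 2 ^ 8) (by norm_num) (by norm_num) (by norm_num) (by norm_num) cB4 ?_ (by norm_num) h0 (by norm_num; linarith) (by norm_num; linarith)
    intro j hj1 hj2
    have := blkD_spec (L := 9) (by norm_num) (by norm_num) blk_a j 0 (by norm_num) hj1 hj2
    simpa using this
  · refine zf_range (d := 2) (m := 7) (s := 1509949 - 2 ^ 8) (by norm_num) (by norm_num) (by norm_num) (by norm_num) cB2 ?_ (by norm_num) h0 (by norm_num; linarith) (by norm_num; linarith)
    intro j hj1 hj2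
    have := blkD_spec (L := 11) (by norm_num) (by norm_num) blk_b j 1 (by norm_num) hj1 hj2
    simpa using this
  · refine zf_range (d := 2) (m := 8) (s := 1488977 - 2 ^ 8) (by norm_num) (by norm_num) (by norm_num) (by norm_num) cB2 ?_ (by norm_num) h0 (by norm_num; linarith) (by norm_num; linarith)
    intro j hj1 hj2
    have := blkD_spec (L := 11) (by norm_num) (by norm_num) blk_b j 0 (by norm_num) hj1 hj2
    simpa using this
  · refine zf_range (d := 2) (m := 9) (s := 1447034 - 2 ^ 8) (by norm_num) (by norm_num) (by norm_num) (by norm_num) cB2 ?_ (by norm_num) h0 (by norm_num; linarith) (by norm_num; linarith)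
    intro j hj1 hj2
    have := blkF_spec (L := 12) le_rfl blk_1 (j - 4096) (by norm_num at hj1 hj2 ⊢; omega)
    rw [Nat.cast_sub (by norm_num at hj1; exact hj1)] at this
    norm_num at this ⊢; exact this
  · refine zf_range (d := 2) (m := 10) (s := 1384120 - 2 ^ 8) (by norm_num) (by norm_num) (by norm_num) (by norm_num) cB2 ?_ (by norm_num) h0 (by norm_num; linarith) (by norm_num; linarith)
    intro j hj1 hj2
    norm_num at hj1 hj2
    by_cases c : j < 12288
    · have := blkF_spec (L := 12) le_rfl blk_2 (j - 8192) (by norm_num; omega)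
      rw [Nat.cast_sub hj1] at this
      norm_num at this ⊢; exact this
    · have := blkF_spec (L := 12) le_rfl blk_3 (j - 12288) (by norm_num; omega)
      rw [Nat.cast_sub (by omega)] at this
      norm_num at this ⊢; exact this
  · refine zf_range (d := 2) (m := 11) (s := 1370488 - 2 ^ 8) (by norm_num) (by norm_num) (by norm_num) (by norm_num) cB2 ?_ (by norm_num) h0 (by norm_num; linarith) (by norm_num; linarith)
    intro j hj1 hj2
    norm_num at hj1 hj2
    by_cases c : j < 20480
    · have := blkF_spec (L := 12) le_rfl blk_4 (j - 16384) (by norm_num; omega)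
      rw [Nat.cast_sub hj1] at this
      norm_num at this ⊢; exact this
    by_cases c : j < 24576
    · have := blkF_spec (L := 12) le_rfl blk_5 (j - 20480) (by norm_num; omega)
      rw [Nat.cast_sub (by omega)] at this
      norm_num at this ⊢; exact this
    by_cases c : j < 28672
    · have := blkF_spec (L := 12) le_rfl blk_6 (j - 24576) (by norm_num; omega)
      rw [Nat.cast_sub (by omega)] at this
      norm_num at this ⊢; exact this
    · have := blkF_spec (L := 12) le_rfl blk_7 (j - 28672) (by norm_num; omega)
      rw [Nat.cast_sub (by omega)] at this
      norm_num at this ⊢; exact this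

/-- zero-free up to height `Q` with margin `η` -/
def ZF (Q η:ℝ) : Prop := ∀ β γ : ℝ, xiG ⟨β, γ⟩ = 0 → |γ| ≤ Q → β ≤ 1 - η

lemma ZF_of_pos {Q η:ℝ} (h : ∀ β γ : ℝ, xiG ⟨β, γ⟩ = 0 → 0 < γ → γ ≤ Q → β ≤ 1 - η) : ZF Q η := by
  intro β γ h0 hQ
  rcases lt_trichotomy γ 0 with hg | hg | hg
  · exact h β (-γ) (xiG_neg h0) (by linarith) (by rwa [abs_of_neg hg] at hQ)
  · have := low_zero h0; rw [hg] at this; norm_num at this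
  · exact h β γ h0 hg (by rwa [abs_of_pos hg] at hQ)

lemma ZF_tab : ZF 31.9 0.35 ∧ ZF 63.9 0.25 ∧ ZF 127.9 0.11 ∧ ZF 255.9 0.08 ∧ ZF 511.9 0.058 ∧
    ZF 1023.9 0.04 ∧ ZF 2047.9 0.027 := by
  refine ⟨?_, ?_, ?_, ?_, ?_, ?_, ?_⟩ <;> refine ZF_of_pos fun β γ h0 hg hQ => ?_ <;>
    obtain ⟨z1, z2, z3, z4, z5, z6, z7⟩ := zf_pos h0 hg <;>
    norm_num at z1 z2 z3 z4 z5 z6 z7 hQ ⊢ <;>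
    (rcases lt_or_ge γ (1023 / 32) with c1 | c1
     · linarith [z1 c1]
     rcases lt_or_ge γ (2047 / 32) with c2 | c2
     · linarith [z2 c1 c2]
     rcases lt_or_ge γ (4095 / 32) with c3 | c3
     · linarith [z3 c2 c3]
     rcases lt_or_ge γ (8191 / 32) with c4 | c4
     · linarith [z4 c3 c4]
     rcases lt_or_ge γ (16383 / 32) with c5 | c5
     · linarith [z5 c4 c5]
     rcases lt_or_ge γ (32767 / 32) with c6 | c6
     · linarith [z6 c5 c6]
     rcases lt_or_ge γ (65535 / 32) with c7 | c7
     · linarith [z7 c6 c7]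
     linarith)

lemma trig5 (x:ℝ) : 0 ≤ 5 + 8 * Real.cos x + 4 * Real.cos (2 * x) + 1 * Real.cos (3 * x) := by
  rw [Real.cos_two_mul, Real.cos_three_mul]
  have h := Real.neg_one_le_cos x
  nlinarith [mul_nonneg (by linarith : 0 ≤ 1 + Real.cos x) (sq_nonneg (1 + 2 * Real.cos x))]

lemma lgT_an {σ t k Q:ℝ} (h : 0 < σ + 1) (h1 : σ ≤ 3 / 2) (hQ : 2000 ≤ Q) (hk : 1 ≤ k) (ht : |t| ≤ k * Q) :
    lgT σ t ≤ (log k + log Q) / 2 + 0.00001 - log (2 * π) / 2 := by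
  unfold lgT
  have hkQ : 2000 ≤ k * Q := by nlinarith
  have h2 : t ^ 2 ≤ (k * Q) ^ 2 := by rw [← sq_abs]; gcongr
  have h3 : (σ + 1) ^ 2 + t ^ 2 ≤ (k * Q) ^ 2 * (1 + 0.000004) := by nlinarith
  have h4 := log_le_log (by positivity) h3
  rw [log_mul (by positivity) (by norm_num), log_pow, log_mul (by positivity) (by positivity)] at h4
  have := Real.log_le_sub_one_of_pos (show (0:ℝ) < 1 + 0.000004 by norm_num)
  push_cast at h4
  linarith

lemma zf_an_core {σ t Q δ:ℝ} (hσ : σ = 1 + δ) (hδ : 0 < δ) (hδ1 : δ ≤ 0.0707) (hQ : 2000 ≤ Q) (ht1 : 2000 ≤ t) (ht : t ≤ Q)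
    {β:ℝ} (h0 : xiG ⟨β, t⟩ = 0) (hβ : 1 / 2 < β) (hb1 : β < 1) :
    8 / (σ - β) ≤ 5 / δ + 65 / 18 * (log Q - 2.65) := by
  have hc := cert_basic (σ := σ) (t := t) (β := β) (γ := t) (a0 := 5) (a1 := 8) (a2 := 4) (a3 := 1) (by linarith) (by linarith)
    (by norm_num) (by norm_num) (by norm_num) (by norm_num) trig5 h0 (by linarith) hβ (by simp) ∅
  have e1 : (σ - β) / ((σ - β) ^ 2 + (t - t) ^ 2) = 1 / (σ - β) := by
    have : σ - β ≠ 0 := by linarith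
    rw [sub_self]; field_simp; ring
  have e2 : ∀ k : ℝ, 1 ≤ k → (σ - 1) / ((σ - 1) ^ 2 + (k * t) ^ 2) ≤ 0.00001 := by
    intro k hk
    rw [div_le_iff₀ (by positivity)]
    have : 2000 ≤ k * t := by nlinarith
    nlinarith [sq_nonneg (σ - 1)]
  have l1 := lgT_an (σ := σ) (t := t) (k := 1) (by linarith) (by linarith) hQ le_rfl (by rw [abs_of_pos (by linarith)]; linarith)
  have l2 := lgT_an (σ := σ) (t := 2 * t) (k := 2) (by linarith) (by linarith) hQ (by norm_num) (by rw [abs_of_pos (by linarith)]; linarith)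
  have l3 := lgT_an (σ := σ) (t := 3 * t) (k := 3) (by linarith) (by linarith) hQ (by norm_num) (by rw [abs_of_pos (by linarith)]; linarith)
  have k1 := e2 1 le_rfl
  have k2 := e2 2 (by norm_num)
  have k3 := e2 3 (by norm_num)
  rw [e1, lgT_zero (by linarith), lgT_zero (by linarith)] at hc
  rw [one_mul] at k1
  rw [Real.log_one] at l1
  have m1 : log (σ + 1) ≤ 0.7286 := by
    have : log (σ + 1) = log 2 + log (1 + δ / 2) := by
      rw [← log_mul (by norm_num) (by linarith)]; congr 1; rw [hσ]; ring
    have := Real.log_le_sub_one_of_pos (show 0 < 1 + δ / 2 by linarith)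
    have := log2_bd
    linarith
  have m2 : 0.9648 ≤ log (σ + 5 / 8 + 1) := by
    have : log (21 / 8) ≤ log (σ + 5 / 8 + 1) := log_le_log (by norm_num) (by linarith)
    have e : log (21 / 8) = log 3 + log 7 - 3 * log 2 := by
      rw [show 3 * log 2 = log (2 ^ 3) by rw [log_pow]; norm_num, ← log_mul (by norm_num) (by norm_num),
      ← log_div (by norm_num) (by norm_num)]; norm_num
    have h7 : 1.9457 ≤ log 7 := by
      have : log (49 / 48) = 2 * log 7 - log 3 - 4 * log 2 := by
        rw [show 2 * log 7 = log (7 ^ 2) by rw [log_pow]; norm_num,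
          show 4 * log 2 = log (2 ^ 4) by rw [log_pow]; norm_num, ← log_div (by norm_num) (by norm_num),
          ← log_div (by norm_num) (by norm_num)]; norm_num
      have h := Real.one_sub_inv_le_log_of_pos (show (0:ℝ) < 49 / 48 by norm_num)
      have := log2_bd; have := log3_bd
      norm_num at h
      linarith
    have := log2_bd; have := log3_bd
    linarith
  have m3 : 1.4373 ≤ 1 / (σ - 3 / 8) := by
    rw [le_div_iff₀ (by linarith)]; linarith
  have e3 : 1 / (σ - 1) = 1 / δ := by rw [hσ]; ring
  rw [e3] at hc
  have := log2_bd; have := log3_bd; have := log2pi_bd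
  simp only [Finset.sum_empty] at hc
  have e4 : 8 / (σ - β) = 8 * (1 / (σ - β)) := by ring
  have e5 : 5 / δ = 5 * (1 / δ) := by ring
  rw [e4, e5]
  linarith

lemma log2000_bd : 7.6009 ≤ log 2000 ∧ log 2000 ≤ 7.601 := by
  have : log 2000 = 4 * log 2 + 3 * log 5 := by
    rw [show 3 * log 5 = log (5 ^ 3) by rw [log_pow]; norm_num,
      show 4 * log 2 = log (2 ^ 4) by rw [log_pow]; norm_num, ← log_mul (by norm_num) (by norm_num)]; norm_num
  have := log2_bd; have := log5_bd
  constructor <;> linarith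

lemma ZF_an {Q:ℝ} (hQ : 2000 ≤ Q) : ZF Q (0.096 / (log Q - 2.65)) := by
  have hl : 7.6009 ≤ log Q := log2000_bd.1.trans (log_le_log (by norm_num) hQ)
  obtain ⟨l, hlq⟩ : ∃ l, l = log Q - 2.65 := ⟨_, rfl⟩
  rw [← hlq]
  have hl4 : 4.95 ≤ l := by linarith
  have hη : 0.096 / l ≤ 0.027 := by rw [div_le_iff₀ (by linarith)]; linarith
  refine ZF_of_pos fun β t h0 hg ht => ?_
  by_cases hb : β ≤ 1 / 2
  · linarith
  push Not at hb
  by_cases h2 : t ≤ 2000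
  · have := ZF_tab.2.2.2.2.2.2 β t h0 (by rw [abs_of_pos hg]; linarith)
    linarith
  push Not at h2
  have hδ : (0.35:ℝ) / l ≤ 0.0707 := by
    rw [div_le_iff₀ (by linarith)]; linarith
  have hδ0 : 0 < (0.35:ℝ) / l := by positivity
  have hb1 := (xiG_zero_re h0).2
  simp only at hb1
  have hc := zf_an_core (σ := 1 + 0.35 / l) rfl hδ0 hδ hQ h2.le ht h0 hb hb1
  rw [← hlq] at hc
  by_contra hcon
  push Not at hcon
  have h3 : 1 + 0.35 / l - β < 0.446 / l := by
    have : (0.446:ℝ) / l = 0.35 / l + 0.096 / l := by ring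
    linarith
  have h4 : 8 / (0.446 / l) < 8 / (1 + 0.35 / l - β) := by
    apply div_lt_div_of_pos_left (by norm_num) (by linarith) h3
  have e1 : 8 / (0.446 / l) = 8 / 0.446 * l := by field_simp
  have e2 : 5 / (0.35 / l) = 5 / 0.35 * l := by field_simp
  rw [e1] at h4
  rw [e2] at hc
  norm_num at h4 hc
  nlinarith

lemma phi_mono {z z0:ℝ} (h : 0 ≤ z) (h1 : z ≤ z0) (h2 : z0 < 1) :
    -log (1 - z) * z0 ≤ -log (1 - z0) * z := by
  rcases eq_or_lt_of_le (h.trans h1) with h0 | h0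
  · have : z = 0 := by linarith
    subst this; simp
  have hc := strictConcaveOn_log_Ioi.concaveOn.2 (show 1 - z0 ∈ Set.Ioi (0:ℝ) by simpa using h2)
    (show (1:ℝ) ∈ Set.Ioi (0:ℝ) by simp) (show 0 ≤ z / z0 by positivity) (show 0 ≤ 1 - z / z0 by rw [sub_nonneg, div_le_one h0]; exact h1) (by ring)
  simp only [smul_eq_mul, Real.log_one, mul_zero, add_zero, mul_one] at hc
  have e : z / z0 * (1 - z0) + (1 - z / z0) = 1 - z := by field_simp; ring
  rw [e] at hc
  have := mul_le_mul_of_nonneg_right hc h0.le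
  have e2 : z / z0 * log (1 - z0) * z0 = z * log (1 - z0) := by field_simp
  rw [e2] at this
  linarith

/-- the constant in the comparison of `log` and the logarithmic derivative -/
noncomputable def kap (δ η r:ℝ) : ℝ := (δ + η) * log ((δ + η) / (η - r))

lemma kap_step {a b X:ℝ} (hX : 0 < X) (h : X < b) (hab : b ≤ a) :
    a * log (a / (a - X)) ≤ b * log (b / (b - X)) := by
  have hb : 0 < b := by linarith
  have ha : 0 < a := by linarith
  have e : ∀ c : ℝ, X < c → log (c / (c - X)) = -log (1 - X / c) := by
    intro c hc
    have : 0 < c := by linarith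
    rw [← Real.log_inv]; congr 1
    have : c - X ≠ 0 := by linarith
    have : 1 - X / c = (c - X) / c := by field_simp
    rw [this, inv_div]
  rw [e a (by linarith), e b h]
  have hm := phi_mono (z := X / a) (z0 := X / b) (by positivity) (by gcongr) (by rw [div_lt_one hb]; exact h)
  have k := mul_le_mul_of_nonneg_left hm (show 0 ≤ a * b / X by positivity)
  have e1 : a * b / X * (-log (1 - X / a) * (X / b)) = a * -log (1 - X / a) := by field_simp
  have e2 : a * b / X * (-log (1 - X / b) * (X / a)) = b * -log (1 - X / b) := by field_simp
  rw [e1, e2] at k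
  exact k

lemma kap_term {a b X y:ℝ} (hX : 0 < X) (h : X < b) (ha : X ≤ 2 * a) (hab : b ≤ a ∨ b ≤ |y|) :
    (log (a ^ 2 + y ^ 2) - log ((a - X) ^ 2 + y ^ 2)) / 2 ≤
      b * log (b / (b - X)) * (a / (a ^ 2 + y ^ 2)) := by
  have ha0 : 0 < a := by linarith
  have hb : 0 < b := by linarith
  have hS : 0 < a ^ 2 + y ^ 2 := by positivity
  have key : ∀ A : ℝ, X < A → 0 < A → (2 * a * X - X ^ 2) / (a ^ 2 + y ^ 2) ≤ (2 * A * X - X ^ 2) / A ^ 2 →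
      (2 * a - X) * A ≤ a * (2 * A - X) →
      (log (a ^ 2 + y ^ 2) - log ((a - X) ^ 2 + y ^ 2)) / 2 ≤
      A * log (A / (A - X)) * (a / (a ^ 2 + y ^ 2)) := by
    intro A hA hA0 hz hw
    have hz0 : 0 ≤ (2 * a * X - X ^ 2) / (a ^ 2 + y ^ 2) := by
      apply div_nonneg _ hS.le; nlinarith
    have e0 : 1 - (2 * A * X - X ^ 2) / A ^ 2 = ((A - X) / A) ^ 2 := by field_simp; ring
    have hAX : 0 < A - X := by linarith
    have hlt : (2 * A * X - X ^ 2) / A ^ 2 < 1 := by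
      have : 0 < ((A - X) / A) ^ 2 := by positivity
      linarith
    have hm := phi_mono hz0 hz hlt
    have e1 : 1 - (2 * a * X - X ^ 2) / (a ^ 2 + y ^ 2) = ((a - X) ^ 2 + y ^ 2) / (a ^ 2 + y ^ 2) := by
      field_simp; ring
    have hpos : 0 < ((a - X) ^ 2 + y ^ 2) := by
      have : 0 < 1 - (2 * a * X - X ^ 2) / (a ^ 2 + y ^ 2) := by linarith
      rw [e1] at this
      exact (div_pos_iff_of_pos_right hS).1 this
    rw [e1, e0, log_div hpos.ne' hS.ne', log_pow] at hm
    have e3 : log (A / (A - X)) = -log ((A - X) / A) := by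
      rw [← Real.log_inv, inv_div]
    rw [e3]
    have hl : 0 ≤ -log ((A - X) / A) := by
      rw [neg_nonneg]; apply Real.log_nonpos (by positivity); rw [div_le_one hA0]; linarith
    obtain ⟨l, hl'⟩ : ∃ l, l = -log ((A - X) / A) := ⟨_, rfl⟩
    obtain ⟨D, hD⟩ : ∃ D, D = log (a ^ 2 + y ^ 2) - log ((a - X) ^ 2 + y ^ 2) := ⟨_, rfl⟩
    rw [← hl'] at hl ⊢
    rw [← hD]
    have hm2 : D * ((2 * A * X - X ^ 2) / A ^ 2) ≤ 2 * l * ((2 * a * X - X ^ 2) / (a ^ 2 + y ^ 2)) := by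
      rw [hD, hl']; push_cast at hm; linarith
    have hq : 0 < X * (2 * A - X) := by apply mul_pos hX; linarith
    have hm3 : D * (X * (2 * A - X)) * (a ^ 2 + y ^ 2) ≤ 2 * l * (X * (2 * a - X)) * A ^ 2 := by
      have h1 : D * ((2 * A * X - X ^ 2) / A ^ 2) = D * (X * (2 * A - X)) / A ^ 2 := by ring
      have h2 : 2 * l * ((2 * a * X - X ^ 2) / (a ^ 2 + y ^ 2)) = 2 * l * (X * (2 * a - X)) / (a ^ 2 + y ^ 2) := by ring
      rw [h1, h2, div_le_div_iff₀ (by positivity) hS] at hm2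
      exact hm2
    have hm4 : 2 * l * (X * (2 * a - X)) * A ^ 2 ≤ 2 * l * A * a * (X * (2 * A - X)) := by
      have := mul_le_mul_of_nonneg_left hw (show 0 ≤ 2 * l * X * A by positivity)
      nlinarith
    have hm5 : D * (a ^ 2 + y ^ 2) ≤ 2 * l * A * a := by
      refine le_of_mul_le_mul_right ?_ hq
      linarith
    have : A * l * (a / (a ^ 2 + y ^ 2)) = (A * l * a) / (a ^ 2 + y ^ 2) := by ring
    rw [this, le_div_iff₀ hS]
    linarith
  by_cases hba : b ≤ a
  · refine (key a (by linarith) ha0 ?_ (by linarith)).trans ?_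
    · have : 0 ≤ 2 * a * X - X ^ 2 := by nlinarith
      gcongr
      nlinarith [sq_nonneg y]
    · apply mul_le_mul_of_nonneg_right (kap_step hX h hba) (by positivity)
  · push Not at hba
    have hy : b ≤ |y| := by
      rcases hab with h' | h'
      · linarith
      · exact h'
    refine key b h hb ?_ (by nlinarith)
    have hy2 : b ^ 2 ≤ y ^ 2 := by rw [← sq_abs y]; gcongr
    have : 0 ≤ 2 * b * X - X ^ 2 := by nlinarith
    apply div_le_div₀ this (by nlinarith) (by positivity)
    nlinarith [sq_nonneg a]

lemma xi_compare {Q η δ r κ t:ℝ} (hZ : ZF Q η) (hX : 0 < δ + r) (hr : r < η) (hrd : r ≤ δ) (hδ : 0 < δ)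
    (ht : |t| + δ + η ≤ Q) (hκ : kap δ η r ≤ κ) :
    xiG ⟨1 - r, t⟩ ≠ 0 ∧
    log ‖xiG ⟨1 + δ, t⟩‖ - log ‖xiG ⟨1 - r, t⟩‖ ≤ κ * zA (1 + δ) t := by
  have hne : xiG ⟨1 - r, t⟩ ≠ 0 := by
    intro h
    have := hZ _ _ h (by linarith)
    linarith
  refine ⟨hne, ?_⟩
  have hκ2 : log ‖xiG ⟨1 + δ, t⟩‖ - log ‖xiG ⟨1 - r, t⟩‖ ≤ kap δ η r * zA (1 + δ) t := by
    obtain ⟨Z, h1, h2, h3, h4⟩ := xiG_real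
    have hn1 : xiG ⟨1 + δ, t⟩ ≠ 0 := xiG_ne_zero (by simp only; linarith)
    have hA := (h3 (1 + δ) t hn1).const_mul (kap δ η r)
    refine le_of_tendsto_of_tendsto' (h4 (1 + δ) (1 - r) t t hn1 hne) hA ?_
    intro N
    rw [← Multiset.sum_map_mul_left]
    apply Multiset.sum_map_le_sum_map
    intro ρ hρ
    have hb : ∀ β γ : ℝ, xiG ⟨β, γ⟩ = 0 → ∀ y, (y = t - γ ∨ y = t + γ) →
        (log ((1 + δ - β) ^ 2 + y ^ 2) - log ((1 - r - β) ^ 2 + y ^ 2)) / 2 ≤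
        kap δ η r * ((1 + δ - β) / ((1 + δ - β) ^ 2 + y ^ 2)) := by
      intro β γ h0 y hy
      have hre := xiG_zero_re h0
      simp only at hre
      have := kap_term (a := 1 + δ - β) (b := δ + η) (X := δ + r) (y := y) hX (by linarith) (by linarith) ?_
      · have e1 : 1 + δ - β - (δ + r) = 1 - r - β := by ring
        have e2 : δ + η - (δ + r) = η - r := by ring
        rw [e1, e2] at this
        exact this
      · by_cases hc : δ + η ≤ |y|
        · exact Or.inr hc
        · left
          push Not at hc
          have hg : |γ| ≤ Q := by
            rcases hy with hy | hy
            · have : γ = t - y := by linarith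
              rw [this]; exact (abs_sub _ _).trans (by linarith)
            · have : γ = y - t := by linarith
              rw [this]; exact (abs_sub _ _).trans (by linarith)
          have := hZ _ _ h0 hg
          linarith
    have h0 := h1 N ρ hρ
    have h0' : xiG ⟨1 - ρ.re, -ρ.im⟩ = 0 := by
      have : (⟨1 - ρ.re, -ρ.im⟩:ℂ) = 1 - ρ := by apply Complex.ext <;> simp
      rw [this, xiG_one_sub]; exact h0
    have b1 := hb ρ.re ρ.im h0 (t - ρ.im) (Or.inl rfl)
    have b2 := hb ρ.re ρ.im h0 (t + ρ.im) (Or.inr rfl)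
    have b3 := hb (1 - ρ.re) (-ρ.im) h0' (t - ρ.im) (Or.inr (by ring))
    have b4 := hb (1 - ρ.re) (-ρ.im) h0' (t + ρ.im) (Or.inl (by ring))
    unfold hdL hdD
    have e1 : 1 + δ - 1 / 2 - (ρ.re - 1 / 2) = 1 + δ - ρ.re := by ring
    have e2 : 1 + δ - 1 / 2 + (ρ.re - 1 / 2) = 1 + δ - (1 - ρ.re) := by ring
    have e3 : 1 - r - 1 / 2 - (ρ.re - 1 / 2) = 1 - r - ρ.re := by ring
    have e4 : 1 - r - 1 / 2 + (ρ.re - 1 / 2) = 1 - r - (1 - ρ.re) := by ring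
    rw [e1, e2, e3, e4]
    linarith
  exact hκ2.trans (mul_le_mul_of_nonneg_right hκ (zA_nonneg (by linarith) t))

lemma zsum_part {σ:ℝ} (hσ : 1 < σ) (N:ℕ) : ∑ i ∈ range N, ((i:ℝ) + 1) ^ (-σ) ≤ 1 + 1 / (σ - 1) := by
  have hp : 0 < 1 / (σ - 1) := by apply div_pos one_pos; linarith
  rcases N with _ | N
  · rw [Finset.sum_range_zero]; linarith
  rw [Finset.sum_range_succ']
  have hanti : AntitoneOn (fun x : ℝ => x ^ (-σ)) (Set.Icc 1 (1 + N)) := by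
    intro x hx y hy hxy
    exact Real.rpow_le_rpow_of_nonpos (by linarith [hx.1]) hxy (by linarith)
  have h := hanti.sum_le_integral
  have hi : ∫ x in (1:ℝ)..(1 + N), x ^ (-σ) = ((1 + N:ℝ) ^ (-σ + 1) - 1 ^ (-σ + 1)) / (-σ + 1) := by
    apply integral_rpow
    right
    refine ⟨by linarith, ?_⟩
    rw [Set.uIcc_of_le (by linarith [Nat.cast_nonneg (α := ℝ) N])]
    intro h; linarith [h.1]
  rw [hi, Real.one_rpow] at h
  have h2 : ((1 + N:ℝ) ^ (-σ + 1) - 1) / (-σ + 1) ≤ 1 / (σ - 1) := by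
    have : ((1 + N:ℝ) ^ (-σ + 1) - 1) / (-σ + 1) = (1 - (1 + N:ℝ) ^ (-σ + 1)) / (σ - 1) := by
      rw [← neg_div_neg_eq]; congr 1 <;> ring
    rw [this]
    have : 0 ≤ (1 + N:ℝ) ^ (-σ + 1) := by positivity
    apply div_le_div_of_nonneg_right _ (by linarith)
    linarith
  have e : ∑ k ∈ range N, (((k + 1:ℕ):ℝ) + 1) ^ (-σ) = ∑ i ∈ range N, (1 + ((i + 1:ℕ):ℝ)) ^ (-σ) := by
    apply Finset.sum_congr rfl; intro i _; rw [add_comm]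
  rw [e]
  simp only [Nat.cast_zero, zero_add, Real.one_rpow]
  linarith

lemma zsum_summable {σ:ℝ} (hσ : 1 < σ) : Summable (fun n : ℕ => ((n:ℝ)) ^ (-σ)) := by
  apply Real.summable_nat_rpow.2; linarith

lemma zsum_le {σ:ℝ} (hσ : 1 < σ) : ∑' n : ℕ, ((n:ℝ)) ^ (-σ) ≤ 1 + 1 / (σ - 1) := by
  apply Real.tsum_le_of_sum_range_le (fun n => by positivity)
  intro N
  rcases N with _ | N
  · have := zsum_part hσ 0; simpa using this
  · rw [Finset.sum_range_succ']
    have := zsum_part hσ N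
    have e : ((0:ℕ):ℝ) ^ (-σ) = 0 := by rw [Nat.cast_zero, Real.zero_rpow (by linarith)]
    rw [e, add_zero]
    simpa using this

lemma lterm_norm (f : ℕ → ℂ) (s:ℂ) (C : ℕ → ℝ) (hf : ∀ n, ‖f n‖ ≤ C n) (n:ℕ) (hn : n ≠ 0) :
    ‖LSeries.term f s n‖ ≤ C n * (n:ℝ) ^ (-s.re) := by
  rw [LSeries.norm_term_eq]
  simp only [hn, if_false]
  rw [div_eq_mul_inv, ← rpow_neg (by positivity)]
  gcongr
  exact hf n

lemma inv_zeta_le {δ t:ℝ} (hδ : 0 < δ) : -log ‖riemannZeta ⟨1 + δ, t⟩‖ ≤ log (1 + 1 / δ) := by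
  have hs : 1 < (⟨1 + δ, t⟩:ℂ).re := by simp only; linarith
  have h := LSeries_zeta_mul_Lseries_moebius hs
  rw [LSeries_zeta_eq_riemannZeta hs] at h
  have hσ : 1 < 1 + δ := by linarith
  have hb : ‖LSeries (fun n => ((moebius n:ℤ):ℂ)) ⟨1 + δ, t⟩‖ ≤ 1 + 1 / δ := by
    unfold LSeries
    have h1 : ∀ n : ℕ, ‖LSeries.term (fun n => ((moebius n:ℤ):ℂ)) ⟨1 + δ, t⟩ n‖ ≤ (n:ℝ) ^ (-(1 + δ)) := by
      intro n
      by_cases hn : n = 0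
      · subst hn; simp; positivity
      · have := lterm_norm (fun n => ((moebius n:ℤ):ℂ)) ⟨1 + δ, t⟩ (fun _ => 1) (fun n => by
          rw [Complex.norm_intCast]; exact_mod_cast abs_moebius_le_one) n hn
        simpa using this
    have h2 := tsum_of_norm_bounded (zsum_summable hσ).hasSum h1
    have h3 := zsum_le hσ
    rw [add_sub_cancel_left] at h3
    exact h2.trans h3
  have hn : ‖riemannZeta ⟨1 + δ, t⟩‖ * ‖LSeries (fun n => ((moebius n:ℤ):ℂ)) ⟨1 + δ, t⟩‖ = 1 := by
    rw [← norm_mul, h, norm_one]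
  have hz : 0 < ‖riemannZeta ⟨1 + δ, t⟩‖ := by
    apply norm_pos_iff.2; intro h0; rw [h0] at hn; simp at hn
  rw [← Real.log_inv]
  apply log_le_log (by positivity)
  rw [inv_le_iff_one_le_mul₀ hz]
  nlinarith

lemma vM_zero_le {δ:ℝ} (hδ : 0 < δ) : vM (1 + δ) 0 ≤ 1 / δ + lgT (1 + δ) 0 + 3 / 100 := by
  have h := (abs_le.1 (zA_bound (σ := 1 + δ) 0 (by linarith))).2
  have h2 := zA_nonneg (σ := 1 + δ) (by linarith) 0
  have h3 := (abs_le.1 (zA_bound (σ := 1 + δ) 0 (by linarith))).1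
  have e : (1 + δ - 1) / ((1 + δ - 1) ^ 2 + 0 ^ 2) = 1 / δ := by
    rw [add_sub_cancel_left]; field_simp; ring
  rw [e] at h
  linarith

lemma vM_neg_le {σ t:ℝ} (hσ : 1 < σ) : -vM σ t ≤ vM σ 0 := by
  have h1 := (vM_hasSum t hσ).neg
  have h2 := vM_hasSum 0 hσ
  refine hasSum_le ?_ h1 h2
  intro n
  have := Real.neg_one_le_cos (t * log n)
  have h3 : 0 ≤ vonMangoldt n * (n:ℝ) ^ (-σ) := mul_nonneg vonMangoldt_nonneg (by positivity)
  simp only [zero_mul, Real.cos_zero]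
  nlinarith

/-- lower bound for zeta to the left of the line 1 -/
lemma zeta_lower {Q η δ r κ t:ℝ} (hZ : ZF Q η) (hX : 0 < δ + r) (hr : r < η) (hrd : |r| ≤ δ) (hδ : 0 < δ) (hr4 : r ≤ 1 / 4)
    (ht : |t| + δ + η ≤ Q) (ht3 : 3 ≤ |t|) (hκ : kap δ η r ≤ κ) (hκ0 : 0 ≤ κ) :
    riemannZeta ⟨1 - r, t⟩ ≠ 0 ∧
    -log ‖riemannZeta ⟨1 - r, t⟩‖ ≤ log (1 + 1 / δ) +
      κ * (δ / 9 + 1 / δ + lgT (1 + δ) 0 + 3 / 50 + lgT (1 + δ) t) - (δ + r) * (lgT (1 - r) t - 3 / 100) := by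
  have hrd' := abs_le.1 hrd
  obtain ⟨hne, hcmp⟩ := xi_compare hZ hX hr hrd'.2 hδ ht hκ
  have ht2 : 9 ≤ t ^ 2 := by rw [← sq_abs]; nlinarith
  have ht0 : t ≠ 0 := by rintro rfl; simp at ht2; linarith
  have hn1 : ∀ σ : ℝ, (⟨σ, t⟩:ℂ) ≠ 1 := by
    intro σ h; have := congrArg Complex.im h; simp at this; exact ht0 this
  have hz2 : riemannZeta ⟨1 - r, t⟩ ≠ 0 := by
    intro h; exact hne (xiG_zero_zeta (s := ⟨1 - r, t⟩) (by simp only; linarith) h)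
  have hz1 : riemannZeta ⟨1 + δ, t⟩ ≠ 0 := riemannZeta_ne_zero_of_one_le_re (by simp only; linarith)
  refine ⟨hz2, ?_⟩
  rw [xi_log (by linarith) (hn1 _) hz1, xi_log (by linarith) (hn1 _) hz2] at hcmp
  have hg := (dg_diff (x := (1 - r) / 2 + 1) (y := t / 2) (h := (δ + r) / 2) (by linarith) (by linarith)).1
  have e1 : (1 - r) / 2 + 1 + (δ + r) / 2 = (1 + δ) / 2 + 1 := by ring
  rw [e1] at hg
  have hP : 0 < (1 - r + 1) ^ 2 + t ^ 2 := by nlinarith [sq_nonneg (1 - r + 1)]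
  have e2 : log ‖(⟨(1 - r) / 2 + 1, t / 2⟩ - 1 / 2:ℂ)‖ = log ((1 - r + 1) ^ 2 + t ^ 2) / 2 - log 2 := by
    have : (⟨(1 - r) / 2 + 1, t / 2⟩ - 1 / 2:ℂ) = ⟨(1 - r + 1) / 2, t / 2⟩ := by
      apply Complex.ext
      · norm_num; ring
      · norm_num
    rw [this, Complex.norm_def, Complex.normSq_mk, log_sqrt (by nlinarith [mul_self_nonneg ((1 - r + 1) / 2), mul_self_nonneg (t / 2)])]
    have : (1 - r + 1) / 2 * ((1 - r + 1) / 2) + t / 2 * (t / 2) = ((1 - r + 1) ^ 2 + t ^ 2) / 2 ^ 2 := by ring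
    rw [this, log_div hP.ne' (by norm_num), log_pow]
    push_cast; ring
  rw [e2] at hg
  have hl : log ((1 - r - 1) ^ 2 + t ^ 2) ≤ log ((1 + δ - 1) ^ 2 + t ^ 2) := by
    apply log_le_log (by positivity)
    have : r ^ 2 ≤ δ ^ 2 := sq_le_sq' hrd'.1 hrd'.2
    nlinarith
  have hA := (abs_le.1 (zA_bound (σ := 1 + δ) t (by linarith))).2
  have h1 := vM_zero_le hδ
  have h2 := vM_neg_le (σ := 1 + δ) (t := t) (by linarith)
  have h3 := inv_zeta_le (t := t) hδ
  have h4 : (1 + δ - 1) / ((1 + δ - 1) ^ 2 + t ^ 2) ≤ δ / 9 := by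
    rw [add_sub_cancel_left]
    gcongr
    nlinarith
  have hA2 : zA (1 + δ) t ≤ δ / 9 + 1 / δ + lgT (1 + δ) 0 + 3 / 50 + lgT (1 + δ) t := by linarith
  have hA3 := mul_le_mul_of_nonneg_left hA2 hκ0
  have e3 : lgT (1 - r) t = log ((1 - r + 1) ^ 2 + t ^ 2) / 4 - (log 2 + log π) / 2 := by
    unfold lgT; rw [log_mul (by norm_num) Real.pi_ne_zero]
  rw [e3]
  nlinarith

lemma zA2_le : zA 2 0 ≤ 1 / 10 := by
  have h := (abs_le.1 (zA_bound (σ := 2) 0 (by norm_num))).2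
  have h1 := vM2_bd
  have h2 : lgT 2 0 = 2 * log 3 / 4 - log (2 * π) / 2 := by
    unfold lgT
    rw [show ((2:ℝ) + 1) ^ 2 + 0 ^ 2 = 3 ^ 2 by norm_num, log_pow]; norm_num
  rw [h2] at h
  have := log2pi_bd; have := log3_bd
  norm_num at h
  linarith

lemma low_hdD {β γ:ℝ} (h1 : 0 < β) (h2 : β < 1) : 3 / (4 + γ ^ 2) ≤ hdD (2 - 1 / 2) (β - 1 / 2) γ := by
  unfold hdD
  have a1 : 0 < 2 - β := by linarith
  have a2 : 0 < 1 + β := by linarith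
  rw [show (2:ℝ) - 1 / 2 - (β - 1 / 2) = 2 - β by ring, show (2:ℝ) - 1 / 2 + (β - 1 / 2) = 1 + β by ring]
  have b1 : (2 - β) / (4 + γ ^ 2) ≤ (2 - β) / ((2 - β) ^ 2 + γ ^ 2) := by
    apply div_le_div_of_nonneg_left a1.le (by positivity)
    nlinarith
  have b2 : (1 + β) / (4 + γ ^ 2) ≤ (1 + β) / ((1 + β) ^ 2 + γ ^ 2) := by
    apply div_le_div_of_nonneg_left a2.le (by positivity)
    nlinarith
  have : 3 / (4 + γ ^ 2) = (2 - β) / (4 + γ ^ 2) + (1 + β) / (4 + γ ^ 2) := by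
    rw [← add_div]; ring
  linarith

lemma low_pair {u t c γ:ℝ} (hu : |u| ≤ 3 / 4) (ht : |t| ≤ 3) (hc : |c| < 1 / 2) (hγ : 25 ≤ γ ^ 2) :
    (log ((3 / 2 - c) ^ 2 + γ ^ 2) + log ((3 / 2 + c) ^ 2 + γ ^ 2)
      - log ((u - c) ^ 2 + (t - γ) ^ 2) - log ((u + c) ^ 2 + (t + γ) ^ 2)) / 2 ≤ 11.8125 / (γ ^ 2 - 9.5625) := by
  have hu2 : u ^ 2 ≤ 9 / 16 := by rw [← sq_abs]; nlinarith [abs_nonneg u]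
  have ht2 : t ^ 2 ≤ 9 := by rw [← sq_abs]; nlinarith [abs_nonneg t]
  obtain ⟨w, hw⟩ : ∃ w : ℂ, w = ⟨c, γ⟩ := ⟨_, rfl⟩
  obtain ⟨z, hz⟩ : ∃ z : ℂ, z = ⟨u, t⟩ := ⟨_, rfl⟩
  have nz : ‖z‖ ^ 2 = u ^ 2 + t ^ 2 := by rw [hz, ← Complex.normSq_eq_norm_sq, Complex.normSq_mk]; ring
  have nw : ‖w‖ ^ 2 = c ^ 2 + γ ^ 2 := by rw [hw, ← Complex.normSq_eq_norm_sq, Complex.normSq_mk]; ring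
  have e0 : log ((3 / 2 - c) ^ 2 + γ ^ 2) + log ((3 / 2 + c) ^ 2 + γ ^ 2) = 2 * log ‖((3 / 2:ℂ)) ^ 2 - w ^ 2‖ := by
    have : ((3 / 2:ℂ)) ^ 2 - w ^ 2 = (3 / 2 - w) * (3 / 2 + w) := by ring
    rw [this, ← log_mul (by nlinarith [sq_nonneg (3 / 2 - c)]) (by nlinarith [sq_nonneg (3 / 2 + c)]),
      show (2:ℝ) * log ‖((3 / 2:ℂ) - w) * (3 / 2 + w)‖ = log (‖((3 / 2:ℂ) - w) * (3 / 2 + w)‖ ^ 2) by rw [log_pow]; norm_num,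
      norm_mul, mul_pow, ← Complex.normSq_eq_norm_sq, ← Complex.normSq_eq_norm_sq, Complex.normSq_apply, Complex.normSq_apply, hw]
    congr 1
    norm_num; ring
  have hB : γ ^ 2 - 9.5625 ≤ ‖z ^ 2 - w ^ 2‖ := by
    have := norm_sub_norm_le (w ^ 2) (z ^ 2)
    rw [norm_pow, norm_pow, norm_sub_rev, nz, nw] at this
    nlinarith [sq_nonneg c]
  have hBpos : 0 < γ ^ 2 - 9.5625 := by linarith
  have hBp : 0 < ‖z ^ 2 - w ^ 2‖ := by linarith
  have e1 : log ((u - c) ^ 2 + (t - γ) ^ 2) + log ((u + c) ^ 2 + (t + γ) ^ 2) = 2 * log ‖z ^ 2 - w ^ 2‖ := by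
    have h1 : z ^ 2 - w ^ 2 = (z - w) * (z + w) := by ring
    have h2 : (u - c) ^ 2 + (t - γ) ^ 2 = ‖z - w‖ ^ 2 := by
      rw [← Complex.normSq_eq_norm_sq, Complex.normSq_apply, hz, hw]; simp; ring
    have h3 : (u + c) ^ 2 + (t + γ) ^ 2 = ‖z + w‖ ^ 2 := by
      rw [← Complex.normSq_eq_norm_sq, Complex.normSq_apply, hz, hw]; simp; ring
    rw [h1, norm_mul] at hBp
    rw [h1, h2, h3, norm_mul, log_pow, log_pow, log_mul]
    · push_cast; ring
    · intro h; rw [h] at hBp; simp at hBp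
    · intro h; rw [h] at hBp; simp at hBp
  have hA : ‖((3 / 2:ℂ)) ^ 2 - w ^ 2‖ ≤ ‖z ^ 2 - w ^ 2‖ + 11.8125 := by
    have h1 : ((3 / 2:ℂ)) ^ 2 - w ^ 2 = (z ^ 2 - w ^ 2) + ((3 / 2:ℂ) ^ 2 - z ^ 2) := by ring
    rw [h1]
    refine (norm_add_le _ _).trans ?_
    have h2 := norm_sub_le ((3 / 2:ℂ) ^ 2) (z ^ 2)
    rw [norm_pow z, nz] at h2
    have h3 : ‖((3 / 2:ℂ)) ^ 2‖ = 9 / 4 := by norm_num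
    rw [h3] at h2
    linarith
  have hlog : log ‖((3 / 2:ℂ)) ^ 2 - w ^ 2‖ ≤ log (‖z ^ 2 - w ^ 2‖ + 11.8125) := by
    rcases eq_or_lt_of_le (norm_nonneg (((3 / 2:ℂ)) ^ 2 - w ^ 2)) with h | h
    · rw [← h, Real.log_zero]; apply Real.log_nonneg; linarith
    · exact log_le_log h hA
  have hl2 : log (‖z ^ 2 - w ^ 2‖ + 11.8125) - log ‖z ^ 2 - w ^ 2‖ ≤ 11.8125 / ‖z ^ 2 - w ^ 2‖ := by
    rw [← log_div (by linarith) hBp.ne']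
    have := Real.log_le_sub_one_of_pos (show 0 < (‖z ^ 2 - w ^ 2‖ + 11.8125) / ‖z ^ 2 - w ^ 2‖ by positivity)
    rw [add_div, div_self hBp.ne'] at this
    rw [add_div, div_self hBp.ne']
    linarith
  have hl3 : 11.8125 / ‖z ^ 2 - w ^ 2‖ ≤ 11.8125 / (γ ^ 2 - 9.5625) := by gcongr
  linarith

lemma xi_low {σ t:ℝ} (h1 : 3 / 4 ≤ σ) (h2 : σ ≤ 5 / 4) (ht : |t| ≤ 3) :
    xiG ⟨σ, t⟩ ≠ 0 ∧ log ‖xiG ⟨2, 0⟩‖ - log ‖xiG ⟨σ, t⟩‖ ≤ 0.75 := by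
  have hne : xiG ⟨σ, t⟩ ≠ 0 := by
    intro h
    have := low_zero h
    have ht2 : t ^ 2 ≤ 9 := by rw [← sq_abs]; nlinarith [abs_nonneg t]
    linarith
  refine ⟨hne, ?_⟩
  obtain ⟨Z, z1, z2, z3, z4⟩ := xiG_real
  have hn1 : xiG ⟨2, 0⟩ ≠ 0 := xiG_ne_zero (by norm_num)
  have hA := (z3 2 0 hn1).const_mul 7.5
  have := le_of_tendsto_of_tendsto' (z4 2 σ 0 t hn1 hne) hA ?_
  · have := zA2_le; linarith
  intro N
  rw [← Multiset.sum_map_mul_left]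
  apply Multiset.sum_map_le_sum_map
  intro ρ hρ
  have h0 := z1 N ρ hρ
  have hre := xiG_zero_re h0
  have hγ := low_zero (β := ρ.re) (γ := ρ.im) h0
  have hu : |σ - 1 / 2| ≤ 3 / 4 := by rw [abs_le]; constructor <;> linarith
  have hc : |ρ.re - 1 / 2| < 1 / 2 := by rw [abs_lt]; constructor <;> linarith
  have p1 := low_pair hu ht hc hγ
  have p2 := low_pair (γ := -ρ.im) hu ht hc (by rwa [neg_sq])
  have d1 := low_hdD (γ := 0 - ρ.im) hre.1 hre.2
  have d2 := low_hdD (γ := 0 + ρ.im) hre.1 hre.2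
  have hq : 11.8125 / (ρ.im ^ 2 - 9.5625) ≤ 7.5 * (3 / (4 + ρ.im ^ 2)) := by
    rw [← mul_div_assoc, div_le_div_iff₀ (by linarith) (by linarith)]
    linarith
  rw [neg_sq, sub_neg_eq_add, ← sub_eq_add_neg] at p2
  rw [zero_sub, neg_sq] at d1
  rw [zero_add] at d2
  rw [zero_sub, zero_add]
  have hL : ∀ y : ℝ, y ^ 2 = ρ.im ^ 2 → hdL (2 - 1 / 2) (ρ.re - 1 / 2) y = (log ((3 / 2 - (ρ.re - 1 / 2)) ^ 2 + ρ.im ^ 2) + log ((3 / 2 + (ρ.re - 1 / 2)) ^ 2 + ρ.im ^ 2)) / 2 := by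
    intro y hy
    unfold hdL; rw [hy, show (2:ℝ) - 1 / 2 = 3 / 2 by norm_num]
  rw [hL _ (neg_sq _), hL _ rfl]
  have l1 : ∀ y, hdL (σ - 1 / 2) (ρ.re - 1 / 2) y = (log ((σ - 1 / 2 - (ρ.re - 1 / 2)) ^ 2 + y ^ 2) + log ((σ - 1 / 2 + (ρ.re - 1 / 2)) ^ 2 + y ^ 2)) / 2 := fun y => rfl
  rw [l1, l1]
  linarith

lemma Gamma_le_one' {x:ℝ} (h1 : 1 ≤ x) (h2 : x ≤ 2) : Real.Gamma x ≤ 1 := by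
  have h := Real.convexOn_Gamma.2 (show (1:ℝ) ∈ Set.Ioi 0 by simp) (show (2:ℝ) ∈ Set.Ioi 0 by simp)
    (show 0 ≤ 2 - x by linarith) (show 0 ≤ x - 1 by linarith) (by ring)
  simp only [smul_eq_mul, Real.Gamma_one, Real.Gamma_two] at h
  have e : (2 - x) * 1 + (x - 1) * 2 = x := by ring
  rw [e] at h
  linarith

lemma zeta_low {σ t:ℝ} (h1 : 3 / 4 ≤ σ) (h2 : σ ≤ 5 / 4) (ht : |t| ≤ 3) (hs : (⟨σ, t⟩:ℂ) ≠ 1) :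
    riemannZeta ⟨σ, t⟩ ≠ 0 ∧ 1 ≤ exp 1 * (‖(⟨σ, t⟩:ℂ) - 1‖ * ‖riemannZeta ⟨σ, t⟩‖) := by
  obtain ⟨hne, hcmp⟩ := xi_low h1 h2 ht
  have hz : riemannZeta ⟨σ, t⟩ ≠ 0 := by
    intro h; exact hne (xiG_zero_zeta (s := ⟨σ, t⟩) (by simp only; linarith) h)
  refine ⟨hz, ?_⟩
  have e2 : (⟨2, 0⟩:ℂ) = 2 := by apply Complex.ext <;> simp
  have hz2 : riemannZeta ⟨2, 0⟩ ≠ 0 := riemannZeta_ne_zero_of_one_le_re (by norm_num)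
  have hn2 : (⟨2, 0⟩:ℂ) ≠ 1 := by rw [e2]; norm_num
  rw [xi_log (by norm_num) hn2 hz2, xi_log (by linarith) hs hz] at hcmp
  have g2 : log ‖Complex.Gamma ⟨2 / 2 + 1, 0 / 2⟩‖ = 0 := by
    have : (⟨2 / 2 + 1, 0 / 2⟩:ℂ) = ((2:ℝ):ℂ) := by apply Complex.ext <;> norm_num
    rw [this, Complex.Gamma_ofReal, Real.Gamma_two]; simp
  have z2 : log ‖riemannZeta ⟨2, 0⟩‖ = 2 * log π - log 2 - log 3 := by
    rw [e2, riemannZeta_two, norm_div, norm_pow, Complex.norm_real, Real.norm_of_nonneg pi_pos.le]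
    have : ‖(6:ℂ)‖ = 2 * 3 := by norm_num
    rw [this, log_div (by positivity) (by norm_num), log_mul (by norm_num) (by norm_num), log_pow]
    push_cast; ring
  rw [g2, z2] at hcmp
  have hG : log ‖Complex.Gamma ⟨σ / 2 + 1, t / 2⟩‖ ≤ 0 := by
    apply Real.log_nonpos (norm_nonneg _)
    refine (norm_Gamma_le (s := ⟨σ / 2 + 1, t / 2⟩) (by simp only; linarith)).trans ?_
    exact Gamma_le_one' (by simp only; linarith) (by simp only; linarith)
  have hn : log ((σ - 1) ^ 2 + t ^ 2) / 2 = log ‖(⟨σ, t⟩:ℂ) - 1‖ := by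
    have : (⟨σ, t⟩:ℂ) - 1 = ⟨σ - 1, t⟩ := by apply Complex.ext <;> simp
    rw [this, Complex.norm_def, Complex.normSq_mk, log_sqrt (by nlinarith [mul_self_nonneg (σ - 1), mul_self_nonneg t])]
    congr 2; ring
  rw [hn] at hcmp
  have hp : log (2 * π) = log 2 + log π := log_mul (by norm_num) Real.pi_ne_zero
  have hlp := log2pi_bd.1
  have h22 := log2_bd
  have h33 := log3_bd
  have hσ : 3 / 8 * log π ≤ σ / 2 * log π := by
    apply mul_le_mul_of_nonneg_right (by linarith); linarith
  norm_num at hcmp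
  have hs1 : 0 < ‖(⟨σ, t⟩:ℂ) - 1‖ := norm_pos_iff.2 (sub_ne_zero.2 hs)
  have hz1 : 0 < ‖riemannZeta ⟨σ, t⟩‖ := norm_pos_iff.2 hz
  have hfin : -1 ≤ log (‖(⟨σ, t⟩:ℂ) - 1‖ * ‖riemannZeta ⟨σ, t⟩‖) := by
    rw [log_mul hs1.ne' hz1.ne']; linarith
  have := (Real.le_log_iff_exp_le (by positivity)).1 hfin
  rw [Real.exp_neg, inv_le_iff_one_le_mul₀ (exp_pos _)] at this
  linarith

/-- local weight -/
def kloc (p e:ℕ) : ℤ := if e = 0 then 1 else if e = 1 then 0 else if p = 2 then 0 else 2 ^ (e - 2)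

lemma kloc_nonneg (p e:ℕ) : 0 ≤ kloc p e := by
  unfold kloc; split_ifs <;> positivity

/-- The nonnegative multiplicative function k. -/
def kA : ArithmeticFunction ℤ where
  toFun n := if n = 0 then 0 else n.factorization.prod kloc
  map_zero' := by simp

lemma kA_apply {n:ℕ} (h : n ≠ 0) : kA n = n.factorization.prod kloc := if_neg h

lemma kA_nonneg (n:ℕ) : 0 ≤ kA n := by
  by_cases h : n = 0
  · simp [h]
  rw [kA_apply h]
  exact Finset.prod_nonneg fun p _ => kloc_nonneg _ _

lemma kA_mult : kA.IsMultiplicative := by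
  rw [IsMultiplicative.iff_ne_zero]
  refine ⟨by rw [kA_apply one_ne_zero]; simp, ?_⟩
  intro m n hm hn h
  rw [kA_apply hm, kA_apply hn, kA_apply (mul_ne_zero hm hn), Nat.factorization_mul_of_coprime h]
  apply Finsupp.prod_add_index_of_disjoint
  exact Nat.Coprime.disjoint_primeFactors h

lemma kA_pp {p:ℕ} (hp : p.Prime) (e:ℕ) : kA (p ^ e) = kloc p e := by
  rw [kA_apply (pow_ne_zero _ hp.ne_zero), hp.factorization_pow, Finsupp.prod_single_index]
  simp [kloc]

/-- indicator of odd numbers -/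
def oA : ArithmeticFunction ℤ where
  toFun n := if Odd n then 1 else 0
  map_zero' := by simp

lemma oA_apply (n:ℕ) : oA n = if Odd n then 1 else 0 := rfl

lemma oA_mul (m n:ℕ) : oA (m * n) = oA m * oA n := by
  simp only [oA_apply, Nat.odd_mul]
  split_ifs <;> simp_all

lemma oA_mult : oA.IsMultiplicative :=
  ⟨by simp [oA_apply], fun {m n} _ => oA_mul m n⟩

/-- the function f -/
def fA : ArithmeticFunction ℤ where
  toFun n := if Odd n then (-2) ^ cardFactors n else 0
  map_zero' := by simp

/-- absolute value of f -/
def aA : ArithmeticFunction ℤ where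
  toFun n := if Odd n then 2 ^ cardFactors n else 0
  map_zero' := by simp

lemma fA_apply (n:ℕ) : fA n = if Odd n then (-2) ^ cardFactors n else 0 := rfl
lemma aA_apply (n:ℕ) : aA n = if Odd n then 2 ^ cardFactors n else 0 := rfl

lemma aA_mult : aA.IsMultiplicative := by
  rw [IsMultiplicative.iff_ne_zero]
  refine ⟨by simp [aA_apply], ?_⟩
  intro m n hm hn _
  simp only [aA_apply, Nat.odd_mul, cardFactors_mul hm hn, pow_add]
  split_ifs <;> simp_all

lemma fA_abs (n:ℕ) : |fA n| = aA n := by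
  simp only [fA_apply, aA_apply]; split_ifs <;> simp [abs_pow]

lemma fA_eq (n:ℕ) : fA n = liouville n * aA n := by
  by_cases h : n = 0
  · simp [h]
  simp only [fA_apply, aA_apply, liouville_apply h]
  split_ifs
  · rw [← mul_pow]; norm_num
  · simp

lemma conv_pp (F G : ArithmeticFunction ℤ) {p:ℕ} (hp : p.Prime) (e:ℕ) :
    (F * G) (p ^ e) = ∑ j ∈ range (e + 1), F (p ^ j) * G (p ^ (e - j)) := by
  rw [ArithmeticFunction.mul_apply, Nat.sum_divisorsAntidiagonal (fun a b => F a * G b),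
    Nat.sum_divisors_prime_pow hp]
  refine sum_congr rfl fun j hj => ?_
  rw [Nat.pow_div (by simp at hj; omega) hp.pos]

lemma oA_two (e:ℕ) : oA (2 ^ e) = if e = 0 then 1 else 0 := by
  by_cases h : e = 0
  · simp [h, oA_apply]
  · simp [oA_apply, h, Nat.even_pow]

lemma oA_odd {p:ℕ} (hp : p.Prime) (h2 : p ≠ 2) (e:ℕ) : oA (p ^ e) = 1 := by
  have := (hp.odd_of_ne_two h2).pow (n := e)
  simp [oA_apply, this]

/-- g = k * 1o on prime powers -/
lemma ko_pp {p:ℕ} (hp : p.Prime) (h2 : p ≠ 2) (e:ℕ) :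
    (kA * oA) (p ^ e) = if e = 0 then 1 else 2 ^ (e - 1) := by
  rw [conv_pp _ _ hp]
  simp only [oA_odd hp h2, mul_one, kA_pp hp]
  induction e with
  | zero => simp [kloc]
  | succ n ih =>
    rw [sum_range_succ, ih]
    rcases n with _ | n
    · simp [kloc]
    · simp [kloc, h2, pow_succ]; ring

lemma koo_pp {p:ℕ} (hp : p.Prime) (h2 : p ≠ 2) (e:ℕ) :
    (kA * oA * oA) (p ^ e) = 2 ^ e := by
  rw [conv_pp _ _ hp]
  simp only [oA_odd hp h2, mul_one, ko_pp hp h2]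
  induction e with
  | zero => simp
  | succ n ih =>
    rw [sum_range_succ, ih]
    simp [pow_succ]; ring

lemma ko_two (e:ℕ) : (kA * oA) (2 ^ e) = if e = 0 then 1 else 0 := by
  rw [conv_pp _ _ Nat.prime_two, sum_eq_single 0]
  · simp [oA_two, kA_mult.map_one]
  · intro b hb h
    rw [kA_pp Nat.prime_two]
    simp [kloc, h]
  · simp

lemma koo_two (e:ℕ) : (kA * oA * oA) (2 ^ e) = if e = 0 then 1 else 0 := by
  rw [conv_pp _ _ Nat.prime_two, sum_eq_single 0]
  · simp only [ko_two, oA_two]; simp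
  · intro b hb h
    rw [ko_two]
    simp [h]
  · simp

lemma aA_eq : aA = kA * oA * oA := by
  rw [IsMultiplicative.eq_iff_eq_on_prime_powers _ aA_mult _ ((kA_mult.mul oA_mult).mul oA_mult)]
  intro p i hp
  by_cases h2 : p = 2
  · subst h2
    rw [koo_two, aA_apply]
    by_cases h : i = 0
    · simp [h]
    · simp [h, Nat.even_pow]
  · rw [koo_pp hp h2, aA_apply, if_pos ((hp.odd_of_ne_two h2).pow), cardFactors_apply_prime_pow hp]

lemma lio_mul (F G : ArithmeticFunction ℤ) :
    liouville.pmul (F * G) = liouville.pmul F * liouville.pmul G := by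
  ext n
  simp only [pmul_apply, ArithmeticFunction.mul_apply, mul_sum]
  refine sum_congr rfl fun x hx => ?_
  rw [Nat.mem_divisorsAntidiagonal] at hx
  rw [← hx.1, liouville_apply_mul]; ring

lemma fA_conv : fA = liouville.pmul kA * liouville.pmul oA * liouville.pmul oA := by
  rw [← lio_mul, ← lio_mul, ← aA_eq]
  ext n
  rw [fA_eq, pmul_apply]

/-- Euler factor excess -/
noncomputable def Ek (s:ℝ) (p:ℕ) : ℝ :=
  if p = 2 then 0 else ((p:ℝ) ^ (-s)) ^ 2 / (1 - 2 * (p:ℝ) ^ (-s))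

lemma pw_le {p a:ℕ} {s t c:ℝ} (ha : 1 ≤ a) (hap : a ≤ p) (hs : t ≤ s) (ht : 0 ≤ t)
    (hc : (a:ℝ) ^ (-t) ≤ c) : (p:ℝ) ^ (-s) ≤ c := by
  refine le_trans ?_ hc
  have ha' : (1:ℝ) ≤ a := by exact_mod_cast ha
  have hap' : (a:ℝ) ≤ p := by exact_mod_cast hap
  calc (p:ℝ) ^ (-s) ≤ (p:ℝ) ^ (-t) := Real.rpow_le_rpow_of_exponent_le (by linarith) (by linarith)
    _ ≤ _ := Real.rpow_le_rpow_of_nonpos (by linarith) hap' (by linarith)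

lemma pw34 {a:ℕ} {c:ℝ} (ha : 1 ≤ a) (hc : 0 ≤ c) (h : 1 ≤ (a:ℝ) ^ 3 * c ^ 4) :
    (a:ℝ) ^ (-(3/4:ℝ)) ≤ c := by
  have ha' : (0:ℝ) < a := by exact_mod_cast ha
  have h0 : (0:ℝ) < (a:ℝ) ^ (-(3/4:ℝ)) := by positivity
  refine le_of_pow_le_pow_left₀ (n := 4) (by norm_num) hc ?_
  rw [← rpow_natCast, ← Real.rpow_mul ha'.le]
  norm_num
  rw [inv_le_iff_one_le_mul₀ (by positivity)]
  linarith

lemma pw3 {p:ℕ} {s:ℝ} (hp : 3 ≤ p) (hs : 3/4 ≤ s) : (p:ℝ) ^ (-s) ≤ 0.4387 :=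
  pw_le (by norm_num) hp hs (by norm_num) (pw34 (by norm_num) (by norm_num) (by norm_num))

lemma Ek_hasSum {p:ℕ} (hp : p.Prime) {s:ℝ} (hs : 3/4 ≤ s) :
    HasSum (fun e : ℕ => (kA (p ^ e):ℝ) * ((p ^ e:ℕ):ℝ) ^ (-s)) (1 + Ek s p) := by
  have hp0 : (0:ℝ) ≤ p := by positivity
  have hX : ∀ e : ℕ, ((p ^ e:ℕ):ℝ) ^ (-s) = ((p:ℝ) ^ (-s)) ^ e := by
    intro e
    push_cast
    rw [← rpow_natCast, ← rpow_natCast, ← Real.rpow_mul hp0, ← Real.rpow_mul hp0, mul_comm]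
  simp only [hX, kA_pp hp]
  rw [← hasSum_nat_add_iff' 2]
  simp only [Finset.sum_range_succ, Finset.sum_range_zero]
  by_cases h2 : p = 2
  · subst h2
    simp only [kloc, Ek]
    simp [hasSum_zero]
  · have h3 : 3 ≤ p := by
      have := hp.two_le
      omega
    have hb := pw3 h3 hs
    have hx0 : 0 ≤ (p:ℝ) ^ (-s) := by positivity
    simp only [kloc, Ek, h2]
    have := (hasSum_geometric_of_lt_one (r := 2 * (p:ℝ) ^ (-s)) (by positivity) (by linarith)).mul_left
      (((p:ℝ) ^ (-s)) ^ 2)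
    have e1 : ∀ e : ℕ, ((if e + 2 = 0 then 1 else if e + 2 = 1 then 0 else if False then 0
        else 2 ^ (e + 2 - 2):ℤ):ℝ) * ((p:ℝ) ^ (-s)) ^ (e + 2)
        = ((p:ℝ) ^ (-s)) ^ 2 * (2 * (p:ℝ) ^ (-s)) ^ e := by
      intro e
      simp
      ring
    simp only [e1]
    have e2 : ((p:ℝ) ^ (-s)) ^ 2 * (1 - 2 * (p:ℝ) ^ (-s))⁻¹ = ((p:ℝ) ^ (-s)) ^ 2 / (1 - 2 * (p:ℝ) ^ (-s)) := by
      rw [div_eq_mul_inv]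
    rw [e2] at this
    simpa using this

lemma Ek_nonneg {p:ℕ} (hp : p.Prime) {s:ℝ} (hs : 3/4 ≤ s) : 0 ≤ Ek s p := by
  unfold Ek
  split_ifs with h
  · rfl
  · have h3 : 3 ≤ p := by
      have := hp.two_le
      omega
    have hb := pw3 h3 hs
    apply div_nonneg (by positivity); linarith

lemma kterm_nonneg (s:ℝ) (n:ℕ) : 0 ≤ (kA n:ℝ) * (n:ℝ) ^ (-s) := by
  have := kA_nonneg n
  positivity

lemma k_part {s:ℝ} (hs : 3/4 ≤ s) (N:ℕ) :
    ∑ d ∈ range N, (kA d:ℝ) * (d:ℝ) ^ (-s) ≤ ∏ p ∈ N.primesBelow, (1 + Ek s p) := by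
  have key := EulerProduct.summable_and_hasSum_smoothNumbers_prod_primesBelow_tsum
    (f := fun d : ℕ => (kA d:ℝ) * (d:ℝ) ^ (-s)) (by simp [kA_mult.map_one])
    (by
      intro m n h
      rw [kA_mult.map_mul_of_coprime h]
      push_cast
      rw [Real.mul_rpow (by positivity) (by positivity)]; ring)
    (fun {p} hp => by
      refine (Ek_hasSum hp hs).summable.congr fun e => ?_
      rw [Real.norm_of_nonneg (kterm_nonneg s (p^e))]) N
  have h2 : ∏ p ∈ N.primesBelow, ∑' n : ℕ, ((kA (p ^ n):ℝ) * ((p ^ n:ℕ):ℝ) ^ (-s))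
      = ∏ p ∈ N.primesBelow, (1 + Ek s p) := by
    refine Finset.prod_congr rfl fun p hp => ?_
    exact (Ek_hasSum (Nat.prime_of_mem_primesBelow hp) hs).tsum_eq
  rw [← h2, ← key.2.tsum_eq]
  have h3 : ∑ d ∈ range N, (kA d:ℝ) * (d:ℝ) ^ (-s)
      = ∑ d ∈ (range N).filter (· ∈ N.smoothNumbers), (kA d:ℝ) * (d:ℝ) ^ (-s) := by
    rw [Finset.sum_filter_of_ne]
    intro d hd h
    have hd0 : 0 < d := by
      rcases Nat.eq_zero_or_pos d with h0 | h0
      · exfalso; apply h; simp [h0]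
      · exact h0
    exact Nat.mem_smoothNumbers_of_lt hd0 (by simpa using hd)
  rw [h3, ← Finset.sum_subtype_eq_sum_filter]
  exact key.2.summable.sum_le_tsum _ fun d _ => kterm_nonneg s d

lemma prod_tel {E h : ℕ → ℝ} {C:ℝ} (hE : ∀ p, p.Prime → 0 ≤ E p)
    (h0 : ∀ m, 5 ≤ m → 0 ≤ h m) (han : ∀ m, 5 ≤ m → h (m + 1) ≤ h m)
    (hst : ∀ m, 5 ≤ m → E (2 * m + 1) ≤ h m - h (m + 1))
    (hC0 : 0 ≤ C)
    (hC : ∏ p ∈ (11:ℕ).primesBelow, (1 + E p) ≤ C) (N:ℕ) :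
    ∏ p ∈ N.primesBelow, (1 + E p) ≤ C * exp (h 5) := by
  have key : ∀ m, 5 ≤ m → ∏ p ∈ (2 * m + 1).primesBelow, (1 + E p) ≤ C * exp (h 5 - h m) := by
    intro m hm
    induction m, hm using Nat.le_induction with
    | base => simpa using hC
    | succ m hm ih =>
      have e1 : (2 * (m + 1) + 1).primesBelow = (2 * m + 2).primesBelow := by
        rw [show 2 * (m+1) + 1 = (2 * m + 2) + 1 by ring, Nat.primesBelow_succ, if_neg]
        intro hp
        have := (hp.even_iff).1 ⟨m + 1, by ring⟩
        omega
      rw [e1, Nat.primesBelow_succ]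
      have hpos : 0 ≤ C * exp (h 5 - h m) := by positivity
      have hs : h m - h (m+1) + (h 5 - h m) = h 5 - h (m+1) := by ring
      split_ifs with hp
      · rw [Finset.prod_insert (by simp [Nat.primesBelow])]
        have h1 : 1 + E (2 * m + 1) ≤ exp (h m - h (m+1)) := by
          linarith [Real.add_one_le_exp (h m - h (m+1)), hst m hm]
        calc _ ≤ exp (h m - h (m+1)) * (C * exp (h 5 - h m)) := by
              apply mul_le_mul h1 ih _ (by positivity)
              exact Finset.prod_nonneg fun p hp => by
                linarith [hE p (Nat.prime_of_mem_primesBelow hp)]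
          _ = C * exp (h 5 - h (m+1)) := by rw [← hs, exp_add]; ring
      · refine ih.trans ?_
        have := han m hm
        gcongr
  have h1 : N.primesBelow ⊆ (2 * (N + 5) + 1).primesBelow := by
    intro p hp
    rw [Nat.mem_primesBelow] at hp ⊢
    exact ⟨by omega, hp.2⟩
  calc _ ≤ ∏ p ∈ (2 * (N + 5) + 1).primesBelow, (1 + E p) := by
        have g1 : ∀ p ∈ (2 * (N + 5) + 1).primesBelow, 1 ≤ 1 + E p := fun p hp => by
          linarith [hE p (Nat.prime_of_mem_primesBelow hp)]
        rw [← Finset.prod_sdiff h1]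
        apply le_mul_of_one_le_left
        · exact Finset.prod_nonneg fun p hp => by linarith [g1 p (h1 hp)]
        · exact Finset.one_le_prod fun p hp => g1 p (Finset.mem_sdiff.1 hp).1
    _ ≤ _ := key (N + 5) (by omega)
    _ ≤ _ := by
        have := h0 (N + 5) (by omega)
        gcongr
        linarith

lemma primesBelow11 : (11:ℕ).primesBelow = {2, 3, 5, 7} := by decide

lemma Ek_one {m:ℕ} (hm : 1 ≤ m) : Ek 1 (2 * m + 1) = 1 / (2 * (2 * (m:ℝ) - 1)) - 1 / (2 * (2 * ((m + 1:ℕ):ℝ) - 1)) := by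
  have h1 : (1:ℝ) ≤ m := by exact_mod_cast hm
  have h2 : (2 * (m:ℝ) - 1) ≠ 0 := by linarith
  have h3 : (2 * (m:ℝ) + 1) ≠ 0 := by linarith
  unfold Ek
  rw [if_neg (by omega), Real.rpow_neg_one]
  push_cast
  have h5 : 1 - 2 * (2 * (m:ℝ) + 1)⁻¹ = (2 * (m:ℝ) - 1) / (2 * (m:ℝ) + 1) := by field_simp; ring
  have h6 : (2 * ((m:ℝ) + 1) - 1) = 2 * (m:ℝ) + 1 := by ring
  rw [h5, h6]
  field_simp
  ring

lemma k_one_part (N:ℕ) : ∑ d ∈ range N, (kA d:ℝ) * (d:ℝ) ^ (-(1:ℝ)) ≤ 1.57 := by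
  refine (k_part (by norm_num) N).trans ?_
  have hC : ∏ p ∈ (11:ℕ).primesBelow, (1 + Ek 1 p) ≤ 1.463 := by
    rw [primesBelow11]
    simp [Ek]
    norm_num
  refine (prod_tel (E := Ek 1) (h := fun m : ℕ => 1 / (2 * (2 * (m:ℝ) - 1))) (C := 1.463)
    (fun p hp => Ek_nonneg hp (by norm_num)) ?_ ?_ ?_ (by norm_num) hC N).trans ?_
  · intro m hm
    have h1 : (5:ℝ) ≤ m := by exact_mod_cast hm
    apply div_nonneg (by norm_num); linarith
  · intro m hm
    have h1 : (5:ℝ) ≤ m := by exact_mod_cast hm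
    apply one_div_le_one_div_of_le
    · linarith
    · push_cast; linarith
  · intro m hm
    exact (Ek_one (by omega)).le
  · have : exp (1 / (2 * (2 * ((5:ℕ):ℝ) - 1))) ≤ 1 / (1 - 1 / 18) := by
      rw [le_div_iff₀ (by norm_num)]
      have := Real.one_sub_le_exp_neg (1/18)
      have h2 : exp (1 / (2 * (2 * ((5:ℕ):ℝ) - 1))) = exp (1/18) := by norm_num
      rw [h2]
      have h3 : exp (1/18) * exp (-(1/18)) = 1 := by rw [← exp_add]; norm_num
      nlinarith [exp_pos (1/18)]
    calc _ ≤ (1.463:ℝ) * (1 / (1 - 1 / 18)) := by gcongr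
      _ ≤ _ := by norm_num

lemma tel32 {x:ℝ} (hx : 1 < x) : x ^ (-(3/2:ℝ)) ≤ 1 / √(x - 1) - 1 / √(x + 1) := by
  have hx0 : 0 < x := by linarith
  have e : x ^ (-(3/2:ℝ)) = 1 / (x * √x) := by
    rw [Real.sqrt_eq_rpow, rpow_neg hx0.le, show (3/2:ℝ) = 1 + 1/2 by norm_num,
      Real.rpow_add hx0, Real.rpow_one, one_div (x * _)]
  rw [e]
  have ha : 0 < √(x - 1) := Real.sqrt_pos.2 (by linarith)
  have hb : 0 < √(x + 1) := Real.sqrt_pos.2 (by linarith)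
  have hc : 0 < √x := Real.sqrt_pos.2 (by linarith)
  have ha2 : √(x - 1) ^ 2 = x - 1 := Real.sq_sqrt (by linarith)
  have hb2 : √(x + 1) ^ 2 = x + 1 := Real.sq_sqrt (by linarith)
  have hc2 : √x ^ 2 = x := Real.sq_sqrt (by linarith)
  generalize √(x - 1) = a at *
  generalize √(x + 1) = b at *
  generalize √x = c at *
  have e2 : 1 / a - 1 / b = 2 / (a * b * (a + b)) := by
    field_simp
    nlinarith
  rw [e2, div_le_div_iff₀ (by positivity) (by positivity)]
  have h1 : a * b ≤ x := by nlinarith [sq_nonneg (a - b)]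
  have h2 : a + b ≤ 2 * c := by
    apply abs_le_of_sq_le_sq' _ (by positivity) |>.2
    nlinarith [sq_nonneg (a - b)]
  nlinarith [mul_le_mul h1 h2 (by positivity) hx0.le]

lemma Ek_34 {m:ℕ} (hm : 5 ≤ m) : Ek (3/4) (2 * m + 1) ≤ 1 / (0.6688 * √(2 * (m:ℝ))) - 1 / (0.6688 * √(2 * ((m + 1:ℕ):ℝ))) := by
  have h1 : (5:ℝ) ≤ m := by exact_mod_cast hm
  have hX : ((2 * m + 1:ℕ):ℝ) ^ (-(3/4:ℝ)) ≤ 0.1656 :=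
    pw_le (a := 11) (by norm_num) (by omega) le_rfl (by norm_num) (pw34 (by norm_num) (by norm_num) (by norm_num))
  unfold Ek
  rw [if_neg (by omega)]
  have e1 : (((2 * m + 1:ℕ):ℝ) ^ (-(3/4:ℝ))) ^ 2 = (2 * (m:ℝ) + 1) ^ (-(3/2:ℝ)) := by
    push_cast
    rw [← rpow_natCast, ← Real.rpow_mul (by positivity)]
    norm_num
  have h3 := tel32 (x := 2 * (m:ℝ) + 1) (by linarith)
  rw [e1]
  have h4 : (2 * (m:ℝ) + 1) - 1 = 2 * m := by ring
  have h5 : (2 * (m:ℝ) + 1) + 1 = 2 * ((m + 1:ℕ):ℝ) := by push_cast; ring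
  rw [h4, h5] at h3
  calc _ ≤ (2 * (m:ℝ) + 1) ^ (-(3/2:ℝ)) / 0.6688 := by
        apply div_le_div_of_nonneg_left (by positivity) (by norm_num)
        linarith
    _ ≤ (1 / √(2 * (m:ℝ)) - 1 / √(2 * ((m + 1:ℕ):ℝ))) / 0.6688 := by gcongr
    _ = _ := by
      rw [sub_div, div_div, div_div, mul_comm, mul_comm (√(2 * ((m + 1:ℕ):ℝ)))]

lemma Ek_le {p:ℕ} (hp : p ≠ 2) {c C:ℝ} (h : (p:ℝ) ^ (-(3/4:ℝ)) ≤ c) (hc : c < 1/2)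
    (hC : c ^ 2 / (1 - 2 * c) ≤ C) : Ek (3/4) p ≤ C := by
  unfold Ek
  rw [if_neg hp]
  refine le_trans ?_ hC
  apply div_le_div₀ (by positivity) _ (by linarith) (by linarith)
  gcongr

lemma k_34_part (N:ℕ) : ∑ d ∈ range N, (kA d:ℝ) * (d:ℝ) ^ (-(3/4:ℝ)) ≤ 5.7 := by
  refine (k_part (by norm_num) N).trans ?_
  have hC : ∏ p ∈ (11:ℕ).primesBelow, (1 + Ek (3/4) p) ≤ 3.47 := by
    rw [primesBelow11]
    have h3 : Ek (3/4) 3 ≤ 1.5700 := Ek_le (c := 0.4387) (by norm_num) (pw34 (by norm_num) (by norm_num) (by norm_num)) (by norm_num) (by norm_num)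
    have h5 : Ek (3/4) 5 ≤ 0.2229 := Ek_le (c := 0.2991) (by norm_num) (pw34 (by norm_num) (by norm_num) (by norm_num)) (by norm_num) (by norm_num)
    have h7 : Ek (3/4) 7 ≤ 0.1011 := Ek_le (c := 0.2325) (by norm_num) (pw34 (by norm_num) (by norm_num) (by norm_num)) (by norm_num) (by norm_num)
    have p3 := Ek_nonneg (p := 3) (s := 3/4) (by norm_num) (by norm_num)
    have p5 := Ek_nonneg (p := 5) (s := 3/4) (by norm_num) (by norm_num)
    have p7 := Ek_nonneg (p := 7) (s := 3/4) (by norm_num) (by norm_num)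
    have e2 : Ek (3/4) 2 = 0 := by simp [Ek]
    rw [Finset.prod_insert (by decide), Finset.prod_insert (by decide), Finset.prod_insert (by decide), Finset.prod_singleton, e2, add_zero, one_mul]
    calc (1 + Ek (3/4) 3) * ((1 + Ek (3/4) 5) * (1 + Ek (3/4) 7)) ≤ (1 + 1.5700) * ((1 + 0.2229) * (1 + 0.1011)) := by gcongr
      _ ≤ _ := by norm_num
  refine (prod_tel (E := Ek (3/4)) (h := fun m : ℕ => 1 / (0.6688 * √(2 * (m:ℝ)))) (C := 3.47)
    (fun p hp => Ek_nonneg hp (by norm_num)) ?_ ?_ ?_ (by norm_num) hC N).trans ?_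
  · intro m hm
    positivity
  · intro m hm
    have h1 : (5:ℝ) ≤ m := by exact_mod_cast hm
    apply one_div_le_one_div_of_le
    · have : 0 < √(2 * (m:ℝ)) := Real.sqrt_pos.2 (by linarith)
      positivity
    · gcongr
      omega
  · intro m hm
    exact Ek_34 hm
  · have h1 : (3.162:ℝ) ≤ √(2 * ((5:ℕ):ℝ)) := by
      apply Real.le_sqrt_of_sq_le; norm_num
    have h2 : 1 / (0.6688 * √(2 * ((5:ℕ):ℝ))) ≤ 0.4729 := by
      rw [div_le_iff₀ (by positivity)]
      nlinarith
    have h3 : exp (0.4729/8) ≤ 1 / (1 - 0.4729/8) := by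
      rw [le_div_iff₀ (by norm_num)]
      have := Real.one_sub_le_exp_neg (0.4729/8)
      have h3 : exp (0.4729/8) * exp (-(0.4729/8)) = 1 := by rw [← exp_add]; norm_num
      nlinarith [exp_pos (0.4729/8)]
    have h4 : exp 0.4729 = exp (0.4729/8) ^ 8 := by
      rw [← Real.exp_nat_mul]; norm_num
    calc _ ≤ (3.47:ℝ) * exp 0.4729 := by gcongr
      _ ≤ 3.47 * (1 / (1 - 0.4729/8)) ^ 8 := by rw [h4]; gcongr
      _ ≤ _ := by norm_num

lemma k_34_summable : Summable fun d : ℕ => (kA d:ℝ) * (d:ℝ) ^ (-(3/4:ℝ)) :=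
  summable_of_sum_range_le (fun n => kterm_nonneg _ n) k_34_part
lemma k_34_tsum : ∑' d : ℕ, (kA d:ℝ) * (d:ℝ) ^ (-(3/4:ℝ)) ≤ 5.7 :=
  Real.tsum_le_of_sum_range_le (fun n => kterm_nonneg _ n) k_34_part

/-- Twisted k. -/
noncomputable def hC (n:ℕ) : ℂ := ((liouville.pmul kA n:ℤ):ℂ)
/-- Twisted odd indicator. -/
noncomputable def lC (n:ℕ) : ℂ := ((liouville.pmul oA n:ℤ):ℂ)
/-- f as complex function. -/
noncomputable def fC (n:ℕ) : ℂ := ((fA n:ℤ):ℂ)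
/-- Dirichlet series of twisted k. -/
noncomputable def HL (s:ℂ) : ℂ := LSeries hC s

lemma lio_norm (n:ℕ) : ‖((liouville n:ℤ):ℂ)‖ ≤ 1 := by
  by_cases h : n = 0
  · simp [h]
  · rw [liouville_apply h]; simp

lemma hC_norm (n:ℕ) : ‖hC n‖ ≤ (kA n:ℝ) := by
  unfold hC
  rw [pmul_apply]
  push_cast
  rw [norm_mul]
  have h1 := lio_norm n
  have h2 : ‖((kA n:ℤ):ℂ)‖ = (kA n:ℝ) := by
    rw [Complex.norm_intCast, abs_of_nonneg]; exact_mod_cast kA_nonneg n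
  rw [h2]
  have : (0:ℝ) ≤ kA n := by exact_mod_cast kA_nonneg n
  nlinarith [norm_nonneg ((liouville n:ℤ):ℂ)]

lemma hC_term {s:ℂ} (hs : 3/4 ≤ s.re) (n:ℕ) :
    ‖LSeries.term hC s n‖ ≤ (kA n:ℝ) * (n:ℝ) ^ (-(3/4:ℝ)) := by
  by_cases h : n = 0
  · simp [h]
  have hn : (1:ℝ) ≤ n := by exact_mod_cast Nat.one_le_iff_ne_zero.2 h
  rw [LSeries.norm_term_eq, if_neg h, div_eq_mul_inv, ← rpow_neg (by linarith)]
  have h1 := hC_norm n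
  have h0 : (0:ℝ) ≤ kA n := by exact_mod_cast kA_nonneg n
  gcongr

lemma hC_summable {s:ℂ} (hs : 3/4 ≤ s.re) : LSeriesSummable hC s :=
  Summable.of_norm_bounded k_34_summable (hC_term hs)

lemma HL_norm {s:ℂ} (hs : 3/4 ≤ s.re) : ‖HL s‖ ≤ 5.7 :=
  (tsum_of_norm_bounded k_34_summable.hasSum (hC_term hs)).trans k_34_tsum

lemma HL_diff {s:ℂ} (hs : 3/4 < s.re) : DifferentiableAt ℂ HL s := by
  have h := (hC_summable (s := (3/4:ℝ)) (by simp)).abscissaOfAbsConv_le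
  have h2 : LSeries.abscissaOfAbsConv hC < s.re := by
    refine lt_of_le_of_lt h ?_
    simp only [Complex.ofReal_re]
    exact_mod_cast hs
  exact (LSeries_hasDerivAt h2).differentiableAt

lemma lC_mul (m n:ℕ) : lC (m * n) = lC m * lC n := by
  unfold lC
  simp only [pmul_apply, liouville_apply_mul, oA_mul]
  push_cast; ring

lemma lC_norm (n:ℕ) : ‖lC n‖ ≤ 1 := by
  unfold lC
  rw [pmul_apply]
  push_cast
  rw [norm_mul]
  have h1 := lio_norm n
  have h2 : ‖((oA n:ℤ):ℂ)‖ ≤ 1 := by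
    rw [oA_apply]; split_ifs <;> simp
  exact mul_le_one₀ h1 (norm_nonneg _) h2

lemma lC_summable {s:ℂ} (hs : 1 < s.re) : LSeriesSummable lC s :=
  LSeriesSummable_of_bounded_of_one_lt_re (fun n _ => lC_norm n) hs

/-- multiplicative hom for L-series of lC -/
noncomputable def lHom (s:ℂ) (_hs : s ≠ 0) : ℕ →*₀ ℂ where
  toFun n := lC n * (n:ℂ) ^ (-s)
  map_zero' := by simp [lC]
  map_one' := by simp [lC, pmul_apply, oA_apply, liouville_apply_one]
  map_mul' m n := by
    rw [lC_mul, Nat.cast_mul, Complex.natCast_mul_natCast_cpow]; ring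

lemma lHom_term {s:ℂ} (hs : s ≠ 0) (n:ℕ) : lHom s hs n = LSeries.term lC s n := by
  by_cases h : n = 0
  · simp [h]
  rw [LSeries.term_of_ne_zero h]
  simp only [lHom, MonoidWithZeroHom.coe_mk, ZeroHom.coe_mk]
  rw [Complex.cpow_neg, div_eq_mul_inv]

lemma lL_prod {s:ℂ} (hs : 1 < s.re) :
    HasProd (fun p : Nat.Primes => (1 - lC p * (p:ℂ) ^ (-s))⁻¹) (LSeries lC s) := by
  have h0 : s ≠ 0 := by rintro rfl; simp at hs; linarith
  have h1 : (fun n => lHom s h0 n) = LSeries.term lC s := funext (lHom_term h0)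
  have hsum : Summable fun n => ‖lHom s h0 n‖ := by
    have := (lC_summable hs).norm
    rwa [← h1] at this
  have := EulerProduct.eulerProduct_completely_multiplicative_hasProd hsum
  rw [h1] at this
  exact this

lemma lC_prime (p : Nat.Primes) : lC p = if (p:ℕ) = 2 then 0 else -1 := by
  unfold lC
  rw [pmul_apply, liouville_apply p.2.ne_zero, cardFactors_apply_prime p.2]
  split_ifs with h
  · rw [h]; simp [oA_apply]
  · have := oA_odd p.2 h 1
    rw [pow_one] at this
    rw [this]; simp

lemma lL_zeta {s:ℂ} (hs : 1 < s.re) :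
    LSeries lC s * riemannZeta s = (1 + 2 ^ (-s)) * riemannZeta (2 * s) := by
  have h2 : 1 < (2 * s).re := by simp; linarith
  have P1 := (lL_prod hs).mul (riemannZeta_eulerProduct_hasProd hs)
  have P2 := (hasProd_ite_eq (⟨2, Nat.prime_two⟩ : Nat.Primes) (1 + (2:ℂ) ^ (-s))).mul
    (riemannZeta_eulerProduct_hasProd h2)
  refine P1.unique ?_
  refine Eq.mp ?_ P2
  congr 1
  funext p
  symm
  have hpne : ((p:ℕ):ℂ) ≠ 0 := by exact_mod_cast p.2.ne_zero
  have e : ((p:ℕ):ℂ) ^ (-(2 * s)) = (((p:ℕ):ℂ) ^ (-s)) ^ 2 := by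
    rw [← Complex.cpow_nat_mul]; congr 1; push_cast; ring
  rw [e]
  have hlt : ‖((p:ℕ):ℂ) ^ (-s)‖ < 1 := by
    rw [Complex.norm_natCast_cpow_of_pos p.2.pos]
    apply Real.rpow_lt_one_of_one_lt_of_neg
    · exact_mod_cast p.2.one_lt
    · simp; linarith
  have hX1 : 1 - ((p:ℕ):ℂ) ^ (-s) ≠ 0 := by
    intro h
    have : ((p:ℕ):ℂ) ^ (-s) = 1 := by linear_combination -h
    rw [this] at hlt; simp at hlt
  have hX2 : 1 + ((p:ℕ):ℂ) ^ (-s) ≠ 0 := by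
    intro h
    have : ((p:ℕ):ℂ) ^ (-s) = -1 := by linear_combination h
    rw [this] at hlt; simp at hlt
  have hX3 : 1 - (((p:ℕ):ℂ) ^ (-s)) ^ 2 = (1 - ((p:ℕ):ℂ) ^ (-s)) * (1 + ((p:ℕ):ℂ) ^ (-s)) := by ring
  have hlp := lC_prime p
  rw [show lC p.1 = _ from hlp, hX3]
  by_cases hp : (p:ℕ) = 2
  · have hp' : p = ⟨2, Nat.prime_two⟩ := Subtype.ext hp
    rw [if_pos hp, if_pos hp', zero_mul, sub_zero, inv_one, one_mul]
    rw [hp] at hX2 hX1 ⊢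
    push_cast at *
    field_simp
  · have hp' : p ≠ ⟨2, Nat.prime_two⟩ := fun h => hp (by rw [h])
    rw [if_neg hp, if_neg hp', one_mul, neg_one_mul, sub_neg_eq_add, mul_inv, mul_comm]

lemma cast_conv (F G : ArithmeticFunction ℤ) (s:ℂ)
    (hF : LSeriesSummable (fun n => ((F n:ℤ):ℂ)) s) (hG : LSeriesSummable (fun n => ((G n:ℤ):ℂ)) s) :
    LSeriesSummable (fun n => (((F * G) n:ℤ):ℂ)) s ∧
    LSeries (fun n => (((F * G) n:ℤ):ℂ)) s
      = LSeries (fun n => ((F n:ℤ):ℂ)) s * LSeries (fun n => ((G n:ℤ):ℂ)) s := by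
  have e : ∀ n, (((F * G) n:ℤ):ℂ) = ((F : ArithmeticFunction ℂ) * (G : ArithmeticFunction ℂ)) n := by
    intro n; rw [← intCoe_mul, intCoe_apply]
  simp only [e]
  exact ⟨LSeriesSummable_mul (f := (F : ArithmeticFunction ℂ)) (g := (G : ArithmeticFunction ℂ)) hF hG,
    LSeries_mul' (f := (F : ArithmeticFunction ℂ)) (g := (G : ArithmeticFunction ℂ)) hF hG⟩

lemma fL {s:ℂ} (hs : 1 < s.re) : LSeriesSummable fC s ∧
    LSeries fC s = HL s * LSeries lC s * LSeries lC s := by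
  have h1 := hC_summable (s := s) (by linarith)
  have h2 := lC_summable hs
  have h3 := cast_conv (liouville.pmul kA) (liouville.pmul oA) s h1 h2
  have h4 := cast_conv (liouville.pmul kA * liouville.pmul oA) (liouville.pmul oA) s h3.1 h2
  rw [h3.2, ← fA_conv] at h4
  exact h4

lemma fL_zeta {s:ℂ} (hs : 1 < s.re) :
    LSeries fC s * riemannZeta s ^ 2 = HL s * ((1 + 2 ^ (-s)) * riemannZeta (2 * s)) ^ 2 := by
  rw [← lL_zeta hs, (fL hs).2]; ring

lemma conv_sum (F G : ArithmeticFunction ℤ) (φ : ℕ → ℝ) (N:ℕ) (hφ : ∀ n, N < n → φ n = 0) :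
    ∑ n ∈ Ioc 0 N, ((F * G) n:ℝ) * φ n
      = ∑ a ∈ Ioc 0 N, ∑ b ∈ Ioc 0 N, (F a:ℝ) * (G b:ℝ) * φ (a * b) := by
  trans ∑ n ∈ Ioc 0 N, ∑ x ∈ Ioc 0 N ×ˢ Ioc 0 N with x.1 * x.2 = n, (F x.1:ℝ) * (G x.2:ℝ) * φ (x.1 * x.2)
  · refine sum_congr rfl fun n hn => ?_
    simp only [mem_Ioc] at hn
    rw [ArithmeticFunction.mul_apply, Nat.divisorsAntidiagonal_eq_prod_filter_of_le hn.1.ne' hn.2]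
    push_cast
    rw [sum_mul]
    refine sum_congr rfl fun x hx => ?_
    rw [(mem_filter.1 hx).2]
  · simp_rw [sum_filter]
    rw [sum_comm, sum_product]
    refine sum_congr rfl fun a ha => sum_congr rfl fun b hb => ?_
    simp only [mem_Ioc] at ha hb
    rw [sum_ite_eq]
    split_ifs with h
    · rfl
    · rw [hφ, mul_zero]
      simp only [mem_Ioc, not_and, not_le] at h
      exact h (Nat.mul_pos ha.1 hb.1)

/-- window weight -/
noncomputable def Wt (X1 X2:ℝ) (n:ℕ) : ℝ := if X1 < n ∧ (n:ℝ) ≤ X2 then 1 / (n:ℝ) else 0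

lemma Wt_nonneg (X1 X2:ℝ) (n:ℕ) : 0 ≤ Wt X1 X2 n := by
  unfold Wt; split_ifs <;> positivity

lemma Wt_mul {X1 X2:ℝ} {a:ℕ} (ha : 0 < a) (b:ℕ) :
    Wt X1 X2 (a * b) = 1 / (a:ℝ) * Wt (X1 / a) (X2 / a) b := by
  have ha' : (0:ℝ) < a := by exact_mod_cast ha
  unfold Wt
  push_cast
  simp only [div_lt_iff₀ ha', le_div_iff₀ ha', mul_comm (b:ℝ) a]
  split_ifs
  · rw [one_div_mul_one_div]
  · simp

lemma Wt_big {X1 X2:ℝ} {N:ℕ} (h : X2 < N + 1) (n:ℕ) (hn : N < n) : Wt X1 X2 n = 0 := by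
  unfold Wt
  rw [if_neg]
  rintro ⟨_, h2⟩
  have : (N:ℝ) + 1 ≤ n := by exact_mod_cast hn
  linarith

lemma sum_odd (g : ℕ → ℝ) (N:ℕ) :
    ∑ b ∈ Ioc 0 N, (oA b:ℝ) * g b = ∑ j ∈ range ((N + 1) / 2), g (2 * j + 1) := by
  induction N with
  | zero => simp
  | succ n ih =>
    rw [Finset.sum_Ioc_succ_top (by omega), ih, oA_apply]
    rcases Nat.even_or_odd' n with ⟨c, rfl | rfl⟩
    · rw [if_pos (by simp), show (2 * c + 1 + 1) / 2 = (2 * c + 1)/2 + 1 by omega, sum_range_succ,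
        show (2 * c + 1) / 2 = c by omega]
      simp
    · rw [if_neg (by rw [Nat.not_odd_iff_even]; exact ⟨c + 1, by ring⟩), show (2 * c + 1 + 1 + 1) / 2 = (2 * c + 1 + 1)/2 by omega]
      simp

lemma log_step {x:ℝ} (hx : 1 ≤ x) : 1 / (x + 2) ≤ (log (x + 2) - log x) / 2 := by
  have h := Real.one_sub_inv_le_log_of_pos (x := (x + 2) / x) (by positivity)
  rw [log_div (by linarith) (by linarith)] at h
  have : 1 - ((x + 2) / x)⁻¹ = 2 * (1 / (x + 2)) := by
    have : x ≠ 0 := by linarith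
    have : x + 2 ≠ 0 := by linarith
    field_simp; ring
  linarith

lemma odd_win_aux {X1:ℝ} (h1 : 0 < X1) (J:ℕ) :
    ∑ j ∈ range J, (if X1 < 2 * (j:ℝ) + 1 then 1 / (2 * (j:ℝ) + 1) else 0)
      ≤ if X1 < 2 * (J:ℝ) - 1 then 1 / X1 + (log (2 * (J:ℝ) - 1) - log X1) / 2 else 0 := by
  induction J with
  | zero => simp; rw [if_neg (by linarith)]
  | succ J ih =>
    rw [sum_range_succ]
    push_cast
    have e : 2 * ((J:ℝ) + 1) - 1 = 2 * (J:ℝ) + 1 := by ring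
    rw [e]
    by_cases h : X1 < 2 * (J:ℝ) - 1
    · rw [if_pos h] at ih
      rw [if_pos (by linarith), if_pos (by linarith)]
      have hJ : (1:ℝ) ≤ J := by
        rcases Nat.eq_zero_or_pos J with h0 | h0
        · subst h0; simp at h; linarith
        · exact_mod_cast h0
      have := log_step (x := 2 * (J:ℝ) - 1) (by linarith)
      rw [show 2 * (J:ℝ) - 1 + 2 = 2 * (J:ℝ) + 1 by ring] at this
      linarith
    · rw [if_neg h] at ih
      split_ifs with h3
      · have : 1 / (2 * (J:ℝ) + 1) ≤ 1 / X1 := one_div_le_one_div_of_le h1 h3.le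
        have := log_le_log h1 h3.le
        linarith
      · linarith

lemma odd_win {X1 X2:ℝ} (h1 : 0 < X1) (h12 : X1 ≤ X2) (N:ℕ) :
    ∑ b ∈ Ioc 0 N, (oA b:ℝ) * Wt X1 X2 b ≤ (log X2 - log X1) / 2 + 1 / X1 := by
  have hl := log_le_log h1 h12
  have hp : 0 < 1 / X1 := by positivity
  rw [sum_odd]
  obtain ⟨J, hJ⟩ : ∃ J : ℕ, J = min ((N + 1) / 2) ⌊(X2 + 1) / 2⌋₊ := ⟨_, rfl⟩
  have h2 : ∑ j ∈ range ((N + 1) / 2), Wt X1 X2 (2 * j + 1)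
      ≤ ∑ j ∈ range J, (if X1 < 2 * (j:ℝ) + 1 then 1 / (2 * (j:ℝ) + 1) else 0) := by
    rw [← sum_subset (s₁ := range J) (range_mono (by omega))]
    · refine sum_le_sum fun j _ => ?_
      unfold Wt
      push_cast
      split_ifs <;> first | rfl | tauto | positivity
    · intro j hj hj'
      unfold Wt
      rw [if_neg]
      rintro ⟨_, h⟩
      push_cast at h
      apply hj'
      simp only [mem_range] at hj ⊢
      rw [hJ, lt_min_iff]
      refine ⟨hj, ?_⟩
      rw [Nat.lt_iff_add_one_le, Nat.le_floor_iff (by linarith)]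
      push_cast
      linarith
  have h3 : (J:ℝ) ≤ (X2 + 1) / 2 := by
    have : J ≤ ⌊(X2 + 1) / 2⌋₊ := by omega
    exact (Nat.cast_le.2 this).trans (Nat.floor_le (by linarith))
  refine h2.trans ((odd_win_aux h1 J).trans ?_)
  split_ifs with h
  · have := log_le_log (by linarith) (show 2 * (J:ℝ) - 1 ≤ X2 by linarith)
    linarith
  · linarith

lemma odd_floor {Y:ℝ} (hY : 1 ≤ Y) : ∃ J : ℕ, (⌊Y⌋₊ + 1) / 2 = J ∧ 1 ≤ J ∧ 2 * (J:ℝ) - 1 ≤ Y := by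
  have h1 : 1 ≤ ⌊Y⌋₊ := by rw [Nat.one_le_floor_iff]; exact hY
  refine ⟨_, rfl, by omega, ?_⟩
  have h2 : ((2 * ((⌊Y⌋₊ + 1) / 2):ℕ):ℝ) ≤ ((⌊Y⌋₊ + 1:ℕ):ℝ) := by
    apply Nat.cast_le.2; omega
  have h3 := Nat.floor_le (show 0 ≤ Y by linarith)
  push_cast at h2 ⊢
  linarith

lemma odd_harm_aux {J:ℕ} (hJ : 1 ≤ J) :
    ∑ j ∈ range J, 1 / (2 * (j:ℝ) + 1) ≤ 1 + log (2 * (J:ℝ) - 1) / 2 := by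
  induction J, hJ using Nat.le_induction with
  | base => norm_num
  | succ J hJ ih =>
    rw [sum_range_succ]
    have hJ' : (1:ℝ) ≤ J := by exact_mod_cast hJ
    have := log_step (x := 2 * (J:ℝ) - 1) (by linarith)
    rw [show 2 * (J:ℝ) - 1 + 2 = 2 * (J:ℝ) + 1 by ring] at this
    push_cast
    rw [show 2 * ((J:ℝ) + 1) - 1 = 2 * (J:ℝ) + 1 by ring]
    linarith

lemma odd_harm {Y:ℝ} (hY : 1 ≤ Y) :
    ∑ a ∈ Ioc 0 ⌊Y⌋₊, (oA a:ℝ) * (1 / (a:ℝ)) ≤ log Y / 2 + 1 := by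
  rw [sum_odd]
  obtain ⟨J, e, h1, h2⟩ := odd_floor hY
  rw [e]
  have h1' : (1:ℝ) ≤ J := by exact_mod_cast h1
  have := odd_harm_aux h1
  have := log_le_log (by linarith) h2
  push_cast
  linarith

lemma odd_count {Y:ℝ} (hY : 1 ≤ Y) : ∑ a ∈ Ioc 0 ⌊Y⌋₊, (oA a:ℝ) * 1 ≤ (Y + 1) / 2 := by
  rw [sum_odd (fun _ => 1)]
  obtain ⟨J, e, h1, h2⟩ := odd_floor hY
  rw [e]
  simp
  linarith

lemma P_step {y x:ℝ} (hx : 1 ≤ x) (hy : log (x + 2) ≤ y) :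
    (y - log (x + 2)) * (1 / (x + 2)) ≤ ((y * log (x + 2) - log (x + 2) ^ 2 / 2)
      - (y * log x - log x ^ 2 / 2)) / 2 := by
  have h1 := log_step hx
  have h2 : log x ≤ log (x + 2) := log_le_log (by linarith) (by linarith)
  have h3 := mul_le_mul_of_nonneg_left h1 (sub_nonneg.2 hy)
  nlinarith [mul_nonneg (sub_nonneg.2 h2) (sub_nonneg.2 h2)]

lemma odd_log_aux {y:ℝ} {J:ℕ} (hJ : 1 ≤ J) (hy : log (2 * (J:ℝ) - 1) ≤ y) :
    ∑ j ∈ range J, (y - log (2 * (j:ℝ) + 1)) * (1 / (2 * (j:ℝ) + 1))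
      ≤ y + (y * log (2 * (J:ℝ) - 1) - log (2 * (J:ℝ) - 1) ^ 2 / 2) / 2 := by
  induction J, hJ using Nat.le_induction with
  | base => norm_num
  | succ J hJ ih =>
    have hJ' : (1:ℝ) ≤ J := by exact_mod_cast hJ
    push_cast at hy ⊢
    rw [show 2 * ((J:ℝ) + 1) - 1 = 2 * (J:ℝ) + 1 by ring] at hy ⊢
    have h0 := log_le_log (show 0 < 2 * (J:ℝ) - 1 by linarith) (show 2 * (J:ℝ) - 1 ≤ 2 * (J:ℝ) + 1 by linarith)
    have ih := ih (by linarith)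
    have e : 2 * (J:ℝ) - 1 + 2 = 2 * (J:ℝ) + 1 := by ring
    have := P_step (x := 2 * (J:ℝ) - 1) (y := y) (by linarith) (by rw [e]; exact hy)
    rw [e] at this
    rw [sum_range_succ]
    linarith

lemma odd_log {Y:ℝ} (hY : 1 ≤ Y) :
    ∑ a ∈ Ioc 0 ⌊Y⌋₊, (oA a:ℝ) * ((log Y - log a) * (1 / (a:ℝ))) ≤ log Y + log Y ^ 2 / 4 := by
  rw [sum_odd (fun a => (log Y - log a) * (1 / (a:ℝ)))]
  obtain ⟨J, e, h1, h2⟩ := odd_floor hY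
  rw [e]
  have h1' : (1:ℝ) ≤ J := by exact_mod_cast h1
  have h3 := log_le_log (by linarith) h2
  have := odd_log_aux h1 h3
  push_cast
  nlinarith [sq_nonneg (log Y - log (2 * (J:ℝ) - 1))]

lemma oA_nonneg (n:ℕ) : (0:ℝ) ≤ (oA n:ℝ) := by
  rw [oA_apply]; split_ifs <;> simp

lemma D2_bound {Y1 Y2:ℝ} (h1 : 0 < Y1) (h12 : Y1 ≤ Y2) (h2 : 1 ≤ Y2) {N:ℕ} (hN : Y2 < N + 1) :
    ∑ m ∈ Ioc 0 N, ((oA * oA) m:ℝ) * Wt Y1 Y2 m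
      ≤ (log Y2 - log Y1) * (log Y2 / 4 + 1) + (√Y2 + 1) / Y1 := by
  have hl := log_le_log h1 h12
  have hs1 : 1 ≤ √Y2 := by rw [Real.one_le_sqrt]; exact h2
  rw [conv_sum _ _ _ N (Wt_big hN)]
  have step1 : ∑ a ∈ Ioc 0 N, ∑ b ∈ Ioc 0 N, (oA a:ℝ) * (oA b:ℝ) * Wt Y1 Y2 (a * b)
      ≤ ∑ a ∈ Ioc 0 N, ∑ b ∈ Ioc 0 N, ((if (a:ℝ) ≤ √Y2 then (oA a:ℝ) * (oA b:ℝ) * Wt Y1 Y2 (a * b) else 0)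
        + (if (b:ℝ) ≤ √Y2 then (oA a:ℝ) * (oA b:ℝ) * Wt Y1 Y2 (a * b) else 0)) := by
    refine sum_le_sum fun a _ => sum_le_sum fun b _ => ?_
    have h0 : 0 ≤ (oA a:ℝ) * (oA b:ℝ) * Wt Y1 Y2 (a * b) :=
      mul_nonneg (mul_nonneg (oA_nonneg _) (oA_nonneg _)) (Wt_nonneg _ _ _)
    by_cases ha : (a:ℝ) ≤ √Y2
    · rw [if_pos ha]; split_ifs <;> linarith
    · by_cases hb : (b:ℝ) ≤ √Y2
      · rw [if_pos hb, if_neg ha]; linarith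
      · have : Wt Y1 Y2 (a * b) = 0 := by
          unfold Wt
          rw [if_neg]
          rintro ⟨_, h⟩
          push Not at ha hb
          push_cast at h
          have := Real.mul_self_sqrt (show 0 ≤ Y2 by linarith)
          nlinarith
        rw [this]; simp
  have e2 : ∑ a ∈ Ioc 0 N, ∑ b ∈ Ioc 0 N, (if (b:ℝ) ≤ √Y2 then (oA a:ℝ) * (oA b:ℝ) * Wt Y1 Y2 (a * b) else 0)
      = ∑ a ∈ Ioc 0 N, ∑ b ∈ Ioc 0 N, (if (a:ℝ) ≤ √Y2 then (oA a:ℝ) * (oA b:ℝ) * Wt Y1 Y2 (a * b) else 0) := by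
    rw [sum_comm]
    refine sum_congr rfl fun a _ => sum_congr rfl fun b _ => ?_
    rw [mul_comm b a, mul_comm (oA b:ℝ)]
  have step3 : ∑ a ∈ Ioc 0 N, ∑ b ∈ Ioc 0 N, (if (a:ℝ) ≤ √Y2 then (oA a:ℝ) * (oA b:ℝ) * Wt Y1 Y2 (a * b) else 0)
      ≤ ∑ a ∈ Ioc 0 ⌊√Y2⌋₊, (oA a:ℝ) * (1 / (a:ℝ)) * ((log Y2 - log Y1) / 2 + a / Y1) := by
    have hsub : Ioc 0 N ∩ Ioc 0 ⌊√Y2⌋₊ ⊆ Ioc 0 N := inter_subset_left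
    rw [← sum_subset hsub]
    · refine (sum_le_sum fun a ha => ?_).trans (sum_le_sum_of_subset_of_nonneg inter_subset_right fun a ha _ => ?_)
      · have ha0 : 0 < a := (mem_Ioc.1 (mem_inter.1 ha).1).1
        have ha' : (0:ℝ) < a := by exact_mod_cast ha0
        calc _ ≤ ∑ b ∈ Ioc 0 N, (oA a:ℝ) * (1 / (a:ℝ)) * ((oA b:ℝ) * Wt (Y1 / a) (Y2 / a) b) := by
              refine sum_le_sum fun b _ => ?_
              have h0 : 0 ≤ (oA a:ℝ) * (oA b:ℝ) * Wt Y1 Y2 (a * b) :=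
                mul_nonneg (mul_nonneg (oA_nonneg _) (oA_nonneg _)) (Wt_nonneg _ _ _)
              have : (oA a:ℝ) * (oA b:ℝ) * Wt Y1 Y2 (a * b) = (oA a:ℝ) * (1 / (a:ℝ)) * ((oA b:ℝ) * Wt (Y1 / a) (Y2 / a) b) := by
                rw [Wt_mul ha0]; ring
              rw [← this]
              split_ifs <;> linarith
          _ = (oA a:ℝ) * (1 / (a:ℝ)) * ∑ b ∈ Ioc 0 N, ((oA b:ℝ) * Wt (Y1 / a) (Y2 / a) b) := by
              rw [mul_sum]
          _ ≤ _ := by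
              apply mul_le_mul_of_nonneg_left _ (mul_nonneg (oA_nonneg _) (by positivity))
              have h := odd_win (X1 := Y1 / a) (X2 := Y2 / a) (by positivity) (by gcongr) N
              rw [log_div (by linarith) ha'.ne', log_div h1.ne' ha'.ne', one_div_div] at h
              linarith
      · have hl' : 0 ≤ log Y2 - log Y1 := by linarith
        have := oA_nonneg a
        positivity
    · intro a ha hna
      refine sum_eq_zero fun b _ => ?_
      rw [if_neg]
      intro h
      apply hna
      rw [mem_inter]
      refine ⟨ha, mem_Ioc.2 ⟨(mem_Ioc.1 ha).1, Nat.le_floor h⟩⟩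
  have e4 : ∑ a ∈ Ioc 0 ⌊√Y2⌋₊, (oA a:ℝ) * (1 / (a:ℝ)) * ((log Y2 - log Y1) / 2 + a / Y1)
      = (log Y2 - log Y1) / 2 * (∑ a ∈ Ioc 0 ⌊√Y2⌋₊, (oA a:ℝ) * (1 / (a:ℝ)))
        + 1 / Y1 * ∑ a ∈ Ioc 0 ⌊√Y2⌋₊, (oA a:ℝ) * 1 := by
    rw [mul_sum, mul_sum, ← sum_add_distrib]
    refine sum_congr rfl fun a ha => ?_
    have ha' : (0:ℝ) < a := by exact_mod_cast (mem_Ioc.1 ha).1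
    field_simp
  have b1 := odd_harm hs1
  have b2 := odd_count hs1
  rw [log_sqrt (by linarith)] at b1
  simp only [sum_add_distrib, e2] at step1
  have b3 := mul_le_mul_of_nonneg_left b1 (show 0 ≤ (log Y2 - log Y1) / 2 by linarith)
  have b4 := mul_le_mul_of_nonneg_left b2 (show 0 ≤ 1 / Y1 by positivity)
  have e5 : (√Y2 + 1) / Y1 = 2 * (1 / Y1 * ((√Y2 + 1) / 2)) := by ring
  rw [e5]
  linarith

lemma D20_bound {Y:ℝ} (h2 : 1 ≤ Y) {N:ℕ} (hN : Y < N + 1) :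
    ∑ m ∈ Ioc 0 N, ((oA * oA) m:ℝ) * Wt 0 Y m ≤ log Y ^ 2 / 8 + log Y + 1 := by
  rw [conv_sum _ _ _ N (Wt_big hN)]
  have hl := Real.log_nonneg h2
  have step3 : ∑ a ∈ Ioc 0 N, ∑ b ∈ Ioc 0 N, (oA a:ℝ) * (oA b:ℝ) * Wt 0 Y (a * b)
      ≤ ∑ a ∈ Ioc 0 ⌊Y⌋₊, (oA a:ℝ) * (1 / (a:ℝ)) * ((log Y - log a) / 2 + 1) := by
    have hN' : ⌊Y⌋₊ ≤ N := by
      have : ⌊Y⌋₊ < N + 1 := by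
        rw [Nat.floor_lt (by linarith)]; exact_mod_cast hN
      omega
    rw [← sum_subset (Ioc_subset_Ioc_right hN')]
    · refine (sum_le_sum fun a ha => ?_)
      have ha0 : 0 < a := (mem_Ioc.1 ha).1
      have ha' : (0:ℝ) < a := by exact_mod_cast ha0
      have haY : (a:ℝ) ≤ Y := (Nat.le_floor_iff (by linarith)).1 (mem_Ioc.1 ha).2
      have hYa : 1 ≤ Y / a := by rw [le_div_iff₀ ha']; linarith
      calc _ = (oA a:ℝ) * (1 / (a:ℝ)) * ∑ b ∈ Ioc 0 N, ((oA b:ℝ) * Wt 0 (Y / a) b) := by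
            rw [mul_sum]
            refine sum_congr rfl fun b _ => ?_
            rw [Wt_mul ha0, zero_div]; ring
        _ ≤ _ := by
            apply mul_le_mul_of_nonneg_left _ (mul_nonneg (oA_nonneg _) (by positivity))
            have h := odd_harm hYa
            rw [log_div (by linarith) ha'.ne'] at h
            refine le_trans ?_ h
            have hY' : ⌊Y / a⌋₊ ≤ N := by
              refine le_trans (Nat.floor_le_floor ?_) hN'
              exact div_le_self (by linarith) (by exact_mod_cast ha0)
            rw [← sum_subset (Ioc_subset_Ioc_right hY')]
            · refine sum_le_sum fun b _ => ?_
              apply mul_le_mul_of_nonneg_left _ (oA_nonneg _)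
              unfold Wt
              split_ifs
              · rfl
              · positivity
            · intro b hb hnb
              have : Wt 0 (Y / a) b = 0 := by
                unfold Wt
                rw [if_neg]
                rintro ⟨_, h⟩
                exact hnb (mem_Ioc.2 ⟨(mem_Ioc.1 hb).1, Nat.le_floor h⟩)
              rw [this, mul_zero]
    · intro a ha hna
      refine sum_eq_zero fun b hb => ?_
      have hb1 : (1:ℝ) ≤ b := by exact_mod_cast (mem_Ioc.1 hb).1
      have : Wt 0 Y (a * b) = 0 := by
        unfold Wt
        rw [if_neg]
        rintro ⟨_, h⟩
        push_cast at h
        refine hna (mem_Ioc.2 ⟨(mem_Ioc.1 ha).1, Nat.le_floor ?_⟩)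
        refine le_trans ?_ h
        exact le_mul_of_one_le_right (by positivity) hb1
      rw [this, mul_zero]
  have e4 : ∑ a ∈ Ioc 0 ⌊Y⌋₊, (oA a:ℝ) * (1 / (a:ℝ)) * ((log Y - log a) / 2 + 1)
      = 1 / 2 * (∑ a ∈ Ioc 0 ⌊Y⌋₊, (oA a:ℝ) * ((log Y - log a) * (1 / (a:ℝ))))
        + ∑ a ∈ Ioc 0 ⌊Y⌋₊, (oA a:ℝ) * (1 / (a:ℝ)) := by
    rw [mul_sum, ← sum_add_distrib]
    refine sum_congr rfl fun a ha => ?_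
    ring
  have b1 := odd_harm h2
  have b2 := odd_log h2
  linarith

lemma k_one_Ioc (N:ℕ) : ∑ a ∈ Ioc 0 N, (kA a:ℝ) * (1 / (a:ℝ)) ≤ 1.57 := by
  refine le_trans ?_ (k_one_part (N + 1))
  have h : ∀ a : ℕ, (kA a:ℝ) * (1 / (a:ℝ)) = (kA a:ℝ) * (a:ℝ) ^ (-(1:ℝ)) := by
    intro a; rw [Real.rpow_neg_one, one_div]
  simp only [h]
  refine sum_le_sum_of_subset_of_nonneg (fun a ha => ?_) fun a _ _ => kterm_nonneg _ _
  rw [mem_range]; have := (mem_Ioc.1 ha).2; omega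

lemma k_34_Ioc (N:ℕ) : ∑ a ∈ Ioc 0 N, (kA a:ℝ) * (a:ℝ) ^ (-(3/4:ℝ)) ≤ 5.7 := by
  refine le_trans ?_ (k_34_part (N + 1))
  refine sum_le_sum_of_subset_of_nonneg (fun a ha => ?_) fun a _ _ => kterm_nonneg _ _
  rw [mem_range]; have := (mem_Ioc.1 ha).2; omega

lemma kA_nonneg' (n:ℕ) : (0:ℝ) ≤ (kA n:ℝ) := by exact_mod_cast kA_nonneg n

lemma aA_trivial {X:ℝ} (hX : 1 ≤ X) :
    ∑ n ∈ Ioc 0 ⌊X⌋₊, (aA n:ℝ) * Wt 0 X n ≤ 1.57 * (log X ^ 2 / 8 + log X + 1) := by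
  have hl := Real.log_nonneg hX
  have hN : X < (⌊X⌋₊:ℝ) + 1 := Nat.lt_floor_add_one X
  rw [aA_eq, mul_assoc, conv_sum _ _ _ _ (Wt_big hN)]
  calc _ ≤ ∑ a ∈ Ioc 0 ⌊X⌋₊, (kA a:ℝ) * (1 / (a:ℝ)) * (log X ^ 2 / 8 + log X + 1) := by
        refine sum_le_sum fun a ha => ?_
        have ha0 : 0 < a := (mem_Ioc.1 ha).1
        have ha' : (1:ℝ) ≤ a := by exact_mod_cast ha0
        have haX : (a:ℝ) ≤ X := (Nat.le_floor_iff (by linarith)).1 (mem_Ioc.1 ha).2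
        have hXa : 1 ≤ X / a := by rw [le_div_iff₀ (by linarith)]; linarith
        have hXa' : X / a ≤ X := div_le_self (by linarith) ha'
        have h := D20_bound hXa (N := ⌊X⌋₊) (by linarith)
        have hl1 := Real.log_nonneg hXa
        have hl2 := log_le_log (by linarith) hXa'
        calc _ = (kA a:ℝ) * (1 / (a:ℝ)) * ∑ b ∈ Ioc 0 ⌊X⌋₊, ((oA * oA) b:ℝ) * Wt 0 (X / a) b := by
              rw [mul_sum]
              refine sum_congr rfl fun b _ => ?_
              rw [Wt_mul ha0, zero_div]; ring
          _ ≤ _ := by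
              apply mul_le_mul_of_nonneg_left _ (mul_nonneg (kA_nonneg' _) (by positivity))
              refine h.trans ?_
              gcongr
    _ = (∑ a ∈ Ioc 0 ⌊X⌋₊, (kA a:ℝ) * (1 / (a:ℝ))) * (log X ^ 2 / 8 + log X + 1) := by
        rw [sum_mul]
    _ ≤ _ := by
        apply mul_le_mul_of_nonneg_right (k_one_Ioc _)
        positivity

lemma aA_window {X1 X2:ℝ} (h1 : 0 < X1) (h12 : X1 ≤ X2) (h2 : 1 ≤ X2) :
    ∑ n ∈ Ioc 0 ⌊X2⌋₊, (aA n:ℝ) * Wt X1 X2 n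
      ≤ 1.57 * ((log X2 - log X1) * (log X2 / 4 + 1)) + 11.4 * (X2 ^ (3/4:ℝ) / X1) := by
  have hl := Real.log_nonneg h2
  have hl12 := log_le_log h1 h12
  have hN : X2 < (⌊X2⌋₊:ℝ) + 1 := Nat.lt_floor_add_one X2
  rw [aA_eq, mul_assoc, conv_sum _ _ _ _ (Wt_big hN)]
  calc _ ≤ ∑ a ∈ Ioc 0 ⌊X2⌋₊, ((kA a:ℝ) * (1 / (a:ℝ)) * ((log X2 - log X1) * (log X2 / 4 + 1))
          + (kA a:ℝ) * (a:ℝ) ^ (-(3/4:ℝ)) * (2 * (X2 ^ (3/4:ℝ) / X1))) := by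
        refine sum_le_sum fun a ha => ?_
        have ha0 : 0 < a := (mem_Ioc.1 ha).1
        have ha' : (1:ℝ) ≤ a := by exact_mod_cast ha0
        have ha'' : (0:ℝ) < a := by linarith
        have haX : (a:ℝ) ≤ X2 := (Nat.le_floor_iff (by linarith)).1 (mem_Ioc.1 ha).2
        have hXa : 1 ≤ X2 / a := by rw [le_div_iff₀ (by linarith)]; linarith
        have hXa' : X2 / a ≤ X2 := div_le_self (by linarith) ha'
        have h := D2_bound (Y1 := X1 / a) (by positivity) (by gcongr) hXa (N := ⌊X2⌋₊) (by linarith)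
        have hl1 := Real.log_nonneg hXa
        have hl2 := log_le_log (by linarith) hXa'
        have e1 : log (X2 / a) - log (X1 / a) = log X2 - log X1 := by
          rw [log_div (by linarith) ha''.ne', log_div h1.ne' ha''.ne']; ring
        rw [e1] at h
        have h3 : (1 / (a:ℝ)) * ((√(X2 / a) + 1) / (X1 / a)) ≤ (a:ℝ) ^ (-(3/4:ℝ)) * (2 * (X2 ^ (3/4:ℝ) / X1)) := by
          have g1 : √(X2 / a) + 1 ≤ 2 * (X2 / a) ^ (3/4:ℝ) := by
            have g2 : 1 ≤ (X2 / a) ^ (3/4:ℝ) := Real.one_le_rpow hXa (by norm_num)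
            have g3 : √(X2 / a) ≤ (X2 / a) ^ (3/4:ℝ) := by
              rw [Real.sqrt_eq_rpow]
              exact Real.rpow_le_rpow_of_exponent_le hXa (by norm_num)
            linarith
          have g4 : (X2 / a) ^ (3/4:ℝ) = X2 ^ (3/4:ℝ) * (a:ℝ) ^ (-(3/4:ℝ)) := by
            rw [Real.div_rpow (by linarith) ha''.le, rpow_neg ha''.le, div_eq_mul_inv]
          have g5 : (1 / (a:ℝ)) * ((√(X2 / a) + 1) / (X1 / a)) = (√(X2 / a) + 1) / X1 := by
            field_simp
          rw [g5]
          rw [g4] at g1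
          calc _ ≤ 2 * (X2 ^ (3/4:ℝ) * (a:ℝ) ^ (-(3/4:ℝ))) / X1 := by gcongr
            _ = _ := by ring
        calc _ = (kA a:ℝ) * (1 / (a:ℝ)) * ∑ b ∈ Ioc 0 ⌊X2⌋₊, ((oA * oA) b:ℝ) * Wt (X1 / a) (X2 / a) b := by
              rw [mul_sum]
              refine sum_congr rfl fun b _ => ?_
              rw [Wt_mul ha0]; ring
          _ ≤ (kA a:ℝ) * (1 / (a:ℝ)) * ((log X2 - log X1) * (log X2 / 4 + 1) + (√(X2 / a) + 1) / (X1 / a)) := by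
              apply mul_le_mul_of_nonneg_left _ (mul_nonneg (kA_nonneg' _) (by positivity))
              refine h.trans ?_
              have : 0 ≤ log X2 - log X1 := by linarith
              gcongr
          _ = (kA a:ℝ) * (1 / (a:ℝ)) * ((log X2 - log X1) * (log X2 / 4 + 1))
              + (kA a:ℝ) * ((1 / (a:ℝ)) * ((√(X2 / a) + 1) / (X1 / a))) := by ring
          _ ≤ _ := by
              have := mul_le_mul_of_nonneg_left h3 (kA_nonneg' a)
              rw [mul_assoc (kA a:ℝ) ((a:ℝ) ^ (-(3/4:ℝ)))]
              linarith
    _ = (∑ a ∈ Ioc 0 ⌊X2⌋₊, (kA a:ℝ) * (1 / (a:ℝ))) * ((log X2 - log X1) * (log X2 / 4 + 1))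
        + (∑ a ∈ Ioc 0 ⌊X2⌋₊, (kA a:ℝ) * (a:ℝ) ^ (-(3/4:ℝ))) * (2 * (X2 ^ (3/4:ℝ) / X1)) := by
        rw [sum_add_distrib, sum_mul, sum_mul]
    _ ≤ _ := by
        have g1 : 0 ≤ (log X2 - log X1) * (log X2 / 4 + 1) :=
          mul_nonneg (by linarith) (by linarith)
        have g2 : 0 ≤ 2 * (X2 ^ (3/4:ℝ) / X1) := by positivity
        have := mul_le_mul_of_nonneg_right (k_one_Ioc ⌊X2⌋₊) g1
        have := mul_le_mul_of_nonneg_right (k_34_Ioc ⌊X2⌋₊) g2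
        linarith

lemma u_eq' {x:ℝ} {N:ℕ} (hN : ⌊x⌋₊ ≤ N) : u x = ∑ n ∈ Ioc 0 N, (fA n:ℝ) * Wt 0 x n := by
  unfold u
  rw [sum_filter]
  have e : Finset.Icc 1 ⌊x⌋₊ = Ioc 0 ⌊x⌋₊ := by ext n; simp [Nat.lt_iff_add_one_le]
  rw [e]
  have hsub : Ioc 0 ⌊x⌋₊ ⊆ Ioc 0 N := Ioc_subset_Ioc le_rfl hN
  rw [← sum_subset hsub]
  · refine sum_congr rfl fun n hn => ?_
    have hn := mem_Ioc.1 hn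
    have h0 : (0:ℝ) < n := by exact_mod_cast hn.1
    have h1 : (n:ℝ) ≤ x := (Nat.le_floor_iff' hn.1.ne').1 hn.2
    unfold Wt
    rw [fA_apply]
    simp only [h0, h1, and_self, if_true]
    split_ifs
    · push_cast; ring
    · simp
  · intro n hn hn2
    have hn := mem_Ioc.1 hn
    unfold Wt
    rw [if_neg, mul_zero]
    rintro ⟨h1, h2⟩
    apply hn2
    exact mem_Ioc.2 ⟨hn.1, Nat.le_floor h2⟩

/-- the step function on the logarithmic scale -/
noncomputable def VV (y:ℝ) : ℝ := u (exp y)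
/-- the trivial bound -/
noncomputable def QQ (y:ℝ) : ℝ := 1.57 * (y ^ 2 / 8 + y + 1)

lemma fA_abs_real (n:ℕ) : |(fA n:ℝ)| = (aA n:ℝ) := by
  rw [← fA_abs]; push_cast; rfl

lemma VV_neg {y:ℝ} (hy : y < 0) : VV y = 0 := by
  unfold VV u
  rw [Nat.floor_eq_zero.2 (by rw [Real.exp_lt_one_iff]; exact hy)]
  simp

lemma u_triv {x:ℝ} (hx : 1 ≤ x) : |u x| ≤ QQ (log x) := by
  rw [u_eq' le_rfl]
  refine (abs_sum_le_sum_abs _ _).trans ?_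
  refine le_trans (le_of_eq ?_) (aA_trivial hx)
  refine sum_congr rfl fun n _ => ?_
  rw [abs_mul, fA_abs_real, abs_of_nonneg (Wt_nonneg _ _ _)]

lemma VV_triv {y:ℝ} (hy : 0 ≤ y) : |VV y| ≤ QQ y := by
  have := u_triv (Real.one_le_exp hy)
  rwa [Real.log_exp] at this

lemma VV_diff {y1 y2:ℝ} (h : y1 ≤ y2) (h2 : 0 ≤ y2) :
    |VV y2 - VV y1| ≤ 1.57 * ((y2 - y1) * (y2 / 4 + 1)) + 11.4 * exp (3 / 4 * y2 - y1) := by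
  have hm := aA_window (exp_pos y1) (exp_le_exp.2 h) (Real.one_le_exp h2)
  rw [Real.log_exp, Real.log_exp, ← Real.exp_mul, ← Real.exp_sub, mul_comm y2 (3/4)] at hm
  refine le_trans ?_ hm
  unfold VV
  rw [u_eq' le_rfl, u_eq' (Nat.floor_mono (exp_le_exp.2 h)), ← sum_sub_distrib]
  refine (abs_sum_le_sum_abs _ _).trans ?_
  refine sum_le_sum fun n hn => ?_
  rw [← mul_sub, abs_mul, fA_abs_real]
  refine mul_le_mul_of_nonneg_left ?_ ?_
  · have h0 : (0:ℝ) < n := by exact_mod_cast (mem_Ioc.1 hn).1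
    have h12 := exp_le_exp.2 h
    unfold Wt
    have hp : (0:ℝ) < 1 / n := by positivity
    by_cases a : (n:ℝ) ≤ exp y1
    · have b := a.trans h12
      have c := not_lt.2 a
      simp [h0, a, b]; split_ifs <;> positivity
    · by_cases b : (n:ℝ) ≤ exp y2
      · have c := not_le.1 a
        simp [h0, a, b, c]
      · simp [a, b]
  · rw [← fA_abs_real]; positivity

lemma u_measurable : Measurable u := by
  have : u = (fun N : ℕ => ∑ n ∈ (Finset.Icc 1 N).filter (fun n => Odd n), (-2:ℝ) ^ (cardFactors n) / n) ∘ Nat.floor := rfl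
  rw [this]
  exact measurable_from_nat.comp Nat.measurable_floor

lemma VV_measurable : Measurable VV := u_measurable.comp Real.measurable_exp

lemma QQ_nonneg {y:ℝ} (hy : 0 ≤ y) : 0 ≤ QQ y := by unfold QQ; positivity

lemma VV_le_exp {c y:ℝ} (hc : 0 < c) : |VV y| ≤ 1.57 * (1 + 1 / c) ^ 2 * exp (c * y) := by
  rcases lt_or_ge y 0 with h | h
  · rw [VV_neg h, abs_zero]; positivity
  · refine (VV_triv h).trans ?_
    unfold QQ
    have h1 := Real.quadratic_le_exp_of_nonneg (x := c * y) (by positivity)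
    rw [mul_assoc]
    refine mul_le_mul_of_nonneg_left ?_ (by norm_num)
    have h2 : y ^ 2 / 8 + y + 1 ≤ (1 + 1 / c) ^ 2 * (1 + c * y + (c * y) ^ 2 / 2) := by
      have : (1 + 1 / c) ^ 2 * (1 + c * y + (c * y) ^ 2 / 2) = (1 + 2 / c + 1 / c^2) + (c + 2 + 1 / c) * y + (c ^ 2 + 2 * c + 1) * y ^ 2 / 2 := by
        field_simp; ring
      rw [this]
      have a1 : 0 < 2 / c + 1 / c ^ 2 := by positivity
      have a2 : 0 ≤ (c + 1 + 1 / c) * y := by positivity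
      have a3 : 0 ≤ (c ^ 2 + 2 * c) * y ^ 2 / 2 := by positivity
      nlinarith
    exact h2.trans (mul_le_mul_of_nonneg_left h1 (by positivity))

lemma GV_integrable {σ:ℝ} (hσ : 0 < σ) :
    Integrable (fun y => VV y * exp (-(σ * y))) := by
  have hm : Measurable (fun y => VV y * exp (-(σ * y))) :=
    VV_measurable.mul (by fun_prop)
  have hi : Integrable (Set.indicator (Set.Ioi (-1:ℝ))
      (fun y => 1.57 * (1 + 1 / (σ/2)) ^ 2 * exp (-(σ/2) * y))) := by
    rw [integrable_indicator_iff measurableSet_Ioi]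
    exact (integrableOn_exp_mul_Ioi (by linarith) _).const_mul _
  refine hi.mono' hm.aestronglyMeasurable (Eventually.of_forall fun y => ?_)
  rw [Real.norm_eq_abs, abs_mul, abs_of_pos (exp_pos _)]
  rcases lt_or_ge y 0 with h | h
  · rw [VV_neg h, abs_zero, zero_mul]
    exact Set.indicator_nonneg (fun _ _ => by positivity) _
  · rw [Set.indicator_of_mem (show y ∈ Set.Ioi (-1:ℝ) by simp; linarith)]
    have := VV_le_exp (c := σ / 2) (y := y) (by linarith)
    calc |VV y| * exp (-(σ * y)) ≤ (1.57 * (1 + 1 / (σ/2)) ^ 2 * exp (σ / 2 * y)) * exp (-(σ * y)) :=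
          mul_le_mul_of_nonneg_right this (exp_pos _).le
      _ = _ := by rw [mul_assoc, ← exp_add]; congr 2; ring

/-- individual steps -/
noncomputable def FF (z:ℂ) (n:ℕ) (y:ℝ) : ℂ :=
  Set.indicator (Set.Ici (log n)) (fun y : ℝ => fC n / n * Complex.exp (-z * y)) y

lemma FF_int {z:ℂ} (hz : 0 < z.re) (n:ℕ) : Integrable (FF z n) := by
  unfold FF
  rw [integrable_indicator_iff measurableSet_Ici, integrableOn_Ici_iff_integrableOn_Ioi]
  exact (integrableOn_exp_mul_complex_Ioi (by simpa using hz) _).const_mul _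

lemma FF_integral {z:ℂ} (hz : 0 < z.re) (n:ℕ) : ∫ y, FF z n y = LSeries.term fC (1 + z) n / z := by
  unfold FF
  rw [integral_indicator measurableSet_Ici, integral_Ici_eq_integral_Ioi,
    integral_const_mul, integral_exp_mul_complex_Ioi (by simpa using hz)]
  rcases Nat.eq_zero_or_pos n with rfl | hn
  · simp
  · have hn0 : (n:ℂ) ≠ 0 := by exact_mod_cast hn.ne'
    rw [LSeries.term_of_ne_zero hn.ne', Complex.cpow_add _ _ hn0, Complex.cpow_one]
    have : Complex.exp (-z * (log n:ℝ)) = ((n:ℂ) ^ z)⁻¹ := by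
      rw [← Complex.cpow_neg, Complex.cpow_def_of_ne_zero hn0, Complex.ofReal_log (by positivity)]
      push_cast; congr 1; ring
    have h2 : (n:ℂ) ^ z ≠ 0 := by simp [Complex.cpow_eq_zero_iff, hn0]
    have hz0 : z ≠ 0 := by rintro rfl; simp at hz
    rw [this]; field_simp

lemma FF_norm {z:ℂ} (hz : 0 < z.re) (n:ℕ) : ∫ y, ‖FF z n y‖ = ‖LSeries.term fC (1 + z) n‖ / z.re := by
  have e : ∀ y, ‖FF z n y‖ = Set.indicator (Set.Ici (log n)) (fun y : ℝ => ‖fC n / n‖ * exp (-z.re * y)) y := by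
    intro y
    unfold FF
    rw [_root_.norm_indicator_eq_indicator_norm]
    congr 1; funext y
    rw [norm_mul, Complex.norm_exp]; simp
  simp_rw [e]
  rw [integral_indicator measurableSet_Ici, integral_Ici_eq_integral_Ioi,
    integral_const_mul, integral_exp_mul_Ioi (by simpa using hz)]
  rcases Nat.eq_zero_or_pos n with rfl | hn
  · simp
  · have hn0 : (0:ℝ) < n := by exact_mod_cast hn
    rw [LSeries.term_of_ne_zero hn.ne', norm_div, norm_div, Complex.norm_natCast_cpow_of_pos hn,
      Complex.norm_natCast, Complex.add_re, Complex.one_re, Real.rpow_add hn0, Real.rpow_one]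
    have : exp (-z.re * log n) = ((n:ℝ) ^ z.re)⁻¹ := by
      rw [← rpow_neg hn0.le, Real.rpow_def_of_pos hn0]; congr 1; ring
    rw [this]; field_simp

lemma FF_tsum (z:ℂ) (y:ℝ) : ∑' n, FF z n y = (VV y:ℂ) * Complex.exp (-z * y) := by
  have key : ∀ n : ℕ, 0 < n → FF z n y = ((fA n * Wt 0 (exp y) n:ℝ):ℂ) * Complex.exp (-z * y) := by
    intro n hn
    have hn0 : (0:ℝ) < n := by exact_mod_cast hn
    unfold FF Wt
    by_cases h : (n:ℝ) ≤ exp y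
    · rw [Set.indicator_of_mem (show y ∈ Set.Ici (log n) from (Real.log_le_iff_le_exp hn0).2 h)]
      simp only [hn0, h, and_self, if_true, fC]
      push_cast; ring
    · rw [Set.indicator_of_notMem (show y ∉ Set.Ici (log n) from fun hh => h ((Real.log_le_iff_le_exp hn0).1 hh))]
      simp [h]
  rw [tsum_eq_sum (s := Ioc 0 ⌊exp y⌋₊)]
  · unfold VV
    rw [u_eq' le_rfl, Complex.ofReal_sum, sum_mul]
    exact sum_congr rfl fun n hn => key n (mem_Ioc.1 hn).1
  · intro n hn
    rcases Nat.eq_zero_or_pos n with rfl | hn0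
    · unfold FF; simp
    · rw [key n hn0, Wt_big (N := ⌊exp y⌋₊) (Nat.lt_floor_add_one _)]
      · simp
      · by_contra hh; exact hn (mem_Ioc.2 ⟨hn0, not_lt.1 hh⟩)

lemma laplace {z:ℂ} (hz : 0 < z.re) :
    ∫ y : ℝ, (VV y:ℂ) * Complex.exp (-z * y) = LSeries fC (1 + z) / z := by
  have hs : LSeriesSummable fC (1 + z) := (fL (by simpa using hz)).1
  have h := hasSum_integral_of_summable_integral_norm (F := FF z) (FF_int hz)
    (by simp_rw [FF_norm hz]; exact (hs.norm).div_const _)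
  simp_rw [FF_integral hz, FF_tsum] at h
  rw [← h.tsum_eq, tsum_div_const]; rfl

/-- the smoothing kernel -/
noncomputable def SS (x:ℝ) : ℝ := Real.sinc x + Real.sinc (x + π) / 2 + Real.sinc (x - π) / 2

lemma SS_neg (x:ℝ) : SS (-x) = SS x := by
  unfold SS
  rw [Real.sinc_neg, show -x + π = -(x - π) by ring, show -x - π = -(x + π) by ring,
    Real.sinc_neg, Real.sinc_neg]; ring

lemma SS_cont : Continuous SS := by
  unfold SS
  have := Real.continuous_sinc
  fun_prop

lemma SS_closed {x:ℝ} (h0 : 0 < x) (h1 : x ≠ π) :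
    SS x = Real.sin x * π ^ 2 / (x * (π - x) * (π + x)) := by
  have hp := pi_pos
  have h2 : x - π ≠ 0 := sub_ne_zero.2 h1
  have h3 : π - x ≠ 0 := sub_ne_zero.2 h1.symm
  have h4 : x + π ≠ 0 := by positivity
  have h5 : π + x ≠ 0 := by positivity
  unfold SS
  rw [Real.sinc_of_ne_zero h0.ne', Real.sinc_of_ne_zero h2, Real.sinc_of_ne_zero h4, Real.sin_add_pi, Real.sin_sub_pi]
  field_simp
  ring

lemma sin_par {x:ℝ} (h0 : 0 ≤ x) (h1 : x ≤ π) : Real.sin x ≤ 4 * x * (π - x) / π ^ 2 := by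
  have hp := pi_pos
  obtain ⟨w, hw⟩ : ∃ w, w = |π / 2 - x| / 2 := ⟨_, rfl⟩
  have hw0 : 0 ≤ w := by rw [hw]; positivity
  have hw1 : w ≤ π / 4 := by
    rw [hw]; have : |π / 2 - x| ≤ π / 2 := abs_le.2 ⟨by linarith, by linarith⟩
    linarith
  have hs : Real.sin x = 1 - 2 * Real.sin w ^ 2 := by
    rw [← Real.cos_pi_div_two_sub, ← Real.cos_abs, show |π / 2 - x| = 2 * w by rw [hw]; ring, Real.cos_two_mul,
      Real.cos_sq']; ring
  have hc := strictConcaveOn_sin_Icc.concaveOn.2 (show (0:ℝ) ∈ Set.Icc 0 π from ⟨le_rfl, hp.le⟩)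
    (show π / 4 ∈ Set.Icc 0 π from ⟨by positivity, by linarith⟩)
    (show 0 ≤ 1 - w / (π / 4) by rw [sub_nonneg, div_le_one (by positivity)]; exact hw1)
    (show 0 ≤ w / (π / 4) by positivity) (by ring)
  simp only [smul_eq_mul, mul_zero, Real.sin_zero, zero_add, Real.sin_pi_div_four] at hc
  rw [div_mul_cancel₀ _ (by positivity)] at hc
  have hsq : (w / (π / 4) * (√2 / 2)) ^ 2 ≤ Real.sin w ^ 2 := pow_le_pow_left₀ (by positivity) hc 2
  have e : (w / (π / 4) * (√2 / 2)) ^ 2 = 8 * w ^ 2 / π ^ 2 := by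
    rw [mul_pow, div_pow, div_pow √2, Real.sq_sqrt (by norm_num)]; field_simp; ring
  have e2 : w ^ 2 = (π / 2 - x) ^ 2 / 4 := by rw [hw, div_pow, sq_abs]; norm_num
  rw [e, e2] at hsq
  rw [hs]
  have : 4 * x * (π - x) / π ^ 2 = 1 - 2 * (8 * ((π / 2 - x) ^ 2 / 4) / π ^ 2) := by
    field_simp; ring
  rw [this]; linarith

lemma SS_zero : SS 0 = 1 := by
  unfold SS
  rw [zero_add, zero_sub, Real.sinc_neg, Real.sinc_of_ne_zero pi_pos.ne']; simp

lemma SS_pi : SS π = 1 / 2 := by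
  have hp := pi_pos
  unfold SS
  rw [Real.sinc_of_ne_zero pi_pos.ne', Real.sinc_of_ne_zero (by positivity), sub_self, Real.sinc_zero]; simp

lemma SS_b1 {x:ℝ} (h0 : 0 ≤ x) (h1 : x ≤ π) : |SS x| ≤ 4 / (π + x) := by
  have hp := pi_pos
  have hp4 := Real.pi_lt_four
  rcases h0.eq_or_lt with rfl | h0'
  · rw [SS_zero, le_div_iff₀ (by positivity), abs_one]; linarith
  rcases h1.eq_or_lt with rfl | h1'
  · rw [SS_pi, le_div_iff₀ (by positivity), abs_of_pos (by norm_num)]; linarith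
  have h3 : 0 < π - x := by linarith
  rw [SS_closed h0' h1'.ne, abs_of_nonneg (div_nonneg (mul_nonneg (Real.sin_nonneg_of_nonneg_of_le_pi h0 h1) (by positivity)) (by positivity))]
  rw [div_le_div_iff₀ (by positivity) (by positivity)]
  have := sin_par h0 h1
  rw [le_div_iff₀ (by positivity)] at this
  nlinarith [mul_le_mul_of_nonneg_right this (show 0 ≤ π + x by positivity)]

lemma SS_b2 {x:ℝ} (h0 : π ≤ x) (h1 : x ≤ 2 * π) : |SS x| ≤ 4 * (2 * π - x) / (x * (π + x)) := by
  have hp := pi_pos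
  have hp4 := Real.pi_lt_four
  rcases h0.eq_or_lt with rfl | h0'
  · rw [SS_pi, le_div_iff₀ (by positivity), abs_of_pos (by norm_num)]; nlinarith
  have h3 : 0 < x - π := by linarith
  have hx : 0 < x := by linarith
  have hs : Real.sin x = - Real.sin (x - π) := by rw [Real.sin_sub_pi]; ring
  rw [SS_closed hx h0'.ne', hs, show -Real.sin (x - π) * π ^ 2 / (x * (π - x) * (π + x))
    = Real.sin (x - π) * π ^ 2 / (x * (x - π) * (π + x)) by
      rw [← neg_div_neg_eq]; congr 1 <;> ring]
  rw [abs_of_nonneg (div_nonneg (mul_nonneg (Real.sin_nonneg_of_nonneg_of_le_pi h3.le (by linarith)) (by positivity)) (by positivity))]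
  rw [div_le_div_iff₀ (by positivity) (by positivity)]
  have := sin_par h3.le (by linarith)
  rw [le_div_iff₀ (by positivity)] at this
  nlinarith [mul_le_mul_of_nonneg_right this (show 0 ≤ x * (π + x) by positivity)]

lemma SS_b3 {x:ℝ} (h0 : 2 * π ≤ x) : |SS x| ≤ 4 / 3 * π ^ 2 * x ^ (-3:ℝ) := by
  have hp := pi_pos
  have hx : 0 < x := by linarith
  rw [rpow_neg hx.le, show (3:ℝ) = ((3:ℕ):ℝ) by norm_num, rpow_natCast, ← div_eq_mul_inv]
  rw [SS_closed hx (by linarith), abs_div, abs_mul, abs_mul, abs_mul, abs_of_pos hx, abs_of_pos (show 0 < π + x by linarith),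
    abs_of_neg (show π - x < 0 by linarith), abs_of_pos (show 0 < π ^ 2 by positivity)]
  have h3 : 0 < -(π - x) := by linarith
  rw [div_le_div_iff₀ (by positivity) (by positivity)]
  have h1 := Real.abs_sin_le_one x
  have h2 : |Real.sin x| * π ^ 2 * x ^ 3 ≤ 1 * π ^ 2 * x ^ 3 := by gcongr
  refine h2.trans ?_
  have h4 : 3 / 4 * x ^ 2 ≤ -(π - x) * (π + x) := by nlinarith
  nlinarith [mul_le_mul_of_nonneg_left h4 (show 0 ≤ 4 / 3 * π ^ 2 * x by positivity)]

lemma SS_tail {c p:ℝ} (hc : 2 * π ≤ c) (hp : p < 2) :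
    IntegrableOn (fun x => 4 / 3 * π ^ 2 * x ^ (p - 3)) (Set.Ioi c) ∧
    ∫ x in Set.Ioi c, 4 / 3 * π ^ 2 * x ^ (p - 3) = 4 / 3 * π ^ 2 * (c ^ (p - 2) / (2 - p)) := by
  have hc0 : 0 < c := by linarith [pi_pos]
  constructor
  · exact (integrableOn_Ioi_rpow_of_lt (by linarith) hc0).const_mul _
  · rw [integral_const_mul, integral_Ioi_rpow_of_lt (by linarith) hc0]
    rw [show p - 3 + 1 = p - 2 by ring, show 2 - p = -(p - 2) by ring, div_neg, neg_div]

/-- piecewise integration of a bound -/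
lemma piece3 {g m1 m2 m3 : ℝ → ℝ} {I1 I2 I3:ℝ} (hg : Continuous g)
    (h1 : ∀ x, 0 ≤ x → x ≤ π → g x ≤ m1 x) (h2 : ∀ x, π ≤ x → x ≤ 2 * π → g x ≤ m2 x)
    (h3 : ∀ x, 2 * π ≤ x → g x ≤ m3 x) (h0 : ∀ x, 0 ≤ x → 0 ≤ g x)
    (c1 : Continuous m1) (c2 : Continuous m2) (i3 : IntegrableOn m3 (Set.Ioi (2 * π)))
    (e1 : ∫ x in (0:ℝ)..Real.pi, m1 x = I1) (e2 : ∫ x in Real.pi..(2*π), m2 x = I2)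
    (e3 : ∫ x in Set.Ioi (2 * π), m3 x = I3) :
    IntegrableOn g (Set.Ioi 0) ∧ ∫ x in Set.Ioi 0, g x ≤ I1 + I2 + I3 := by
  have hp := pi_pos
  have g3 : IntegrableOn g (Set.Ioi (2 * π)) := by
    refine Integrable.mono' i3 hg.aestronglyMeasurable ?_
    refine (ae_restrict_iff' measurableSet_Ioi).2 (Eventually.of_forall fun x hx => ?_)
    have hx : 2 * π < x := hx
    rw [Real.norm_eq_abs, abs_of_nonneg (h0 x (by linarith))]
    exact h3 x hx.le
  have g2 : IntegrableOn g (Set.Ioc π (2*π)) := (hg.integrableOn_Icc).mono_set Set.Ioc_subset_Icc_self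
  have g1 : IntegrableOn g (Set.Ioc 0 π) := (hg.integrableOn_Icc).mono_set Set.Ioc_subset_Icc_self
  have u1 : Set.Ioc π (2 * π) ∪ Set.Ioi (2 * π) = Set.Ioi π := Set.Ioc_union_Ioi_eq_Ioi (by linarith)
  have u2 : Set.Ioc 0 π ∪ Set.Ioi π = Set.Ioi 0 := Set.Ioc_union_Ioi_eq_Ioi (by linarith)
  have g23 : IntegrableOn g (Set.Ioi π) := by rw [← u1]; exact g2.union g3
  refine ⟨by rw [← u2]; exact g1.union g23, ?_⟩
  rw [← u2, setIntegral_union (Set.Ioc_disjoint_Ioi le_rfl) measurableSet_Ioi g1 g23, ← u1,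
    setIntegral_union (Set.Ioc_disjoint_Ioi le_rfl) measurableSet_Ioi g2 g3,
    ← intervalIntegral.integral_of_le hp.le, ← intervalIntegral.integral_of_le (by linarith)]
  have a1 := intervalIntegral.integral_mono_on hp.le (hg.intervalIntegrable (μ := volume) 0 π) (c1.intervalIntegrable 0 π) (fun x hx => h1 x hx.1 hx.2)
  have a2 := intervalIntegral.integral_mono_on (show π ≤ 2 * π by linarith) (hg.intervalIntegrable (μ := volume) _ _) (c2.intervalIntegrable _ _) (fun x hx => h2 x hx.1 hx.2)
  have a3 := setIntegral_mono_on g3 i3 measurableSet_Ioi (fun x hx => h3 x (le_of_lt hx))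
  linarith

lemma SS_L1 : IntegrableOn (fun x => |SS x|) (Set.Ioi 0) ∧ ∫ x in Set.Ioi 0, |SS x| ≤ 25 / 6 := by
  have hp := pi_pos
  have ht := SS_tail (c := 2 * π) (p := 0) le_rfl (by norm_num)
  have := piece3 (g := fun x => |SS x|) (m1 := fun x => 4 / π - 2 / π ^ 2 * x)
    (m2 := fun x => 4 / π - 2 / π ^ 2 * x) (m3 := fun x => 4 / 3 * π ^ 2 * x ^ ((0:ℝ) - 3))
    (I1 := 3) (I2 := 1) SS_cont.abs ?_ ?_ ?_ (fun x _ => abs_nonneg _) (by fun_prop) (by fun_prop) ht.1 ?_ ?_ ht.2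
  · refine ⟨this.1, this.2.trans (le_of_eq ?_)⟩
    rw [show (0:ℝ) - 2 = -((2:ℕ):ℝ) by norm_num, rpow_neg (by positivity), rpow_natCast]
    field_simp; norm_num
  · intro x h0 h1
    refine (SS_b1 h0 h1).trans ?_
    rw [div_le_iff₀ (by positivity)]
    have : (4 / π - 2 / π ^ 2 * x) * (π + x) = 4 + 2 * x * (π - x) / π ^ 2 := by
      field_simp; ring
    rw [this]
    have : 0 ≤ 2 * x * (π - x) / π ^ 2 := div_nonneg (mul_nonneg (by linarith) (by linarith)) (by positivity)
    linarith
  · intro x h0 h1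
    refine (SS_b2 h0 h1).trans ?_
    have : 4 / π - 2 / π ^ 2 * x = 4 * (2 * π - x) / (π * (π + π)) := by
      field_simp; ring
    rw [this]
    have h4 : 0 ≤ 4 * (2 * π - x) := by linarith
    have hx : 0 ≤ x := by linarith
    gcongr
  · intro x h
    have := SS_b3 h
    rwa [show (0:ℝ) - 3 = -3 by norm_num]
  · rw [intervalIntegral.integral_sub (by simp) (by apply Continuous.intervalIntegrable; fun_prop), intervalIntegral.integral_const_mul, integral_id]
    simp; field_simp; norm_num
  · rw [intervalIntegral.integral_sub (by simp) (by apply Continuous.intervalIntegrable; fun_prop), intervalIntegral.integral_const_mul, integral_id]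
    simp; field_simp; norm_num

lemma SS_L2 : IntegrableOn (fun x => x * |SS x|) (Set.Ioi 0) ∧ ∫ x in Set.Ioi 0, x * |SS x| ≤ 3 * π := by
  have hp := pi_pos
  have ht := SS_tail (c := 2 * π) (p := 1) le_rfl (by norm_num)
  have := piece3 (g := fun x => x * |SS x|) (m1 := fun x => 4 / 9 + 16 / (9 * π) * x)
    (m2 := fun x => 4 - 2 / π * x) (m3 := fun x => 4 / 3 * π ^ 2 * x ^ ((1:ℝ) - 3))
    (I1 := 4 * π / 3) (I2 := π) (continuous_id.mul SS_cont.abs) ?_ ?_ ?_ (fun x hx => by positivity) (by fun_prop) (by fun_prop) ht.1 ?_ ?_ ht.2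
  · refine ⟨this.1, this.2.trans (le_of_eq ?_)⟩
    rw [show (1:ℝ) - 2 = -((1:ℕ):ℝ) by norm_num, rpow_neg (by positivity), rpow_natCast]
    field_simp; norm_num
  · intro x h0 h1
    refine (mul_le_mul_of_nonneg_left (SS_b1 h0 h1) h0).trans ?_
    rw [← mul_div_assoc, div_le_iff₀ (by positivity)]
    have : (4 / 9 + 16 / (9 * π) * x) * (π + x) = x * 4 + 4 * (π - 2 * x) ^ 2 / (9 * π) := by
      field_simp; ring
    rw [this]
    have : 0 ≤ 4 * (π - 2 * x) ^ 2 / (9 * π) := by positivity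
    linarith
  · intro x h0 h1
    have hx : 0 < x := by linarith
    refine (mul_le_mul_of_nonneg_left (SS_b2 h0 h1) hx.le).trans ?_
    have : x * (4 * (2 * π - x) / (x * (π + x))) = 4 * (2 * π - x) / (π + x) := by
      field_simp
    rw [this]
    have : 4 - 2 / π * x = 4 * (2 * π - x) / (π + π) := by
      field_simp; ring
    rw [this]
    have h4 : 0 ≤ 4 * (2 * π - x) := by linarith
    gcongr
  · intro x h
    have hx : 0 < x := by linarith
    refine (mul_le_mul_of_nonneg_left (SS_b3 h) hx.le).trans (le_of_eq ?_)
    rw [show (1:ℝ) - 3 = 1 + -3 by norm_num, Real.rpow_add hx, Real.rpow_one]; ring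
  · rw [intervalIntegral.integral_add (by simp) (by apply Continuous.intervalIntegrable; fun_prop), intervalIntegral.integral_const_mul, integral_id]
    simp; field_simp; norm_num
  · rw [intervalIntegral.integral_sub (by simp) (by apply Continuous.intervalIntegrable; fun_prop), intervalIntegral.integral_const_mul, integral_id]
    simp; field_simp; norm_num

lemma SS_integrable : Integrable SS := by
  have h1 : IntegrableOn SS (Set.Ioi 0) := by
    have := SS_L1.1
    exact (integrable_norm_iff SS_cont.aestronglyMeasurable).1 this
  have h2 : IntegrableOn SS (Set.Iic 0) := by
    have h3 := (integrableOn_Ici_iff_integrableOn_Ioi).2 h1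
    have h4 : IntegrableOn (fun x => SS (-x)) (Set.Iic 0) :=
      IntegrableOn.comp_neg_Iic (by simpa using h3)
    simpa [SS_neg] using h4
  rw [← integrableOn_univ, ← Set.Iic_union_Ioi (a := (0:ℝ))]
  exact h2.union h1

lemma sinc_int (x:ℝ) : ∫ τ in (-1:ℝ)..1, Complex.exp (τ * x * I) = 2 * Real.sinc x := by
  rcases eq_or_ne x 0 with rfl | hx
  · simp; norm_num
  · have h := integral_exp_mul_I_eq_sinc x
    have e := intervalIntegral.integral_comp_mul_right (a := -1) (b := 1) (fun t : ℝ => Complex.exp (t * I)) hx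
    simp only [Complex.ofReal_mul] at e
    rw [e, neg_one_mul, one_mul, h]
    have : (x:ℂ) ≠ 0 := by exact_mod_cast hx
    rw [Complex.real_smul, Complex.ofReal_inv]; field_simp

/-- the cutoff -/
noncomputable def kk (τ:ℝ) : ℝ := Real.cos (π * τ / 2) ^ 2

lemma kk_cont : Continuous kk := by unfold kk; fun_prop

lemma kk_exp (τ:ℝ) (x:ℝ) : (kk τ:ℂ) * Complex.exp (τ * x * I)
    = Complex.exp (τ * x * I) / 2 + Complex.exp (τ * (x + π:ℝ) * I) / 4
      + Complex.exp (τ * (x - π:ℝ) * I) / 4 := by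
  have : (kk τ:ℂ) = 1 / 2 + (Complex.exp (τ * π * I) + Complex.exp (-(τ * π * I))) / 4 := by
    have h1 : kk τ = 1 / 2 + Real.cos (π * τ) / 2 := by
      unfold kk; rw [Real.cos_sq]; ring_nf
    rw [h1]; push_cast
    rw [Complex.cos, show (π:ℂ) * τ * I = τ * π * I by ring,
      show -((π:ℂ) * τ) * I = -(τ * π * I) by ring]; ring
  rw [this, add_mul, div_mul_eq_mul_div _ (4:ℂ), add_mul, ← Complex.exp_add, ← Complex.exp_add]
  push_cast
  rw [show (τ:ℂ) * (x + π) * I = τ * π * I + τ * x * I by ring,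
    show (τ:ℂ) * (x - π) * I = -(τ * π * I) + τ * x * I by ring]
  ring

lemma SS_fourier (x:ℝ) : ∫ τ in (-1:ℝ)..1, (kk τ:ℂ) * Complex.exp (τ * x * I) = SS x := by
  simp_rw [kk_exp]
  have i : ∀ y : ℝ, ∀ c : ℂ, IntervalIntegrable (fun τ : ℝ => Complex.exp (τ * y * I) / c) volume (-1) 1 := by
    intro y c; apply Continuous.intervalIntegrable; fun_prop
  rw [intervalIntegral.integral_add ((i _ _).add (i _ _)) (i _ _), intervalIntegral.integral_add (i _ _) (i _ _),
    intervalIntegral.integral_div, intervalIntegral.integral_div, intervalIntegral.integral_div, sinc_int, sinc_int, sinc_int]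
  unfold SS; push_cast; ring

/-- the truncated cutoff -/
noncomputable def kT (τ:ℝ) : ℂ := Set.indicator (Set.Icc (-1:ℝ) 1) (fun τ => (kk τ:ℂ)) τ

lemma kT_integrable : Integrable kT := by
  unfold kT
  rw [integrable_indicator_iff measurableSet_Icc]
  exact (Complex.continuous_ofReal.comp kk_cont).integrableOn_Icc

lemma kT_int (g : ℝ → ℂ) : ∫ τ, kT τ * g τ = ∫ τ in (-1:ℝ)..1, (kk τ:ℂ) * g τ := by
  rw [intervalIntegral.integral_of_le (by norm_num), ← integral_Icc_eq_integral_Ioc,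
    ← integral_indicator measurableSet_Icc]
  congr 1; funext τ
  unfold kT
  by_cases h : τ ∈ Set.Icc (-1:ℝ) 1
  · rw [Set.indicator_of_mem h, Set.indicator_of_mem h]
  · rw [Set.indicator_of_notMem h, Set.indicator_of_notMem h, zero_mul]

lemma kT_SS (x:ℝ) : ∫ τ, kT τ * Complex.exp (τ * x * I) = SS x := by
  rw [kT_int, SS_fourier]

open FourierTransform in
lemma SS_total : ∫ x, SS x = 2 * π := by
  have hp := pi_pos
  have hF : 𝓕 kT = fun w => ((SS (2 * π * w):ℝ):ℂ) := by
    funext w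
    rw [Real.fourier_real_eq_integral_exp_smul, ← SS_neg, ← kT_SS]
    congr 1; funext τ
    rw [smul_eq_mul, mul_comm]; push_cast; ring_nf
  have hi : Integrable (𝓕 kT) := by
    rw [hF]
    have := (SS_integrable.comp_mul_left' (R := 2 * π) (by positivity)).ofReal (𝕜 := ℂ)
    simpa using this
  have hc : ContinuousAt kT 0 := by
    have : (fun τ => (kk τ:ℂ)) =ᶠ[nhds 0] kT := by
      filter_upwards [Icc_mem_nhds (show (-1:ℝ) < 0 by norm_num) (show (0:ℝ) < 1 by norm_num)] with τ hτ
      unfold kT; rw [Set.indicator_of_mem hτ]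
    exact (Complex.continuous_ofReal.comp kk_cont).continuousAt.congr this
  have h := Integrable.fourierInv_fourier_eq kT_integrable hi hc
  rw [Real.fourierInv_eq] at h
  simp only [inner_zero_right, AddChar.map_zero_eq_one, one_smul] at h
  rw [hF, integral_complex_ofReal] at h
  have h0 : kT 0 = 1 := by
    unfold kT kk; rw [Set.indicator_of_mem (by simp)]; simp
  rw [h0, Measure.integral_comp_mul_left, abs_of_pos (by positivity)] at h
  have h' : (2 * π)⁻¹ * ∫ x, SS x = 1 := by exact_mod_cast h
  field_simp at h'
  linarith

lemma GVs_integrable {σ T:ℝ} (hσ : 0 < σ) (hT : 0 < T) (v:ℝ) :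
    Integrable (fun x => VV (v - x / T) * exp (-(σ * (v - x / T)))) := by
  have h := ((GV_integrable hσ).comp_sub_left v).comp_mul_left' (R := T⁻¹) (by positivity)
  refine h.congr (Eventually.of_forall fun x => ?_)
  simp only [div_eq_inv_mul]

lemma inner_int {σ T:ℝ} (hσ : 0 < σ) (hT : 0 < T) (v τ:ℝ) :
    ∫ x, ((VV (v - x / T) * exp (-(σ * (v - x / T))):ℝ):ℂ) * Complex.exp (τ * x * I)
      = T * (Complex.exp (τ * T * v * I) * (LSeries fC (1 + (σ + τ * T * I)) / (σ + τ * T * I))) := by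
  have hz : 0 < ((σ:ℂ) + τ * T * I).re := by simpa using hσ
  rw [← laplace hz]
  have e : ∀ x : ℝ, ((VV (v - x / T) * exp (-(σ * (v - x / T))):ℝ):ℂ) * Complex.exp (τ * x * I)
      = (fun x : ℝ => (fun y : ℝ => Complex.exp (τ * T * v * I) * ((VV y:ℂ) * Complex.exp (-(σ + τ * T * I) * y))) (v - x)) (T⁻¹ * x) := by
    intro x
    have hT' : (T:ℂ) ≠ 0 := by exact_mod_cast hT.ne'
    simp only []
    rw [← div_eq_inv_mul, mul_left_comm, ← Complex.exp_add, Complex.ofReal_mul, mul_assoc, Complex.ofReal_exp, ← Complex.exp_add]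
    congr 2
    push_cast; field_simp; ring
  simp_rw [e]
  rw [Measure.integral_comp_mul_left (fun x : ℝ => (fun y : ℝ => Complex.exp (τ * T * v * I) * ((VV y:ℂ) * Complex.exp (-(σ + τ * T * I) * y))) (v - x)),
    integral_sub_left_eq_self (fun y : ℝ => Complex.exp (τ * T * v * I) * ((VV y:ℂ) * Complex.exp (-(σ + τ * T * I) * y))) volume v, integral_const_mul, inv_inv, abs_of_pos hT, Complex.real_smul]

lemma smooth_id {σ T:ℝ} (hσ : 0 < σ) (hT : 0 < T) (v:ℝ) :
    ((∫ x, VV (v - x / T) * exp (-(σ * (v - x / T))) * SS x:ℝ):ℂ)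
      = ∫ τ in (-1:ℝ)..1, (kk τ:ℂ) * (T * (Complex.exp (τ * T * v * I) *
        (LSeries fC (1 + (σ + τ * T * I)) / (σ + τ * T * I)))) := by
  rw [← kT_int, ← integral_complex_ofReal]
  have hG := (GVs_integrable hσ hT v).ofReal (𝕜 := ℂ)
  have hP := hG.mul_prod kT_integrable
  have hP2 : Integrable (Function.uncurry fun (x:ℝ) (τ:ℝ) =>
      ((VV (v - x / T) * exp (-(σ * (v - x / T))):ℝ):ℂ) * kT τ * Complex.exp (τ * x * I))
      (volume.prod volume) := by
    refine Integrable.mono hP ?_ (Eventually.of_forall fun p => ?_)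
    · refine hP.aestronglyMeasurable.mul (Continuous.aestronglyMeasurable ?_)
      fun_prop
    · simp only [Function.uncurry]
      rw [norm_mul _ (Complex.exp _), Complex.norm_exp]
      simp
  have hs := integral_integral_swap hP2
  have e1 : ∀ x : ℝ, ∫ τ, ((VV (v - x / T) * exp (-(σ * (v - x / T))):ℝ):ℂ) * kT τ * Complex.exp (τ * x * I)
      = ((VV (v - x / T) * exp (-(σ * (v - x / T))) * SS x:ℝ):ℂ) := by
    intro x
    rw [Complex.ofReal_mul _ (SS x), ← kT_SS, ← integral_const_mul]
    congr 1; funext τ; ring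
  have e2 : ∀ τ : ℝ, ∫ x, ((VV (v - x / T) * exp (-(σ * (v - x / T))):ℝ):ℂ) * kT τ * Complex.exp (τ * x * I)
      = kT τ * (T * (Complex.exp (τ * T * v * I) *
        (LSeries fC (1 + (σ + τ * T * I)) / (σ + τ * T * I)))) := by
    intro τ
    rw [← inner_int hσ hT, ← integral_const_mul]
    congr 1; funext x; ring
  simp_rw [e1, e2] at hs
  exact hs

/-- damped step function -/
noncomputable def GG (σ y:ℝ) : ℝ := VV y * exp (-(σ * y))

lemma QQ_mono {a b:ℝ} (h0 : 0 ≤ a) (h : a ≤ b) : QQ a ≤ QQ b := by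
  unfold QQ; gcongr

lemma GG_le {σ y:ℝ} (hσ : 0 < σ) (hy : 0 ≤ y) : |GG σ y| ≤ QQ y := by
  unfold GG
  rw [abs_mul, abs_of_pos (exp_pos _)]
  have h1 : exp (-(σ * y)) ≤ 1 := by rw [Real.exp_le_one_iff]; have := mul_nonneg hσ.le hy; linarith
  calc _ ≤ QQ y * 1 := mul_le_mul (VV_triv hy) h1 (exp_pos _).le (QQ_nonneg hy)
    _ = _ := mul_one _

lemma dG_near {σ y1 y2:ℝ} (hσ : 0 < σ) (h0 : 0 ≤ y1) (h : y1 ≤ y2) :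
    |GG σ y2 - GG σ y1| ≤ 1.57 * ((y2 - y1) * (y2 / 4 + 1)) + 11.4 * exp (3 / 4 * y2 - y1)
      + QQ y2 * σ * (y2 - y1) := by
  have h2 : 0 ≤ y2 := h0.trans h
  have e : GG σ y2 - GG σ y1 = (VV y2 - VV y1) * exp (-(σ * y1))
      + VV y2 * (exp (-(σ * y2)) - exp (-(σ * y1))) := by unfold GG; ring
  have h1 : exp (-(σ * y1)) ≤ 1 := by rw [Real.exp_le_one_iff]; have := mul_nonneg hσ.le h0; linarith
  have h3 : |exp (-(σ * y2)) - exp (-(σ * y1))| ≤ σ * (y2 - y1) := by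
    have hm : exp (-(σ * y2)) ≤ exp (-(σ * y1)) := by
      apply exp_le_exp.2; nlinarith
    rw [abs_sub_comm, abs_of_nonneg (by linarith)]
    have e2 : exp (-(σ * y2)) = exp (-(σ * y1)) * exp (-(σ * (y2 - y1))) := by
      rw [← exp_add]; congr 1; ring
    have h4 := Real.add_one_le_exp (-(σ * (y2 - y1)))
    have h5 : 0 ≤ σ * (y2 - y1) := mul_nonneg hσ.le (by linarith)
    rw [e2]
    have := exp_pos (-(σ * y1))
    nlinarith
  rw [e]
  refine (abs_add_le _ _).trans ?_
  rw [abs_mul, abs_mul, abs_of_pos (exp_pos _)]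
  have hd := VV_diff h h2
  have a1 : |VV y2 - VV y1| * exp (-(σ * y1)) ≤ |VV y2 - VV y1| :=
    mul_le_of_le_one_right (abs_nonneg _) h1
  have a2 : |VV y2| * |exp (-(σ * y2)) - exp (-(σ * y1))| ≤ QQ y2 * (σ * (y2 - y1)) :=
    mul_le_mul (VV_triv h2) h3 (abs_nonneg _) (QQ_nonneg h2)
  linarith

lemma dG_right {v w:ℝ} (hv : 17 ≤ v) (h0 : 0 ≤ w) (h1 : w ≤ v / 5) :
    |GG (1 / v ^ 2) v - GG (1 / v ^ 2) (v - w)| ≤ (1.57 * (v / 4 + 1) + QQ (9 / 8 * v) / v ^ 2) * w + 11.4 * exp (-v / 20) := by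
  have h := dG_near (σ := 1 / v ^ 2) (y1 := v - w) (y2 := v) (by positivity) (by linarith) (by linarith)
  refine h.trans ?_
  have e : exp (3 / 4 * v - (v - w)) ≤ exp (-v / 20) := exp_le_exp.2 (by linarith)
  have q : QQ v / v ^ 2 * w ≤ QQ (9 / 8 * v) / v ^ 2 * w := by
    have := QQ_mono (show 0 ≤ v by linarith) (show v ≤ 9 / 8 * v by linarith)
    gcongr
  have : QQ v * (1 / v ^ 2) * (v - (v - w)) = QQ v / v ^ 2 * w := by ring
  rw [this]
  nlinarith

lemma dG_left {v w:ℝ} (hv : 17 ≤ v) (h0 : 0 ≤ w) (h1 : w ≤ v / 8) :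
    |GG (1 / v ^ 2) v - GG (1 / v ^ 2) (v + w)| ≤ (1.57 * (9 / 32 * v + 1) + QQ (9 / 8 * v) / v ^ 2) * w + 11.4 * exp (-v / 20) := by
  have h := dG_near (σ := 1 / v ^ 2) (y1 := v) (y2 := v + w) (by positivity) (by linarith) (by linarith)
  rw [abs_sub_comm]
  refine h.trans ?_
  have e : exp (3 / 4 * (v + w) - v) ≤ exp (-v / 20) := exp_le_exp.2 (by linarith)
  have q : QQ (v + w) / v ^ 2 * w ≤ QQ (9 / 8 * v) / v ^ 2 * w := by
    have := QQ_mono (show 0 ≤ v + w by linarith) (show v + w ≤ 9 / 8 * v by linarith)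
    gcongr
  have : QQ (v + w) * (1 / v ^ 2) * (v + w - v) = QQ (v + w) / v ^ 2 * w := by ring
  rw [this]
  have : w * ((v + w) / 4 + 1) ≤ w * (9 / 32 * v + 1) := mul_le_mul_of_nonneg_left (by linarith) h0
  nlinarith

lemma dG_rfar {σ v w:ℝ} (hσ : 0 < σ) (hv : 17 ≤ v) (h0 : 0 ≤ w) :
    |GG σ v - GG σ (v - w)| ≤ 2 * QQ v := by
  refine (abs_sub _ _).trans ?_
  have h1 := GG_le hσ (show 0 ≤ v by linarith)
  have h2 : |GG σ (v - w)| ≤ QQ v := by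
    rcases lt_or_ge (v - w) 0 with h | h
    · unfold GG; rw [VV_neg h, zero_mul, abs_zero]; exact QQ_nonneg (by linarith)
    · exact (GG_le hσ h).trans (QQ_mono h (by linarith))
  linarith

lemma dG_lfar {v w:ℝ} (hv : 17 ≤ v) (h0 : 0 < w) :
    |GG (1 / v ^ 2) v - GG (1 / v ^ 2) (v + w)| ≤ 2 * QQ v + 1.57 * (v / 4 + 1) * w + 1.57 * v / 16 * w ^ (3/2:ℝ) := by
  refine (abs_sub _ _).trans ?_
  have hv0 : 0 < v := by linarith
  have h1 := GG_le (σ := 1 / v ^ 2) (by positivity) hv0.le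
  have hE : exp (-(1 / v ^ 2 * (v + w))) ≤ 1 := by
    rw [Real.exp_le_one_iff]; have : 0 ≤ 1 / v ^ 2 * (v + w) := by positivity
    linarith
  have h2 : |GG (1 / v ^ 2) (v + w)| ≤ QQ (v + w) * exp (-(1 / v ^ 2 * (v + w))) := by
    unfold GG
    rw [abs_mul, abs_of_pos (exp_pos _)]
    exact mul_le_mul_of_nonneg_right (VV_triv (by linarith)) (exp_pos _).le
  have hQ : QQ (v + w) = (QQ v + 1.57 * (v / 4 + 1) * w) + 1.57 * (w ^ 2 / 8) := by unfold QQ; ring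
  have h3 : (QQ v + 1.57 * (v / 4 + 1) * w) * exp (-(1 / v ^ 2 * (v + w))) ≤ QQ v + 1.57 * (v / 4 + 1) * w :=
    mul_le_of_le_one_right (add_nonneg (QQ_nonneg hv0.le) (by positivity)) hE
  have h4 : w ^ 2 * exp (-(1 / v ^ 2 * (v + w))) ≤ v / 2 * w ^ (3/2:ℝ) := by
    have a : exp (-(1 / v ^ 2 * (v + w))) ≤ exp (-(w / v ^ 2)) := by
      apply exp_le_exp.2
      have : 1 / v ^ 2 * (v + w) = 1 / v + w / v ^ 2 := by field_simp
      rw [this]; have : 0 < 1 / v := by positivity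
      linarith
    have hw : w = (√w) ^ 2 := (Real.sq_sqrt h0.le).symm
    have hs : 0 < √w := Real.sqrt_pos.2 h0
    have hw32 : w ^ (3/2:ℝ) = (√w) ^ 3 := by
      rw [show (3/2:ℝ) = 1 / 2 * ((3:ℕ):ℝ) by norm_num, Real.rpow_mul h0.le, rpow_natCast, ← Real.sqrt_eq_rpow]
    have b : exp (-(w / v ^ 2)) ≤ v / 2 / √w := by
      obtain ⟨s, hsd⟩ : ∃ s, s = √w / v := ⟨_, rfl⟩
      have hs0 : 0 < s := by rw [hsd]; positivity
      have e1 : w / v ^ 2 = s ^ 2 := by rw [hsd, div_pow, ← hw]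
      have e2 : v / 2 / √w = 1 / (2 * s) := by rw [hsd]; field_simp
      rw [e1, e2, Real.exp_neg, ← one_div]
      apply one_div_le_one_div_of_le (by positivity)
      have := Real.add_one_le_exp (s ^ 2)
      nlinarith [sq_nonneg (s - 1)]
    calc w ^ 2 * exp (-(1 / v ^ 2 * (v + w))) ≤ w ^ 2 * (v / 2 / √w) := by gcongr; exact a.trans b
      _ = v / 2 * w ^ (3/2:ℝ) := by
        rw [hw32]; nth_rw 1 [hw]; field_simp
  rw [hQ] at h2
  nlinarith

lemma half_int {g : ℝ → ℝ} {α β a1 a2 a3 c:ℝ} (hc : 2 * π ≤ c) (hα : 0 ≤ α) (hβ : 0 ≤ β)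
    (h1 : 0 ≤ a1) (h2 : 0 ≤ a2) (h3 : 0 ≤ a3)
    (hg : IntegrableOn (fun x => g x * |SS x|) (Set.Ioi 0))
    (hn : ∀ x, 0 < x → x ≤ c → g x ≤ α * x + β)
    (hf : ∀ x, c < x → g x ≤ a1 + a2 * x + a3 * x ^ (3/2:ℝ)) :
    ∫ x in Set.Ioi 0, g x * |SS x| ≤ 3 * π * α + 25 / 6 * β
      + 4 / 3 * π ^ 2 * (a1 * (c ^ (-2:ℝ) / 2) + a2 * c ^ (-1:ℝ) + a3 * (2 * c ^ (-(1/2):ℝ))) := by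
  have hp := pi_pos
  have hc0 : 0 < c := by linarith
  obtain ⟨i1, e1⟩ := SS_tail (c := c) (p := 0) hc (by norm_num)
  obtain ⟨i2, e2⟩ := SS_tail (c := c) (p := 1) hc (by norm_num)
  obtain ⟨i3, e3⟩ := SS_tail (c := c) (p := 3/2) hc (by norm_num)
  have j1 := SS_L1.1.const_mul β
  have j2 := SS_L2.1.const_mul α
  have k := ((i1.const_mul a1).add (i2.const_mul a2)).add (i3.const_mul a3)
  have k' : IntegrableOn (Set.indicator (Set.Ioi c) (fun x => a1 * (4 / 3 * π ^ 2 * x ^ ((0:ℝ) - 3))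
      + a2 * (4 / 3 * π ^ 2 * x ^ ((1:ℝ) - 3)) + a3 * (4 / 3 * π ^ 2 * x ^ ((3/2:ℝ) - 3)))) (Set.Ioi 0) := by
    apply Integrable.integrableOn
    rw [integrable_indicator_iff measurableSet_Ioi]
    exact k
  have hle := setIntegral_mono_on hg ((j2.add j1).add k') measurableSet_Ioi (fun x hx => ?_)
  · refine hle.trans ?_
    have k12 : IntegrableOn (fun x => a1 * (4 / 3 * π ^ 2 * x ^ ((0:ℝ) - 3))
      + a2 * (4 / 3 * π ^ 2 * x ^ ((1:ℝ) - 3))) (Set.Ioi c) := (i1.const_mul a1).add (i2.const_mul a2)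
    rw [integral_add' (j2.add j1) k', integral_add' j2 j1, integral_const_mul, integral_const_mul,
      setIntegral_indicator measurableSet_Ioi, Set.Ioi_inter_Ioi, max_eq_right hc0.le,
      integral_add k12 (i3.const_mul a3), integral_add (i1.const_mul a1) (i2.const_mul a2),
      integral_const_mul a1, integral_const_mul a2, integral_const_mul a3, e1, e2, e3]
    have q1 := mul_le_mul_of_nonneg_left SS_L2.2 hα
    have q2 := mul_le_mul_of_nonneg_left SS_L1.2 hβ
    have q3 : c ^ ((0:ℝ) - 2) = c ^ (-2:ℝ) := by norm_num
    have q4 : c ^ ((1:ℝ) - 2) = c ^ (-1:ℝ) := by norm_num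
    have q5 : c ^ ((3/2:ℝ) - 2) = c ^ (-(1/2):ℝ) := by norm_num
    rw [q3, q4, q5]
    norm_num at *
    linarith
  · have hx : 0 < x := hx
    simp only [Pi.add_apply]
    rcases le_or_gt x c with h | h
    · rw [Set.indicator_of_notMem (by simpa using h)]
      have := mul_le_mul_of_nonneg_right (hn x hx h) (abs_nonneg (SS x))
      linarith
    · rw [Set.indicator_of_mem (by simpa using h)]
      have hS := SS_b3 (x := x) (by linarith)
      have hr := hf x h
      have n1 : 0 ≤ α * (x * |SS x|) + β * |SS x| := by positivity
      have n2 : g x * |SS x| ≤ (a1 + a2 * x + a3 * x ^ (3/2:ℝ)) * (4 / 3 * π ^ 2 * x ^ (-3:ℝ)) :=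
        (mul_le_mul_of_nonneg_right hr (abs_nonneg _)).trans (mul_le_mul_of_nonneg_left hS (by positivity))
      have z1 : x ^ ((0:ℝ) - 3) = x ^ (-3:ℝ) := by norm_num
      have z2 : x ^ ((1:ℝ) - 3) = x * x ^ (-3:ℝ) := by
        rw [show (1:ℝ) - 3 = 1 + -3 by norm_num, Real.rpow_add hx, Real.rpow_one]
      have z3 : x ^ ((3/2:ℝ) - 3) = x ^ (3/2:ℝ) * x ^ (-3:ℝ) := by
        rw [show (3/2:ℝ) - 3 = 3/2 + -3 by norm_num, Real.rpow_add hx]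
      rw [z1, z2, z3]
      linarith

lemma SS_le (x:ℝ) : |SS x| ≤ 2 := by
  unfold SS
  have h1 := Real.abs_sinc_le_one x
  have h2 := Real.abs_sinc_le_one (x + π)
  have h3 := Real.abs_sinc_le_one (x - π)
  rw [abs_le] at *
  constructor <;> linarith [h1.1, h1.2, h2.1, h2.2, h3.1, h3.2]

/-- the explicit smoothing error -/
noncomputable def EE (v T:ℝ) : ℝ :=
  3 / 2 * ((1.57 * (v / 4 + 1) + QQ (9 / 8 * v) / v ^ 2) / T + (1.57 * (9 / 32 * v + 1) + QQ (9 / 8 * v) / v ^ 2) / T)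
    + 25 / (6 * π) * (11.4 * exp (-v / 20))
    + 2 * π / 3 * (2 * QQ v * ((1/5 * v * T) ^ (-2:ℝ) / 2) + 2 * QQ v * ((1/8 * v * T) ^ (-2:ℝ) / 2)
      + 1.57 * (v / 4 + 1) / T * (1/8 * v * T) ^ (-1:ℝ) + 1.57 * v / 16 / T ^ (3/2:ℝ) * (2 * (1/8 * v * T) ^ (-(1/2):ℝ)))

lemma smooth_err {v T:ℝ} (hv : 17 ≤ v) (hT : 3 ≤ T) :
    |GG (1 / v ^ 2) v| ≤ EE v T + |∫ x, VV (v - x / T) * exp (-(1 / v ^ 2 * (v - x / T))) * SS x| / (2 * π) := by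
  have hp := pi_pos
  have hp4 := Real.pi_lt_d2
  have hv0 : 0 < v := by linarith
  have hT0 : 0 < T := by linarith
  have hσ : 0 < 1 / v ^ 2 := by positivity
  have hvT : 51 ≤ v * T := by nlinarith
  have hI := GVs_integrable hσ hT0 v
  have hIS : Integrable (fun x => VV (v - x / T) * exp (-(1 / v ^ 2 * (v - x / T))) * SS x) := by
    refine Integrable.mono (hI.const_mul 2) (hI.aestronglyMeasurable.mul SS_cont.aestronglyMeasurable)
      (Eventually.of_forall fun x => ?_)
    rw [norm_mul, norm_mul 2, mul_comm]
    refine mul_le_mul_of_nonneg_right ?_ (norm_nonneg _)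
    rw [Real.norm_eq_abs]; simpa using SS_le x
  have hS := SS_integrable.const_mul (GG (1 / v ^ 2) v)
  have hD := hS.sub hIS
  have hDabs : Integrable (fun x => |GG (1 / v ^ 2) v - GG (1 / v ^ 2) (v - x / T)| * |SS x|) := by
    refine hD.norm.congr (Eventually.of_forall fun x => ?_)
    simp only [Pi.sub_apply, Real.norm_eq_abs, GG]
    rw [← abs_mul]; congr 1; ring
  have key : 2 * π * |GG (1 / v ^ 2) v| ≤ |∫ x, VV (v - x / T) * exp (-(1 / v ^ 2 * (v - x / T))) * SS x|
      + ∫ x, |GG (1 / v ^ 2) v - GG (1 / v ^ 2) (v - x / T)| * |SS x| := by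
    have e : GG (1 / v ^ 2) v * (2 * π) = (∫ x, VV (v - x / T) * exp (-(1 / v ^ 2 * (v - x / T))) * SS x)
        + ∫ x, (GG (1 / v ^ 2) v * SS x - VV (v - x / T) * exp (-(1 / v ^ 2 * (v - x / T))) * SS x) := by
      rw [integral_sub hS hIS, integral_const_mul, SS_total]; ring
    have e2 : 2 * π * |GG (1 / v ^ 2) v| = |GG (1 / v ^ 2) v * (2 * π)| := by
      rw [abs_mul, abs_of_pos (show 0 < 2 * π by positivity), mul_comm]
    rw [e2, e]
    refine (abs_add_le _ _).trans (add_le_add le_rfl ?_)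
    refine (abs_integral_le_integral_abs).trans (le_of_eq ?_)
    congr 1; funext x
    rw [← abs_mul]; unfold GG; congr 1; ring
  have split : ∫ x, |GG (1 / v ^ 2) v - GG (1 / v ^ 2) (v - x / T)| * |SS x|
      = (∫ x in Set.Ioi 0, |GG (1 / v ^ 2) v - GG (1 / v ^ 2) (v + x / T)| * |SS x|)
       + ∫ x in Set.Ioi 0, |GG (1 / v ^ 2) v - GG (1 / v ^ 2) (v - x / T)| * |SS x| := by
    rw [← intervalIntegral.integral_Iic_add_Ioi (b := (0:ℝ)) hDabs.integrableOn hDabs.integrableOn]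
    congr 1
    have := integral_comp_neg_Ioi (0:ℝ) (fun x => |GG (1 / v ^ 2) v - GG (1 / v ^ 2) (v - x / T)| * |SS x|)
    rw [neg_zero] at this
    rw [← this]
    congr 1; funext x
    rw [SS_neg, neg_div, sub_neg_eq_add]
  have hDneg : Integrable (fun x => |GG (1 / v ^ 2) v - GG (1 / v ^ 2) (v + x / T)| * |SS x|) := by
    refine (hDabs.comp_neg).congr (Eventually.of_forall fun x => ?_)
    simp only []
    rw [SS_neg, neg_div, sub_neg_eq_add]
  have hq := QQ_nonneg hv0.le
  have hq2 := QQ_nonneg (show 0 ≤ 9 / 8 * v by positivity)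
  have R := half_int (g := fun x => |GG (1 / v ^ 2) v - GG (1 / v ^ 2) (v - x / T)|)
    (α := (1.57 * (v / 4 + 1) + QQ (9 / 8 * v) / v ^ 2) / T) (β := 11.4 * exp (-v / 20)) (a1 := 2 * QQ v) (a2 := 0) (a3 := 0)
    (c := 1/5 * v * T) (by nlinarith) (by positivity) (by positivity) (by positivity) le_rfl le_rfl hDabs.integrableOn
    (fun x h0 h1 => by
      have := dG_right (w := x / T) hv (by positivity) (by rw [div_le_iff₀ hT0]; linarith)
      refine this.trans (le_of_eq ?_); ring)
    (fun x h => by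
      have hx : 0 < x := lt_trans (by positivity) h
      have := dG_rfar (w := x / T) hσ hv (by positivity)
      linarith)
  have L := half_int (g := fun x => |GG (1 / v ^ 2) v - GG (1 / v ^ 2) (v + x / T)|)
    (α := (1.57 * (9 / 32 * v + 1) + QQ (9 / 8 * v) / v ^ 2) / T) (β := 11.4 * exp (-v / 20)) (a1 := 2 * QQ v)
    (a2 := 1.57 * (v / 4 + 1) / T) (a3 := 1.57 * v / 16 / T ^ (3/2:ℝ))
    (c := 1/8 * v * T) (by nlinarith) (by positivity) (by positivity) (by positivity) (by positivity) (by positivity) hDneg.integrableOn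
    (fun x h0 h1 => by
      have := dG_left (w := x / T) hv (by positivity) (by rw [div_le_iff₀ hT0]; linarith)
      refine this.trans (le_of_eq ?_); ring)
    (fun x h => by
      have hx : 0 < x := lt_trans (by positivity) h
      have := dG_lfar (w := x / T) hv (by positivity)
      rw [Real.div_rpow hx.le hT0.le] at this
      refine this.trans (le_of_eq ?_); ring)
  rw [split] at key
  rw [← mul_le_mul_iff_right₀ (show 0 < 2 * π by positivity)]
  refine key.trans ?_
  have e : 2 * π * (EE v T + |∫ x, VV (v - x / T) * exp (-(1 / v ^ 2 * (v - x / T))) * SS x| / (2 * π))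
     = |∫ x, VV (v - x / T) * exp (-(1 / v ^ 2 * (v - x / T))) * SS x| + 2 * π * EE v T := by
    field_simp; ring
  rw [e]
  refine add_le_add le_rfl ((add_le_add L R).trans (le_of_eq ?_))
  unfold EE
  field_simp
  ring

/-- numerator -/
noncomputable def NN (z:ℂ) : ℂ := HL (1 + z) * ((1 + 2 ^ (-(1 + z))) * riemannZeta (2 * (1 + z))) ^ 2
/-- the regularised Laplace transform -/
noncomputable def Fc (z:ℂ) : ℂ :=
  NN z * z * (2 * (π:ℂ) ^ (-(1 + z) / 2) * Complex.Gamma ((1 + z) / 2 + 1) / xiG (1 + z)) ^ 2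

lemma xiG_prod {z:ℂ} (hz : -1 < z.re) (h0 : z ≠ 0) :
    xiG (1 + z) = z * (2 * (π:ℂ) ^ (-(1 + z) / 2) * Complex.Gamma ((1 + z) / 2 + 1)) * riemannZeta (1 + z) := by
  have hre : 0 < (1 + z).re := by simp; linarith
  have hne : 1 + z ≠ 0 := by intro h; rw [h] at hre; simp at hre
  rw [xiG_eq hre (by simpa using h0), Complex.Gammaℝ, Complex.Gamma_add_one _ (by simpa using hne)]
  ring

lemma Fc_eq {z:ℂ} (hz : -1 < z.re) (h0 : z ≠ 0) (hx : riemannZeta (1 + z) ≠ 0) :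
    Fc z = NN z / (z * riemannZeta (1 + z) ^ 2) := by
  have hre : 0 < (1 + z).re := by simp; linarith
  have hg : Complex.Gamma ((1 + z) / 2 + 1) ≠ 0 := Complex.Gamma_ne_zero_of_re_pos (by
    have : ((1 + z) / 2 + 1).re = (1 + z).re / 2 + 1 := by simp
    rw [this]; linarith)
  have hp : (π:ℂ) ^ (-(1 + z) / 2) ≠ 0 := by
    rw [Complex.cpow_ne_zero_iff]; left; exact_mod_cast pi_pos.ne'
  unfold Fc
  rw [xiG_prod hz h0]
  generalize NN z = N at *
  generalize riemannZeta (1 + z) = Z at *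
  generalize Complex.Gamma ((1 + z) / 2 + 1) = G at *
  generalize (π:ℂ) ^ (-(1 + z) / 2) = P at *
  field_simp

lemma Fc_L {z:ℂ} (hz : 0 < z.re) : LSeries fC (1 + z) / z = Fc z := by
  have h1 : 1 < (1 + z).re := by simpa using hz
  have hne : riemannZeta (1 + z) ≠ 0 := riemannZeta_ne_zero_of_one_lt_re h1
  have h0 : z ≠ 0 := by rintro rfl; simp at hz
  rw [Fc_eq (by linarith) h0 hne, NN, ← fL_zeta h1]
  field_simp

lemma Fc_diff {z:ℂ} (hz : -(1/4) < z.re) (hx : xiG (1 + z) ≠ 0) : DifferentiableAt ℂ Fc z := by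
  have h1 : DifferentiableAt ℂ (fun z : ℂ => HL (1 + z)) z := by
    have := HL_diff (s := 1 + z) (by simp; linarith)
    exact DifferentiableAt.comp z (f := fun z : ℂ => 1 + z) this (by fun_prop)
  have h2 : DifferentiableAt ℂ (fun z : ℂ => riemannZeta (2 * (1 + z))) z := by
    have hne : 2 * (1 + z) ≠ 1 := by
      intro h
      have := congrArg Complex.re h
      simp at this; linarith
    exact DifferentiableAt.comp z (f := fun z : ℂ => 2 * (1 + z)) (differentiableAt_riemannZeta hne) (by fun_prop)
  have h3 : DifferentiableAt ℂ (fun z : ℂ => (2:ℂ) ^ (-(1 + z))) z := by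
    refine DifferentiableAt.const_cpow (by fun_prop) (Or.inl (by norm_num))
  have h4 : DifferentiableAt ℂ (fun z : ℂ => (π:ℂ) ^ (-(1 + z) / 2)) z := by
    refine DifferentiableAt.const_cpow (by fun_prop) (Or.inl (by exact_mod_cast pi_pos.ne'))
  have h5 : DifferentiableAt ℂ (fun z : ℂ => Complex.Gamma ((1 + z) / 2 + 1)) z := by
    refine DifferentiableAt.comp z (f := fun z : ℂ => (1 + z) / 2 + 1) (Complex.differentiableAt_Gamma _ ?_) (by fun_prop)
    intro m h
    have := congrArg Complex.re h
    simp at this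
    have hm : (0:ℝ) ≤ m := by positivity
    linarith
  have h6 : DifferentiableAt ℂ (fun z : ℂ => xiG (1 + z)) z :=
    DifferentiableAt.comp z (f := fun z : ℂ => 1 + z) (xiG_diff _) (by fun_prop)
  unfold Fc NN
  have h7 : DifferentiableAt ℂ (fun z : ℂ => 1 + (2:ℂ) ^ (-(1 + z))) z := h3.const_add 1
  refine ((h1.mul ((h7.mul h2).pow 2)).mul differentiableAt_id).mul ((((h4.const_mul 2).mul h5).div h6 hx).pow 2)

lemma zeta_norm_le {s:ℂ} (hs : 1 < s.re) : ‖riemannZeta s‖ ≤ 1 + 1 / (s.re - 1) := by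
  rw [zeta_eq_tsum_one_div_nat_cpow hs]
  refine le_trans (tsum_of_norm_bounded (zsum_summable hs).hasSum fun n => ?_) (zsum_le hs)
  rcases Nat.eq_zero_or_pos n with rfl | hn
  · have : s ≠ 0 := by rintro rfl; norm_num at hs
    simp [Complex.zero_cpow this]
    rw [Real.zero_rpow (by linarith)]
  · rw [norm_div, Complex.norm_natCast_cpow_of_pos hn, rpow_neg (by positivity)]; simp

lemma NN_norm {z:ℂ} (hz : -(1/4) ≤ z.re) : ‖NN z‖ ≤ 130.5 := by
  unfold NN
  rw [norm_mul, norm_pow, norm_mul]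
  have h1 := HL_norm (s := 1 + z) (by simp; linarith)
  have h2 : ‖riemannZeta (2 * (1 + z))‖ ≤ 3 := by
    have hre : (2 * (1 + z)).re = 2 * (1 + z.re) := by simp
    refine (zeta_norm_le (by rw [hre]; linarith)).trans ?_
    rw [hre]
    have : 1 / (2 * (1 + z.re) - 1) ≤ 1 / (1/2) := one_div_le_one_div_of_le (by norm_num) (by linarith)
    linarith
  have h3 : ‖1 + (2:ℂ) ^ (-(1 + z))‖ ≤ 1.5947 := by
    refine (norm_add_le _ _).trans ?_
    have : ‖(2:ℂ) ^ (-(1 + z))‖ ≤ 0.5947 := by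
      have e := Complex.norm_cpow_eq_rpow_re_of_pos (show (0:ℝ) < 2 by norm_num) (-(1 + z))
      push_cast at e
      rw [e]
      have : (2:ℝ) ^ (-(1 + z)).re ≤ 2 ^ (-(3/4):ℝ) := by
        apply Real.rpow_le_rpow_of_exponent_le (by norm_num)
        simp; linarith
      refine this.trans ?_
      rw [← pow_le_pow_iff_left₀ (by positivity) (by norm_num) (show (4:ℕ) ≠ 0 by norm_num), ← rpow_natCast, ← Real.rpow_mul (by norm_num)]
      norm_num
    simp only [norm_one]; linarith
  refine le_trans (b := (5.7:ℝ) * (1.5947 * 3) ^ 2) ?_ (by norm_num)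
  gcongr

lemma Fc_norm {z:ℂ} (hz : -(1/4) ≤ z.re) (h0 : z ≠ 0) (hx : riemannZeta (1 + z) ≠ 0) :
    ‖Fc z‖ ≤ 130.5 * ((1 / ‖riemannZeta (1 + z)‖ ^ 2) / ‖z‖) := by
  rw [Fc_eq (by linarith) h0 hx, norm_div, norm_mul, norm_pow, div_div, mul_comm (‖riemannZeta (1 + z)‖ ^ 2), mul_one_div]
  exact div_le_div_of_nonneg_right (NN_norm hz) (by positivity)

lemma Fc_low {z:ℂ} (hz : -(1/4) ≤ z.re) (h2 : z.re ≤ 1/4) (ht : |z.im| ≤ 3) (h0 : z ≠ 0) :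
    ‖Fc z‖ ≤ 130.5 * (exp 2 * ‖z‖) := by
  have e : (⟨1 + z.re, z.im⟩:ℂ) = 1 + z := by apply Complex.ext <;> simp
  have hl := zeta_low (σ := 1 + z.re) (t := z.im) (by linarith) (by linarith) ht (by rw [e]; simpa using h0)
  rw [e] at hl
  obtain ⟨hne, hl⟩ := hl
  rw [add_sub_cancel_left] at hl
  refine (Fc_norm hz h0 hne).trans ?_
  have hzp : 0 < ‖z‖ := norm_pos_iff.2 h0
  have hxp : 0 < ‖riemannZeta (1 + z)‖ := norm_pos_iff.2 hne
  refine mul_le_mul_of_nonneg_left ?_ (by norm_num)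
  rw [div_div, div_le_iff₀ (by positivity)]
  have e2 : exp 2 = exp 1 ^ 2 := by rw [← Real.exp_nat_mul]; norm_num
  have : 1 ≤ (exp 1 * (‖z‖ * ‖riemannZeta (1 + z)‖)) ^ 2 := one_le_pow₀ hl
  rw [e2]; nlinarith

/-- contour integrand -/
noncomputable def fK (v T σ:ℝ) (z:ℂ) : ℂ :=
  Complex.cosh ((π / (2 * T):ℝ) * (z - σ)) ^ 2 * Fc z * Complex.exp (z * v)

lemma cosh_norm_sq (w:ℂ) : ‖Complex.cosh w ^ 2‖ ≤ exp (w.re ^ 2) := by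
  have h1 : ‖Complex.cosh w‖ ≤ Real.cosh w.re := by
    rw [Complex.cosh, Real.cosh_eq, norm_div]
    have := norm_add_le (Complex.exp w) (Complex.exp (-w))
    rw [Complex.norm_exp, Complex.norm_exp, Complex.neg_re] at this
    simp only [Complex.norm_ofNat]
    linarith
  rw [norm_pow]
  calc ‖Complex.cosh w‖ ^ 2 ≤ (exp (w.re ^ 2 / 2)) ^ 2 := by
        gcongr; exact h1.trans (Real.cosh_le_exp_half_sq _)
    _ = exp (w.re ^ 2) := by rw [← Real.exp_nat_mul]; congr 1; push_cast; ring

lemma sinh_sq_le {a:ℝ} (ha : |a| ≤ 0.14) : Real.sinh a ^ 2 ≤ 1.3 * a ^ 2 := by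
  have h1 := abs_le.1 (Real.abs_exp_sub_one_sub_id_le (x := a) (by linarith))
  have h2 := abs_le.1 (Real.abs_exp_sub_one_sub_id_le (x := -a) (by rw [abs_neg]; linarith))
  have h3 : |Real.sinh a| ≤ 1.14 * |a| := by
    rw [Real.sinh_eq]
    have e : a ^ 2 ≤ 0.14 * |a| := by rw [← sq_abs]; nlinarith [abs_nonneg a]
    have : |(exp a - exp (-a)) / 2 - a| ≤ a ^ 2 := by
      rw [abs_le]; constructor <;> nlinarith
    have h5 := abs_sub_abs_le_abs_sub ((exp a - exp (-a)) / 2) a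
    linarith
  calc Real.sinh a ^ 2 = |Real.sinh a| ^ 2 := (sq_abs _).symm
    _ ≤ (1.14 * |a|) ^ 2 := by gcongr
    _ ≤ 1.3 * a ^ 2 := by rw [mul_pow, sq_abs]; nlinarith [sq_nonneg a]

lemma cosh_edge {a:ℝ} {w:ℂ} (hw : w = a + (π / 2:ℝ) * I ∨ w = a - (π / 2:ℝ) * I) :
    ‖Complex.cosh w ^ 2‖ = Real.sinh a ^ 2 := by
  have : Complex.cosh w ^ 2 = -((Real.sinh a ^ 2:ℝ):ℂ) := by
    rcases hw with rfl | rfl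
    · rw [Complex.cosh_add, Complex.cosh_mul_I, Complex.sinh_mul_I]
      have e1 : Complex.cos ((π / 2:ℝ):ℂ) = 0 := by rw [← Complex.ofReal_cos]; simp
      have e2 : Complex.sin ((π / 2:ℝ):ℂ) = 1 := by rw [← Complex.ofReal_sin]; simp
      rw [e1, e2]; push_cast; ring_nf; simp [Complex.I_sq]
    · rw [Complex.cosh_sub, Complex.cosh_mul_I, Complex.sinh_mul_I]
      have e1 : Complex.cos ((π / 2:ℝ):ℂ) = 0 := by rw [← Complex.ofReal_cos]; simp
      have e2 : Complex.sin ((π / 2:ℝ):ℂ) = 1 := by rw [← Complex.ofReal_sin]; simp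
      rw [e1, e2]; push_cast; ring_nf; simp [Complex.I_sq]
  rw [this, norm_neg, Complex.norm_real, Real.norm_of_nonneg (by positivity)]

lemma sq_exp_le {y v:ℝ} (hy : 0 ≤ y) (hv : 0 < v) : y ^ 2 * exp (-(y * v)) ≤ 0.5414 / v ^ 2 := by
  have h := Real.add_one_le_exp (y * v / 2 - 1)
  have h0 : 0 ≤ y * v / 2 := by positivity
  have h2 : (y * v / 2) ^ 2 ≤ exp (y * v / 2 - 1) ^ 2 := by
    apply pow_le_pow_left₀ h0; linarith
  rw [← Real.exp_nat_mul] at h2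
  have h3 : exp (((2:ℕ):ℝ) * (y * v / 2 - 1)) * exp (-(y * v)) = exp (-2) := by
    rw [← exp_add]; congr 1; push_cast; ring
  have h4 : exp (-2) ≤ 0.13535 := by
    rw [show (-2:ℝ) = -1 + -1 by norm_num, exp_add]
    have := Real.exp_neg_one_lt_d9
    have := exp_pos (-1)
    nlinarith
  have h5 := mul_le_mul_of_nonneg_right h2 (exp_pos (-(y * v))).le
  rw [h3] at h5
  rw [le_div_iff₀ (by positivity)]
  nlinarith

section
variable {v T r η Q M:ℝ}

lemma fK_re {σ T:ℝ} (z:ℂ) : ((π / (2 * T):ℝ) * (z - σ)).re = π / (2 * T) * (z.re - σ) := by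
  rw [Complex.re_ofReal_mul]; simp

lemma a_le {σ x:ℝ} (hT : 3 ≤ T) (hx : |x - σ| ≤ 1/4) : |π / (2 * T) * (x - σ)| ≤ 0.131 := by
  have hp := Real.pi_lt_d6
  have hp0 := pi_pos
  rw [abs_mul, abs_of_nonneg (by positivity)]
  have : π / (2 * T) ≤ 0.524 := by
    rw [div_le_iff₀ (by positivity)]; nlinarith
  calc _ ≤ 0.524 * (1/4:ℝ) := by gcongr
    _ ≤ 0.131 := by norm_num

lemma fK_norm {σ:ℝ} {z:ℂ} (hT : 3 ≤ T) (hx : |z.re - σ| ≤ 1/4) :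
    ‖fK v T σ z‖ ≤ 1.02 * exp (z.re * v) * ‖Fc z‖ := by
  unfold fK
  rw [norm_mul, norm_mul, Complex.norm_exp]
  have h1 := cosh_norm_sq ((π / (2 * T):ℝ) * (z - σ))
  rw [fK_re] at h1
  have h2 := a_le hT hx
  have h3 : (π / (2 * T) * (z.re - σ)) ^ 2 ≤ 0.0172 := by
    rw [← sq_abs]
    calc _ ≤ (0.131:ℝ) ^ 2 := by gcongr
      _ ≤ _ := by norm_num
  have h4 : exp ((π / (2 * T) * (z.re - σ)) ^ 2) ≤ 1.02 := by
    refine (exp_le_exp.2 h3).trans ?_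
    have := abs_le.1 (Real.abs_exp_sub_one_sub_id_le (x := 0.0172) (by norm_num [abs_le]))
    norm_num at this ⊢; linarith
  have e : (z * (v:ℂ)).re = z.re * v := by simp
  rw [e]
  calc _ ≤ 1.02 * ‖Fc z‖ * exp (z.re * v) := by gcongr; exact h1.trans h4
    _ = _ := by ring

lemma fK_hor {σ x t:ℝ} (hT : 3 ≤ T) (hx : x ≤ σ) (hx' : σ - x ≤ 1/4) (hv : 0 < v) (ht : t = T ∨ t = -T) :
    ‖fK v T σ (x + t * I)‖ ≤ 1.3 * (π / (2 * T)) ^ 2 * (0.5414 / v ^ 2) * exp (σ * v) * ‖Fc (x + t * I)‖ := by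
  unfold fK
  rw [norm_mul, norm_mul, Complex.norm_exp]
  have hT0 : (T:ℂ) ≠ 0 := by exact_mod_cast (by linarith : T ≠ 0)
  rw [cosh_edge (a := π / (2 * T) * (x - σ)) (by
    rcases ht with rfl | rfl
    · left; push_cast; field_simp; ring
    · right; push_cast; field_simp; ring)]
  have h1 := sinh_sq_le (a := π / (2 * T) * (x - σ)) ((a_le hT (by rw [abs_le]; constructor <;> linarith)).trans (by norm_num))
  have e : (((x:ℂ) + t * I) * (v:ℂ)).re = σ * v + -((σ - x) * v) := by simp; ring
  rw [e, exp_add]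
  have h2 := sq_exp_le (y := σ - x) (by linarith) hv
  calc _ ≤ (1.3 * (π / (2 * T) * (x - σ)) ^ 2) * ‖Fc (x + t * I)‖ * (exp (σ * v) * exp (-((σ - x) * v))) := by gcongr
    _ = 1.3 * (π / (2 * T)) ^ 2 * ((σ - x) ^ 2 * exp (-((σ - x) * v))) * exp (σ * v) * ‖Fc (x + t * I)‖ := by ring
    _ ≤ _ := by gcongr

/-- hypothesis on 1/zeta -/
def HM (v r T M:ℝ) : Prop := ∀ x t : ℝ, -r ≤ x → x ≤ 1 / v ^ 2 → 3 ≤ |t| → |t| ≤ T →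
  riemannZeta ⟨1 + x, t⟩ ≠ 0 ∧ 1 / ‖riemannZeta ⟨1 + x, t⟩‖ ^ 2 ≤ M

lemma HM_Fc (hM : HM v r T M) (hr : r ≤ 1/4) {x t:ℝ} (h1 : -r ≤ x) (h2 : x ≤ 1 / v ^ 2) (h3 : 3 ≤ |t|) (h4 : |t| ≤ T) :
    ‖Fc (x + t * I)‖ ≤ 130.5 * (M / |t|) := by
  obtain ⟨hne, hle⟩ := hM x t h1 h2 h3 h4
  have e : (⟨1 + x, t⟩:ℂ) = 1 + (x + t * I) := by apply Complex.ext <;> simp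
  rw [e] at hne hle
  have ht : |t| ≤ ‖(x:ℂ) + t * I‖ := by
    have := Complex.abs_im_le_norm ((x:ℂ) + t * I)
    simpa using this
  have h0 : (x:ℂ) + t * I ≠ 0 := by
    intro h; rw [h] at ht; simp at ht; rw [ht] at h3; norm_num at h3
  refine (Fc_norm (by simp; linarith) h0 hne).trans ?_
  have : 0 ≤ 1 / ‖riemannZeta (1 + (x + t * I))‖ ^ 2 := by positivity
  have : 0 < |t| := by linarith
  gcongr
  linarith

end

section
variable {v T r η Q M:ℝ}

lemma fK_diff (hZ : ZF Q η) (hr : r < η) (hr4 : r < 1/4) (hTQ : T ≤ Q) {σ:ℝ} {z:ℂ} (h1 : -r ≤ z.re) (h2 : |z.im| ≤ T) :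
    DifferentiableAt ℂ (fK v T σ) z := by
  have hx : xiG (1 + z) ≠ 0 := by
    intro h
    have := hZ (1 + z.re) z.im (by
      rw [← h]; congr 1; apply Complex.ext <;> simp) (h2.trans hTQ)
    linarith
  have hF := Fc_diff (z := z) (by linarith) hx
  unfold fK
  refine DifferentiableAt.mul (DifferentiableAt.mul ?_ hF) (by fun_prop)
  refine DifferentiableAt.pow ?_ 2
  exact (Complex.differentiable_cosh _).comp z (by fun_prop)

lemma left_edge (hM : HM v r T M) (hv : 0 < v) (hr0 : 0 < r) (hr : r ≤ 1/4) (hT : 3 ≤ T) {σ:ℝ} (hσ : 0 < σ) (hσr : σ + r ≤ 1/4)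
    (hc : ContinuousOn (fun y : ℝ => fK v T σ ((-r:ℝ) + y * I)) (Set.Icc (-T) T)) :
    ‖∫ y in (-T)..T, fK v T σ ((-r:ℝ) + y * I)‖ ≤
      130.5 * (1.02 * exp (-(r * v)) * (6 * exp 2 * 3.011 + 2 * M * log (T / 3))) := by
  obtain ⟨g, hg⟩ : ∃ g : ℝ → ℂ, g = fun y : ℝ => fK v T σ ((-r:ℝ) + y * I) := ⟨_, rfl⟩
  rw [← hg] at hc
  have hgn : ∀ y, ‖g y‖ ≤ 1.02 * exp (-(r * v)) * ‖Fc ((-r:ℝ) + y * I)‖ := by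
    intro y
    rw [hg]
    have := fK_norm (v := v) (T := T) (σ := σ) (z := (-r:ℝ) + y * I) hT (by
      simp only [Complex.add_re, Complex.ofReal_re, Complex.mul_re, Complex.I_re, Complex.ofReal_im, Complex.I_im]
      rw [abs_le]; constructor <;> linarith)
    simpa using this
  have hI : ∀ a b : ℝ, -T ≤ a → a ≤ b → b ≤ T → IntervalIntegrable g volume a b := by
    intro a b h1 h2 h3
    apply ContinuousOn.intervalIntegrable
    rw [Set.uIcc_of_le h2]
    exact hc.mono (Set.Icc_subset_Icc h1 h3)
  have hhi : ∀ y : ℝ, 3 ≤ |y| → |y| ≤ T → ‖g y‖ ≤ 130.5 * (1.02 * exp (-(r * v)) * (M / |y|)) := by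
    intro y h1 h2
    have hv2 : 0 < 1 / v ^ 2 := by positivity
    have := HM_Fc hM hr (x := -r) (t := y) le_rfl (by linarith) h1 h2
    refine (hgn y).trans ?_
    calc _ ≤ 1.02 * exp (-(r * v)) * (130.5 * (M / |y|)) := by gcongr
      _ = _ := by ring
  have hIntg : ∀ C : ℝ, (∫ y in (3:ℝ)..T, 130.5 * (C * (M / y))) = 130.5 * (C * (M * log (T / 3))) := by
    intro C
    have : (fun y : ℝ => 130.5 * (C * (M / y))) = fun y => (130.5 * C * M) * y⁻¹ := by ext y; ring
    rw [this, intervalIntegral.integral_const_mul, integral_inv_of_pos (by norm_num) (by linarith)]; ring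
  have hii : ∀ C : ℝ, IntervalIntegrable (fun y : ℝ => 130.5 * (C * (M / y))) volume 3 T := by
    intro C
    apply ContinuousOn.intervalIntegrable
    rw [Set.uIcc_of_le hT]
    apply ContinuousOn.mul continuousOn_const
    apply ContinuousOn.mul continuousOn_const
    apply ContinuousOn.div continuousOn_const continuousOn_id
    intro y hy
    have := hy.1
    simp only [id]; intro h; linarith
  have b1 : ‖∫ y in (3:ℝ)..T, g y‖ ≤ 130.5 * (1.02 * exp (-(r * v)) * (M * log (T / 3))) := by
    rw [← hIntg]
    refine intervalIntegral.norm_integral_le_of_norm_le hT (Eventually.of_forall fun y hy => ?_) (hii _)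
    have hy1 := hy.1
    have hy2 := hy.2
    have := hhi y (by rw [abs_of_pos (by linarith)]; linarith) (by rw [abs_of_pos (by linarith)]; linarith)
    rwa [abs_of_pos (by linarith)] at this
  have b2 : ‖∫ y in (-T)..(-3:ℝ), g y‖ ≤ 130.5 * (1.02 * exp (-(r * v)) * (M * log (T / 3))) := by
    rw [← intervalIntegral.integral_comp_neg, ← hIntg]
    refine intervalIntegral.norm_integral_le_of_norm_le hT (Eventually.of_forall fun y hy => ?_) (hii _)
    have hy1 := hy.1
    have hy2 := hy.2
    have := hhi (-y) (by rw [abs_neg, abs_of_pos (by linarith)]; linarith) (by rw [abs_neg, abs_of_pos (by linarith)]; linarith)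
    rwa [abs_neg, abs_of_pos (by linarith)] at this
  have b3 : ‖∫ y in (-3:ℝ)..3, g y‖ ≤ (1.02 * exp (-(r * v)) * (130.5 * (exp 2 * 3.011))) * |3 - (-3)| := by
    refine intervalIntegral.norm_integral_le_of_norm_le_const fun y hy => ?_
    rw [Set.uIoc_of_le (by norm_num)] at hy
    have hy1 := hy.1
    have hy2 := hy.2
    refine (hgn y).trans ?_
    have h0 : ((-r:ℝ):ℂ) + y * I ≠ 0 := by
      intro h
      have := congrArg Complex.re h
      simp at this; linarith
    have hl := Fc_low (z := (-r:ℝ) + y * I) (by simp; linarith) (by simp; linarith) (by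
      simp only [Complex.add_im, Complex.ofReal_im, Complex.mul_im, Complex.I_re, Complex.I_im, Complex.ofReal_re]
      rw [abs_le]; constructor <;> linarith) h0
    have hn : ‖((-r:ℝ):ℂ) + y * I‖ ≤ 3.011 := by
      rw [← pow_le_pow_iff_left₀ (norm_nonneg _) (by norm_num) (show (2:ℕ) ≠ 0 by norm_num), Complex.sq_norm, Complex.normSq_apply]
      simp only [Complex.add_re, Complex.add_im, Complex.ofReal_im, Complex.mul_im, Complex.mul_re, Complex.I_re, Complex.I_im, Complex.ofReal_re]
      nlinarith
    gcongr
    exact hl.trans (by gcongr)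
  have s1 := intervalIntegral.integral_add_adjacent_intervals (hI (-T) (-3) le_rfl (by linarith) (by linarith)) (hI (-3) 3 (by linarith) (by norm_num) hT)
  have s2 := intervalIntegral.integral_add_adjacent_intervals (hI (-T) 3 le_rfl (by linarith) hT) (hI 3 T (by linarith) hT le_rfl)
  rw [← hg, ← s2, ← s1]
  have t1 := norm_add_le ((∫ y in (-T)..(-3:ℝ), g y) + ∫ y in (-3:ℝ)..3, g y) (∫ y in (3:ℝ)..T, g y)
  have t2 := norm_add_le (∫ y in (-T)..(-3:ℝ), g y) (∫ y in (-3:ℝ)..3, g y)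
  rw [show |(3:ℝ) - -3| = 6 by norm_num [abs_of_pos]] at b3
  linarith

end

/-- contour error -/
noncomputable def CE (v T r M:ℝ) : ℝ :=
  130.5 * (1.02 * exp (-(r * v)) * (6 * exp 2 * 3.011 + 2 * M * log (T / 3)))
    + 2 * (1.3 * (π / (2 * T)) ^ 2 * (0.5414 / v ^ 2) * exp (1 / v) * (130.5 * (M / T)) * (1/4))

section
variable {v T r η Q M:ℝ}

lemma contour (hv : 17 ≤ v) (hT : 3 ≤ T) (hTQ : T ≤ Q) (hr0 : 0 < r) (hr : r ≤ 0.245) (hrη : r < η) (hZ : ZF Q η)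
    (hM : HM v r T M) :
    ‖∫ y in (-T)..T, fK v T (1 / v ^ 2) ((1 / v ^ 2:ℝ) + y * I)‖ ≤ CE v T r M := by
  obtain ⟨σ, hσ⟩ : ∃ σ : ℝ, σ = 1 / v ^ 2 := ⟨_, rfl⟩
  have hσ0 : 0 < σ := by rw [hσ]; positivity
  have hσ1 : σ ≤ 0.005 := by rw [hσ, div_le_iff₀ (by positivity)]; nlinarith
  have hσv : σ * v = 1 / v := by rw [hσ]; field_simp
  rw [← hσ]
  have hd : ∀ z : ℂ, -r ≤ z.re → |z.im| ≤ T → DifferentiableAt ℂ (fK v T σ) z :=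
    fun z h1 h2 => fK_diff hZ hrη (by linarith) hTQ h1 h2
  have key := Complex.integral_boundary_rect_eq_zero_of_differentiableOn (fK v T σ) ⟨-r, -T⟩ ⟨σ, T⟩ (by
    intro z hz
    apply DifferentiableAt.differentiableWithinAt
    simp only [Complex.mem_reProdIm] at hz
    rw [Set.uIcc_of_le (by linarith), Set.uIcc_of_le (by linarith)] at hz
    exact hd z hz.1.1 (abs_le.2 hz.2))
  simp only at key
  have hor : ∀ t : ℝ, (t = T ∨ t = -T) → ‖∫ x in (-r)..σ, fK v T σ (x + t * I)‖ ≤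
      1.3 * (π / (2 * T)) ^ 2 * (0.5414 / v ^ 2) * exp (1 / v) * (130.5 * (M / T)) * (1/4) := by
    intro t ht
    have habs : |t| = T := by
      rcases ht with rfl | rfl
      · exact abs_of_pos (by linarith)
      · rw [abs_neg]; exact abs_of_pos (by linarith)
    have hM0 : 0 ≤ M := by
      have := (hM 0 T (by linarith) (by positivity) (by rw [abs_of_pos (by linarith)]; exact hT) (by rw [abs_of_pos (by linarith)])).2
      refine le_trans ?_ this
      positivity
    have h1 := intervalIntegral.norm_integral_le_of_norm_le_const (a := -r) (b := σ) (f := fun x : ℝ => fK v T σ (x + t * I))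
      (C := 1.3 * (π / (2 * T)) ^ 2 * (0.5414 / v ^ 2) * exp (1 / v) * (130.5 * (M / T))) (fun x hx => by
        rw [Set.uIoc_of_le (by linarith)] at hx
        have hx1 := hx.1
        have hx2 := hx.2
        have := fK_hor (v := v) (σ := σ) (x := x) (t := t) hT hx2 (by linarith) (by linarith) ht
        rw [hσv] at this
        refine this.trans ?_
        have h2 := HM_Fc hM (by linarith) (x := x) (t := t) hx1.le (by rw [← hσ]; exact hx2) (by rw [habs]; exact hT) habs.le
        rw [habs] at h2
        gcongr)
    refine h1.trans ?_
    have h2 : |σ - -r| ≤ 1/4 := by rw [abs_le]; constructor <;> linarith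
    have hT0 : 0 < T := by linarith
    gcongr
  have hle := left_edge hM (by linarith) hr0 (by linarith) hT hσ0 (by linarith) (by
    intro y hy
    apply ContinuousAt.continuousWithinAt
    have := (hd ((-r:ℝ) + y * I) (by simp) (by simpa using abs_le.2 hy)).continuousAt
    exact ContinuousAt.comp (f := fun y : ℝ => ((-r:ℝ):ℂ) + y * I) this (by fun_prop))
  have h1 := hor T (Or.inl rfl)
  have h2 := hor (-T) (Or.inr rfl)
  unfold CE
  obtain ⟨A, hA⟩ : ∃ A, A = ∫ x in (-r)..σ, fK v T σ (x + ((-T:ℝ):ℂ) * I) := ⟨_, rfl⟩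
  obtain ⟨B, hB⟩ : ∃ B, B = ∫ x in (-r)..σ, fK v T σ (x + (T:ℂ) * I) := ⟨_, rfl⟩
  obtain ⟨C, hC⟩ : ∃ C, C = ∫ y in (-T)..T, fK v T σ (σ + y * I) := ⟨_, rfl⟩
  obtain ⟨D, hD⟩ : ∃ D, D = ∫ y in (-T)..T, fK v T σ ((-r:ℝ) + y * I) := ⟨_, rfl⟩
  rw [← hA, ← hB, ← hC, ← hD] at key
  rw [← hA] at h2
  rw [← hB] at h1
  rw [← hC]
  rw [← hD] at hle
  simp only [smul_eq_mul] at key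
  have e : C = D + I * (A - B) := by
    have hI := Complex.I_mul_I
    linear_combination (-I) * key + (C - D) * hI
  have hI : ‖I * (A - B)‖ ≤ ‖A‖ + ‖B‖ := by
    rw [norm_mul, Complex.norm_I, one_mul]; exact norm_sub_le _ _
  have := norm_add_le D (I * (A - B))
  rw [← e] at this
  linarith

lemma smooth_fK (hv : 17 ≤ v) (hT : 3 ≤ T) :
    |∫ x, VV (v - x / T) * exp (-(1 / v ^ 2 * (v - x / T))) * SS x| * exp (1 / v) =
      ‖∫ y in (-T)..T, fK v T (1 / v ^ 2) ((1 / v ^ 2:ℝ) + y * I)‖ := by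
  obtain ⟨σ, hσ⟩ : ∃ σ : ℝ, σ = 1 / v ^ 2 := ⟨_, rfl⟩
  have hσ0 : 0 < σ := by rw [hσ]; positivity
  have hσv : σ * v = 1 / v := by rw [hσ]; field_simp
  rw [← hσ]
  have hT0 : 0 < T := by linarith
  have h := smooth_id hσ0 hT0 v
  have e2 : (∫ y in (-T)..T, fK v T σ (σ + y * I)) =
      exp (1 / v) * ∫ τ in (-1:ℝ)..1, (kk τ:ℂ) * (T * (Complex.exp (τ * T * v * I) * (LSeries fC (1 + (σ + τ * T * I)) / (σ + τ * T * I)))) := by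
    have hs := intervalIntegral.integral_comp_mul_right (a := -1) (b := 1) (c := T) (fun y : ℝ => fK v T σ (σ + y * I)) hT0.ne'
    rw [neg_one_mul, one_mul, Complex.real_smul] at hs
    have hTc : (T:ℂ) ≠ 0 := by exact_mod_cast hT0.ne'
    have hs2 : (∫ y in (-T)..T, fK v T σ (σ + y * I)) = T * ∫ x in (-1:ℝ)..1, fK v T σ (σ + ((x * T:ℝ):ℂ) * I) := by
      rw [hs, Complex.ofReal_inv, ← mul_assoc, mul_inv_cancel₀ hTc, one_mul]
    rw [hs2, ← intervalIntegral.integral_const_mul, ← intervalIntegral.integral_const_mul]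
    congr 1
    ext τ
    have hF := Fc_L (z := (σ:ℂ) + τ * T * I) (by simp; exact hσ0)
    rw [hF]
    unfold fK kk
    have e3 : ((π / (2 * T):ℝ):ℂ) * ((σ:ℂ) + ((τ * T:ℝ):ℂ) * I - σ) = ((π * τ / 2:ℝ):ℂ) * I := by
      push_cast; field_simp; ring
    rw [e3, Complex.cosh_mul_I]
    have e4 : ((σ:ℂ) + ((τ * T:ℝ):ℂ) * I) * v = ((1 / v:ℝ):ℂ) + τ * T * v * I := by
      rw [← hσv]; push_cast; ring
    rw [e4, Complex.exp_add]
    push_cast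
    ring
  rw [e2, ← h, norm_mul, Complex.norm_real, Complex.norm_real, Real.norm_of_nonneg (exp_pos _).le, Real.norm_eq_abs]
  ring

lemma VV_bd (hv : 17 ≤ v) (hT : 3 ≤ T) (hTQ : T ≤ Q) (hr0 : 0 < r) (hr : r ≤ 0.245) (hrη : r < η) (hZ : ZF Q η)
    (hM : HM v r T M) : |VV v| ≤ exp (1 / v) * EE v T + CE v T r M / (2 * π) := by
  have h1 := contour hv hT hTQ hr0 hr hrη hZ hM
  rw [← smooth_fK hv hT] at h1
  have h2 := smooth_err hv hT
  have e : |VV v| = exp (1 / v) * |GG (1 / v ^ 2) v| := by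
    unfold GG
    rw [abs_mul, abs_of_pos (exp_pos _)]
    have : exp (1 / v) * (|VV v| * exp (-(1 / v ^ 2 * v))) = |VV v| * (exp (1 / v) * exp (-(1 / v ^ 2 * v))) := by ring
    rw [this, ← exp_add, show 1 / v + -(1 / v ^ 2 * v) = 0 by field_simp; ring]; simp
  rw [e]
  have hp := pi_pos
  calc _ ≤ exp (1 / v) * (EE v T + |∫ x, VV (v - x / T) * exp (-(1 / v ^ 2 * (v - x / T))) * SS x| / (2 * π)) := by gcongr
    _ = exp (1 / v) * EE v T + (|∫ x, VV (v - x / T) * exp (-(1 / v ^ 2 * (v - x / T))) * SS x| * exp (1 / v)) / (2 * π) := by ring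
    _ ≤ _ := by gcongr

end

lemma exp_inv_le {v:ℝ} (hv : 17 ≤ v) : exp (1 / v) ≤ 1 + 1 / v + 1 / v ^ 2 := by
  have h0 : 0 < 1 / v := by positivity
  have h1 : 1 / v ≤ 1 := by rw [div_le_iff₀ (by linarith)]; linarith
  have := (abs_le.1 (Real.abs_exp_sub_one_sub_id_le (x := 1 / v) (by rw [abs_of_pos h0]; exact h1))).2
  rw [div_pow, one_pow] at this
  linarith

lemma EE_le {v T:ℝ} (hv : 17 ≤ v) (hT : 3 ≤ T) :
    EE v T ≤ 2.355 / T * (17 / 32 * v + 2.3165 + 2.25 / v + 2 / v ^ 2) + 15.13 * exp (-v / 20)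
      + 3.2884 / T ^ 2 * (13.125 + 97 / v + 89 / v ^ 2 + 0.3537 * √v) := by
  have hv0 : 0 < v := by linarith
  have hT0 : 0 < T := by linarith
  have hp := Real.pi_gt_d6
  have hp2 := Real.pi_lt_d6
  obtain ⟨s, hs⟩ : ∃ s, s = √v := ⟨_, rfl⟩
  obtain ⟨w, hw⟩ : ∃ w, w = √T := ⟨_, rfl⟩
  have hs2 : s ^ 2 = v := by rw [hs]; exact Real.sq_sqrt hv0.le
  have hw2 : w ^ 2 = T := by rw [hw]; exact Real.sq_sqrt hT0.le
  have hs0 : 0 < s := by rw [hs]; positivity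
  have hw0 : 0 < w := by rw [hw]; positivity
  have r1 : (1 / 5 * v * T) ^ (-2:ℝ) = 25 / (v * T) ^ 2 := by
    rw [rpow_neg (by positivity), show (2:ℝ) = ((2:ℕ):ℝ) by norm_num, rpow_natCast]; field_simp; norm_num
  have r2 : (1 / 8 * v * T) ^ (-2:ℝ) = 64 / (v * T) ^ 2 := by
    rw [rpow_neg (by positivity), show (2:ℝ) = ((2:ℕ):ℝ) by norm_num, rpow_natCast]; field_simp; norm_num
  have r3 : (1 / 8 * v * T) ^ (-1:ℝ) = 8 / (v * T) := by
    rw [rpow_neg (by positivity), Real.rpow_one]; field_simp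
  have r4 : T ^ (3 / 2:ℝ) = T * w := by
    rw [show (3 / 2:ℝ) = 1 + 1 / 2 by norm_num, Real.rpow_add hT0, Real.rpow_one, hw, Real.sqrt_eq_rpow]
  have r5 : (1 / 8 * v * T) ^ (-(1 / 2):ℝ) ≤ 2.8285 / (s * w) := by
    rw [rpow_neg (by positivity), ← Real.sqrt_eq_rpow, Real.sqrt_mul (by positivity), Real.sqrt_mul (by positivity), ← hs, ← hw]
    have h8 : 1 / 2.8285 ≤ √(1 / 8:ℝ) := by
      apply Real.le_sqrt_of_sq_le; norm_num
    have : (2.8285 / (s * w):ℝ) = (1 / 2.8285 * s * w)⁻¹ := by field_simp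
    rw [this]
    gcongr
  have t1 : 3 / 2 * ((1.57 * (v / 4 + 1) + QQ (9 / 8 * v) / v ^ 2) / T + (1.57 * (9 / 32 * v + 1) + QQ (9 / 8 * v) / v ^ 2) / T)
      ≤ 2.355 / T * (17 / 32 * v + 2.3165 + 2.25 / v + 2 / v ^ 2) := by
    unfold QQ
    have : 2.355 / T * (17 / 32 * v + 2.3165 + 2.25 / v + 2 / v ^ 2) - 3 / 2 * ((1.57 * (v / 4 + 1) + 1.57 * ((9 / 8 * v) ^ 2 / 8 + 9 / 8 * v + 1) / v ^ 2) / T + (1.57 * (9 / 32 * v + 1) + 1.57 * ((9 / 8 * v) ^ 2 / 8 + 9 / 8 * v + 1) / v ^ 2) / T)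
       = 2.355 / T * (2.3165 - 2 - 2 * (81 / 512)) := by
      field_simp; ring
    have h2 : 0 ≤ 2.355 / T * (2.3165 - 2 - 2 * (81 / 512)) := by
      apply mul_nonneg (by positivity); norm_num
    linarith
  have t2 : 25 / (6 * π) * (11.4 * exp (-v / 20)) ≤ 15.13 * exp (-v / 20) := by
    have : 25 / (6 * π) ≤ 1.3264 := by
      rw [div_le_iff₀ (by positivity)]; nlinarith
    have h3 := exp_pos (-v / 20)
    nlinarith
  have t3 : 2 * π / 3 * (2 * QQ v * ((1 / 5 * v * T) ^ (-2:ℝ) / 2) + 2 * QQ v * ((1 / 8 * v * T) ^ (-2:ℝ) / 2) + 1.57 * (v / 4 + 1) / T * (1 / 8 * v * T) ^ (-1:ℝ) + 1.57 * v / 16 / T ^ (3 / 2:ℝ) * (2 * (1 / 8 * v * T) ^ (-(1 / 2):ℝ)))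
      ≤ 3.2884 / T ^ 2 * (13.125 + 97 / v + 89 / v ^ 2 + 0.3537 * √v) := by
    rw [r1, r2, r3, r4, ← hs]
    have h1 : 1.57 * v / 16 / (T * w) * (2 * (1 / 8 * v * T) ^ (-(1 / 2):ℝ)) ≤ 1.57 * v / 16 / (T * w) * (2 * (2.8285 / (s * w))) := by
      gcongr
    have h2 : 1.57 * v / 16 / (T * w) * (2 * (2.8285 / (s * w))) ≤ 1.57 / T ^ 2 * (0.3537 * s) := by
      have : 1.57 * v / 16 / (T * w) * (2 * (2.8285 / (s * w))) = 1.57 / T ^ 2 * (2.8285 / 8 * s) := by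
        rw [← hs2, ← hw2]; field_simp; ring
      rw [this]
      have : 2.8285 / 8 * s ≤ 0.3537 * s := by nlinarith
      gcongr
    have h3 : 2 * QQ v * (25 / (v * T) ^ 2 / 2) + 2 * QQ v * (64 / (v * T) ^ 2 / 2) + 1.57 * (v / 4 + 1) / T * (8 / (v * T))
        = 1.57 / T ^ 2 * (13.125 + 97 / v + 89 / v ^ 2) := by
      unfold QQ; field_simp; ring
    rw [h3]
    have h4 : 0 ≤ 13.125 + 97 / v + 89 / v ^ 2 + 0.3537 * s := by positivity
    calc _ ≤ 2 * π / 3 * (1.57 / T ^ 2 * (13.125 + 97 / v + 89 / v ^ 2) + 1.57 / T ^ 2 * (0.3537 * s)) := by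
            exact mul_le_mul_of_nonneg_left (add_le_add le_rfl (h1.trans h2)) (by positivity)
      _ = (2 * π / 3 * 1.57) / T ^ 2 * (13.125 + 97 / v + 89 / v ^ 2 + 0.3537 * s) := by ring
      _ ≤ _ := by gcongr; nlinarith
  unfold EE
  linarith

lemma xexp_dec {a v L:ℝ} (ha : 0 < a) (hL : 1 ≤ a * L) (hv : L ≤ v) : v * exp (-(a * v)) ≤ L * exp (-(a * L)) := by
  have h := Real.add_one_le_exp (a * (v - L))
  have hL0 : 0 < L := by
    by_contra h'; push Not at h'; nlinarith
  have e : exp (-(a * L)) = exp (a * (v - L)) * exp (-(a * v)) := by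
    rw [← exp_add]; congr 1; ring
  rw [e]
  have h2 : v ≤ L * exp (a * (v - L)) := by
    have := mul_le_mul_of_nonneg_left h hL0.le
    nlinarith [mul_nonneg (sub_nonneg.2 hL) (sub_nonneg.2 hv)]
  rw [← mul_assoc]
  gcongr

lemma CE_le {v T r M lt:ℝ} (hv : 17 ≤ v) (hT : 3 ≤ T) (hM : 0 ≤ M) (hlt : log (T / 3) ≤ lt) :
    v * (CE v T r M / (2 * π)) ≤ 21.186 * (v * exp (-(r * v))) * (133.5 + 2 * M * lt) + 19.4 * M / (v * T ^ 3) := by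
  have hv0 : 0 < v := by linarith
  have hT0 : 0 < T := by linarith
  have hp := Real.pi_gt_d6
  have hp2 := Real.pi_lt_d6
  have he2 : 6 * exp 2 * 3.011 ≤ 133.5 := by
    have e2 : exp 2 = exp 1 * exp 1 := by rw [← exp_add]; norm_num
    have := Real.exp_one_lt_d9
    have := exp_pos 1
    rw [e2]; nlinarith
  have he : exp (1 / v) ≤ 1.0625 := by
    refine (exp_inv_le hv).trans ?_
    have : 1 / v ≤ 1 / 17 := one_div_le_one_div_of_le (by norm_num) hv
    have : 1 / v ^ 2 ≤ 1 / 17 ^ 2 := one_div_le_one_div_of_le (by norm_num) (by gcongr)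
    norm_num at *; linarith
  have hlt0 : 0 ≤ log (T / 3) := Real.log_nonneg (by rw [le_div_iff₀ (by norm_num)]; linarith)
  unfold CE
  rw [add_div, mul_add]
  have a1 : v * (130.5 * (1.02 * exp (-(r * v)) * (6 * exp 2 * 3.011 + 2 * M * log (T / 3))) / (2 * π))
      ≤ 21.186 * (v * exp (-(r * v))) * (133.5 + 2 * M * lt) := by
    have : 130.5 * 1.02 / (2 * π) ≤ 21.186 := by
      rw [div_le_iff₀ (by positivity)]; nlinarith
    calc _ = (130.5 * 1.02 / (2 * π)) * (v * exp (-(r * v))) * (6 * exp 2 * 3.011 + 2 * M * log (T / 3)) := by ring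
      _ ≤ _ := by gcongr
  have a2 : v * (2 * (1.3 * (π / (2 * T)) ^ 2 * (0.5414 / v ^ 2) * exp (1 / v) * (130.5 * (M / T)) * (1/4)) / (2 * π))
      ≤ 19.4 * M / (v * T ^ 3) := by
    calc _ = (2 * 1.3 * 0.5414 * 130.5 / 32) * π * exp (1 / v) * M / (v * T ^ 3) := by
            field_simp; ring
      _ ≤ (2 * 1.3 * 0.5414 * 130.5 / 32) * 3.141593 * 1.0625 * M / (v * T ^ 3) := by gcongr
      _ ≤ _ := by gcongr; norm_num
  linarith

lemma row {v T r η Q M L1 L2 e1 e2 lt s:ℝ} (h17 : 17 ≤ L1) (h1 : L1 ≤ v) (h2 : v ≤ L2) (hT : 3 ≤ T) (hTQ : T ≤ Q) (hr0 : 0 < r)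
    (hr : r ≤ 0.245) (hrη : r < η) (hZ : ZF Q η) (hM : HM v r T M) (hM0 : 0 ≤ M) (hrL : 1 ≤ r * L1) (he1 : exp (-(r * L1)) ≤ e1)
    (he2 : v * exp (-v / 20) ≤ e2) (hlt : log (T / 3) ≤ lt) (hlt0 : 0 ≤ lt) (hs : L2 ≤ s ^ 2) (hs0 : 0 ≤ s) :
    v * |VV v| ≤ (L2 + 1 + 1 / L1) * (2.355 / T * (17 / 32 * L2 + 2.3165 + 2.25 / L1 + 2 / L1 ^ 2) + 3.2884 / T ^ 2 * (13.125 + 97 / L1 + 89 / L1 ^ 2 + 0.3537 * s))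
      + 16.1 * e2 + 21.186 * (L1 * e1) * (133.5 + 2 * M * lt) + 19.4 * M / (L1 * T ^ 3) := by
  have hL0 : 0 < L1 := by linarith
  have hL2 : 0 < L2 := by linarith
  have hv : 17 ≤ v := by linarith
  have hv0 : 0 < v := by linarith
  have hT0 : 0 < T := by linarith
  have b := VV_bd hv hT hTQ hr0 hr hrη hZ hM
  have c := CE_le (r := r) hv hT hM0 hlt
  have d := EE_le hv hT
  have hsq : √v ≤ s := by apply Real.sqrt_le_iff.2; exact ⟨hs0, h2.trans hs⟩
  have x1 := (xexp_dec hr0 hrL h1).trans (mul_le_mul_of_nonneg_left he1 hL0.le)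
  have c2 : v * (CE v T r M / (2 * π)) ≤ 21.186 * (L1 * e1) * (133.5 + 2 * M * lt) + 19.4 * M / (L1 * T ^ 3) := by
    refine c.trans ?_
    gcongr
  have hE := exp_inv_le hv
  have hvE : v * exp (1 / v) ≤ L2 + 1 + 1 / L1 := by
    calc _ ≤ v * (1 + 1 / v + 1 / v ^ 2) := by gcongr
      _ = v + 1 + 1 / v := by field_simp
      _ ≤ _ := by gcongr
  have hE2 : exp (1 / v) * 15.13 ≤ 16.1 := by
    have : 1 / v ≤ 1 / 17 := one_div_le_one_div_of_le (by norm_num) hv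
    have : 1 / v ^ 2 ≤ 1 / 17 ^ 2 := one_div_le_one_div_of_le (by norm_num) (by gcongr)
    norm_num at *; linarith
  have hEx := exp_pos (1 / v)
  have hEy := exp_pos (-v / 20)
  have e0 : 0 ≤ v * exp (-v / 20) := by positivity
  have f1 : v * (exp (1 / v) * EE v T) ≤ (L2 + 1 + 1 / L1) * (2.355 / T * (17 / 32 * L2 + 2.3165 + 2.25 / L1 + 2 / L1 ^ 2) + 3.2884 / T ^ 2 * (13.125 + 97 / L1 + 89 / L1 ^ 2 + 0.3537 * s))
      + 16.1 * e2 := by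
    calc _ ≤ v * (exp (1 / v) * (2.355 / T * (17 / 32 * v + 2.3165 + 2.25 / v + 2 / v ^ 2) + 15.13 * exp (-v / 20)
      + 3.2884 / T ^ 2 * (13.125 + 97 / v + 89 / v ^ 2 + 0.3537 * √v))) := by gcongr
      _ = (v * exp (1 / v)) * (2.355 / T * (17 / 32 * v + 2.3165 + 2.25 / v + 2 / v ^ 2) + 3.2884 / T ^ 2 * (13.125 + 97 / v + 89 / v ^ 2 + 0.3537 * √v)) + (exp (1 / v) * 15.13) * (v * exp (-v / 20)) := by ring
      _ ≤ _ := by gcongr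
  have f2 := mul_le_mul_of_nonneg_left b hv0.le
  rw [mul_add] at f2
  linarith

lemma lub {x:ℝ} (hx : 0 < x) (i j k:ℤ) (h : x ≤ 2 ^ i * 3 ^ j * 5 ^ k) :
    log x ≤ i * log 2 + j * log 3 + k * log 5 := by
  refine (log_le_log hx h).trans ?_
  rw [log_mul (by positivity) (by positivity), log_mul (by positivity) (by positivity), Real.log_zpow, Real.log_zpow, Real.log_zpow]

lemma llb {x:ℝ} (i j k:ℤ) (h : 2 ^ i * 3 ^ j * 5 ^ k ≤ x) :
    i * log 2 + j * log 3 + k * log 5 ≤ log x := by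
  refine le_trans ?_ (log_le_log (by positivity) h)
  rw [log_mul (by positivity) (by positivity), log_mul (by positivity) (by positivity), Real.log_zpow, Real.log_zpow, Real.log_zpow]

lemma HM_three {v r:ℝ} (hv : 17 ≤ v) (hr : r ≤ 1/4) : HM v r 3 67.3 := by
  intro x t h1 h2 h3 h4
  have hσ1 : 1 / v ^ 2 ≤ 0.005 := by rw [div_le_iff₀ (by positivity)]; nlinarith
  have ht2 : t ^ 2 = 9 := by rw [← sq_abs, le_antisymm h4 h3]; norm_num
  have hne : (⟨1 + x, t⟩:ℂ) ≠ 1 := by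
    intro h
    have := congrArg Complex.im h
    simp at this; rw [this] at ht2; norm_num at ht2
  obtain ⟨a, b⟩ := zeta_low (σ := 1 + x) (t := t) (by linarith) (by linarith) h4 hne
  refine ⟨a, ?_⟩
  have hz : 0 < ‖riemannZeta ⟨1 + x, t⟩‖ := norm_pos_iff.2 a
  have hn : ‖(⟨1 + x, t⟩:ℂ) - 1‖ ^ 2 ≤ 9.07 := by
    rw [Complex.sq_norm, Complex.normSq_apply]
    simp
    nlinarith
  rw [div_le_iff₀ (by positivity)]
  have h5 : 1 ≤ (exp 1 * (‖(⟨1 + x, t⟩:ℂ) - 1‖ * ‖riemannZeta ⟨1 + x, t⟩‖)) ^ 2 := one_le_pow₀ b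
  have he : exp 1 ^ 2 ≤ 7.3891 := by
    have := Real.exp_one_lt_d9
    have := exp_pos 1
    nlinarith
  rw [mul_pow, mul_pow] at h5
  refine h5.trans ?_
  rw [← mul_assoc]
  refine mul_le_mul_of_nonneg_right ?_ (by positivity)
  calc _ ≤ (7.3891:ℝ) * 9.07 := by gcongr
    _ ≤ _ := by norm_num

lemma HM_of {v r T M δ η Q κ m:ℝ} (hZ : ZF Q η) (hr0 : 0 < r) (hr : r < η) (hrδ : r ≤ δ) (hr4 : r ≤ 1/4) (hT : T + δ + η ≤ Q)
    (hδv : 1 / v ^ 2 < δ) (hκ : kap δ η r ≤ κ)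
    (hm : log (1 + 1 / δ) + κ * (δ / 9 + 1 / δ + lgT (1 + δ) 0 + 3 / 50 + lgT (1 + δ) T) + 0.33 * (δ + r) ≤ m)
    (hM : exp (2 * m) ≤ M) : HM v r T M := by
  intro x t h1 h2 h3 h4
  have hδ : 0 < δ := by linarith
  have hkap : ∀ r', r' ≤ r → kap δ η r' ≤ kap δ η r := by
    intro r' h
    unfold kap
    have h5 : 0 < η - r := by linarith
    have h6 : 0 < δ + η := by linarith
    have h7 : 0 < η - r' := by linarith
    refine mul_le_mul_of_nonneg_left (log_le_log (by positivity) ?_) h6.le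
    gcongr
  have hκ0 : 0 ≤ κ := by
    refine le_trans ?_ hκ
    unfold kap
    refine mul_nonneg (by linarith) (Real.log_nonneg ?_)
    rw [le_div_iff₀ (by linarith)]; linarith
  obtain ⟨a, b⟩ := zeta_lower (Q := Q) (η := η) (δ := δ) (r := -x) (κ := κ) (t := t) hZ (by linarith) (by linarith)
    (by rw [abs_le]; constructor <;> linarith) hδ (by linarith) (by linarith) h3 ((hkap (-x) (by linarith)).trans hκ) hκ0
  rw [sub_neg_eq_add] at a b
  refine ⟨a, le_trans ?_ hM⟩
  have hz : 0 < ‖riemannZeta ⟨1 + x, t⟩‖ := norm_pos_iff.2 a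
  have e : 1 / ‖riemannZeta ⟨1 + x, t⟩‖ ^ 2 = exp (2 * -log ‖riemannZeta ⟨1 + x, t⟩‖) := by
    rw [show 2 * -log ‖riemannZeta ⟨1 + x, t⟩‖ = -(((2:ℕ):ℝ) * log ‖riemannZeta ⟨1 + x, t⟩‖) by push_cast; ring,
      Real.exp_neg, Real.exp_nat_mul, Real.exp_log hz, one_div]
  rw [e, exp_le_exp]
  have ht2 : 9 ≤ t ^ 2 := by rw [← sq_abs]; nlinarith
  have ht3 : t ^ 2 ≤ T ^ 2 := by rw [← sq_abs t]; gcongr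
  have c1 : lgT (1 + δ) t ≤ lgT (1 + δ) T := by
    unfold lgT
    have : log ((1 + δ + 1) ^ 2 + t ^ 2) ≤ log ((1 + δ + 1) ^ 2 + T ^ 2) := log_le_log (by positivity) (by linarith)
    linarith
  have c2 : -0.30 ≤ lgT (1 + x) t := by
    unfold lgT
    have h12 := llb (x := (1 + x + 1) ^ 2 + t ^ 2) 2 1 0 (by norm_num; nlinarith)
    have := log2_bd; have := log3_bd; have := log2pi_bd
    push_cast at h12
    linarith
  have c3 : -((δ + -x) * (lgT (1 + x) t - 3 / 100)) ≤ 0.33 * (δ + r) := by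
    have : 0 ≤ (δ + -x) * (lgT (1 + x) t + 0.30) := mul_nonneg (by linarith) (by linarith)
    nlinarith
  have c4 : κ * (δ / 9 + 1 / δ + lgT (1 + δ) 0 + 3 / 50 + lgT (1 + δ) t) ≤ κ * (δ / 9 + 1 / δ + lgT (1 + δ) 0 + 3 / 50 + lgT (1 + δ) T) := by
    gcongr
  linarith

/-- tabulated form; the numerical hypotheses are checked by `norm_num` -/
lemma HM_tab {v r T M η Q:ℝ} (δ K A1 A2 A3 A4 B:ℝ) (hv : 46 ≤ v) (hZ : ZF Q η) (h1 : log (1 + 1 / δ) ≤ A1)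
    (h2 : log K ≤ A2) (h3 : log (2 + δ) ≤ A3) (h4 : log ((2 + δ) ^ 2 + T ^ 2) ≤ A4) (hB : B ≤ log M)
    (hr0 : 0 < r := by norm_num) (hr : r < η := by norm_num) (hrδ : r ≤ δ := by norm_num) (hr4 : r ≤ 1/4 := by norm_num)
    (hT : T + δ + η ≤ Q := by norm_num) (hδ1 : 0.001 ≤ δ := by norm_num) (hK : (δ + η) / (η - r) = K := by norm_num)
    (hM0 : 0 < M := by norm_num) (hA2 : 0 ≤ A2 := by norm_num)
    (hm : 2 * (A1 + (δ + η) * A2 * (δ / 9 + 1 / δ + A3 / 2 + 3 / 50 + A4 / 4 - 1.83786) + 0.33 * (δ + r)) ≤ B := by norm_num) :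
    HM v r T M := by
  have hδv : 1 / v ^ 2 < δ := by
    rw [div_lt_iff₀ (by positivity)]; nlinarith
  have hδ : 0 < δ := by linarith
  have hp := log2pi_bd
  refine HM_of (κ := (δ + η) * A2) (m := A1 + (δ + η) * A2 * (δ / 9 + 1 / δ + A3 / 2 + 3 / 50 + A4 / 4 - 1.83786) + 0.33 * (δ + r)) hZ hr0 hr hrδ hr4 hT hδv ?_ ?_ ?_
  · unfold kap; rw [hK]; gcongr; linarith
  · rw [lgT_zero (by linarith)]
    unfold lgT
    rw [show 1 + δ + 1 = 2 + δ by ring]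
    have hk : 0 ≤ (δ + η) * A2 := mul_nonneg (by linarith) hA2
    gcongr
    linarith
  · rw [← Real.le_log_iff_exp_le hM0]; linarith

lemma exp_le_inv {y N:ℝ} (hN : 0 < N) (h : log N ≤ y) : exp (-y) ≤ 1 / N := by
  rw [one_div, Real.exp_neg]
  exact inv_anti₀ hN ((Real.log_le_iff_le_exp hN).1 h)

lemma e2_of {v L N:ℝ} (hv : L ≤ v) (h : log N ≤ L / 20) (hL : 20 ≤ L := by norm_num) (hN : 0 < N := by norm_num) :
    v * exp (-v / 20) ≤ L / N := by
  have h1 := xexp_dec (a := 1 / 20) (v := v) (L := L) (by norm_num) (by linarith) hv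
  have h2 := exp_le_inv (y := 1 / 20 * L) hN (by linarith)
  rw [show -v / 20 = -(1 / 20 * v) by ring]
  refine h1.trans ?_
  rw [div_eq_mul_one_div L N]
  exact mul_le_mul_of_nonneg_left h2 (by linarith)

lemma e2_gen {v:ℝ} : v * exp (-v / 20) ≤ 7.36 := by
  have h := Real.add_one_le_exp (v / 20 - 1)
  have e : exp (v / 20 - 1) * exp (-v / 20) = exp (-1) := by rw [← exp_add]; congr 1; ring
  have h2 := mul_le_mul_of_nonneg_right h (exp_pos (-v / 20)).le
  rw [e] at h2
  have := Real.exp_neg_one_lt_d9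
  linarith

/-- numerical upper bound for a logarithm, the auxiliary inequalities being checked by `norm_num` -/
lemma lubn {x c:ℝ} (i j k:ℤ) (hx : 0 < x := by norm_num) (h : x ≤ 2 ^ i * 3 ^ j * 5 ^ k := by norm_num)
    (hc : i * 0.69314715 + |(i:ℝ)| * 0.00000005 + (j * 1.0986123 + |(j:ℝ)| * 0.0000001) + (k * 1.60943795 + |(k:ℝ)| * 0.00000005) ≤ c := by norm_num) :
    log x ≤ c := by
  have h0 := lub hx i j k h
  have key : ∀ (n m l e:ℝ), |l - m| ≤ e → n * l ≤ n * m + |n| * e := by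
    intro n m l e he
    have h1 := le_abs_self (n * (l - m))
    rw [abs_mul] at h1
    have h2 := mul_le_mul_of_nonneg_left he (abs_nonneg n)
    linarith
  have h2 := key i 0.69314715 (log 2) 0.00000005 (by have := log2_bd; rw [abs_le]; constructor <;> linarith)
  have h3 := key j 1.0986123 (log 3) 0.0000001 (by have := log3_bd; rw [abs_le]; constructor <;> linarith)
  have h5 := key k 1.60943795 (log 5) 0.00000005 (by have := log5_bd; rw [abs_le]; constructor <;> linarith)
  linarith

lemma llbn {x c:ℝ} (i j k:ℕ) (h : (2:ℝ) ^ i * 3 ^ j * 5 ^ k ≤ x := by norm_num)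
    (hc : c ≤ i * 0.6931471 + j * 1.0986122 + k * 1.6094379 := by norm_num) : c ≤ log x := by
  have h0 := llb (x := x) i j k (by simpa using h)
  have h2 : (i:ℝ) * 0.6931471 ≤ i * log 2 := by gcongr; exact log2_bd.1
  have h3 : (j:ℝ) * 1.0986122 ≤ j * log 3 := by gcongr; exact log3_bd.1
  have h5 : (k:ℝ) * 1.6094379 ≤ k * log 5 := by gcongr; exact log5_bd.1
  push_cast at h0
  linarith

/-- `row` with the numerical hypotheses checked by `norm_num` -/
lemma row_num {v T r η Q M L1 L2:ℝ} (N e2 lt s:ℝ) (h1 : L1 ≤ v) (h2 : v ≤ L2) (hZ : ZF Q η) (hM : HM v r T M)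
    (hN : log N ≤ r * L1) (he2 : v * exp (-v / 20) ≤ e2) (hlt : log (T / 3) ≤ lt) (hN0 : 0 < N := by norm_num)
    (h17 : 17 ≤ L1 := by norm_num) (hT : 3 ≤ T := by norm_num) (hTQ : T ≤ Q := by norm_num) (hr0 : 0 < r := by norm_num)
    (hr : r ≤ 0.245 := by norm_num) (hrη : r < η := by norm_num) (hM0 : 0 ≤ M := by norm_num) (hrL : 1 ≤ r * L1 := by norm_num)
    (hlt0 : 0 ≤ lt := by norm_num) (hs : L2 ≤ s ^ 2 := by norm_num) (hs0 : 0 ≤ s := by norm_num)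
    (hf : (L2 + 1 + 1 / L1) * (2.355 / T * (17 / 32 * L2 + 2.3165 + 2.25 / L1 + 2 / L1 ^ 2) + 3.2884 / T ^ 2 * (13.125 + 97 / L1 + 89 / L1 ^ 2 + 0.3537 * s))
      + 16.1 * e2 + 21.186 * (L1 * (1 / N)) * (133.5 + 2 * M * lt) + 19.4 * M / (L1 * T ^ 3) ≤ 1501.93 := by norm_num) :
    v * |VV v| ≤ 1501.93 :=
  (row h17 h1 h2 hT hTQ hr0 hr hrη hZ hM hM0 hrL (exp_le_inv hN0 hN) he2 hlt hlt0 hs hs0).trans hf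

lemma row_17 {v:ℝ} (h1 : 17 ≤ v) (h2 : v ≤ 26) : v * |VV v| ≤ 1501.93 :=
  row_num 64 7.36 0 5.1 h1 h2 ZF_tab.1 (HM_three (r := 0.245) (by linarith) (by norm_num)) (lubn 6 0 0) e2_gen (by norm_num)

lemma row_26 {v:ℝ} (h1 : 26 ≤ v) (h2 : v ≤ 37) : v * |VV v| ≤ 1501.93 :=
  row_num 576 7.36 0 6.1 h1 h2 ZF_tab.1 (HM_three (r := 0.245) (by linarith) (by norm_num)) (lubn 6 2 0) e2_gen (by norm_num)

lemma row_37 {v:ℝ} (h1 : 37 ≤ v) (h2 : v ≤ 46) : v * |VV v| ≤ 1501.93 :=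
  row_num 8640 7.36 0 6.8 h1 h2 ZF_tab.1 (HM_three (r := 0.245) (by linarith) (by norm_num)) (lubn 6 3 1) e2_gen (by norm_num)

lemma HM_14 {v:ℝ} (hv : 46 ≤ v) : HM v 0.245 14 20736 :=
  HM_tab 0.7 (10 / 1) 0.88792 2.30261 0.99328 5.32206 9.93962 hv ZF_tab.1 (lubn (-2) 5 (-2)) (lubn 1 0 1) (lubn (-1) 3 (-1)) (lubn 10 0 (-1)) (llbn 8 4 0)

lemma row_46 {v:ℝ} (h1 : 46 ≤ v) (h2 : v ≤ 70) : v * |VV v| ≤ 1501.93 :=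
  row_num 78125 7.36 1.54491 8.4 h1 h2 ZF_tab.1 (HM_14 (by linarith)) (lubn 0 0 7) e2_gen (lubn (-4) 1 2)

lemma row_70 {v:ℝ} (h1 : 70 ≤ v) (h2 : v ≤ 116) : v * |VV v| ≤ 1501.93 :=
  row_num 27337500 7.36 1.54491 10.8 h1 h2 ZF_tab.1 (HM_14 (by linarith)) (lubn 2 7 5) e2_gen (lubn (-4) 1 2)

lemma HM_30 {v:ℝ} (hv : 46 ≤ v) : HM v 0.21 30 38400 :=
  HM_tab 0.7 (15 / 2) 0.88792 2.01493 0.99328 6.81484 10.55581 hv ZF_tab.1 (lubn (-2) 5 (-2)) (lubn (-1) 1 1) (lubn (-1) 3 (-1)) (lubn (-2) 6 1) (llbn 9 1 2)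

lemma row_116 {v:ℝ} (h1 : 116 ≤ v) (h2 : v ≤ 173) : v * |VV v| ≤ 1501.93 :=
  row_num 36905625000 (116 / 300) 2.30260 13.2 h1 h2 ZF_tab.1 (HM_30 (by linarith)) (lubn 3 10 7) (e2_of h1 (lubn 2 1 2)) (lubn 1 0 1)

lemma HM_60 {v:ℝ} (hv : 46 ≤ v) : HM v 0.125 60 24300 :=
  HM_tab 0.5 (6 / 1) 1.09864 1.79178 0.91632 8.19340 10.09823 hv ZF_tab.2.1 (lubn 0 1 0) (lubn 1 1 0) (lubn (-1) 0 1) (lubn (-2) (-3) 8) (llbn 2 5 2)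

lemma row_173 {v:ℝ} (h1 : 173 ≤ v) (h2 : v ≤ 245) : v * |VV v| ≤ 1501.93 :=
  row_num 2441406250 (173 / 5625) 2.99575 15.7 h1 h2 ZF_tab.2.1 (HM_60 (by linarith)) (lubn 1 0 13) (e2_of h1 (lubn 0 2 4)) (lubn 2 0 1)

lemma HM_120 {v:ℝ} (hv : 46 ≤ v) : HM v 0.0935 120 3125000 :=
  HM_tab 0.33 (80 / 3) 1.39761 3.28344 0.84709 9.57969 14.95494 hv ZF_tab.2.2.1 (lubn 13 (-4) (-2)) (lubn 4 (-1) 1) (lubn 1 6 (-4)) (lubn 0 (-3) 8) (llbn 3 0 8)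

lemma row_245 {v:ℝ} (h1 : 245 ≤ v) (h2 : v ≤ 346) : v * |VV v| ≤ 1501.93 :=
  row_num 8789062500 (245 / 156250) 3.68889 18.7 h1 h2 ZF_tab.2.2.1 (HM_120 (by linarith)) (lubn 2 2 12) (e2_of h1 (lubn 1 0 7)) (lubn 3 0 1)

lemma HM_250 {v:ℝ} (hv : 46 ≤ v) : HM v 0.068 250 4147200 :=
  HM_tab 0.24 (80 / 3) 1.64560 3.28344 0.80983 11.05069 15.23794 hv ZF_tab.2.2.2.1 (lubn 3 4 (-3)) (lubn 4 (-1) 1) (lubn 13 (-6) (-1)) (lubn 4 9 (-1)) (llbn 11 4 2)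

lemma row_346 {v:ℝ} (h1 : 346 ≤ v) (h2 : v ≤ 500) : v * |VV v| ≤ 1501.93 :=
  row_num 16142520375 (346 / 156250) 4.42286 22.4 h1 h2 ZF_tab.2.2.2.1 (HM_250 (by linarith)) (lubn 0 17 3) (e2_of h1 (lubn 1 0 7)) (lubn 1 (-1) 3)

lemma HM_500 {v:ℝ} (hv : 46 ≤ v) : HM v 0.0522 500 19531250 :=
  HM_tab 0.174 (40 / 1) 1.90957 3.68890 0.78143 12.43698 16.78752 hv ZF_tab.2.2.2.2.1 (lubn (-2) 3 0) (lubn 3 0 1) (lubn 12 (-1) (-4)) (lubn 6 9 (-1)) (llbn 1 0 10)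

lemma row_500 {v:ℝ} (h1 : 500 ≤ v) (h2 : v ≤ 707) : v * |VV v| ≤ 1501.93 :=
  row_num 192216796875 (500 / 156250) 5.11601 26.6 h1 h2 ZF_tab.2.2.2.2.1 (HM_500 (by linarith)) (lubn 0 9 10) (e2_of h1 (lubn 1 0 7)) (lubn 2 (-1) 3)

lemma HM_1000 {v:ℝ} (hv : 46 ≤ v) : HM v 0.036 1000 21093750 :=
  HM_tab 0.12 (40 / 1) 2.23694 3.68890 0.75303 13.82328 16.86448 hv ZF_tab.2.2.2.2.2.1 (lubn 12 (-7) 1) (lubn 3 0 1) (lubn 11 4 (-7)) (lubn 8 9 (-1)) (llbn 1 3 8)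

lemma row_707 {v:ℝ} (h1 : 707 ≤ v) (h2 : v ≤ 1000) : v * |VV v| ≤ 1501.93 :=
  row_num 109863281250 (707 / 156250) 5.80916 31.7 h1 h2 ZF_tab.2.2.2.2.2.1 (HM_1000 (by linarith)) (lubn 1 2 14) (e2_of h1 (lubn 1 0 7)) (lubn 3 (-1) 3)

lemma HM_2000 {v:ℝ} (hv : 46 ≤ v) : HM v 0.0243 2000 26244000 :=
  HM_tab 0.108 (50 / 1) 2.33101 3.91205 0.74642 15.20957 17.08294 hv ZF_tab.2.2.2.2.2.2 (lubn 2 (-5) 4) (lubn 1 0 2) (lubn (-6) 3 1) (lubn 10 9 (-1)) (llbn 5 8 3)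

lemma row_1000 {v:ℝ} (h1 : 1000 ≤ v) (h2 : v ≤ 1414) : v * |VV v| ≤ 1501.93 :=
  row_num 35595703125 (1000 / 156250) 6.50231 37.7 h1 h2 ZF_tab.2.2.2.2.2.2 (HM_2000 (by linarith)) (lubn 0 6 11) (e2_of h1 (lubn 1 0 7)) (lubn 4 (-1) 3)

lemma row_1414 {v:ℝ} (h1 : 1414 ≤ v) (h2 : v ≤ 1500) : v * |VV v| ≤ 1501.93 :=
  row_num 192216796875 (1414 / 156250) 6.50231 38.8 h1 h2 ZF_tab.2.2.2.2.2.2 (HM_2000 (by linarith)) (lubn 0 9 10) (e2_of h1 (lubn 1 0 7)) (lubn 4 (-1) 3)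

lemma exp_11 : exp 11.722 ≤ 125000 := by
  rw [← Real.le_log_iff_exp_le (by norm_num)]
  exact llbn 3 0 6

lemma exp_25 : exp (-25.4) ≤ 1 / 105000000000 :=
  exp_le_inv (by norm_num) (lubn 4 3 12)

set_option maxHeartbeats 2000000 in
lemma tail {v:ℝ} (hv : 1500 ≤ v) : v * |VV v| ≤ 1501.93 := by
  obtain ⟨x2, y2⟩ := log2_bd
  obtain ⟨x3, y3⟩ := log3_bd
  obtain ⟨x5, y5⟩ := log5_bd
  have hpi := log2pi_bd
  obtain ⟨q, hq1, hq⟩ : ∃ q : ℝ, 1 ≤ q ∧ v = 1500 * q ^ 2 := by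
    refine ⟨√(v / 1500), ?_, ?_⟩
    · rw [Real.one_le_sqrt, le_div_iff₀ (by norm_num)]; linarith
    · rw [Real.sq_sqrt (by positivity)]; ring
  have hq0 : 0 < q := by linarith
  have hq2 : 1 ≤ q ^ 2 := one_le_pow₀ hq1
  have hq4 : 1 ≤ q ^ 4 := one_le_pow₀ hq1
  have hlq : log q ≤ q - 1 := Real.log_le_sub_one_of_pos hq0
  obtain ⟨T, hT⟩ : ∃ T : ℝ, T = 2250 * q ^ 4 := ⟨_, rfl⟩
  have hT3 : 2250 ≤ T := by rw [hT]; linarith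
  obtain ⟨w, hw⟩ : ∃ w : ℝ, w = log (T + 1) - 2.65 := ⟨_, rfl⟩
  have hw1 : 4.95 ≤ w := by
    have h1 : log 2000 ≤ log (T + 1) := log_le_log (by norm_num) (by linarith)
    have := log2000_bd
    linarith
  have hw2 : w ≤ 5.1 * q := by
    have h1 : log (T + 1) ≤ log (2304 * q ^ 4) := log_le_log (by linarith) (by rw [hT]; linarith)
    rw [log_mul (by norm_num) (by positivity), log_pow] at h1
    have := lub (x := 2304) (by norm_num) 8 2 0 (by norm_num)
    push_cast at this h1
    linarith
  have hw0 : 0 < w := by linarith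
  have hZ : ZF (T + 1) (0.096 / w) := by rw [hw]; exact ZF_an (by linarith)
  have hη : 0.096 / w ≤ 0.0194 := by rw [div_le_iff₀ hw0]; linarith
  have hδ : 0.384 / w ≤ 0.0776 := by rw [div_le_iff₀ hw0]; linarith
  have hr1 : 0.0864 / w ≤ 0.0175 := by rw [div_le_iff₀ hw0]; linarith
  have hδ0 : 0 < 0.384 / w := by positivity
  have hrη : 0.0864 / w < 0.096 / w := by
    apply div_lt_div_of_pos_right _ hw0; norm_num
  have hl50 : log 50 ≤ 3.91203 := lubn 1 0 2
  have hM : HM v (0.0864 / w) T (25600000 * q ^ 2) := by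
    refine HM_of (δ := 0.384 / w) (κ := 0.48 / w * 3.91203) (m := log (14.29 * q) + 5.861) hZ (by positivity) hrη ?_ (by linarith) (by linarith) ?_ ?_ ?_ ?_
    · apply div_le_div_of_nonneg_right _ hw0.le; norm_num
    · rw [div_lt_div_iff₀ (by positivity) hw0]
      have : w ≤ v := by nlinarith
      nlinarith
    · unfold kap
      have e1 : 0.384 / w + 0.096 / w = 0.48 / w := by ring
      have e2 : 0.48 / w / (0.096 / w - 0.0864 / w) = 50 := by
        have : 0.096 / w - 0.0864 / w = 0.0096 / w := by ring
        rw [this]; field_simp; norm_num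
      rw [e1, e2]; gcongr
    · have l1 : log (1 + 1 / (0.384 / w)) ≤ log (14.29 * q) := by
        apply log_le_log (by positivity)
        have : 1 / (0.384 / w) = w / 0.384 := by rw [one_div_div]
        rw [this]
        have : w / 0.384 ≤ 5.1 * q / 0.384 := by gcongr
        refine (add_le_add le_rfl this).trans ?_
        have : 5.1 * q / 0.384 = 13.28125 * q := by ring
        linarith
      have l2 : lgT (1 + 0.384 / w) 0 ≤ 0.3666 - 0.91893 := by
        rw [lgT_zero (by linarith)]
        have h1 : log (1 + 0.384 / w + 1) ≤ log (2 * (1 + 0.0388)) := log_le_log (by linarith) (by linarith)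
        rw [log_mul (by norm_num) (by norm_num)] at h1
        have h2 := Real.log_le_sub_one_of_pos (show (0:ℝ) < 1 + 0.0388 by norm_num)
        linarith
      have l3 := lgT_an (σ := 1 + 0.384 / w) (t := T) (k := 1) (Q := T + 1) (by linarith) (by linarith) (by linarith) le_rfl (by
        rw [abs_of_pos (by linarith)]; linarith)
      rw [Real.log_one] at l3
      have l4 : 0.384 / w / 9 + 1 / (0.384 / w) + lgT (1 + 0.384 / w) 0 + 3 / 50 + lgT (1 + 0.384 / w) T ≤ w / 0.384 + w / 2 := by
        have : 1 / (0.384 / w) = w / 0.384 := by rw [one_div_div]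
        rw [this]
        have : log (T + 1) = w + 2.65 := by linarith
        rw [this] at l3
        linarith
      have l5 : 0.48 / w * 3.91203 * (0.384 / w / 9 + 1 / (0.384 / w) + lgT (1 + 0.384 / w) 0 + 3 / 50 + lgT (1 + 0.384 / w) T) ≤ 0.48 / w * 3.91203 * (w / 0.384 + w / 2) := by
        gcongr
      have l6 : 0.48 / w * 3.91203 * (w / 0.384 + w / 2) = 0.48 * 3.91203 * (1 / 0.384 + 1 / 2) := by field_simp
      rw [l6] at l5
      norm_num at l5 ⊢
      norm_num at l1 hδ hr1
      linarith
    · rw [show 2 * (log (14.29 * q) + 5.861) = ((2:ℕ):ℝ) * log (14.29 * q) + 11.722 by push_cast; ring, exp_add,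
        Real.exp_nat_mul, Real.exp_log (by positivity)]
      have h := exp_11
      calc _ ≤ (14.29 * q) ^ 2 * 125000 := by gcongr
        _ ≤ _ := by rw [mul_pow]; nlinarith
  have hv17 : 17 ≤ v := by linarith
  have hv0 : 0 < v := by linarith
  have b := VV_bd hv17 (by linarith) (show T ≤ T + 1 by linarith) (by positivity) (by linarith) hrη hZ hM
  have hlt : log (T / 3) ≤ 6.7 * q := by
    have h1 : T / 3 = 750 * q ^ 4 := by rw [hT]; ring
    rw [h1, log_mul (by norm_num) (by positivity), log_pow]
    have := lub (x := 750) (by norm_num) 1 1 3 (by norm_num)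
    push_cast at this ⊢
    linarith
  have c := CE_le (r := 0.0864 / w) (M := 25600000 * q ^ 2) hv17 (by linarith) (by positivity) hlt
  have d := EE_le hv17 (show 3 ≤ T by linarith)
  have hrv : 25.4 * q ≤ 0.0864 / w * v := by
    rw [div_mul_eq_mul_div, le_div_iff₀ hw0, hq]
    have h1 : q * w ≤ q * (5.1 * q) := by gcongr
    have h2 : 0 ≤ q ^ 2 := by positivity
    have h3 : q * (5.1 * q) = 5.1 * q ^ 2 := by ring
    rw [h3] at h1
    have h4 : 25.4 * q * w = 25.4 * (q * w) := by ring
    rw [h4]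
    linarith
  have hexp : q ^ 5 * exp (-(0.0864 / w * v)) ≤ 1 / 105000000000 := by
    have h1 : exp (-(0.0864 / w * v)) ≤ exp (-(25.4 * q)) := exp_le_exp.2 (by linarith)
    have h2 : q ≤ exp (q - 1) := by have := Real.add_one_le_exp (q - 1); linarith
    have h3 : q ^ 5 ≤ exp (5 * (q - 1)) := by
      calc q ^ 5 ≤ exp (q - 1) ^ 5 := by gcongr
        _ = _ := by rw [← Real.exp_nat_mul]; norm_num
    calc _ ≤ exp (5 * (q - 1)) * exp (-(25.4 * q)) := by gcongr
      _ = exp (5 * (q - 1) - 25.4 * q) := by rw [← exp_add]; congr 1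
      _ ≤ exp (-25.4) := exp_le_exp.2 (by linarith)
      _ ≤ _ := exp_25
  have c1 : 21.186 * (v * exp (-(0.0864 / w * v))) * (133.5 + 2 * (25600000 * q ^ 2) * (6.7 * q)) ≤ 104 := by
    have h3 : 1 ≤ q ^ 3 := one_le_pow₀ hq1
    have hx := exp_pos (-(0.0864 / w * v))
    calc _ ≤ 21.186 * (v * exp (-(0.0864 / w * v))) * (343100000 * q ^ 3) := by
            gcongr
            linarith
      _ = 21.186 * 1500 * 343100000 * (q ^ 5 * exp (-(0.0864 / w * v))) := by
            rw [show v * exp (-(0.0864 / w * v)) = 1500 * q ^ 2 * exp (-(0.0864 / w * v)) by rw [← hq]]; ring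
      _ ≤ 21.186 * 1500 * 343100000 * (1 / 105000000000) := by gcongr
      _ ≤ _ := by norm_num
  have c2 : 19.4 * (25600000 * q ^ 2) / (v * T ^ 3) ≤ 0.001 := by
    rw [div_le_iff₀ (by positivity)]
    have h1 : (2250:ℝ) ^ 3 ≤ T ^ 3 := by gcongr
    have h2 : v * 2250 ^ 3 ≤ v * T ^ 3 := by gcongr
    rw [hq] at h2 ⊢
    norm_num at h2 ⊢
    linarith
  have hTv : T = v ^ 2 / 1000 := by rw [hT, hq]; ring
  have i1 : 1 / v ≤ 0.001 := by rw [div_le_iff₀ hv0]; linarith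
  have i2 : 1 / v ^ 2 ≤ 0.001 * 0.001 := by
    rw [show 1 / v ^ 2 = (1 / v) * (1 / v) by field_simp]
    gcongr
  have hsq : √v ≤ v / 38 := by
    apply Real.sqrt_le_iff.2
    refine ⟨by positivity, ?_⟩
    rw [div_pow, le_div_iff₀ (by norm_num)]; nlinarith
  have hvE : v * exp (1 / v) ≤ v + 1.001 := by
    calc _ ≤ v * (1 + 1 / v + 1 / v ^ 2) := by have := exp_inv_le hv17; gcongr
      _ = v + 1 + 1 / v := by field_simp
      _ ≤ _ := by linarith
  have hE1 : exp (1 / v) ≤ 1.002 := by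
    refine (exp_inv_le hv17).trans ?_
    norm_num at *; linarith
  have hg := e2_gen (v := v)
  have hEx := exp_pos (1 / v)
  have hEy := exp_pos (-v / 20)
  have d2 : EE v T ≤ 2355 / v ^ 2 * (17 / 32 * v + 2.33) + 15.13 * exp (-v / 20) + 66 / v ^ 2 := by
    refine d.trans ?_
    have j1 : 2.355 / T * (17 / 32 * v + 2.3165 + 2.25 / v + 2 / v ^ 2) ≤ 2355 / v ^ 2 * (17 / 32 * v + 2.33) := by
      have : 2.355 / T = 2355 / v ^ 2 := by rw [hTv]; field_simp; norm_num
      rw [this]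
      have e1 : 2.25 / v = 2.25 * (1 / v) := by ring
      have e2 : 2 / v ^ 2 = 2 * (1 / v ^ 2) := by ring
      have : 17 / 32 * v + 2.3165 + 2.25 / v + 2 / v ^ 2 ≤ 17 / 32 * v + 2.33 := by
        rw [e1, e2]; linarith
      gcongr
    have j2 : 3.2884 / T ^ 2 * (13.125 + 97 / v + 89 / v ^ 2 + 0.3537 * √v) ≤ 66 / v ^ 2 := by
      have e1 : 97 / v = 97 * (1 / v) := by ring
      have e2 : 89 / v ^ 2 = 89 * (1 / v ^ 2) := by ring
      have : 13.125 + 97 / v + 89 / v ^ 2 + 0.3537 * √v ≤ 0.03 * v := by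
        rw [e1, e2]; linarith
      calc _ ≤ 3.2884 / T ^ 2 * (0.03 * v) := by gcongr
        _ = (98652 / v) * (1 / v ^ 2) := by rw [hTv]; field_simp; norm_num
        _ ≤ 66 * (1 / v ^ 2) := by
            gcongr
            rw [div_le_iff₀ hv0]; linarith
        _ = _ := by ring
    linarith
  have f1 : v * (exp (1 / v) * EE v T) ≤ (v + 1.001) * (2355 / v ^ 2 * (17 / 32 * v + 2.33) + 66 / v ^ 2) + 15.2 * 7.36 := by
    calc _ ≤ v * (exp (1 / v) * (2355 / v ^ 2 * (17 / 32 * v + 2.33) + 15.13 * exp (-v / 20) + 66 / v ^ 2)) := by gcongr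
      _ = (v * exp (1 / v)) * (2355 / v ^ 2 * (17 / 32 * v + 2.33) + 66 / v ^ 2) + (exp (1 / v) * 15.13) * (v * exp (-v / 20)) := by ring
      _ ≤ _ := by gcongr; linarith
  have f3 : (v + 1.001) * (2355 / v ^ 2 * (17 / 32 * v + 2.33) + 66 / v ^ 2) ≤ 1260 := by
    have : (v + 1.001) * (2355 / v ^ 2 * (17 / 32 * v + 2.33) + 66 / v ^ 2) = (v + 1.001) * (2355 * (17 / 32 * v + 2.33) + 66) / v ^ 2 := by
      field_simp
    rw [this, div_le_iff₀ (by positivity)]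
    nlinarith
  have f2 := mul_le_mul_of_nonneg_left b hv0.le
  rw [mul_add] at f2
  linarith

theorem u_bound : ∀ x : ℝ, 1 < x → |u x| ≤ 1501.93 / log x := by
  intro x hx
  have hL : 0 < log x := Real.log_pos hx
  rw [le_div_iff₀ hL, mul_comm]
  have hVV : VV (log x) = u x := by unfold VV; rw [Real.exp_log (by linarith)]
  rcases le_total (log x) 17 with h | h
  · have h1 := u_triv hx.le
    have h2 := QQ_mono hL.le h
    have h3 : QQ 17 ≤ 85 := by unfold QQ; norm_num
    have h4 : |u x| ≤ 85 := by linarith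
    calc _ ≤ 17 * (85:ℝ) := by gcongr
      _ ≤ _ := by norm_num
  rw [← hVV]
  generalize log x = v at h
  rcases le_total v 26 with h' | h'
  · exact row_17 h h'
  replace h := h'
  rcases le_total v 37 with h' | h'
  · exact row_26 h h'
  replace h := h'
  rcases le_total v 46 with h' | h'
  · exact row_37 h h'
  replace h := h'
  rcases le_total v 70 with h' | h'
  · exact row_46 h h'
  replace h := h'
  rcases le_total v 116 with h' | h'
  · exact row_70 h h'
  replace h := h'
  rcases le_total v 173 with h' | h'
  · exact row_116 h h'
  replace h := h'
  rcases le_total v 245 with h' | h'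
  · exact row_173 h h'
  replace h := h'
  rcases le_total v 346 with h' | h'
  · exact row_245 h h'
  replace h := h'
  rcases le_total v 500 with h' | h'
  · exact row_346 h h'
  replace h := h'
  rcases le_total v 707 with h' | h'
  · exact row_500 h h'
  replace h := h'
  rcases le_total v 1000 with h' | h'
  · exact row_707 h h'
  replace h := h'
  rcases le_total v 1414 with h' | h'
  · exact row_1000 h h'
  replace h := h'
  rcases le_total v 1500 with h' | h'
  · exact row_1414 h h'
  replace h := h'
  exact tail h
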